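/- Fix t > 1 and a free ultrafilter ω on ℕ. If Q ≤ L(F_t) is a von Neumann subalgebra such that the relative commutant Q' ∩ L(F_t)^ω is diffuse, then Q is amenable. -/

import Mathlib

/-! # Common framework: tracial von Neumann algebras in standard form,
amenability, free group factors, 1-bounded entropy, bimodules. -/

noncomputable section

open scoped InnerProductSpace
open Filter

universe u

variable {H : Type u} [NormedAddCommGroup H] [InnerProductSpace ℂ H] [CompleteSpace H]

/-- A projection in `B(H)`. -/
def IsProj (p : H →L[ℂ] H) : Prop := p = p * p ∧ IsSelfAdjoint p

/-- `Ω` is a cyclic separating tracial unit vector for the von Neumann algebra `M`;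
this realizes `(M, τ)` in standard form, with `τ a = ⟪a Ω, Ω⟫` and `L²(M) = H`. -/
structure IsTraceVector (M : VonNeumannAlgebra H) (Ω : H) : Prop where
  norm_one : ‖Ω‖ = 1
  tracial : ∀ a b : H →L[ℂ] H, a ∈ M → b ∈ M → ⟪(a * b) Ω, Ω⟫_ℂ = ⟪(b * a) Ω, Ω⟫_ℂ
  cyclic : Dense ((fun a : H →L[ℂ] H => a Ω) '' (M : Set (H →L[ℂ] H)))
  separating : ∀ a : H →L[ℂ] H, a ∈ M → a Ω = 0 → a = 0

/-- The strong-operator-topology closure of a set of operators. -/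
def sotClosure (s : Set (H →L[ℂ] H)) : Set (H →L[ℂ] H) :=
  {x | ∀ (F : Finset H) (ε : ℝ), 0 < ε → ∃ a ∈ s, ∀ v ∈ F, ‖x v - a v‖ < ε}

/-- Amenability (= hyperfiniteness) of a set of operators (e.g. the carrier of a von Neumann
subalgebra): there is a directed family of finite-dimensional *-subalgebras whose union is
strongly dense. -/
def IsAmenableSet (s : Set (H →L[ℂ] H)) : Prop :=
  ∃ 𝒜 : Set (StarSubalgebra ℂ (H →L[ℂ] H)),
    (∀ A ∈ 𝒜, (A : Set (H →L[ℂ] H)) ⊆ s ∧ FiniteDimensional ℂ A) ∧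
    DirectedOn (· ≤ ·) 𝒜 ∧
    s ⊆ sotClosure (⋃ A ∈ 𝒜, (A : Set (H →L[ℂ] H)))

/-- `P` is a maximal amenable von Neumann subalgebra of `M`. -/
def MaximalAmenable (M P : VonNeumannAlgebra H) : Prop :=
  P ≤ M ∧ IsAmenableSet (P : Set (H →L[ℂ] H)) ∧
    ∀ Q : VonNeumannAlgebra H, Q ≤ M → IsAmenableSet (Q : Set (H →L[ℂ] H)) → P ≤ Q → Q = P

/-- Diffuseness: no nonzero minimal projections (every nonzero projection has a proper
nonzero subprojection). -/
def DiffuseSet (s : Set (H →L[ℂ] H)) : Prop :=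
  ∀ p ∈ s, IsProj p → p ≠ 0 → ∃ q ∈ s, IsProj q ∧ q ≠ 0 ∧ q ≠ p ∧ q * p = q

/-- Triviality of the relative center: a factor. -/
def IsFactorSet (s : Set (H →L[ℂ] H)) : Prop :=
  ∀ z ∈ s, (∀ x ∈ s, z * x = x * z) → ∃ c : ℂ, z = c • (1 : H →L[ℂ] H)

/-- A unitary element of `M`. -/
def unitaryIn (M : VonNeumannAlgebra H) (u : H →L[ℂ] H) : Prop :=
  u ∈ M ∧ star u * u = 1 ∧ u * star u = 1

/-- Order on projections. -/
def ProjLe (p q : H →L[ℂ] H) : Prop := p * q = p ∧ q * p = p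

/-- The corner `e s e` of a set of operators. -/
def corner (e : H →L[ℂ] H) (s : Set (H →L[ℂ] H)) : Set (H →L[ℂ] H) :=
  (fun x => e * x * e) '' s

/-- The double commutant (the von Neumann algebra generated by a self-adjoint set). -/
def wstarGen (s : Set (H →L[ℂ] H)) : Set (H →L[ℂ] H) :=
  Set.centralizer (Set.centralizer s)

/-! ## Interpolated free group factors -/

/-- The *-algebra generated by a single unitary `u` of a corner with unit `e`. -/
def genAlgAt (e u : H →L[ℂ] H) : Submodule ℂ (H →L[ℂ] H) :=
  Submodule.span ℂ ({e} ∪ {x | ∃ n : ℕ, 0 < n ∧ (x = u ^ n ∨ x = star u ^ n)})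

/-- `u` is a Haar unitary in the corner `e M e`, with respect to the normalized trace
`τ(e)⁻¹ τ` of the corner (`τ a = ⟪a Ω, Ω⟫`). -/
def IsHaarUnitaryAt (Ω : H) (e u : H →L[ℂ] H) : Prop :=
  star u * u = e ∧ u * star u = e ∧
    ∀ n : ℕ, 0 < n → ⟪(u ^ n) Ω, Ω⟫_ℂ = 0 ∧ ⟪(star u ^ n) Ω, Ω⟫_ℂ = 0

/-- Voiculescu free independence, w.r.t. the normalized trace of the corner with unit `e`,
of the family of *-algebras generated by the unitaries `u i`: alternating products of
trace-centred elements are centred. -/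
def IsFreeFamilyAt (Ω : H) (e : H →L[ℂ] H) {ι : Type*} (u : ι → H →L[ℂ] H) : Prop :=
  ∀ (k : ℕ) (j : Fin (k + 1) → ι) (a : Fin (k + 1) → H →L[ℂ] H),
    (∀ l : Fin k, j l.castSucc ≠ j l.succ) →
    (∀ l, a l ∈ genAlgAt e (u (j l)) ∧ ⟪a l Ω, Ω⟫_ℂ = 0) →
    ⟪(List.ofFn a).prod Ω, Ω⟫_ℂ = 0

/-- The corner `e M e` (with its normalized trace) is the free group factor `L(F_r)`:
it is generated by `r` free Haar unitaries. -/
def CornerIsFreeGroupFactor (M : VonNeumannAlgebra H) (Ω : H) (e : H →L[ℂ] H) (r : ℕ) : Prop :=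
  ∃ u : Fin r → H →L[ℂ] H,
    (∀ i, u i ∈ M ∧ u i = e * u i * e ∧ IsHaarUnitaryAt Ω e (u i)) ∧
    IsFreeFamilyAt Ω e u ∧
    corner e (M : Set (H →L[ℂ] H)) ⊆ wstarGen (insert e (⋃ i, {u i, star (u i)}))

/-- `(M, τ)` (in standard form with trace vector `Ω`) is the interpolated free group factor
`L(F_t)` of Dykema–Rădulescu: `M` is a factor and some corner of `M` of trace
`√((t-1)/(r-1))` is the free group factor `L(F_r)`, for an integer `r ≥ max (2, t)`. -/
def IsIFGF (t : ℝ) (M : VonNeumannAlgebra H) (Ω : H) : Prop :=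
  IsTraceVector M Ω ∧ IsFactorSet (M : Set (H →L[ℂ] H)) ∧
    ∃ (r : ℕ) (e : H →L[ℂ] H), 2 ≤ r ∧ t ≤ (r : ℝ) ∧ e ∈ M ∧ IsProj e ∧
      ⟪e Ω, Ω⟫_ℂ = ((Real.sqrt ((t - 1) / ((r : ℝ) - 1)) : ℝ) : ℂ) ∧
      CornerIsFreeGroupFactor M Ω e r

/-! ## 1-bounded entropy via microstates -/

/-- Operator norm of a complex matrix. -/
def matOpNorm {n : ℕ} (X : Matrix (Fin n) (Fin n) ℂ) : ℝ :=
  ‖(Matrix.toEuclideanCLM (𝕜 := ℂ) X : EuclideanSpace ℂ (Fin n) →L[ℂ] EuclideanSpace ℂ (Fin n))‖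

/-- Normalized Hilbert-Schmidt distance between matrices. -/
def hsDist {n : ℕ} (X Y : Matrix (Fin n) (Fin n) ℂ) : ℝ :=
  Real.sqrt ((Matrix.trace ((X - Y).conjTranspose * (X - Y))).re / n)

/-- The noncommutative law of a matrix tuple w.r.t. the normalized trace. -/
def matLaw {I : Type u} (n : ℕ) (X : I → Matrix (Fin n) (Fin n) ℂ) :
    FreeAlgebra ℂ I → ℂ :=
  fun q => Matrix.trace (FreeAlgebra.lift ℂ X q) / n

/-- Voiculescu microstate space: self-adjoint matrix tuples, norm bounded by `R`,
whose law lies in the neighborhood `O`. -/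
def microstates {I : Type u} (R : I → ℝ) (O : Set (FreeAlgebra ℂ I → ℂ)) (n : ℕ) :
    Set (I → Matrix (Fin n) (Fin n) ℂ) :=
  {X | (∀ i, IsSelfAdjoint (X i) ∧ matOpNorm (X i) ≤ R i) ∧ matLaw n X ∈ O}

/-- The orbital `(F, ε)`-neighborhood of a set of matrix tuples. -/
def orbitalNbhd {I : Type u} {n : ℕ} (F : Finset I) (ε : ℝ)
    (s : Set (I → Matrix (Fin n) (Fin n) ℂ)) : Set (I → Matrix (Fin n) (Fin n) ℂ) :=
  {Y | ∃ Y' ∈ s, ∃ U : Matrix (Fin n) (Fin n) ℂ, star U * U = 1 ∧ U * star U = 1 ∧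
    ∀ i ∈ F, hsDist (Y i) (U * Y' i * star U) < ε}

/-- Orbital covering numbers. -/
def orbCov {I : Type u} {n : ℕ} (F : Finset I) (ε : ℝ)
    (s : Set (I → Matrix (Fin n) (Fin n) ℂ)) : ℕ∞ :=
  ⨅ (s' : Set (I → Matrix (Fin n) (Fin n) ℂ)) (_ : s ⊆ orbitalNbhd F ε s'), s'.encard

/-- `log k / n²` as an extended real. -/
def logDivSq (k : ℕ∞) (n : ℕ) : EReal :=
  if k = 0 then ⊥ else if k = ⊤ then ⊤
  else ((Real.log k.toNat / (n : ℝ) ^ 2 : ℝ) : EReal)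

/-- The 1-bounded entropy associated to a noncommutative law `lam` of an `(I ⊔ J)`-indexed
tuple with operator norm cutoffs `R, S`: exponential growth rate of orbital covering numbers
of projections of microstate spaces onto the `I`-indexed coordinates. -/
def hEntLaw (I : Type u) (J : Type u) (R : I → ℝ) (S : J → ℝ)
    (lam : FreeAlgebra ℂ (I ⊕ J) → ℂ) : EReal :=
  ⨆ (F : Finset I) (ε : ℝ) (_ : 0 < ε),
    ⨅ (O : Set (FreeAlgebra ℂ (I ⊕ J) → ℂ)) (_ : O ∈ nhds lam),
      Filter.limsup
        (fun n : ℕ =>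
          logDivSq (orbCov F ε ((fun X => X ∘ Sum.inl) '' microstates (Sum.elim R S) O n)) n)
        Filter.atTop

/-- The self-adjoint elements of a set of operators (used as a canonical generating tuple). -/
def saElems (s : Set (H →L[ℂ] H)) : Type u := {a : H →L[ℂ] H // a ∈ s ∧ IsSelfAdjoint a}

/-- The noncommutative law of a tuple of operators w.r.t. the vector state of `Ω`. -/
def opLaw (Ω : H) {K : Type u} (z : K → H →L[ℂ] H) : FreeAlgebra ℂ K → ℂ :=
  fun q => ⟪(FreeAlgebra.lift ℂ z q) Ω, Ω⟫_ℂ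

/-- The joint noncommutative law of the canonical generating tuples of the corners
`e P e ≤ e M e`, w.r.t. the normalized trace `τ(e)⁻¹ τ` of the corner. -/
def cornerLaw (M : VonNeumannAlgebra H) (Ω : H) (e : H →L[ℂ] H) (P : Set (H →L[ℂ] H)) :
    FreeAlgebra ℂ (saElems (corner e P) ⊕ saElems (corner e (M : Set (H →L[ℂ] H)))) → ℂ :=
  fun q =>
    ⟪(e * FreeAlgebra.lift ℂ (Sum.elim (fun i => i.1) fun j => j.1) q * e) Ω, Ω⟫_ℂ / ⟪e Ω, Ω⟫_ℂ

/-- The 1-bounded entropy `h(ePe : eMe)` of the compression of `P` in the presence of the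
compression of `M`, w.r.t. the normalized trace of the corner `e M e`. -/
def hCorner (M : VonNeumannAlgebra H) (Ω : H) (e : H →L[ℂ] H) (P : Set (H →L[ℂ] H)) : EReal :=
  hEntLaw (saElems (corner e P)) (saElems (corner e (M : Set (H →L[ℂ] H))))
    (fun i => ‖i.1‖) (fun j => ‖j.1‖) (cornerLaw M Ω e P)

/-- The 1-bounded entropy `h(P : M)` of `P` in the presence of `M`. -/
def hSub (M : VonNeumannAlgebra H) (Ω : H) (P : Set (H →L[ℂ] H)) : EReal :=
  hCorner M Ω 1 P

/-- `P` is a Pinsker subalgebra of `M`: `h(P : M) ≤ 0`, and every strictly larger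
subalgebra `Q ≤ M` has `h(Q : M) > 0`. -/
def IsPinsker (M : VonNeumannAlgebra H) (Ω : H) (P : VonNeumannAlgebra H) : Prop :=
  P ≤ M ∧ hSub M Ω (P : Set (H →L[ℂ] H)) ≤ 0 ∧
    ∀ Q : VonNeumannAlgebra H, P ≤ Q → Q ≤ M → Q ≠ P →
      0 < hSub M Ω (Q : Set (H →L[ℂ] H))

/-- `p P p` is a Pinsker subalgebra of the compression `p M p` (von Neumann subalgebras of a
corner `pMp` are exactly the sets `p W p` with `W ≤ M` a von Neumann subalgebra
containing `p`). -/
def IsPinskerCorner (M : VonNeumannAlgebra H) (Ω : H) (p : H →L[ℂ] H)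
    (P : Set (H →L[ℂ] H)) : Prop :=
  hCorner M Ω p P ≤ 0 ∧
    ∀ W : VonNeumannAlgebra H, W ≤ M → p ∈ W →
      corner p P ⊆ corner p (W : Set (H →L[ℂ] H)) →
      corner p (W : Set (H →L[ℂ] H)) ≠ corner p P →
      0 < hCorner M Ω p (corner p (W : Set (H →L[ℂ] H)))

/-! ## `L²`-spaces, bimodules, the anti-coarse space -/

/-- The subspace `L²(N) ⊆ L²(M) = H`, for a subset `N ⊆ M`: the closure of `N Ω`. -/
def L2set (Ω : H) (s : Set (H →L[ℂ] H)) : Set H := closure ((fun a : H →L[ℂ] H => a Ω) '' s)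

/-- `L²(N)` as a closed subspace of `H`. -/
def L2sub (Ω : H) (s : Set (H →L[ℂ] H)) : Submodule ℂ H :=
  (Submodule.span ℂ ((fun a : H →L[ℂ] H => a Ω) '' s)).topologicalClosure

/-- `R` implements right multiplication by `b ∈ M` on `L²(M) = H`: it is the unique element of
the commutant `M'` with `R Ω = b Ω`. -/
def IsRightMul (M : VonNeumannAlgebra H) (Ω : H) (b R : H →L[ℂ] H) : Prop :=
  R ∈ Set.centralizer (M : Set (H →L[ℂ] H)) ∧ R Ω = b Ω

/-- A realization of the coarse `N`-`N` bimodule `L²(N) ⊗ L²(N)`: a Hilbert space with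
left/right `N`-actions and a map `(a, b) ↦ aΩ ⊗ bΩ` with total vectors, the correct inner
products, and the correct actions. Any such realization is canonically isomorphic to
`L²(N) ⊗ L²(N)`. -/
structure CoarseBimodule (M : VonNeumannAlgebra H) (Ω : H) (N : Set (H →L[ℂ] H)) :
    Type (u + 1) where
  K : Type u
  [nacg : NormedAddCommGroup K]
  [ips : InnerProductSpace ℂ K]
  [cs : CompleteSpace K]
  vec : (H →L[ℂ] H) → (H →L[ℂ] H) → K
  lact : (H →L[ℂ] H) → K →L[ℂ] K
  ract : (H →L[ℂ] H) → K →L[ℂ] K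
  inner_vec : ∀ a b c d : H →L[ℂ] H, a ∈ N → b ∈ N → c ∈ N → d ∈ N →
    ⟪vec a b, vec c d⟫_ℂ = ⟪a Ω, c Ω⟫_ℂ * ⟪b Ω, d Ω⟫_ℂ
  dense_span : Dense
    ((Submodule.span ℂ {x : K | ∃ a ∈ N, ∃ b ∈ N, x = vec a b} : Submodule ℂ K) : Set K)
  lact_vec : ∀ x a b : H →L[ℂ] H, x ∈ N → a ∈ N → b ∈ N → lact x (vec a b) = vec (x * a) b
  ract_vec : ∀ y a b : H →L[ℂ] H, y ∈ N → a ∈ N → b ∈ N → ract y (vec a b) = vec a (b * y)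

attribute [instance] CoarseBimodule.nacg CoarseBimodule.ips CoarseBimodule.cs

/-- The anti-coarse space `H_antic(N ≤ M)`: the joint kernel of all bounded `N`-`N` bimodular
maps `L²(M) → L²(N) ⊗ L²(N)`. -/
def antiCoarse (M : VonNeumannAlgebra H) (Ω : H) (N : Set (H →L[ℂ] H)) : Set H :=
  {ξ | ∀ (W : CoarseBimodule M Ω N) (T : H →L[ℂ] W.K),
    (∀ a ∈ N, ∀ η : H, T (a η) = W.lact a (T η)) →
    (∀ b ∈ N, ∀ R : H →L[ℂ] H, IsRightMul M Ω b R → ∀ η : H, T (R η) = W.ract b (T η)) →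
    T ξ = 0}

/-- For a set of vectors `Y ⊆ L²(M)`, the von Neumann algebra `W*(Y)` generated by the polar
parts and the spectral data of the unbounded operators `L_ξ`, `ξ ∈ Y`: equivalently, the
smallest von Neumann subalgebra `N ≤ M` with `Y ⊆ L²(N)`. -/
def WstarVec (M : VonNeumannAlgebra H) (Ω : H) (Y : Set H) : Set (H →L[ℂ] H) :=
  ⋂ (N : VonNeumannAlgebra H) (_ : N ≤ M) (_ : Y ⊆ L2set Ω (N : Set (H →L[ℂ] H))),
    (N : Set (H →L[ℂ] H))

/-! ## Generalized normalizers and intertwining spaces -/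

/-- The one-sided quasi-normalizer `q¹N_M(N)`. -/
def oneSidedQNormalizer (M : VonNeumannAlgebra H) (N : Set (H →L[ℂ] H)) :
    Set (H →L[ℂ] H) :=
  {x | x ∈ M ∧ ∃ (n : ℕ) (xs : Fin n → H →L[ℂ] H), (∀ j, xs j ∈ M) ∧
    ∀ a ∈ N, ∃ b : Fin n → H →L[ℂ] H, (∀ j, b j ∈ N) ∧ x * a = ∑ j, b j * xs j}

/-- The wq-normalizer `N^{wq}_M(N)`: unitaries `u ∈ M` with `uNu* ∩ N` diffuse. -/
def wqNormalizer (M : VonNeumannAlgebra H) (N : Set (H →L[ℂ] H)) : Set (H →L[ℂ] H) :=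
  {u | unitaryIn M u ∧ DiffuseSet ({x | ∃ a ∈ N, x = u * a * star u} ∩ N)}

/-- The set `s` contains a sequence of unitaries of `M` tending weakly to `0`. -/
def weakNullUnitaries (M : VonNeumannAlgebra H) (s : Set (H →L[ℂ] H)) : Prop :=
  ∃ w : ℕ → H →L[ℂ] H, (∀ n, unitaryIn M (w n) ∧ w n ∈ s) ∧
    ∀ ξ η : H, Filter.Tendsto (fun n => ⟪w n ξ, η⟫_ℂ) Filter.atTop (nhds 0)

/-- The very weak quasi-normalizer `N^{vwq}_M(N)`. -/
def vwqNormalizer (M : VonNeumannAlgebra H) (N : Set (H →L[ℂ] H)) : Set (H →L[ℂ] H) :=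
  {u | unitaryIn M u ∧ ∃ v, unitaryIn M v ∧
    weakNullUnitaries M ({x | ∃ a ∈ N, x = u * a * v} ∩ N)}

/-- The set `s ⊆ L²(M)` generates a right `P`-submodule of finite dimension (it is contained
in the closure of a finitely generated right `P`-module). -/
def finRankRight (M : VonNeumannAlgebra H) (Ω : H) (P : Set (H →L[ℂ] H)) (s : Set H) : Prop :=
  ∃ (n : ℕ) (ζ : Fin n → H),
    s ⊆ closure ((Submodule.span ℂ
      {η : H | ∃ j : Fin n, ∃ b ∈ P, ∃ R : H →L[ℂ] H, IsRightMul M Ω b R ∧ η = R (ζ j)} :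
        Submodule ℂ H) : Set H)

/-- `ξ` lies in the intertwining space `I_M(Q, P)`: the right `P`-module generated by `Q ξ P`
has finite dimension as a right `P`-module. -/
def intertwiners (M : VonNeumannAlgebra H) (Ω : H) (Q P : Set (H →L[ℂ] H)) (ξ : H) : Prop :=
  finRankRight M Ω P
    {η : H | ∃ a ∈ Q, ∃ b ∈ P, ∃ R : H →L[ℂ] H, IsRightMul M Ω b R ∧ η = a (R ξ)}

/-- The weak intertwining space `wI_{zMz}(Q, P)` computed inside the corner `z M z`:
the union of `I(Q₀, P)` over all diffuse von Neumann subalgebras `Q₀` of `Q` (with unit `z`).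
Taking `z = 1` gives the usual weak intertwining space `wI_M(Q, P)`. -/
def wIntertwinersAt (M : VonNeumannAlgebra H) (Ω : H) (z : H →L[ℂ] H)
    (Q P : Set (H →L[ℂ] H)) : Set H :=
  {ξ | ξ ∈ L2set Ω (corner z (M : Set (H →L[ℂ] H))) ∧
    ∃ W : VonNeumannAlgebra H, W ≤ M ∧ z ∈ W ∧
      corner z (W : Set (H →L[ℂ] H)) ⊆ Q ∧ DiffuseSet (corner z (W : Set (H →L[ℂ] H))) ∧
      intertwiners M Ω (corner z (W : Set (H →L[ℂ] H))) P ξ}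

/-- The weak intertwining space `wI_M(Q, P)`. -/
def wIntertwiners (M : VonNeumannAlgebra H) (Ω : H) (Q P : Set (H →L[ℂ] H)) : Set H :=
  wIntertwinersAt M Ω 1 Q P

/-- The relative commutant of a set `Q` inside (the carrier of) `Mw`. -/
def relComm (Mw : VonNeumannAlgebra H) (Q : Set (H →L[ℂ] H)) : Set (H →L[ℂ] H) :=
  {z | z ∈ Mw ∧ ∀ x ∈ Q, z * x = x * z}

/-! ## Tracial ultrapowers -/

/-- A realization of the tracial ultrapower `M^ω` of a tracial von Neumann algebra `(M, τ)`
in standard form: a tracial von Neumann algebra `(Mw, τ_ω)` in standard form, together with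
the quotient map `Φ` from bounded sequences in `M`, which is a surjective unital
*-homomorphism with `τ_ω(Φ(x)) = lim_ω τ(x_k)`. -/
structure Ultrapower (M : VonNeumannAlgebra H) (Ω : H) (ω : Ultrafilter ℕ) :
    Type (u + 1) where
  carrier : Type u
  [nacg : NormedAddCommGroup carrier]
  [ips : InnerProductSpace ℂ carrier]
  [cs : CompleteSpace carrier]
  Mw : VonNeumannAlgebra carrier
  vec : carrier
  traceVec : IsTraceVector Mw vec
  Φ : (ℕ → H →L[ℂ] H) → carrier →L[ℂ] carrier
  mem : ∀ x : ℕ → H →L[ℂ] H, (∀ k, x k ∈ M) → BddAbove (Set.range fun k => ‖x k‖) →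
    Φ x ∈ Mw
  surj : ∀ z ∈ Mw, ∃ x : ℕ → H →L[ℂ] H,
    (∀ k, x k ∈ M) ∧ BddAbove (Set.range fun k => ‖x k‖) ∧ Φ x = z
  map_add : ∀ x y : ℕ → H →L[ℂ] H, (∀ k, x k ∈ M) → BddAbove (Set.range fun k => ‖x k‖) →
    (∀ k, y k ∈ M) → BddAbove (Set.range fun k => ‖y k‖) → Φ (x + y) = Φ x + Φ y
  map_smul : ∀ (c : ℂ) (x : ℕ → H →L[ℂ] H), (∀ k, x k ∈ M) →
    BddAbove (Set.range fun k => ‖x k‖) → Φ (c • x) = c • Φ x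
  map_mul : ∀ x y : ℕ → H →L[ℂ] H, (∀ k, x k ∈ M) → BddAbove (Set.range fun k => ‖x k‖) →
    (∀ k, y k ∈ M) → BddAbove (Set.range fun k => ‖y k‖) → Φ (x * y) = Φ x * Φ y
  map_star : ∀ x : ℕ → H →L[ℂ] H, (∀ k, x k ∈ M) → BddAbove (Set.range fun k => ‖x k‖) →
    Φ (fun k => star (x k)) = star (Φ x)
  map_one : Φ 1 = 1
  norm_le : ∀ (x : ℕ → H →L[ℂ] H) (C : ℝ), (∀ k, x k ∈ M) → (∀ k, ‖x k‖ ≤ C) → ‖Φ x‖ ≤ C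
  trace_eq : ∀ x : ℕ → H →L[ℂ] H, (∀ k, x k ∈ M) → BddAbove (Set.range fun k => ‖x k‖) →
    Filter.Tendsto (fun k => ⟪x k Ω, Ω⟫_ℂ) (↑ω) (nhds ⟪Φ x vec, vec⟫_ℂ)

attribute [instance] Ultrapower.nacg Ultrapower.ips Ultrapower.cs

/-- The copy of `M` inside `M^ω` given by constant sequences. -/
def Ultrapower.diag {M : VonNeumannAlgebra H} {Ω : H} {ω : Ultrafilter ℕ}
    (U : Ultrapower M Ω ω) : Set (U.carrier →L[ℂ] U.carrier) :=
  {z | ∃ a ∈ M, z = U.Φ fun _ => a}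

/-- An ultrafilter on `ℕ` is free when it contains all cofinite sets. -/
def Ultrafilter.IsFreeUltrafilter (ω : Ultrafilter ℕ) : Prop :=
  (↑ω : Filter ℕ) ≤ Filter.cofinite


/-- The Hilbert space `H ⊗ ℓ²(n × n)` on which the matrix amplification `Mₙ(M)` acts in
standard form. -/
abbrev MatHilbert (n : ℕ) (H : Type u) [NormedAddCommGroup H] [InnerProductSpace ℂ H]
    [CompleteSpace H] : Type u :=
  PiLp 2 (fun _ : Fin n × Fin n => H)

/-- The action of a matrix of operators on `MatHilbert n H`, acting on the first
(column) index; the second index carries the right action. -/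
def matOp {n : ℕ} (T : Matrix (Fin n) (Fin n) (H →L[ℂ] H)) :
    MatHilbert n H →L[ℂ] MatHilbert n H :=
  ((PiLp.continuousLinearEquiv 2 ℂ (fun _ : Fin n × Fin n => H)).symm.toContinuousLinearMap.comp
    ((ContinuousLinearMap.pi fun ik : Fin n × Fin n =>
        ∑ j : Fin n, (T ik.1 j).comp (ContinuousLinearMap.proj (j, ik.2))).comp
      (PiLp.continuousLinearEquiv 2 ℂ (fun _ : Fin n × Fin n => H)).toContinuousLinearMap))

/-- The canonical trace vector for `Mₙ(M)` acting on `MatHilbert n H`. -/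
def matTraceVec (n : ℕ) (Ω : H) : MatHilbert n H :=
  (WithLp.equiv 2 (∀ _ : Fin n × Fin n, H)).symm
    (fun ik => if ik.1 = ik.2 then (Real.sqrt n)⁻¹ • Ω else 0)

/-- A realization of the tracial ultraproduct `∏_{k→ω} M_k(ℂ)` of matrix algebras with their
normalized traces: a tracial von Neumann algebra in standard form together with the quotient
map `Φ` from operator-norm-bounded sequences of matrices, a surjective unital *-homomorphism
with `τ(Φ(x)) = lim_ω tr_k(x_k)`. -/
structure MatrixUltraproduct (ω : Ultrafilter ℕ) : Type (u + 1) where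
  carrier : Type u
  [nacg : NormedAddCommGroup carrier]
  [ips : InnerProductSpace ℂ carrier]
  [cs : CompleteSpace carrier]
  Mw : VonNeumannAlgebra carrier
  vec : carrier
  traceVec : IsTraceVector Mw vec
  Φ : (∀ k : ℕ, Matrix (Fin k) (Fin k) ℂ) → carrier →L[ℂ] carrier
  mem : ∀ x : ∀ k : ℕ, Matrix (Fin k) (Fin k) ℂ,
    BddAbove (Set.range fun k => matOpNorm (x k)) → Φ x ∈ Mw
  surj : ∀ z ∈ Mw, ∃ x : ∀ k : ℕ, Matrix (Fin k) (Fin k) ℂ,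
    BddAbove (Set.range fun k => matOpNorm (x k)) ∧ Φ x = z
  map_add : ∀ x y : ∀ k : ℕ, Matrix (Fin k) (Fin k) ℂ,
    BddAbove (Set.range fun k => matOpNorm (x k)) →
    BddAbove (Set.range fun k => matOpNorm (y k)) →
    Φ (fun k => x k + y k) = Φ x + Φ y
  map_smul : ∀ (c : ℂ) (x : ∀ k : ℕ, Matrix (Fin k) (Fin k) ℂ),
    BddAbove (Set.range fun k => matOpNorm (x k)) → Φ (fun k => c • x k) = c • Φ x
  map_mul : ∀ x y : ∀ k : ℕ, Matrix (Fin k) (Fin k) ℂ,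
    BddAbove (Set.range fun k => matOpNorm (x k)) →
    BddAbove (Set.range fun k => matOpNorm (y k)) →
    Φ (fun k => x k * y k) = Φ x * Φ y
  map_star : ∀ x : ∀ k : ℕ, Matrix (Fin k) (Fin k) ℂ,
    BddAbove (Set.range fun k => matOpNorm (x k)) →
    Φ (fun k => star (x k)) = star (Φ x)
  map_one : Φ (fun _ => 1) = 1
  norm_le : ∀ (x : ∀ k : ℕ, Matrix (Fin k) (Fin k) ℂ) (C : ℝ),
    (∀ k, matOpNorm (x k) ≤ C) → ‖Φ x‖ ≤ C
  trace_eq : ∀ x : ∀ k : ℕ, Matrix (Fin k) (Fin k) ℂ,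
    BddAbove (Set.range fun k => matOpNorm (x k)) →
    Filter.Tendsto (fun k => Matrix.trace (x k) / (k : ℂ)) (↑ω) (nhds ⟪Φ x vec, vec⟫_ℂ)

attribute [instance] MatrixUltraproduct.nacg MatrixUltraproduct.ips MatrixUltraproduct.cs

set_option linter.unusedSectionVars false
open scoped ENNReal
universe v w x
namespace S6

open Complex (conj_ofReal norm_real)
open Equiv (prodCongr_apply refl_apply coe_mulRight)
open ContinuousLinearMap (adjoint adjoint_adjoint adjoint_comp adjoint_inner_left adjoint_inner_right ext_on isPositive_def isSelfAdjoint_iff_isSymmetric le_opNorm le_opNorm_enorm map_tsum nonneg_iff_isPositive norm_id_le opNorm_comp_le opNorm_le_bound reApplyInnerSelf smulRight_apply star_eq_adjoint)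
open Finset (sum_congr mul_sum sum_le_sum sum_sub_distrib sum_mul sum_add_distrib sum_comm sum_nonneg smul_sum mem_filter sum_neg_distrib sum_const sum_eq_single sum_const_zero sum_ite_eq sum_le_card_nsmul card_univ single_le_sum sum_eq_zero)

/-- bounded operators on `H` -/
local notation "𝔹" => H →L[ℂ] H
/-- von Neumann algebras on `H` -/
local notation "𝔳𝔑" => VonNeumannAlgebra H
local notation "⟪" a "," b "⟫" => inner ℂ a b
open Submodule (starProjection_eq_self_iff isClosed_topologicalClosure starProjection_apply_mem mem_sup_left mem_sup_right le_topologicalClosure dense_iff_topologicalClosure_eq_top mem_orthogonal subset_span span_induction)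
open ENNReal (mul_ne_top ofReal_le_ofReal ofReal_sum_of_nonneg ofReal_le_one ofReal_le_ofReal_iff)

theorem inner_sq {E : Type*} [NormedAddCommGroup E] [InnerProductSpace ℂ E] (x : E) :
    ⟪x, x⟫ = (RCLike.ofReal ‖x‖ : ℂ) ^ 2 := inner_self_eq_norm_sq_to_K x


theorem isProj_iff {p : 𝔹} : IsProj p ↔ IsStarProjection p :=
  ⟨fun h => ⟨h.1.symm, h.2⟩, fun h => ⟨h.1.symm, h.2⟩⟩

theorem mem_of_comm {Q : 𝔳𝔑} {x : 𝔹}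
    (h : ∀ y ∈ Q.commutant, y * x = x * y) : x ∈ Q := by
  rw [← Q.commutant_commutant, VonNeumannAlgebra.mem_commutant_iff]; exact h

theorem comm_of_mem {Q : 𝔳𝔑} {x y : 𝔹} (hx : x ∈ Q)
    (hy : y ∈ Q.commutant) : x * y = y * x :=
  VonNeumannAlgebra.mem_commutant_iff.1 hy x hx

theorem smul_mem' {Q : 𝔳𝔑} {x : 𝔹} (c : ℂ) (hx : x ∈ Q) : c • x ∈ Q :=
  Q.toStarSubalgebra.smul_mem hx c

theorem rsmul_mem' {Q : 𝔳𝔑} {x : 𝔹} (c : ℝ) (hx : x ∈ Q) : c • x ∈ Q := by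
  have := smul_mem' (c : ℂ) hx
  rwa [Complex.coe_smul] at this

theorem cfc_mem_vn {Q : 𝔳𝔑} {a : 𝔹} (ha : IsSelfAdjoint a) (haQ : a ∈ Q)
    (f : ℝ → ℝ) : cfc f a ∈ Q := by
  refine mem_of_comm fun y hy => ?_
  have h : Commute a y := comm_of_mem haQ hy
  exact ((h.cfc (by rwa [ha.star_eq]) f)).eq.symm

theorem starProjection_mem {Q : 𝔳𝔑} (K : Submodule ℂ H)
    [K.HasOrthogonalProjection] (h : ∀ y ∈ Q.commutant, ∀ v ∈ K, y v ∈ K) :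
    K.starProjection ∈ Q := by
  rw [VonNeumannAlgebra.IsStarProjection.mem_iff isStarProjection_starProjection]
  intro y hy v hv
  simp only [Submodule.range_starProjection, Submodule.mem_comap] at hv ⊢
  exact h y hy v hv

theorem proj_inner {p : 𝔹} (hp : IsStarProjection p) (v w : H) :
    ⟪p v, w⟫ = ⟪v, p w⟫ := by
  have := adjoint_inner_left p w v
  rw [← star_eq_adjoint, hp.isSelfAdjoint.star_eq] at this
  exact this

theorem sa_inner {p : 𝔹} (hp : IsSelfAdjoint p) (v w : H) :
    ⟪p v, w⟫ = ⟪v, p w⟫ := by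
  have := adjoint_inner_left p w v
  rw [← star_eq_adjoint, hp.star_eq] at this
  exact this

theorem star_inner_left (a : 𝔹) (v w : H) : ⟪star a v, w⟫ = ⟪v, a w⟫ := by
  rw [star_eq_adjoint]; exact adjoint_inner_left a w v

theorem star_inner_right (a : 𝔹) (v w : H) : ⟪v, star a w⟫ = ⟪a v, w⟫ := by
  rw [star_eq_adjoint]; exact adjoint_inner_right a v w

theorem proj_idem {p : 𝔹} (hp : IsStarProjection p) (v : H) : p (p v) = p v := by
  have := hp.isIdempotentElem
  exact congrArg (fun f : 𝔹 => f v) this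

theorem proj_inner_self {p : 𝔹} (hp : IsStarProjection p) (v : H) :
    ⟪p v, v⟫ = ((‖p v‖ ^ 2 : ℝ) : ℂ) := by
  rw [← proj_idem hp v, proj_inner hp, proj_idem hp, inner_sq]
  push_cast; rfl

/-- orthogonality of ranges from operator identity -/
theorem inner_eq_zero_of_mul {p q : 𝔹} (hp : IsStarProjection p) (h : p * q = 0) (v w : H) :
    ⟪p v, q w⟫ = 0 := by
  rw [proj_inner hp]
  have : p (q w) = 0 := congrArg (fun f : 𝔹 => f w) h
  rw [this, inner_zero_right]

theorem mul_eq_zero_symm {p q : 𝔹} (hp : IsStarProjection p) (hq : IsStarProjection q)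
    (h : p * q = 0) : q * p = 0 := by
  have := congrArg star h
  simpa [hp.isSelfAdjoint.star_eq, hq.isSelfAdjoint.star_eq] using this

theorem mul_symm_of_le {p q : 𝔹} (hp : IsStarProjection p) (hq : IsStarProjection q)
    (h : p * q = q) : q * p = q := by
  have := congrArg star h
  simpa [hp.isSelfAdjoint.star_eq, hq.isSelfAdjoint.star_eq] using this

theorem norm_proj_le {p : 𝔹} (hp : IsStarProjection p) : ‖p‖ ≤ 1 := hp.norm_le

/-- Zorn: decomposition of `1` into projections with a property. -/
theorem zorn_partition (C : 𝔳𝔑) (P : 𝔹 → Prop)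
    (h : ∀ p ∈ C, IsStarProjection p → p ≠ 0 →
      ∃ q ∈ C, IsStarProjection q ∧ q ≠ 0 ∧ p * q = q ∧ P q) :
    ∃ S : Set 𝔹, (∀ q ∈ S, q ∈ C ∧ IsStarProjection q ∧ q ≠ 0 ∧ P q) ∧
      (∀ q ∈ S, ∀ q' ∈ S, q ≠ q' → q * q' = 0) ∧
      ∀ ζ : H, HasSum (fun q : S => (q : 𝔹) ζ) ζ := by
  let 𝒮 : Set (Set 𝔹) := {S | (∀ q ∈ S, q ∈ C ∧ IsStarProjection q ∧ q ≠ 0 ∧ P q) ∧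
      (∀ q ∈ S, ∀ q' ∈ S, q ≠ q' → q * q' = 0)}
  obtain ⟨S, hS⟩ : ∃ S, Maximal (· ∈ 𝒮) S := by
    refine zorn_subset 𝒮 fun c hc hchain => ⟨⋃₀ c, ⟨?_, ?_⟩, fun s hs => Set.subset_sUnion_of_mem hs⟩
    · rintro q ⟨s, hs, hq⟩; exact (hc hs).1 q hq
    · rintro q ⟨s, hs, hq⟩ q' ⟨s', hs', hq'⟩ hne
      rcases hchain.total hs hs' with hh | hh
      · exact (hc hs').2 q (hh hq) q' hq' hne
      · exact (hc hs).2 q hq q' (hh hq') hne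
  refine ⟨S, hS.prop.1, hS.prop.2, ?_⟩
  have hS1 := hS.prop.1
  have hS2 := hS.prop.2
  -- the orthogonal complement
  let K : Submodule ℂ H := (⨆ q : S, (q : 𝔹).range)ᗮ
  have hK : ∀ v, v ∈ K ↔ ∀ q ∈ S, (q : 𝔹) v = 0 := by
    intro v
    simp only [K, ← Submodule.iInf_orthogonal, Submodule.mem_iInf, mem_orthogonal]
    constructor
    · intro hv q hq
      have h1 := hv ⟨q, hq⟩ (q (q v)) ⟨q v, rfl⟩
      rw [proj_idem (hS1 q hq).2.1, proj_inner_self (hS1 q hq).2.1] at h1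
      simpa using h1
    · rintro hv ⟨q, hq⟩ _ ⟨w, rfl⟩
      change ⟪q w, v⟫ = 0
      rw [proj_inner (hS1 q hq).2.1, hv q hq, inner_zero_right]
  have hKC : K.starProjection ∈ C := by
    refine starProjection_mem K fun y hy v hv => ?_
    rw [hK] at hv ⊢
    intro q hq
    have h1 := comm_of_mem (hS1 q hq).1 hy
    have h2 : q (y v) = y (q v) := congrArg (fun f : 𝔹 => f v) h1
    rw [h2, hv q hq, map_zero]
  have hK0 : K.starProjection = 0 := by
    by_contra hne
    obtain ⟨q, hqC, hqp, hq0, hle, hPq⟩ := h _ hKC isStarProjection_starProjection hne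
    have horth : ∀ q' ∈ S, q' * q = 0 := by
      intro q' hq'
      ext v
      have h1 : q v ∈ K := by
        have : K.starProjection (q v) = q v := congrArg (fun f : 𝔹 => f v) hle
        rw [← this]; exact starProjection_apply_mem _ _
      exact (hK _).1 h1 q' hq'
    have hqS : q ∉ S := fun hq => by
      have := horth q hq
      rw [hqp.isIdempotentElem] at this
      exact hq0 this
    have : insert q S ∈ 𝒮 := by
      refine ⟨?_, ?_⟩
      · rintro q' (rfl | hq')
        · exact ⟨hqC, hqp, hq0, hPq⟩
        · exact hS1 q' hq'
      · rintro q1 (rfl | h1) q2 (rfl | h2) hne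
        · exact absurd rfl hne
        · exact mul_eq_zero_symm (hS1 q2 h2).2.1 hqp (horth q2 h2)
        · exact horth q1 h1
        · exact hS2 q1 h1 q2 h2 hne
    exact hqS (hS.le_of_ge this (Set.subset_insert _ _) (Set.mem_insert _ _))
  have hKbot : ∀ v ∈ K, v = 0 := by
    intro v hv
    rw [← starProjection_eq_self_iff.2 hv, hK0]; rfl
  intro ζ
  have hV : OrthogonalFamily ℂ (fun q : S => (q : 𝔹).range)
      (fun q : S => ((q : 𝔹).range).subtypeₗᵢ) := by
    rintro ⟨q, hq⟩ ⟨q', hq'⟩ hne ⟨_, v, rfl⟩ ⟨_, w, rfl⟩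
    have hne' : q ≠ q' := fun hh => hne (Subtype.ext hh)
    exact inner_eq_zero_of_mul (hS1 q hq).2.1 (hS2 q hq q' hq' hne') v w
  have hfin : ∀ F : Finset S, ∑ q ∈ F, ‖(q : 𝔹) ζ‖ ^ 2 ≤ ‖ζ‖ ^ 2 := by
    intro F
    have h1 : ‖∑ q ∈ F, (q : 𝔹) ζ‖ ^ 2 = ∑ q ∈ F, ‖(q : 𝔹) ζ‖ ^ 2 :=
      hV.norm_sum (fun q => ⟨(q : 𝔹) ζ, ζ, rfl⟩) F
    have h2 : ⟪∑ q ∈ F, (q : 𝔹) ζ, ζ⟫ = ((∑ q ∈ F, ‖(q : 𝔹) ζ‖ ^ 2 : ℝ) : ℂ) := by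
      rw [sum_inner]; push_cast
      refine sum_congr rfl fun q _ => ?_
      rw [proj_inner_self (hS1 q q.2).2.1]; push_cast; rfl
    have h3 := norm_inner_le_norm (𝕜 := ℂ) (∑ q ∈ F, (q : 𝔹) ζ) ζ
    rw [h2, norm_real, Real.norm_of_nonneg (sum_nonneg fun _ _ => sq_nonneg _),
      ← h1] at h3
    rw [← h1]
    set x := ‖∑ q ∈ F, (q : 𝔹) ζ‖
    have hx : 0 ≤ x := norm_nonneg _
    have hz : 0 ≤ ‖ζ‖ := norm_nonneg _
    by_cases hx0 : x = 0
    · rw [hx0]; nlinarith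
    · have : x ≤ ‖ζ‖ := by
        have hxp : 0 < x := lt_of_le_of_ne hx (Ne.symm hx0)
        nlinarith
      gcongr
  have hsum : Summable (fun q : S => (q : 𝔹) ζ) := by
    have := (hV.summable_iff_norm_sq_summable
      (fun q => (⟨(q : 𝔹) ζ, ζ, rfl⟩ : (q : 𝔹).range))).2
      (summable_of_sum_le (c := ‖ζ‖ ^ 2) (fun _ => sq_nonneg _) (by simpa using hfin))
    simpa using this
  have hdiff : ζ - ∑' q : S, (q : 𝔹) ζ = 0 := by
    apply hKbot
    rw [hK]
    intro q hq
    rw [map_sub, map_tsum _ hsum, tsum_eq_single ⟨q, hq⟩]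
    · simp [proj_idem (hS1 q hq).2.1]
    · rintro ⟨q', hq'⟩ hne
      exact congrArg (fun f : 𝔹 => f ζ)
        (hS2 q hq q' hq' fun hh => hne (Subtype.ext hh.symm))
  rw [sub_eq_zero] at hdiff
  have := hsum.hasSum
  rwa [← hdiff] at this

theorem re_inner_nonneg {g : 𝔹} (hg : 0 ≤ g) (v : H) : 0 ≤ (⟪g v, v⟫).re := by
  rw [nonneg_iff_isPositive] at hg
  exact hg.re_inner_nonneg_left v

/-- spectral projections -/
theorem spec_proj {Q : 𝔳𝔑} {b : 𝔹} (hb : IsSelfAdjoint b) (hbQ : b ∈ Q)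
    (c : ℝ) : ∃ e ∈ Q, IsStarProjection e ∧
      (∀ x : 𝔹, IsSelfAdjoint x → x * b = b * x → x * e = e * x) ∧
      (∀ F : ℝ → ℝ, Continuous F → (∀ t, c ≤ t → F t = 0) → cfc F b * e = 0) ∧
      (∀ v, e v = v → c * ‖v‖ ^ 2 ≤ (⟪b v, v⟫).re) ∧
      (∀ v, e v = 0 → (⟪b v, v⟫).re ≤ c * ‖v‖ ^ 2) ∧
      (e = 0 → ∀ x ∈ spectrum ℝ b, x ≤ c) := by
  set f : ℝ → ℝ := fun t => max (t - c) 0 with hf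
  have hfc : Continuous f := by fun_prop
  set g := cfc f b with hgdef
  have hg0 : 0 ≤ g := cfc_nonneg fun x _ => le_max_right _ _
  have hgsa : IsSelfAdjoint g := hg0.isSelfAdjoint
  have hgQ : g ∈ Q := cfc_mem_vn hb hbQ f
  set K : Submodule ℂ H := (g : 𝔹).range.topologicalClosure with hKdef
  have hKcl : IsClosed (K : Set H) := isClosed_topologicalClosure _
  have : CompleteSpace K := hKcl.completeSpace_coe
  have hrange : ∀ w, g w ∈ K := fun w => le_topologicalClosure _ ⟨w, rfl⟩
  -- closed-condition induction
  have hind : ∀ {s : Set H}, IsClosed s → (∀ w, g w ∈ s) → ∀ v ∈ K, v ∈ s := by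
    intro s hs h v hv
    have : (K : Set H) ⊆ s := by
      rw [hKdef, Submodule.topologicalClosure_coe]
      refine closure_minimal ?_ hs
      rintro _ ⟨w, rfl⟩; exact h w
    exact this hv
  have heK : ∀ v, K.starProjection v = v ↔ v ∈ K := fun v => starProjection_eq_self_iff
  have hker : ∀ v, K.starProjection v = 0 ↔ g v = 0 := by
    intro v
    rw [Submodule.starProjection_apply_eq_zero_iff, mem_orthogonal]
    constructor
    · intro h
      have h1 := h (g (g v)) (hrange _)
      rw [sa_inner hgsa, inner_self_eq_zero] at h1
      exact h1
    · intro h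
      exact hind (s := {u | ⟪u, v⟫ = 0}) (isClosed_eq (by fun_prop) continuous_const)
        (fun w => by simp [sa_inner hgsa, h])
  have hmul : ∀ F G : ℝ → ℝ, Continuous F → Continuous G →
      cfc F b * cfc G b = cfc (fun t => F t * G t) b := fun F G hF hG =>
    (cfc_mul F G b hF.continuousOn hG.continuousOn).symm
  refine ⟨K.starProjection, ?_, isStarProjection_starProjection, ?_, ?_, ?_, ?_, ?_⟩
  · refine starProjection_mem K fun y hy v hv => ?_
    refine hind (s := y ⁻¹' K) (hKcl.preimage y.continuous) (fun w => ?_) v hv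
    have : g (y w) = y (g w) := congrArg (fun f : 𝔹 => f w) (comm_of_mem hgQ hy)
    rw [Set.mem_preimage, ← this]; exact hrange _
  · intro x hx hxb
    have hxg : Commute g x := (show Commute b x from hxb.symm).cfc
      (by rw [hb.star_eq]; exact hxb.symm) f
    have hinv : ∀ v ∈ K, x v ∈ K := fun v hv => by
      refine hind (s := x ⁻¹' K) (hKcl.preimage x.continuous) (fun w => ?_) v hv
      have : g (x w) = x (g w) := congrArg (fun f : 𝔹 => f w) hxg.eq
      rw [Set.mem_preimage, ← this]; exact hrange _
    have h1 : K.starProjection * x * K.starProjection = x * K.starProjection := by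
      ext v
      exact (heK _).2 (hinv _ (starProjection_apply_mem _ _))
    have h2 := congrArg star h1
    have hsp : star K.starProjection = K.starProjection :=
      (isStarProjection_starProjection (U := K)).isSelfAdjoint.star_eq
    simp only [star_mul, hsp, hx.star_eq] at h2
    rw [← h1, mul_assoc, h2]
  · intro F hF hF0
    have h0 : cfc F b * g = 0 := by
      rw [hmul F f hF hfc]
      have : (fun t => F t * f t) = fun _ => 0 := by
        ext t
        rcases le_total c t with h | h
        · simp [hF0 t h]
        · simp [hf, h]
      rw [this, cfc_const_zero ℝ b]
    ext v
    refine hind (s := {u | cfc F b u = 0}) (isClosed_eq (by fun_prop) continuous_const)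
      (fun w => congrArg (fun f : 𝔹 => f w) h0) _ (starProjection_apply_mem K v)
  · intro v hv
    refine hind (s := {v | c * ‖v‖ ^ 2 ≤ (⟪b v, v⟫).re}) ?_ ?_ v ((heK v).1 hv)
    · exact isClosed_le (by fun_prop) (Complex.continuous_re.comp (by fun_prop))
    · intro w
      have h1 : b * g - c • g = g * g := by
        have e1 : b * g = cfc (fun t => t * f t) b := by
          conv_lhs => rw [← cfc_id' ℝ b]
          rw [hgdef, hmul (fun t => t) _ continuous_id hfc]
        have e2 : c • g = cfc (fun t => c * f t) b := by
          rw [hgdef, ← cfc_const_mul c f b]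
        rw [e1, e2, ← cfc_sub _ _ b (by fun_prop) (by fun_prop), hgdef, hmul _ _ hfc hfc]
        congr 1; ext t
        rcases le_total c t with h | h
        · simp only [hf, max_eq_left (sub_nonneg.2 h)]; ring
        · simp [hf, h]
      have h2 : b (g w) - (c : ℂ) • g w = g (g w) := by
        have := congrArg (fun f : 𝔹 => f w) h1
        simpa [← Complex.coe_smul] using this
      have h3 := re_inner_nonneg hg0 (g w)
      rw [← h2, inner_sub_left, inner_smul_left, inner_sq] at h3
      simp only [Complex.sub_re, conj_ofReal, Complex.re_ofReal_mul] at h3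
      have h4 : (((‖g w‖ : ℂ)) ^ 2).re = ‖g w‖ ^ 2 := by
        rw [← Complex.ofReal_pow, Complex.ofReal_re]
      change c * ‖g w‖ ^ 2 ≤ (⟪b (g w), g w⟫).re
      erw [h4] at h3
      linarith
  · intro v hv
    have hgv := (hker v).1 hv
    have h1 : 0 ≤ g - (b - algebraMap ℝ _ c) := by
      have e2 : b - algebraMap ℝ _ c = cfc (fun t => t - c) b := by
        rw [cfc_sub (fun t => t) (fun _ => c) b, cfc_id' ℝ b, cfc_const c b]
      rw [e2, hgdef, ← cfc_sub _ _ b (by fun_prop) (by fun_prop)]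
      exact cfc_nonneg fun x _ => sub_nonneg.2 (le_max_left _ _)
    have h3 := re_inner_nonneg h1 v
    have h2 : (g - (b - algebraMap ℝ 𝔹 c)) v = (c : ℂ) • v - b v := by
      have : (algebraMap ℝ 𝔹 c) v = (c : ℂ) • v := by
        rw [Algebra.algebraMap_eq_smul_one]; simp [← Complex.coe_smul]
      simp [hgv, this]
    rw [h2, inner_sub_left, inner_smul_left, inner_sq] at h3
    simp only [Complex.sub_re, conj_ofReal, Complex.re_ofReal_mul] at h3
    have h4 : (((‖v‖ : ℂ)) ^ 2).re = ‖v‖ ^ 2 := by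
      rw [← Complex.ofReal_pow, Complex.ofReal_re]
    erw [h4] at h3
    linarith
  · intro he x hx
    have hg : g = 0 := by
      ext v
      exact (hker v).1 (by rw [he]; rfl)
    have := norm_apply_le_norm_cfc f b hx hfc.continuousOn hb
    rw [← hgdef, hg, norm_zero] at this
    have h1 : f x = 0 := norm_le_zero_iff.1 this
    simp only [hf, max_eq_right_iff, tsub_le_iff_right, zero_add] at h1
    exact h1

/-- polar decomposition lemma -/
theorem polar_lemma {C : 𝔳𝔑} {a : 𝔹} (haC : a ∈ C) (ha : a ≠ 0) :
    ∃ k ∈ C, ∃ e ∈ C, IsStarProjection e ∧ e ≠ 0 ∧ star (a * k) * (a * k) = e ∧ k * e = k ∧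
      (∀ p, IsStarProjection p → a * p = a → p * e = e) := by
  set b := star a * a with hb
  have hb0 : 0 ≤ b := star_mul_self_nonneg a
  have hbsa : IsSelfAdjoint b := hb0.isSelfAdjoint
  have hbC : b ∈ C := mul_mem (star_mem haC) haC
  have hbne : b ≠ 0 := by
    rw [hb]; exact (CStarRing.star_mul_self_eq_zero_iff a).not.2 ha
  set c := ‖b‖ / 2 with hc
  have hcpos : 0 < c := by have := norm_pos_iff.2 hbne; positivity
  obtain ⟨e, heC, hep, hecomm, heF, hege, hele, hespec⟩ := spec_proj hbsa hbC c
  have hbe : b * e = e * b := hecomm b hbsa rfl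
  have hhc : Continuous (fun t : ℝ => (Real.sqrt (max t c))⁻¹) := by
    refine Continuous.inv₀ (by fun_prop) fun t => ?_
    have : 0 < max t c := lt_of_lt_of_le hcpos (le_max_right _ _)
    positivity
  have hhc' := fun s => hhc.continuousOn (s := s)
  set h := cfc (fun t : ℝ => (Real.sqrt (max t c))⁻¹) b with hh
  have hhsa : IsSelfAdjoint h := cfc_predicate _ b
  have hhb : h * b = b * h := ((Commute.refl b).cfc (by rw [hbsa.star_eq]; exact Commute.refl b) _).eq
  have hhe : h * e = e * h := hecomm h hhsa hhb
  refine ⟨h * e, mul_mem (cfc_mem_vn hbsa hbC _) heC, e, heC, hep, ?_, ?_, ?_, ?_⟩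
  · intro h0
    have : Nontrivial (𝔹) := ⟨a, 0, ha⟩
    have h1 := hespec h0 ‖b‖ (CStarAlgebra.norm_mem_spectrum_of_nonneg hb0)
    linarith [norm_pos_iff.2 hbne]
  · have h1 : (h * b * h - 1) * e = 0 := by
      have := heF (fun t => (Real.sqrt (max t c))⁻¹ * t * (Real.sqrt (max t c))⁻¹ - 1)
        (by fun_prop) (fun t ht => by
          have h2 : 0 < t := lt_of_lt_of_le hcpos ht
          simp only [max_eq_left ht]
          have h3 := Real.mul_self_sqrt h2.le
          have h4 : Real.sqrt t ≠ 0 := by positivity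
          field_simp
          linarith [h3])
      rw [cfc_sub _ _ b (by fun_prop) (by fun_prop), cfc_const_one ℝ b,
        cfc_mul (fun t : ℝ => (Real.sqrt (max t c))⁻¹ * t) (fun t : ℝ => (Real.sqrt (max t c))⁻¹) b
          ((hhc' _).mul continuousOn_id) (hhc' _),
        cfc_mul (fun t : ℝ => (Real.sqrt (max t c))⁻¹) (fun t : ℝ => t) b (hhc' _) continuousOn_id,
        cfc_id' ℝ b] at this
      exact this
    have h2 : h * b * h * e = e := by
      rw [sub_mul, one_mul, sub_eq_zero] at h1; exact h1
    calc star (a * (h * e)) * (a * (h * e)) = e * (h * b * h * e) := by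
          simp only [star_mul, hep.isSelfAdjoint.star_eq, hhsa.star_eq, hb, mul_assoc]
      _ = e := by rw [h2, hep.isIdempotentElem]
  · rw [mul_assoc, hep.isIdempotentElem]
  · intro p hp hap
    have h1 : b * (1 - p) = 0 := by rw [hb, mul_sub, mul_one, mul_assoc, hap, sub_self]
    have h2 : e * (1 - p) = 0 := by
      ext v
      set w := (e * (1 - p)) v with hw
      have hbw : b w = 0 := by
        have : b * (e * (1 - p)) = 0 := by rw [← mul_assoc, hbe, mul_assoc, h1, mul_zero]
        exact congrArg (fun f : 𝔹 => f v) this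
      have hew : e w = w := proj_idem hep _
      have := hege w hew
      rw [hbw, inner_zero_left, Complex.zero_re] at this
      have h3 : ‖w‖ ^ 2 ≤ 0 := by
        by_contra hcon
        push Not at hcon
        have := mul_pos hcpos hcon
        linarith
      have h4 : ‖w‖ = 0 := by
        have := sq_nonneg ‖w‖
        exact pow_eq_zero_iff two_ne_zero |>.1 (le_antisymm h3 this)
      simpa using h4
    have h3 : e = e * p := by rw [mul_sub, mul_one, sub_eq_zero] at h2; exact h2
    have h4 := congrArg star h3
    rw [star_mul, hep.isSelfAdjoint.star_eq, hp.isSelfAdjoint.star_eq] at h4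
    exact h4.symm

/-- partitions of projections into pieces satisfying `P` -/
def Pav (Q : 𝔳𝔑) (P : 𝔹 → Prop) : Prop :=
  ∀ p ∈ Q, IsStarProjection p → ∃ (ι : Type) (_ : Fintype ι) (q : ι → 𝔹),
    (∀ i, q i ∈ Q ∧ IsStarProjection (q i) ∧ p * q i = q i ∧ P (q i)) ∧ ∑ i, q i = p

theorem pav_and {Q : 𝔳𝔑} {P₁ P₂ : 𝔹 → Prop} (h₁ : Pav Q P₁)
    (h₂ : Pav Q P₂) (her : ∀ q q', IsStarProjection q → IsStarProjection q' → q * q' = q' → P₁ q →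
      P₁ q') : Pav Q (fun q => P₁ q ∧ P₂ q) := by
  intro p hpQ hp
  obtain ⟨ι, _, q, hq, hqs⟩ := h₁ p hpQ hp
  choose κ hκ q' hq' hqs' using fun i => h₂ (q i) (hq i).1 (hq i).2.1
  refine ⟨Σ i, κ i, inferInstance, fun x => q' x.1 x.2, ?_, ?_⟩
  · rintro ⟨i, j⟩
    obtain ⟨a1, a2, a3, a4⟩ := hq' i j
    refine ⟨a1, a2, ?_, her _ _ (hq i).2.1 a2 a3 (hq i).2.2.2, a4⟩
    change p * q' i j = q' i j
    rw [← a3, ← mul_assoc, (hq i).2.2.1]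
  · rw [Fintype.sum_sigma, ← hqs]
    exact sum_congr rfl fun i _ => hqs' i

theorem proj_mul_of_comm {p e : 𝔹} (hp : IsStarProjection p) (he : IsStarProjection e)
    (h : p * e = e * p) : IsStarProjection (p * e) := by
  refine ⟨?_, ?_⟩
  · change p * e * (p * e) = p * e
    calc p * e * (p * e) = p * (e * p) * e := by simp only [mul_assoc]
      _ = (p * p) * (e * e) := by rw [← h]; simp only [mul_assoc]
      _ = p * e := by rw [hp.isIdempotentElem, he.isIdempotentElem]
  · rw [IsSelfAdjoint, star_mul, hp.isSelfAdjoint.star_eq, he.isSelfAdjoint.star_eq, h]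

theorem proj_mul_apply {p : 𝔹} {q : 𝔹} (h : p * q = q) {v : H} (hv : q v = v) :
    p v = v := by
  have := congrArg (fun f : 𝔹 => f v) h
  simp only [mul_apply_eq_comp, hv] at this
  exact this

theorem norm_le_of_form {T : 𝔹} (hT : IsSelfAdjoint T) {d : ℝ} (hd : 0 ≤ d)
    (h0 : ∀ v, 0 ≤ (⟪T v, v⟫).re) (h1 : ∀ v, (⟪T v, v⟫).re ≤ d * ‖v‖ ^ 2) : ‖T‖ ≤ d := by
  have hT0 : 0 ≤ T := by
    rw [nonneg_iff_isPositive, isPositive_def]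
    exact ⟨isSelfAdjoint_iff_isSymmetric.1 hT, h0⟩
  rw [CStarAlgebra.norm_le_iff_le_algebraMap T hd, ContinuousLinearMap.le_def,
    isPositive_def]
  refine ⟨isSelfAdjoint_iff_isSymmetric.1 ((IsSelfAdjoint.algebraMap _
    (IsSelfAdjoint.all d)).sub hT), fun v => ?_⟩
  have : (algebraMap ℝ 𝔹 d) v = (d : ℂ) • v := by
    rw [Algebra.algebraMap_eq_smul_one]; simp [← Complex.coe_smul]
  rw [reApplyInnerSelf, sub_apply, this, inner_sub_left,
    inner_smul_left, inner_sq]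
  have h4 : (((‖v‖ : ℂ)) ^ 2).re = ‖v‖ ^ 2 := by
    rw [← Complex.ofReal_pow, Complex.ofReal_re]
  simp only [map_sub, conj_ofReal]
  have := h1 v
  simp only [RCLike.re_to_complex, Complex.re_ofReal_mul]
  erw [h4]
  linarith

theorem pav_sa_aux {Q : 𝔳𝔑} {y : 𝔹} (hy : IsSelfAdjoint y) (hyQ : y ∈ Q)
    {ε : ℝ} (hε : 0 < ε) (n : ℕ) : ∀ p ∈ Q, IsStarProjection p → ∀ a d : ℝ, a ≤ d →
      d - a ≤ 2 ^ n * ε → (∀ v, p v = v → a * ‖v‖ ^ 2 ≤ (⟪y v, v⟫).re ∧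
        (⟪y v, v⟫).re ≤ d * ‖v‖ ^ 2) →
      ∃ (ι : Type) (_ : Fintype ι) (q : ι → 𝔹),
        (∀ i, q i ∈ Q ∧ IsStarProjection (q i) ∧ p * q i = q i ∧
          ∃ l : ℂ, ‖q i * y * q i - l • q i‖ ≤ ε) ∧ ∑ i, q i = p := by
  induction n with
  | zero =>
    intro p hpQ hp a d had hda hv
    refine ⟨Unit, inferInstance, fun _ => p, fun _ => ⟨hpQ, hp, hp.isIdempotentElem, (a : ℂ), ?_⟩,
      by simp⟩
    rw [pow_zero, one_mul] at hda
    have hform : ∀ v, (⟪(p * y * p - (a : ℂ) • p) v, v⟫).re =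
        (⟪y (p v), p v⟫).re - a * ‖p v‖ ^ 2 := by
      intro v
      simp only [sub_apply, mul_apply_eq_comp,
        smul_apply, inner_sub_left, inner_smul_left, proj_inner_self hp]
      rw [proj_inner hp]
      simp [← Complex.ofReal_pow, ← Complex.ofReal_mul]
    refine (norm_le_of_form ?_ (sub_nonneg.2 had) ?_ ?_).trans hda
    · refine IsSelfAdjoint.sub ?_ (IsSelfAdjoint.smul (by simp [IsSelfAdjoint]) hp.isSelfAdjoint)
      rw [IsSelfAdjoint]; simp [hp.isSelfAdjoint.star_eq, hy.star_eq, mul_assoc]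
    · intro v
      rw [hform]
      have := (hv (p v) (proj_idem hp v)).1
      linarith
    · intro v
      rw [hform]
      have h1 := (hv (p v) (proj_idem hp v)).2
      have h2 : ‖p v‖ ≤ ‖v‖ := by
        have := p.le_of_opNorm_le (norm_proj_le hp) v
        linarith
      have h3 : ‖p v‖ ^ 2 ≤ ‖v‖ ^ 2 := by gcongr
      nlinarith
  | succ n ih =>
    intro p hpQ hp a d had hda hv
    set m := (a + d) / 2 with hm
    have hpyp : IsSelfAdjoint (p * y * p) := by
      rw [IsSelfAdjoint]; simp [hp.isSelfAdjoint.star_eq, hy.star_eq, mul_assoc]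
    obtain ⟨e, heQ, hep, hecomm, -, hege, hele, -⟩ :=
      spec_proj hpyp (mul_mem (mul_mem hpQ hyQ) hpQ) m
    have hpe : p * e = e * p := hecomm p hp.isSelfAdjoint (by
      have := hp.isIdempotentElem
      rw [IsIdempotentElem] at this
      rw [mul_assoc _ p p, this, ← mul_assoc, ← mul_assoc, this])
    have he1 : IsStarProjection (1 - e) := hep.one_sub
    have hpe1 : p * (1 - e) = (1 - e) * p := by rw [mul_sub, sub_mul, hpe]; simp
    have hform : ∀ v, p v = v → ⟪(p * y * p) v, v⟫ = ⟪y v, v⟫ := by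
      intro v hv
      simp only [mul_apply_eq_comp]
      rw [proj_inner hp, hv]
    have hple : ∀ f : 𝔹, p * (p * f) = p * f := fun f => by
      rw [← mul_assoc, hp.isIdempotentElem]
    obtain ⟨ι₁, _, q₁, h₁, s₁⟩ := ih (p * e) (mul_mem hpQ heQ) (proj_mul_of_comm hp hep hpe) m d
      (by linarith) (by rw [pow_succ] at hda; linarith) (fun v hv' => by
        have hpv : p v = v := proj_mul_apply (hple e) hv'
        refine ⟨?_, (hv v hpv).2⟩
        rw [← hform v hpv]
        refine hege v ?_
        rw [hpe] at hv'
        exact proj_mul_apply (by rw [← mul_assoc, hep.isIdempotentElem]) hv')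
    obtain ⟨ι₂, _, q₂, h₂, s₂⟩ := ih (p * (1 - e)) (mul_mem hpQ (sub_mem (one_mem _) heQ))
      (proj_mul_of_comm hp he1 hpe1) a m
      (by linarith) (by rw [pow_succ] at hda; linarith) (fun v hv' => by
        have hpv : p v = v := proj_mul_apply (hple _) hv'
        refine ⟨(hv v hpv).1, ?_⟩
        rw [← hform v hpv]
        refine hele v ?_
        rw [hpe1] at hv'
        have := proj_mul_apply (p := 1 - e) (by rw [← mul_assoc, he1.isIdempotentElem]) hv'
        simpa using this)
    refine ⟨ι₁ ⊕ ι₂, inferInstance, Sum.elim q₁ q₂, ?_, ?_⟩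
    · rintro (i | i)
      · obtain ⟨a1, a2, a3, a4⟩ := h₁ i
        exact ⟨a1, a2, by simp only [Sum.elim_inl]; rw [← a3, ← mul_assoc, hple], a4⟩
      · obtain ⟨a1, a2, a3, a4⟩ := h₂ i
        exact ⟨a1, a2, by simp only [Sum.elim_inr]; rw [← a3, ← mul_assoc, hple], a4⟩
    · rw [Fintype.sum_sum_type]
      simp only [Sum.elim_inl, Sum.elim_inr, s₁, s₂]
      rw [← mul_add]; simp

/-- near-scalar compression -/
def NS (y : 𝔹) (ε : ℝ) (q : 𝔹) : Prop := ∃ l : ℂ, ‖q * y * q - l • q‖ ≤ ε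

theorem NS_her {y : 𝔹} {ε : ℝ} {q q' : 𝔹} (hq : IsStarProjection q)
    (hq' : IsStarProjection q') (hle : q * q' = q') (h : NS y ε q) : NS y ε q' := by
  obtain ⟨l, hl⟩ := h
  refine ⟨l, ?_⟩
  have h2 := mul_symm_of_le hq hq' hle
  have : q' * y * q' - l • q' = q' * (q * y * q - l • q) * q' := by
    have h3 := hq'.isIdempotentElem
    rw [IsIdempotentElem] at h3
    rw [mul_sub, sub_mul, mul_smul_comm, smul_mul_assoc, h2, h3]
    congr 1
    calc q' * y * q' = (q' * q) * y * (q * q') := by rw [h2, hle]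
      _ = _ := by simp only [mul_assoc]
  rw [this]
  calc ‖q' * (q * y * q - l • q) * q'‖ ≤ ‖q'‖ * ‖q * y * q - l • q‖ * ‖q'‖ :=
        (norm_mul_le _ _).trans (by gcongr; exact norm_mul_le _ _)
    _ ≤ 1 * ε * 1 := by
        gcongr
        · rw [one_mul]; exact (norm_nonneg _).trans hl
        · exact norm_proj_le hq'
        · exact norm_proj_le hq'
    _ = ε := by ring

theorem pav_sa {Q : 𝔳𝔑} {y : 𝔹} (hy : IsSelfAdjoint y) (hyQ : y ∈ Q)
    {ε : ℝ} (hε : 0 < ε) : Pav Q (NS y ε) := by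
  intro p hpQ hp
  obtain ⟨n, hn⟩ := pow_unbounded_of_one_lt (2 * ‖y‖ / ε) (one_lt_two)
  have hn' : 2 * ‖y‖ ≤ 2 ^ n * ε := by rw [div_lt_iff₀ hε] at hn; exact hn.le
  refine pav_sa_aux hy hyQ hε n p hpQ hp (-‖y‖) ‖y‖ (by linarith [norm_nonneg y]) (by linarith)
    fun v _ => ?_
  have h1 : |(⟪y v, v⟫).re| ≤ ‖y‖ * ‖v‖ ^ 2 := by
    refine (Complex.abs_re_le_norm _).trans ((norm_inner_le_norm _ _).trans ?_)
    have := y.le_opNorm v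
    nlinarith [norm_nonneg v]
  rw [abs_le] at h1
  exact ⟨by linarith, h1.2⟩

theorem pav_one {Q : 𝔳𝔑} {y : 𝔹} (hyQ : y ∈ Q)
    {ε : ℝ} (hε : 0 < ε) : Pav Q (NS y ε) := by
  set a : 𝔹 := (2⁻¹ : ℂ) • (y + star y) with ha
  set b : 𝔹 := (-Complex.I * 2⁻¹ : ℂ) • (y - star y) with hb
  have hyab : y = a + Complex.I • b := by
    rw [ha, hb, smul_smul]
    have : Complex.I * (-Complex.I * 2⁻¹) = 2⁻¹ := by
      rw [← mul_assoc, mul_neg, Complex.I_mul_I]; simp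
    rw [this, ← smul_add]
    have : y + star y + (y - star y) = (2 : ℂ) • y := by rw [two_smul]; abel
    rw [this, smul_smul]; simp
  have hasa : IsSelfAdjoint a := by
    rw [IsSelfAdjoint, ha, star_smul]; simp [add_comm]
  have hbsa : IsSelfAdjoint b := by
    rw [IsSelfAdjoint, hb, star_smul, star_sub, star_star, ← neg_sub, smul_neg, ← neg_smul]
    congr 1; simp
  have haQ : a ∈ Q := smul_mem' _ (add_mem hyQ (star_mem hyQ))
  have hbQ : b ∈ Q := smul_mem' _ (sub_mem hyQ (star_mem hyQ))
  clear_value a b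
  have := pav_and (pav_sa hasa haQ (half_pos hε)) (pav_sa hbsa hbQ (half_pos hε))
    (fun q q' h1 h2 h3 h4 => NS_her h1 h2 h3 h4)
  intro p hpQ hp
  obtain ⟨ι, i1, q, hq, hs⟩ := this p hpQ hp
  refine ⟨ι, i1, q, fun i => ?_, hs⟩
  obtain ⟨a1, a2, a3, ⟨l, hl⟩, ⟨m, hm⟩⟩ := hq i
  refine ⟨a1, a2, a3, l + Complex.I * m, ?_⟩
  have : q i * y * q i - (l + Complex.I * m) • q i =
      (q i * a * q i - l • q i) + Complex.I • (q i * b * q i - m • q i) := by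
    have e3 : q i * y * q i = q i * a * q i + Complex.I • (q i * b * q i) := by
      conv_lhs => rw [hyab]
      rw [mul_add, add_mul, mul_smul_comm, smul_mul_assoc]
    rw [e3, add_smul, smul_sub, smul_smul]
    abel
  rw [this]
  refine (norm_add_le _ _).trans ?_
  rw [norm_smul, Complex.norm_I, one_mul]
  linarith

theorem pav_finset {Q : 𝔳𝔑} (Y : Finset (𝔹)) (hY : ∀ y ∈ Y, y ∈ Q)
    {ε : ℝ} (hε : 0 < ε) : Pav Q (fun q => ∀ y ∈ Y, NS y ε q) := by
  classical
  induction Y using Finset.induction_on with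
  | empty =>
    intro p hpQ hp
    exact ⟨Unit, inferInstance, fun _ => p, fun _ => ⟨hpQ, hp, hp.isIdempotentElem, by simp⟩, by simp⟩
  | insert y Y hy ih =>
    have := pav_and (pav_one (hY y (Finset.mem_insert_self _ _)) hε)
      (ih fun z hz => hY z (Finset.mem_insert_of_mem hz))
      (fun q q' h1 h2 h3 h4 => NS_her h1 h2 h3 h4)
    simpa [Finset.forall_mem_insert] using this

theorem NS_vec {y : 𝔹} {ε : ℝ} {q : 𝔹} (hq : IsStarProjection q) (Ω : H)
    (hΩ : q Ω ≠ 0) (h : NS y ε q) :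
    ‖q * y * q - (⟪q Ω, y (q Ω)⟫ / (‖q Ω‖ ^ 2 : ℝ)) • q‖ ≤ 2 * ε := by
  obtain ⟨l, hl⟩ := h
  have hn : 0 < ‖q Ω‖ := norm_pos_iff.2 hΩ
  have h1 : ⟪q Ω, (q * y * q - l • q) (q Ω)⟫ = ⟪q Ω, y (q Ω)⟫ - l * (‖q Ω‖ ^ 2 : ℝ) := by
    simp only [sub_apply, mul_apply_eq_comp,
        smul_apply, inner_sub_right, inner_smul_right, proj_idem hq]
    rw [← proj_inner hq, proj_idem hq, inner_sq]
    push_cast; rfl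
  have h2 : ‖⟪q Ω, y (q Ω)⟫ / (‖q Ω‖ ^ 2 : ℝ) - l‖ ≤ ε := by
    have e1 : ⟪q Ω, y (q Ω)⟫ / (‖q Ω‖ ^ 2 : ℝ) - l =
        ⟪q Ω, (q * y * q - l • q) (q Ω)⟫ / (‖q Ω‖ ^ 2 : ℝ) := by
      rw [h1, sub_div, mul_div_assoc, div_self, mul_one]
      exact_mod_cast (by positivity : ‖q Ω‖ ^ 2 ≠ 0)
    rw [e1, norm_div, norm_real, Real.norm_of_nonneg (by positivity),
      div_le_iff₀ (by positivity)]
    refine (norm_inner_le_norm _ _).trans ?_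
    have := (q * y * q - l • q).le_of_opNorm_le hl (q Ω)
    nlinarith
  have e2 : q * y * q - (⟪q Ω, y (q Ω)⟫ / (‖q Ω‖ ^ 2 : ℝ)) • q =
      (q * y * q - l • q) - (⟪q Ω, y (q Ω)⟫ / (‖q Ω‖ ^ 2 : ℝ) - l) • q := by
    rw [sub_smul]; abel
  rw [e2]
  refine (norm_sub_le _ _).trans ?_
  rw [norm_smul]
  have := norm_proj_le hq
  have h3 : ‖⟪q Ω, y (q Ω)⟫ / (‖q Ω‖ ^ 2 : ℝ) - l‖ * ‖q‖ ≤ ε * 1 := by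
    gcongr; exact (norm_nonneg _).trans h2
  linarith

/-- cut-off inverse square root -/
def fcut (t : ℝ) : ℝ := max 0 (min 1 (2 * (t - 1/4))) * (Real.sqrt (max t (3/4)))⁻¹

theorem fcut_cont : Continuous fcut := by
  unfold fcut
  refine Continuous.mul (by fun_prop) (Continuous.inv₀ (by fun_prop) fun t => ?_)
  have : (0 : ℝ) < max t (3/4) := lt_of_lt_of_le (by norm_num) (le_max_right _ _)
  positivity

theorem fcut_zero {t : ℝ} (h : t ≤ 1/4) : fcut t = 0 := by
  unfold fcut
  have h1 : min 1 (2 * (t - 1/4)) ≤ 0 := (min_le_right _ _).trans (by linarith)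
  rw [max_eq_left h1, zero_mul]

theorem fcut_one {t : ℝ} (h : 3/4 ≤ t) : fcut t = (Real.sqrt t)⁻¹ := by
  unfold fcut
  have h1 : min 1 (2 * (t - 1/4)) = 1 := min_eq_left (by linarith)
  rw [h1, max_eq_right zero_le_one, one_mul, max_eq_left h]

theorem fcut_cases {t k : ℝ} (hk : k ≤ 1/50) (h : |t ^ 2 - t| ≤ k) :
    (t ≤ 1/4 ∧ |t| ≤ 2 * k) ∨ (3/4 ≤ t ∧ |1 - t| ≤ 2 * k) := by
  have h2 := abs_le.1 h
  rcases le_or_gt t (1/4) with h1 | h1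
  · left
    refine ⟨h1, ?_⟩
    rw [abs_le]; constructor <;> nlinarith
  · right
    have : 3/4 ≤ t := by
      by_contra hc; push Not at hc
      nlinarith
    refine ⟨this, ?_⟩
    rw [abs_le]; constructor <;> nlinarith

theorem fcut_facts {t k : ℝ} (hk : k ≤ 1/50) (h : |t ^ 2 - t| ≤ k) :
    |(fcut t ^ 2 - 1) * t| ≤ 2 * k ∧ |fcut t ^ 2 - 1| ≤ 1 ∧ |(fcut t - 1) * t| ≤ 2 * k ∧
      |fcut t - 1| ≤ 1 ∧ fcut t ^ 2 * t * fcut t = fcut t := by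
  rcases fcut_cases hk h with ⟨h1, h2⟩ | ⟨h1, h2⟩
  · rw [fcut_zero h1]; norm_num; exact h2
  · rw [fcut_one h1]
    have ht : 0 < t := by linarith
    set r := Real.sqrt t with hr
    have hrp : 0 < r := Real.sqrt_pos.2 ht
    have hrt : r * r = t := Real.mul_self_sqrt ht.le
    have e1 : (r⁻¹ ^ 2 - 1) * t = 1 - t := by rw [← hrt]; field_simp
    have e2 : (r⁻¹ - 1) * t = r * (1 - r) := by rw [← hrt]; field_simp
    have e3 : r⁻¹ ^ 2 * t * r⁻¹ = r⁻¹ := by rw [← hrt]; field_simp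
    have hr34 : 3/4 ≤ r := by nlinarith
    have hri : r⁻¹ ≤ 4/3 := by
      rw [inv_le_comm₀ hrp (by norm_num)]; norm_num; linarith
    have hr2 : r⁻¹ ^ 2 ≤ 4/3 := by
      rw [inv_pow, inv_le_comm₀ (by positivity) (by norm_num)]; norm_num; nlinarith
    have hrip : 0 < r⁻¹ := inv_pos.2 hrp
    refine ⟨by rw [e1]; exact h2, ?_, ?_, ?_, e3⟩
    · rw [abs_le]; constructor <;> nlinarith
    · rw [e2]
      have h3 : |r * (1 - r)| ≤ |1 - t| := by
        rw [← hrt, show 1 - r * r = (1 + r) * (1 - r) by ring, abs_mul, abs_mul]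
        gcongr
        linarith
      exact h3.trans h2
    · rw [abs_le]; constructor <;> linarith

set_option maxHeartbeats 1000000 in
theorem mu_perturb (m : ℕ) {η : ℝ} (hη : 0 < η) : ∃ κ : ℝ, 0 < κ ∧
    ∀ (Q : 𝔳𝔑) (ι : Type) [Fintype ι] [DecidableEq ι], Fintype.card ι ≤ m →
    ∀ (q : 𝔹) (a : ι → 𝔹), IsStarProjection q →
      (∀ i, a i ∈ Q) → (∀ i, a i * q = a i) →
      (∀ i j, ‖star (a i) * a j - (if i = j then q else 0)‖ ≤ κ) →
      ∃ g ∈ Q, IsSelfAdjoint g ∧ (∀ y, Commute (∑ i, a i * star (a i)) y → Commute g y) ∧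
        (∀ i j, star (g * a i) * (g * a j) = if i = j then q else 0) ∧
        ∀ i, ‖g * a i - a i‖ ≤ η := by
  set η' := min η 1 with hη'
  have hη'p : 0 < η' := lt_min hη one_pos
  have hη'1 : η' ≤ 1 := min_le_right _ _
  set K : ℝ := m + 1 with hK
  have hK1 : 1 ≤ K := by rw [hK]; have : (0 : ℝ) ≤ m := Nat.cast_nonneg m; linarith
  refine ⟨η' / (400 * K ^ 3), by positivity, ?_⟩
  set κ := η' / (400 * K ^ 3) with hκ
  have hκp : 0 < κ := by positivity
  have hκK : K ^ 3 * κ = η' / 400 := by rw [hκ]; field_simp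
  intro Q ι _ _ hcard q a hq haQ haq hgram
  set M : ℝ := (Fintype.card ι : ℝ) with hM
  have hMK : M ≤ K := by
    have : (Fintype.card ι : ℝ) ≤ m := by exact_mod_cast hcard
    rw [hM, hK]; linarith
  have hM0 : 0 ≤ M := Nat.cast_nonneg _
  have hKκ : K * κ ≤ η' / 400 ∧ K ^ 2 * κ ≤ η' / 400 ∧ κ ≤ η' / 400 := by
    refine ⟨?_, ?_, ?_⟩ <;> rw [← hκK]
    · gcongr; exact le_self_pow₀ hK1 (by norm_num)
    · gcongr; norm_num
    · have : 1 ≤ K ^ 3 := one_le_pow₀ hK1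
      nlinarith
  have hM2 : M ^ 2 ≤ K ^ 2 := by gcongr
  have hanorm : ∀ i, ‖a i‖ ≤ 3/2 := by
    intro i
    have h1 := hgram i i
    rw [if_pos rfl] at h1
    have h2 : ‖star (a i) * a i‖ ≤ κ + 1 := by
      have := norm_le_norm_sub_add (star (a i) * a i) q
      linarith [norm_proj_le hq]
    rw [CStarRing.norm_star_mul_self] at h2
    nlinarith [norm_nonneg (a i), hKκ.2.2]
  set X := ∑ i, a i * star (a i) with hX
  have hX0 : 0 ≤ X := sum_nonneg fun i _ => mul_star_self_nonneg (a i)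
  have hXsa : IsSelfAdjoint X := hX0.isSelfAdjoint
  have hXQ : X ∈ Q := sum_mem fun i _ => mul_mem (haQ i) (star_mem (haQ i))
  have hXa : ∀ j, ‖a j - X * a j‖ ≤ 2 * M * κ := by
    intro j
    have e : X * a j - a j = ∑ i, a i * (star (a i) * a j - (if i = j then q else 0)) := by
      simp only [mul_sub, sum_sub_distrib, hX, sum_mul, mul_assoc]
      congr 1
      simp [haq]
    rw [← norm_neg, neg_sub, e]
    refine (norm_sum_le _ _).trans ?_
    have : ∀ i ∈ Finset.univ, ‖a i * (star (a i) * a j - (if i = j then q else 0))‖ ≤ 3/2 * κ := by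
      intro i _
      refine (norm_mul_le _ _).trans ?_
      gcongr
      · exact hanorm i
      · exact hgram i j
    refine (sum_le_card_nsmul _ _ _ this).trans ?_
    rw [nsmul_eq_mul, card_univ]
    nlinarith [mul_nonneg hM0 hκp.le]
  set k := 2 * M * (κ * 3/2) * M with hk
  have hX2 : ‖X * X - X‖ ≤ k := by
    have e : X * X - X = ∑ j, (X * a j - a j) * star (a j) := by
      simp only [sub_mul, sum_sub_distrib, mul_assoc]
      rw [← mul_sum, ← hX]
    rw [e]
    refine (norm_sum_le _ _).trans ?_
    have : ∀ i ∈ Finset.univ, ‖(X * a i - a i) * star (a i)‖ ≤ 2 * M * (κ * 3/2) := by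
      intro i _
      refine (norm_mul_le _ _).trans ?_
      rw [norm_star, ← norm_neg (X * a i - a i), neg_sub]
      calc ‖a i - X * a i‖ * ‖a i‖ ≤ (2 * M * κ) * (3/2) := by
            gcongr
            · exact hXa i
            · exact hanorm i
        _ = _ := by ring
    refine (sum_le_card_nsmul _ _ _ this).trans ?_
    rw [nsmul_eq_mul, card_univ, hk]
    linarith
  have hk3 : k = 3 * (M ^ 2 * κ) := by rw [hk]; ring
  have hMk : M ^ 2 * κ ≤ η' / 400 := le_trans (by gcongr) hKκ.2.1
  have hMk1 : M * κ ≤ η' / 400 := le_trans (by gcongr) hKκ.1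
  have hkη : k ≤ 3 / 400 * η' := by rw [hk3]; linarith
  have hk50 : k ≤ 1 / 50 := by linarith
  have hspec : ∀ t ∈ spectrum ℝ X, |t ^ 2 - t| ≤ k := by
    intro t ht
    have e : cfc (fun t : ℝ => t ^ 2 - t) X = X * X - X := by
      rw [cfc_sub (fun t : ℝ => t ^ 2) (fun t : ℝ => t) X, cfc_pow (fun t : ℝ => t) 2 X, cfc_id' ℝ X, sq]
    have := norm_apply_le_norm_cfc (fun t : ℝ => t ^ 2 - t) X ht (by fun_prop) hXsa
    rw [e, Real.norm_eq_abs] at this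
    exact this.trans hX2
  have hk0 : 0 ≤ k := by rw [hk]; positivity
  set g := cfc fcut X with hg
  have hfc : ContinuousOn fcut (spectrum ℝ X) := fcut_cont.continuousOn
  have hgsa : IsSelfAdjoint g := cfc_predicate _ X
  have hsmall : ∀ h : ℝ → ℝ, Continuous h → (∀ t ∈ spectrum ℝ X, |h t * t| ≤ 2 * k) →
      (∀ t ∈ spectrum ℝ X, |h t| ≤ 1) → ∀ j, ‖cfc h X * a j‖ ≤ 3 * k + 2 * M * κ := by
    intro h hc h1 h2 j
    have e : cfc h X * a j = cfc (fun t => h t * t) X * a j + cfc h X * (a j - X * a j) := by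
      rw [cfc_mul h (fun t => t) X hc.continuousOn continuousOn_id, cfc_id' ℝ X]
      noncomm_ring
    rw [e]
    have n1 : ‖cfc (fun t => h t * t) X‖ ≤ 2 * k :=
      norm_cfc_le (by linarith) fun t ht => by rw [Real.norm_eq_abs]; exact h1 t ht
    have n2 : ‖cfc h X‖ ≤ 1 :=
      norm_cfc_le (by norm_num) fun t ht => by rw [Real.norm_eq_abs]; exact h2 t ht
    refine (norm_add_le _ _).trans ?_
    have i1 : ‖cfc (fun t => h t * t) X * a j‖ ≤ 2 * k * (3/2) := by
      refine (norm_mul_le _ _).trans ?_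
      gcongr
      exact hanorm j
    have i2 : ‖cfc h X * (a j - X * a j)‖ ≤ 1 * (2 * M * κ) := by
      refine (norm_mul_le _ _).trans ?_
      gcongr
      exact hXa j
    linarith
  have hg1 : ∀ j, ‖g * a j - a j‖ ≤ 3 * k + 2 * M * κ := by
    intro j
    have := hsmall (fun t => fcut t - 1) (by have := fcut_cont; fun_prop)
      (fun t ht => (fcut_facts hk50 (hspec t ht)).2.2.1)
      (fun t ht => (fcut_facts hk50 (hspec t ht)).2.2.2.1) j
    rwa [cfc_sub fcut (fun _ => 1) X hfc continuousOn_const, cfc_const_one ℝ X, sub_mul, one_mul] at this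
  have hg2 : ∀ j, ‖g * g * a j - a j‖ ≤ 3 * k + 2 * M * κ := by
    intro j
    have := hsmall (fun t => fcut t ^ 2 - 1) (by have := fcut_cont; fun_prop)
      (fun t ht => (fcut_facts hk50 (hspec t ht)).1)
      (fun t ht => (fcut_facts hk50 (hspec t ht)).2.1) j
    rwa [cfc_sub (fun t => fcut t ^ 2) (fun _ => 1) X (hfc.pow 2) continuousOn_const,
      cfc_pow fcut 2 X hfc, cfc_const_one ℝ X, sub_mul, one_mul, sq] at this
  have hgX : g * g * X * g = g := by
    have : cfc (fun t => fcut t ^ 2 * t * fcut t) X = cfc fcut X :=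
      cfc_congr fun t ht => (fcut_facts hk50 (hspec t ht)).2.2.2.2
    rwa [cfc_mul (fun t => fcut t ^ 2 * t) fcut X ((hfc.pow 2).mul continuousOn_id) hfc,
      cfc_mul (fun t => fcut t ^ 2) (fun t => t) X (hfc.pow 2) continuousOn_id,
      cfc_pow fcut 2 X hfc, cfc_id' ℝ X, sq] at this
  have hqa : ∀ i, q * star (a i) = star (a i) := by
    intro i
    have := congrArg star (haq i)
    rwa [star_mul, hq.isSelfAdjoint.star_eq] at this
  have hqq : q * q = q := hq.isIdempotentElem
  clear_value g X
  set P : ι → ι → 𝔹 := fun i j => star (g * a i) * (g * a j) with hP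
  set D : ι → ι → 𝔹 := fun i j => (if i = j then q else 0) - P i j with hD
  have hPe : ∀ i j, P i j = star (a i) * (g * g * a j) := by
    intro i j
    simp only [hP, star_mul, hgsa.star_eq]; noncomm_ring
  have hqP : ∀ i j, q * P i j = P i j := by
    intro i j; rw [hPe, ← mul_assoc, hqa]
  have hPq : ∀ i j, P i j * q = P i j := by
    intro i j; rw [hPe, mul_assoc, mul_assoc (g * g), haq]
  have hPP : ∀ i j, ∑ l, P i l * P l j = P i j := by
    intro i j
    have : ∀ l, P i l * P l j = star (a i) * (g * g) * (a l * star (a l)) * (g * g * a j) := by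
      intro l; rw [hPe, hPe]; noncomm_ring
    simp only [this]
    rw [← sum_mul, ← mul_sum, ← hX, hPe]
    calc star (a i) * (g * g) * X * (g * g * a j) = star (a i) * (g * g * X * g) * (g * a j) := by noncomm_ring
      _ = _ := by rw [hgX]; noncomm_ring
  have hDD : ∀ i j, D i j = ∑ l, D i l * D l j := by
    intro i j
    simp only [hD, sub_mul, mul_sub, sum_sub_distrib, hPP]
    simp only [ite_mul, mul_ite, zero_mul, mul_zero, hqP, hPq, hqq]
    simp
  set d := 3/2 * (3 * k + 2 * M * κ) + κ with hd
  have hDd : ∀ i j, ‖D i j‖ ≤ d := by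
    intro i j
    have e : D i j = -(star (a i) * (g * g * a j - a j) + (star (a i) * a j - (if i = j then q else 0))) := by
      simp only [hD, hPe]; noncomm_ring
    rw [e, norm_neg]
    refine (norm_add_le _ _).trans ?_
    have : ‖star (a i) * (g * g * a j - a j)‖ ≤ 3/2 * (3 * k + 2 * M * κ) := by
      refine (norm_mul_le _ _).trans ?_
      rw [norm_star]
      gcongr
      · exact hanorm i
      · exact hg2 j
    linarith [hgram i j]
  have hMd : M * d < 1 := by
    have hd0 : 0 ≤ d := by rw [hd]; positivity
    have h1 : d ≤ 18 * (K ^ 2 * κ) := by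
      have a1 : M ^ 2 * κ ≤ K ^ 2 * κ := by gcongr
      have a2 : M * κ ≤ K ^ 2 * κ := by
        gcongr; exact hMK.trans (le_self_pow₀ hK1 (by norm_num))
      have a3 : κ ≤ K ^ 2 * κ := by
        have : 1 ≤ K ^ 2 := one_le_pow₀ hK1
        nlinarith
      rw [hd, hk3]; linarith
    calc M * d ≤ K * (18 * (K ^ 2 * κ)) := by gcongr
      _ = 18 * (K ^ 3 * κ) := by ring
      _ < 1 := by rw [hκK]; linarith
  have hD0 : ∀ i j, D i j = 0 := by
    intro i₁ j₁
    have : Nonempty (ι × ι) := ⟨(i₁, j₁)⟩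
    obtain ⟨⟨i₀, j₀⟩, hmax⟩ := Finite.exists_max (fun p : ι × ι => ‖D p.1 p.2‖)
    set mx := ‖D i₀ j₀‖ with hmx
    have h1 : mx ≤ M * (d * mx) := by
      have h0 : mx = ‖∑ l, D i₀ l * D l j₀‖ := by rw [hmx, ← hDD i₀ j₀]
      refine h0.le.trans ?_
      refine (norm_sum_le _ _).trans ?_
      have : ∀ l ∈ Finset.univ, ‖D i₀ l * D l j₀‖ ≤ d * mx := by
        intro l _
        refine (norm_mul_le _ _).trans ?_
        have u1 := hmax (l, j₀)
        have u2 := hDd i₀ l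
        have := norm_nonneg (D l j₀)
        have := norm_nonneg (D i₀ l)
        gcongr
      refine (sum_le_card_nsmul _ _ _ this).trans ?_
      rw [nsmul_eq_mul, card_univ]
    have h0 : 0 ≤ mx := norm_nonneg _
    have hz : mx = 0 := by
      have h2 : M * (d * mx) = (M * d) * mx := by ring
      rw [h2] at h1
      nlinarith
    have := hmax (i₁, j₁)
    exact norm_le_zero_iff.1 (this.trans hz.le)
  refine ⟨g, ?_, hgsa, ?_, ?_, ?_⟩
  · rw [hg]; exact cfc_mem_vn hXsa hXQ _
  · intro y hy
    rw [hg]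
    exact Commute.cfc hy (by rw [hXsa.star_eq]; exact hy) fcut
  · intro i j
    exact (sub_eq_zero.1 (hD0 i j)).symm
  · intro i
    refine (hg1 i).trans ?_
    have : η' ≤ η := min_le_left _ _
    linarith

theorem layer_cake {ι : Type} [Fintype ι] (c p q : ι → ℝ) (t₀ : ℝ)
    (h : ∀ t, t₀ ≤ t → ∑ i, c i * (if p i ≤ t ∧ t < q i then 1 else 0) ≤ 0) :
    ∑ i, c i * max (max (q i) t₀ - max (p i) t₀) 0 ≤ 0 := by
  have e : ∑ i, c i * max (max (q i) t₀ - max (p i) t₀) 0 =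
      ∫ t : ℝ, ∑ i, (Set.Ico (max (p i) t₀) (max (q i) t₀)).indicator (fun _ => c i) t := by
    rw [MeasureTheory.integral_finset_sum]
    · refine sum_congr rfl fun i _ => ?_
      rw [MeasureTheory.integral_indicator_const _ measurableSet_Ico, MeasureTheory.measureReal_def,
        Real.volume_Ico, ENNReal.toReal_ofReal', smul_eq_mul, mul_comm]
    · intro i _
      rw [MeasureTheory.integrable_indicator_iff measurableSet_Ico]
      exact MeasureTheory.integrableOn_const (by simp)
  rw [e]
  refine MeasureTheory.integral_nonpos fun t => ?_
  change ∑ i, _ ≤ (0 : ℝ)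
  rcases lt_or_ge t t₀ with ht | ht
  · refine (sum_eq_zero fun i _ => ?_).le
    rw [Set.indicator_of_notMem]
    rintro ⟨h1, _⟩
    exact absurd ((le_max_right _ _).trans h1) (not_le.2 ht)
  · refine le_trans (le_of_eq ?_) (h t ht)
    refine sum_congr rfl fun i _ => ?_
    rw [Set.indicator_apply]
    have : t ∈ Set.Ico (max (p i) t₀) (max (q i) t₀) ↔ (p i ≤ t ∧ t < q i) := by
      rw [Set.mem_Ico, max_le_iff, lt_max_iff]
      constructor
      · rintro ⟨⟨a, _⟩, b | b⟩
        · exact ⟨a, b⟩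
        · exact absurd b (not_lt.2 ht)
      · rintro ⟨a, b⟩; exact ⟨⟨a, ht⟩, Or.inl b⟩
    simp [this]

theorem bessel_orth {ι : Type} [Fintype ι] (y : ι → H) (hy : ∀ i j, i ≠ j → ⟪y i, y j⟫ = 0) (v : H) :
    ∑ i, (‖⟪y i, v⟫‖ / ‖y i‖) ^ 2 ≤ ‖v‖ ^ 2 := by
  classical
  set x : {i // y i ≠ 0} → H := fun i => ((‖y i‖⁻¹ : ℝ) : ℂ) • y i with hx
  have ho : Orthonormal ℂ x := by
    rw [orthonormal_iff_ite]
    rintro ⟨i, hi⟩ ⟨j, hj⟩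
    simp only [hx, inner_smul_left, inner_smul_right]
    by_cases h : i = j
    · subst h
      have : ‖y i‖ ≠ 0 := norm_ne_zero_iff.2 hi
      have h' : (‖y i‖ : ℂ) ≠ 0 := by exact_mod_cast this
      simp [inner_sq]
      field_simp
    · simp [h, hy i j h]
  have := ho.sum_inner_products_le (x := v) (s := Finset.univ)
  refine le_trans (le_of_eq ?_) this
  have h1 : ∑ i, (‖⟪y i, v⟫‖ / ‖y i‖) ^ 2 = ∑ i with y i ≠ 0, (‖⟪y i, v⟫‖ / ‖y i‖) ^ 2 := by
    rw [Finset.sum_filter]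
    refine sum_congr rfl fun i _ => ?_
    split_ifs with h
    · rfl
    · push Not at h; simp [h]
  rw [h1, Finset.sum_subtype (p := fun i => y i ≠ 0) _ (by simp)]
  refine sum_congr rfl fun i _ => ?_
  simp only [hx, inner_smul_left, norm_mul]
  simp [div_eq_inv_mul]

theorem norm_sq_sum_orth {ι : Type} [Fintype ι] (y : ι → H)
    (hy : ∀ i j, i ≠ j → ⟪y i, y j⟫ = 0) (c : ι → ℂ) :
    ‖∑ i, c i • y i‖ ^ 2 = ∑ i, ‖c i‖ ^ 2 * ‖y i‖ ^ 2 := by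
  classical
  have : ((‖∑ i, c i • y i‖ ^ 2 : ℝ) : ℂ) = ((∑ i, ‖c i‖ ^ 2 * ‖y i‖ ^ 2 : ℝ) : ℂ) := by
    have h := inner_sq (∑ i, c i • y i)
    push_cast
    refine (h.symm).trans ?_
    simp only [sum_inner, inner_sum, inner_smul_left, inner_smul_right]
    refine sum_congr rfl fun i _ => ?_
    rw [sum_eq_single i]
    · rw [inner_sq, ← mul_assoc, Complex.mul_conj']
      simp
    · intro j _ hj; rw [hy j i hj]; simp
    · simp
  exact_mod_cast this

theorem LL_B1 {ι : Type} [Fintype ι] {μ : ℝ} (hμ : 0 < μ) (hμ1 : μ ≤ 1)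
    (V : 𝔹) (hV : ∀ v, ‖V v‖ = ‖v‖) (hV' : ∀ v, ‖star V v‖ = ‖v‖) (y : ι → H)
    (hy : ∀ i j, i ≠ j → ⟪y i, y j⟫ = 0) (C : ι → ι → ℂ)
    (hcol : ∀ j, ∑ k, ‖C k j‖ ^ 2 ≤ 1) (hrow : ∀ k, ∑ j, ‖C k j‖ ^ 2 ≤ 1)
    (hz : ∑ j, ‖V (y j) - ∑ k, C k j • y k‖ ^ 2 ≤ μ ^ 4 * ∑ j, ‖y j‖ ^ 2) :
    (∀ j, ∑ i, (‖⟪y i, V (y j)⟫‖ / (‖y i‖ * ‖y j‖)) ^ 2 ≤ 1) ∧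
    ∑ j, ‖y j‖ ^ 2 * (1 - ∑ i, (‖⟪y i, V (y j)⟫‖ / (‖y i‖ * ‖y j‖)) ^ 2) ≤ 6 * μ ^ 2 * ∑ j, ‖y j‖ ^ 2 ∧
    ∑ j, ∑ i, |‖y i‖ ^ 2 - ‖y j‖ ^ 2| * (‖⟪y i, V (y j)⟫‖ / (‖y i‖ * ‖y j‖)) ^ 2
      ≤ 5 * μ * ∑ j, ‖y j‖ ^ 2 := by
  set σ : ι → ℝ := fun j => ‖y j‖ with hσ
  have hσ0 : ∀ j, 0 ≤ σ j := fun j => norm_nonneg _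
  set A : ι → ι → ℝ := fun i j => ‖⟪y i, V (y j)⟫‖ / (σ i * σ j) with hA
  have hA0 : ∀ i j, 0 ≤ A i j := fun i j => by positivity
  have hAσ : ∀ i j, ‖⟪y i, V (y j)⟫‖ = σ i * σ j * A i j := by
    intro i j
    by_cases h : σ i * σ j = 0
    · have : ‖⟪y i, V (y j)⟫‖ ≤ σ i * σ j := (norm_inner_le_norm _ _).trans (by rw [hV])
      rw [h] at this ⊢
      rw [zero_mul]; exact le_antisymm this (norm_nonneg _)
    · simp only [hA]; rw [mul_div_cancel₀ _ h]
  have hAcol : ∀ j, ∑ i, A i j ^ 2 ≤ 1 := by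
    intro j
    have h := bessel_orth y hy (V (y j))
    rw [hV] at h
    by_cases h0 : σ j = 0
    · simp [hA, h0]
    · have : ∑ i, A i j ^ 2 = (∑ i, (‖⟪y i, V (y j)⟫‖ / ‖y i‖) ^ 2) / σ j ^ 2 := by
        rw [Finset.sum_div]
        refine sum_congr rfl fun i _ => ?_
        simp only [hA]
        rw [← div_div, div_pow (_ / _) (σ j)]
      rw [this, div_le_one (by positivity)]
      exact h
  have hArow : ∀ i, ∑ j, A i j ^ 2 ≤ 1 := by
    intro i
    have h := bessel_orth y hy (star V (y i))
    rw [hV'] at h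
    by_cases h0 : σ i = 0
    · simp [hA, h0]
    · have : ∑ j, A i j ^ 2 = (∑ j, (‖⟪y j, star V (y i)⟫‖ / ‖y j‖) ^ 2) / σ i ^ 2 := by
        rw [Finset.sum_div]
        refine sum_congr rfl fun j _ => ?_
        simp only [hA]
        rw [star_inner_right, norm_inner_symm, mul_comm (σ i), ← div_div, div_pow (_ / _) (σ i)]
      rw [this, div_le_one (by positivity)]
      exact h
  set s := ∑ j, σ j ^ 2 with hs
  have hs0 : 0 ≤ s := sum_nonneg fun j _ => by positivity
  change (∀ j, ∑ i, A i j ^ 2 ≤ 1) ∧ ∑ j, σ j ^ 2 * (1 - ∑ i, A i j ^ 2) ≤ 6 * μ ^ 2 * s ∧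
    ∑ j, ∑ i, |σ i ^ 2 - σ j ^ 2| * A i j ^ 2 ≤ 5 * μ * s
  set W : ι → H := fun j => ∑ k, C k j • y k with hW
  have wsum : ∀ (B : ι → ι → ℝ), (∀ j, ∑ k, B k j ≤ 1) → ∑ j, ∑ k, σ j ^ 2 * B k j ≤ s := by
    intro B hB
    rw [hs]
    refine sum_le_sum fun j _ => ?_
    rw [← mul_sum]
    nlinarith [hB j, sq_nonneg (σ j)]
  have wsum' : ∀ (B : ι → ι → ℝ), (∀ k, ∑ j, B k j ≤ 1) → ∑ j, ∑ k, σ k ^ 2 * B k j ≤ s := by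
    intro B hB
    rw [sum_comm]
    exact wsum (fun j k => B k j) hB
  -- norms
  have hWn : ∀ j, ‖W j‖ ^ 2 = ∑ k, σ k ^ 2 * ‖C k j‖ ^ 2 := by
    intro j
    rw [hW]; simp only
    rw [norm_sq_sum_orth y hy]
    exact sum_congr rfl fun k _ => mul_comm _ _
  set N := ∑ j, ‖W j‖ ^ 2 with hN
  have hre : ∀ j, 2 * (⟪W j, V (y j)⟫).re = ‖W j‖ ^ 2 + σ j ^ 2 - ‖V (y j) - W j‖ ^ 2 := by
    intro j
    have h := norm_sub_sq (𝕜 := ℂ) (V (y j)) (W j)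
    rw [hV] at h
    have h2 : RCLike.re ⟪V (y j), W j⟫ = (⟪W j, V (y j)⟫).re := by
      rw [← inner_conj_symm]; exact Complex.conj_re _
    rw [h2] at h
    simp only [hσ]; linarith
  have hre' : 2 * ∑ j, (⟪W j, V (y j)⟫).re ≥ N + s - μ ^ 4 * s := by
    rw [mul_sum]
    simp only [hre]
    rw [sum_sub_distrib, sum_add_distrib]
    linarith
  have hNs : (1 - 2 * μ ^ 2) * s ≤ N := by
    have hp : ∀ j, σ j ^ 2 ≤ (1 + μ ^ 2) * ‖W j‖ ^ 2 + (1 + 1 / μ ^ 2) * ‖V (y j) - W j‖ ^ 2 := by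
      intro j
      have h1 : σ j ≤ ‖W j‖ + ‖V (y j) - W j‖ := by
        simp only [hσ]
        rw [← hV]
        have := norm_add_le (W j) (V (y j) - W j)
        rwa [add_sub_cancel] at this
      have h2 : σ j ^ 2 ≤ (‖W j‖ + ‖V (y j) - W j‖) ^ 2 := by
        gcongr
      refine h2.trans ?_
      have h3 : 0 ≤ (μ * ‖W j‖ - (1 / μ) * ‖V (y j) - W j‖) ^ 2 := sq_nonneg _
      have h4 : (μ * ‖W j‖ - (1 / μ) * ‖V (y j) - W j‖) ^ 2 =
        μ ^ 2 * ‖W j‖ ^ 2 + (1 / μ ^ 2) * ‖V (y j) - W j‖ ^ 2 - 2 * ‖W j‖ * ‖V (y j) - W j‖ := by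
        field_simp; ring
      rw [h4] at h3
      nlinarith
    have h1 : s ≤ (1 + μ ^ 2) * N + (1 + 1 / μ ^ 2) * (μ ^ 4 * s) := by
      calc s ≤ ∑ j, ((1 + μ ^ 2) * ‖W j‖ ^ 2 + (1 + 1 / μ ^ 2) * ‖V (y j) - W j‖ ^ 2) :=
            sum_le_sum fun j _ => hp j
        _ = (1 + μ ^ 2) * N + (1 + 1 / μ ^ 2) * ∑ j, ‖V (y j) - W j‖ ^ 2 := by
            rw [sum_add_distrib, ← mul_sum, ← mul_sum]
        _ ≤ _ := by gcongr
    have h2 : (1 + 1 / μ ^ 2) * (μ ^ 4 * s) = (μ ^ 4 + μ ^ 2) * s := by field_simp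
    rw [h2] at h1
    have hN0 : N ≤ s := by
      rw [hN]; simp only [hWn]
      exact wsum' (fun k j => ‖C k j‖ ^ 2) hrow
    have h5 : μ ^ 4 ≤ μ ^ 2 := pow_le_pow_of_le_one hμ.le hμ1 (by norm_num)
    -- (1+m) N ≥ (1 - m^2 - m) s = (1+m)(1-2m) s + m² s
    have h6 : (1 + μ ^ 2) * ((1 - 2 * μ ^ 2) * s) ≤ (1 + μ ^ 2) * N := by
      have : 0 ≤ μ ^ 4 * s := by positivity
      nlinarith
    exact le_of_mul_le_mul_left h6 (by positivity)
  set X := ∑ j, ∑ i, σ i * σ j * A i j ^ 2 with hX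
  have hup : 2 * ∑ j, (⟪W j, V (y j)⟫).re ≤ s + X := by
    have h1 : ∀ j, 2 * (⟪W j, V (y j)⟫).re ≤
        ∑ i, ((σ i ^ 2 * ‖C i j‖ ^ 2 + σ j ^ 2 * ‖C i j‖ ^ 2) / 2 + σ i * σ j * A i j ^ 2) := by
      intro j
      have h2 : (⟪W j, V (y j)⟫).re ≤ ∑ i, ‖C i j‖ * (σ i * σ j * A i j) := by
        refine (Complex.re_le_norm _).trans ?_
        rw [hW]; simp only [sum_inner, inner_smul_left]
        refine (norm_sum_le _ _).trans (sum_le_sum fun i _ => ?_)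
        rw [norm_mul, hAσ]; simp
      calc 2 * (⟪W j, V (y j)⟫).re ≤ 2 * ∑ i, ‖C i j‖ * (σ i * σ j * A i j) := by linarith
        _ = ∑ i, 2 * (‖C i j‖ * (σ i * σ j * A i j)) := mul_sum _ _ _
        _ ≤ _ := by
          refine sum_le_sum fun i _ => ?_
          have e1 : 0 ≤ (σ i * σ j) * (‖C i j‖ - A i j) ^ 2 :=
            mul_nonneg (mul_nonneg (hσ0 i) (hσ0 j)) (sq_nonneg _)
          have e2 : 0 ≤ ‖C i j‖ ^ 2 * (σ i - σ j) ^ 2 := by positivity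
          nlinarith
    calc 2 * ∑ j, (⟪W j, V (y j)⟫).re = ∑ j, 2 * (⟪W j, V (y j)⟫).re := mul_sum _ _ _
      _ ≤ ∑ j, ∑ i, ((σ i ^ 2 * ‖C i j‖ ^ 2 + σ j ^ 2 * ‖C i j‖ ^ 2) / 2 + σ i * σ j * A i j ^ 2) :=
          sum_le_sum fun j _ => h1 j
      _ = (∑ j, ∑ i, σ i ^ 2 * ‖C i j‖ ^ 2 + ∑ j, ∑ i, σ j ^ 2 * ‖C i j‖ ^ 2) / 2 + X := by
          simp only [sum_add_distrib, ← Finset.sum_div, hX]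
      _ ≤ s + X := by
          have := wsum (fun k j => ‖C k j‖ ^ 2) hcol
          have := wsum' (fun k j => ‖C k j‖ ^ 2) hrow
          linarith
  have h4 : μ ^ 4 ≤ μ ^ 2 := pow_le_pow_of_le_one hμ.le hμ1 (by norm_num)
  have hXs : (1 - 3 * μ ^ 2) * s ≤ X := by nlinarith
  have hA1 := wsum (fun k j => A k j ^ 2) hAcol
  have hA2 := wsum' (fun k j => A k j ^ 2) hArow
  set R1 := ∑ j, ∑ i, σ j ^ 2 * A i j ^ 2 with hR1
  set R2 := ∑ j, ∑ i, σ i ^ 2 * A i j ^ 2 with hR2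
  have hXR : 2 * X ≤ R1 + R2 := by
    rw [hX, hR1, hR2, mul_sum, ← sum_add_distrib]
    refine sum_le_sum fun j _ => ?_
    rw [mul_sum, ← sum_add_distrib]
    refine sum_le_sum fun i _ => ?_
    have e2 : 0 ≤ A i j ^ 2 * (σ i - σ j) ^ 2 := by positivity
    nlinarith
  refine ⟨hAcol, ?_, ?_⟩
  · have : ∑ j, σ j ^ 2 * (1 - ∑ i, A i j ^ 2) = s - R1 := by
      simp only [mul_sub, mul_one, sum_sub_distrib, mul_sum, hs, hR1]
    rw [this]; nlinarith
  · have hp : ∀ i j, |σ i ^ 2 - σ j ^ 2| * A i j ^ 2 ≤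
        (1 / (2 * μ)) * ((σ i ^ 2 + σ j ^ 2 - 2 * (σ i * σ j)) * A i j ^ 2) +
          μ * ((σ i ^ 2 + σ j ^ 2) * A i j ^ 2) := by
      intro i j
      have h1 : |σ i ^ 2 - σ j ^ 2| ≤ (1 / (2 * μ)) * (σ i ^ 2 + σ j ^ 2 - 2 * (σ i * σ j)) +
          μ * (σ i ^ 2 + σ j ^ 2) := by
        have e : σ i ^ 2 - σ j ^ 2 = (σ i - σ j) * (σ i + σ j) := by ring
        rw [e, abs_mul, abs_of_nonneg (add_nonneg (hσ0 i) (hσ0 j))]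
        have h2 : 0 ≤ (1 / (2 * μ)) * (|σ i - σ j| - μ * (σ i + σ j)) ^ 2 := by positivity
        have h3 : (1 / (2 * μ)) * (|σ i - σ j| - μ * (σ i + σ j)) ^ 2 =
          (1 / (2 * μ)) * |σ i - σ j| ^ 2 - |σ i - σ j| * (σ i + σ j) + μ / 2 * (σ i + σ j) ^ 2 := by
          field_simp; ring
        rw [h3, sq_abs] at h2
        have h5 : (σ i - σ j) ^ 2 = σ i ^ 2 + σ j ^ 2 - 2 * (σ i * σ j) := by ring
        rw [h5] at h2
        have h6 : 0 ≤ μ * (σ i - σ j) ^ 2 := by positivity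
        nlinarith
      calc _ ≤ _ := mul_le_mul_of_nonneg_right h1 (sq_nonneg (A i j))
        _ = _ := by ring
    calc ∑ j, ∑ i, |σ i ^ 2 - σ j ^ 2| * A i j ^ 2 ≤ ∑ j, ∑ i,
          ((1 / (2 * μ)) * ((σ i ^ 2 + σ j ^ 2 - 2 * (σ i * σ j)) * A i j ^ 2) +
          μ * ((σ i ^ 2 + σ j ^ 2) * A i j ^ 2)) :=
          sum_le_sum fun j _ => sum_le_sum fun i _ => hp i j
      _ = (1 / (2 * μ)) * (R2 + R1 - 2 * X) + μ * (R2 + R1) := by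
          simp only [sum_add_distrib, ← mul_sum, sub_mul, add_mul, sum_sub_distrib,
            hR1, hR2, hX, mul_assoc]
      _ ≤ (1 / (2 * μ)) * (6 * μ ^ 2 * s) + μ * (2 * s) := by
          gcongr
          · nlinarith
          · linarith
      _ = 5 * μ * s := by field_simp; ring

theorem LL_B {ι U : Type} [Fintype ι] [DecidableEq ι] [Fintype U] {μ ε : ℝ} (hμ : 0 < μ) (hμ1 : μ ≤ 1)
    (hε : 22 * μ * (Fintype.card U) < ε)
    (V : U → 𝔹) (hV : ∀ u v, ‖V u v‖ = ‖v‖) (hV' : ∀ u v, ‖star (V u) v‖ = ‖v‖) (y : ι → H)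
    (hy : ∀ i j, i ≠ j → ⟪y i, y j⟫ = 0) (C : U → ι → ι → ℂ)
    (hcol : ∀ u j, ∑ k, ‖C u k j‖ ^ 2 ≤ 1) (hrow : ∀ u k, ∑ j, ‖C u k j‖ ^ 2 ≤ 1)
    (hz : ∑ u, ∑ j, ‖V u (y j) - ∑ k, C u k j • y k‖ ^ 2 ≤ μ ^ 4 * ∑ j, ‖y j‖ ^ 2)
    (hs : 0 < ∑ j, ‖y j‖ ^ 2) :
    ∃ t, (∑ j, ‖y j‖ ^ 2) / (2 * Fintype.card ι) ≤ t ∧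
      (Finset.univ.filter fun j => t < ‖y j‖ ^ 2).Nonempty ∧
      ∑ u, ∑ j with t < ‖y j‖ ^ 2, (1 - ∑ i with t < ‖y i‖ ^ 2,
        (‖⟪y i, V u (y j)⟫‖ / (‖y i‖ * ‖y j‖)) ^ 2)
        < ε * (Finset.univ.filter fun j => t < ‖y j‖ ^ 2).card := by
  have hB := fun u => LL_B1 hμ hμ1 (V u) (hV u) (hV' u) y hy (C u) (hcol u) (hrow u)
    (le_trans (single_le_sum (f := fun u => ∑ j, ‖V u (y j) - ∑ k, C u k j • y k‖ ^ 2)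
      (fun u _ => sum_nonneg fun j _ => by positivity) (Finset.mem_univ u)) hz)
  set A : U → ι → ι → ℝ := fun u i j => (‖⟪y i, V u (y j)⟫‖ / (‖y i‖ * ‖y j‖)) ^ 2 with hA
  have hA0 : ∀ u i j, 0 ≤ A u i j := fun u i j => by positivity
  change ∀ u, (∀ j, ∑ i, A u i j ≤ 1) ∧ ∑ j, ‖y j‖ ^ 2 * (1 - ∑ i, A u i j) ≤ 6 * μ ^ 2 * ∑ j, ‖y j‖ ^ 2 ∧
    ∑ j, ∑ i, |‖y i‖ ^ 2 - ‖y j‖ ^ 2| * A u i j ≤ 5 * μ * ∑ j, ‖y j‖ ^ 2 at hB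
  set σ : ι → ℝ := fun j => ‖y j‖ ^ 2 with hσ
  have hσ0 : ∀ j, 0 ≤ σ j := fun j => by positivity
  set s := ∑ j, ‖y j‖ ^ 2 with hsdef
  change ∃ t, s / (2 * Fintype.card ι) ≤ t ∧ (Finset.univ.filter fun j => t < σ j).Nonempty ∧
      ∑ u, ∑ j with t < σ j, (1 - ∑ i with t < σ i, A u i j)
        < ε * (Finset.univ.filter fun j => t < σ j).card
  change ∀ u, (∀ j, ∑ i, A u i j ≤ 1) ∧ ∑ j, σ j * (1 - ∑ i, A u i j) ≤ 6 * μ ^ 2 * s ∧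
    ∑ j, ∑ i, |σ i - σ j| * A u i j ≤ 5 * μ * s at hB
  have hsσ : s = ∑ j, σ j := rfl
  clear_value A σ s
  have hnpos : 0 < (Fintype.card ι : ℝ) := by
    rcases isEmpty_or_nonempty ι with h | h
    · rw [hsσ] at hs; simp at hs
    · exact_mod_cast Fintype.card_pos
  set t₀ := s / (2 * Fintype.card ι) with ht₀
  have ht₀p : 0 ≤ t₀ := by positivity
  have hε0 : 0 < ε := lt_of_le_of_lt (by positivity) hε
  have hkey : ∃ t, t₀ ≤ t ∧ ∑ u, ∑ j with t < σ j, (1 - ∑ i with t < σ i, A u i j)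
        < ε * (Finset.univ.filter fun j => t < σ j).card := by
    by_contra hcon
    push Not at hcon
    have hl := layer_cake (ι := ι ⊕ (U × ι) ⊕ (U × ι × ι))
      (Sum.elim (fun _ => ε) (Sum.elim (fun x => -(1 - ∑ i, A x.1 i x.2)) (fun x => - A x.1 x.2.1 x.2.2)))
      (Sum.elim (fun _ => t₀) (Sum.elim (fun _ => t₀) (fun x => σ x.2.1)))
      (Sum.elim (fun j => σ j) (Sum.elim (fun x => σ x.2) (fun x => σ x.2.2))) t₀ ?_
    · simp only [Fintype.sum_sum_type, Sum.elim_inl, Sum.elim_inr, Fintype.sum_prod_type, max_self] at hl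
      have h1 : s / 2 ≤ ∑ j, max (max (σ j) t₀ - t₀) 0 := by
        have : ∑ j, (σ j - t₀) ≤ ∑ j, max (max (σ j) t₀ - t₀) 0 :=
          sum_le_sum fun j _ => le_trans (by linarith [le_max_left (σ j) t₀]) (le_max_left _ _)
        refine le_trans (le_of_eq ?_) this
        rw [sum_sub_distrib, ← hsσ, sum_const, card_univ, nsmul_eq_mul, ht₀]
        field_simp; ring
      have h2 : ∀ u, ∑ j, (1 - ∑ i, A u i j) * max (max (σ j) t₀ - t₀) 0 ≤ 6 * μ ^ 2 * s := by
        intro u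
        refine le_trans (sum_le_sum fun j _ => ?_) (hB u).2.1
        rw [mul_comm]
        refine mul_le_mul_of_nonneg_right ?_ (by linarith [(hB u).1 j])
        refine max_le ?_ (hσ0 j)
        have := max_le_iff.2 (⟨by linarith, by linarith [hσ0 j]⟩ : σ j ≤ σ j + t₀ ∧ t₀ ≤ σ j + t₀)
        linarith
      have h3 : ∀ u, ∑ i, ∑ j, A u i j * max (max (σ j) t₀ - max (σ i) t₀) 0 ≤ 5 * μ * s := by
        intro u
        refine le_trans ?_ (hB u).2.2
        rw [sum_comm]
        refine sum_le_sum fun j _ => sum_le_sum fun i _ => ?_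
        rw [mul_comm]
        refine mul_le_mul_of_nonneg_right ?_ (hA0 u i j)
        refine max_le ?_ (abs_nonneg _)
        have := abs_max_sub_max_le_abs (σ j) (σ i) t₀
        rw [abs_sub_comm (σ i)]
        exact (le_abs_self _).trans this
      rw [← mul_sum] at hl
      simp only [neg_mul, sum_neg_distrib] at hl
      have h4 : ∑ u, ∑ j, (1 - ∑ i, A u i j) * max (max (σ j) t₀ - t₀) 0 ≤ Fintype.card U * (6 * μ ^ 2 * s) := by
        have := sum_le_card_nsmul Finset.univ _ _ fun u _ => h2 u
        rwa [nsmul_eq_mul, card_univ] at this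
      have h5 : ∑ u, ∑ i, ∑ j, A u i j * max (max (σ j) t₀ - max (σ i) t₀) 0 ≤ Fintype.card U * (5 * μ * s) := by
        have := sum_le_card_nsmul Finset.univ _ _ fun u _ => h3 u
        rwa [nsmul_eq_mul, card_univ] at this
      have h6 : ε * (s / 2) ≤ Fintype.card U * (6 * μ ^ 2 * s) + Fintype.card U * (5 * μ * s) := by
        have := mul_le_mul_of_nonneg_left h1 hε0.le
        linarith
      have h7 : (Fintype.card U : ℝ) * (6 * μ ^ 2 * s) ≤ Fintype.card U * (6 * μ * s) := by
        gcongr; nlinarith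
      nlinarith
    · intro t ht
      have := hcon t ht
      rw [Fintype.sum_sum_type, Fintype.sum_sum_type, Fintype.sum_prod_type, Fintype.sum_prod_type]
      simp only [Fintype.sum_prod_type]
      change ∑ j, ε * (if t₀ ≤ t ∧ t < σ j then (1:ℝ) else 0) +
        (∑ u, ∑ j, -(1 - ∑ i, A u i j) * (if t₀ ≤ t ∧ t < σ j then (1:ℝ) else 0) +
          ∑ u, ∑ i, ∑ j, -A u i j * (if σ i ≤ t ∧ t < σ j then (1:ℝ) else 0)) ≤ 0
      simp only [ht, true_and]
      have e1 : ∑ j, ε * (if t < σ j then (1:ℝ) else 0) = ε * (Finset.univ.filter fun j => t < σ j).card := by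
        rw [← mul_sum]; simp
      have e2 : ∀ u, ∑ j, -(1 - ∑ i, A u i j) * (if t < σ j then (1:ℝ) else 0) +
          ∑ i, ∑ j, -A u i j * (if σ i ≤ t ∧ t < σ j then (1:ℝ) else 0) =
          - ∑ j with t < σ j, (1 - ∑ i with t < σ i, A u i j) := by
        intro u
        rw [sum_comm (f := fun i j => -A u i j * (if σ i ≤ t ∧ t < σ j then (1:ℝ) else 0)),
          ← sum_add_distrib, Finset.sum_filter, ← sum_neg_distrib]
        refine sum_congr rfl fun j _ => ?_
        by_cases h : t < σ j
        · simp only [h, if_true, and_true, mul_one]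
          have : ∑ i, A u i j = ∑ i with t < σ i, A u i j + ∑ i, A u i j * (if σ i ≤ t then 1 else 0) := by
            rw [Finset.sum_filter, ← sum_add_distrib]
            refine sum_congr rfl fun i _ => ?_
            by_cases h' : t < σ i
            · simp [h', not_le.2 h']
            · simp [h', not_lt.1 h']
          rw [this]
          simp only [neg_mul, sum_neg_distrib]
          ring
        · simp [h]
      rw [e1, ← sum_add_distrib]
      rw [sum_congr rfl fun u _ => e2 u, sum_neg_distrib]
      linarith
  obtain ⟨t, ht, hlt⟩ := hkey
  refine ⟨t, ht, ?_, hlt⟩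
  by_contra hne
  rw [Finset.not_nonempty_iff_eq_empty] at hne
  rw [hne] at hlt
  simp at hlt

/-- tracial separating vector -/
structure TrV (Q : 𝔳𝔑) (Ω : H) : Prop where
  norm_one : ‖Ω‖ = 1
  tr : ∀ a ∈ Q, ∀ b ∈ Q, ⟪Ω, a (b Ω)⟫ = ⟪Ω, b (a Ω)⟫
  sep : ∀ a ∈ Q, a Ω = 0 → a = 0

/-- approximately commuting finite rank data -/
def I1 (Q : 𝔳𝔑) (Ω : H) (B0 : Set 𝔹) (r : 𝔹) {U : Type} [Fintype U]
    (V : U → 𝔹) (δ : ℝ) : Prop :=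
  ∃ (L0 : Submodule ℂ H) (_ : FiniteDimensional ℂ L0) (n : ℕ) (e0 : OrthonormalBasis (Fin n) ℂ L0)
    (a : H →ₗ[ℂ] (𝔹)), (∀ v, a v ∈ Q) ∧ (∀ v, r * a v = a v) ∧ (∀ v ∈ L0ᗮ, a v = 0) ∧
    (∀ b ∈ B0, ∀ v, b * a v = a (b v)) ∧ (∃ v, a v ≠ 0) ∧
    ∑ u, ∑ j, ‖(V u * a (e0 j) - a (V u (e0 j))) Ω‖ ^ 2 ≤ δ * ∑ j, ‖a (e0 j) Ω‖ ^ 2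

theorem TrV.sq_eq {Q : 𝔳𝔑} {Ω : H} (h : TrV Q Ω) {a q : 𝔹} (ha : a ∈ Q)
    (hq : q ∈ Q) (hp : IsStarProjection q) : ⟪Ω, star a (a (q Ω))⟫ = ((‖a (q Ω)‖ ^ 2 : ℝ) : ℂ) := by
  have h1 : ⟪Ω, star a (a (q Ω))⟫ = ⟪Ω, (star a * a) ((q * q) Ω)⟫ := by
    rw [hp.isIdempotentElem]; rfl
  rw [h1]
  have h2 := h.tr (star a * a * q) (mul_mem (mul_mem (star_mem ha) ha) hq) q hq
  have h3 : (star a * a) ((q * q) Ω) = (star a * a * q) (q Ω) := rfl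
  rw [h3, h2]
  simp only [mul_apply_eq_comp]
  rw [← proj_inner hp, star_inner_right, inner_sq]
  norm_num

theorem TrV.sum_partition {Q : 𝔳𝔑} {Ω : H} (h : TrV Q Ω) {ι : Type} [Fintype ι]
    {q : ι → 𝔹} (hq : ∀ i, q i ∈ Q ∧ IsStarProjection (q i)) {p : 𝔹} (hpQ : p ∈ Q)
    (hp : IsStarProjection p) (hs : ∑ i, q i = p) {a : 𝔹} (ha : a ∈ Q) :
    ∑ i, ‖a (q i Ω)‖ ^ 2 = ‖a (p Ω)‖ ^ 2 := by
  have : ((∑ i, ‖a (q i Ω)‖ ^ 2 : ℝ) : ℂ) = ((‖a (p Ω)‖ ^ 2 : ℝ) : ℂ) := by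
    rw [Complex.ofReal_sum, ← h.sq_eq ha hpQ hp]
    rw [sum_congr rfl fun i _ => (h.sq_eq ha (hq i).1 (hq i).2).symm]
    rw [← inner_sum, ← hs]
    simp [sum_apply, map_sum, inner_sum]
  exact_mod_cast this

theorem sum_sq_onb {L : Type*} [NormedAddCommGroup L] [InnerProductSpace ℂ L] [FiniteDimensional ℂ L]
    (S : L →ₗ[ℂ] H) {n : ℕ} (b b' : OrthonormalBasis (Fin n) ℂ L) :
    ∑ j, ‖S (b j)‖ ^ 2 = ∑ j, ‖S (b' j)‖ ^ 2 := by
  set T : L →L[ℂ] H := LinearMap.toContinuousLinearMap S with hT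
  have key : ∀ b : OrthonormalBasis (Fin n) ℂ L, ((∑ j, ‖S (b j)‖ ^ 2 : ℝ) : ℂ) =
      LinearMap.trace ℂ L (((adjoint T).comp T : L →L[ℂ] L) : L →ₗ[ℂ] L) := by
    intro b
    rw [LinearMap.trace_eq_sum_inner _ b, Complex.ofReal_sum]
    refine sum_congr rfl fun j _ => ?_
    change _ = ⟪b j, (adjoint T) (T (b j))⟫
    rw [adjoint_inner_right, inner_sq]
    simp [hT]
  have := (key b).trans (key b').symm
  exact_mod_cast this

theorem diag_onb {L : Type*} [NormedAddCommGroup L] [InnerProductSpace ℂ L] [FiniteDimensional ℂ L]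
    (S : L →ₗ[ℂ] H) {n : ℕ} (b : OrthonormalBasis (Fin n) ℂ L) :
    ∃ e : OrthonormalBasis (Fin n) ℂ L, ∀ i j, i ≠ j → ⟪S (e i), S (e j)⟫ = 0 := by
  set T : L →L[ℂ] H := LinearMap.toContinuousLinearMap S with hT
  have hn : Module.finrank ℂ L = n := by
    have := Module.finrank_eq_card_basis b.toBasis
    simpa using this
  set P : L →ₗ[ℂ] L := (((adjoint T).comp T : L →L[ℂ] L) : L →ₗ[ℂ] L) with hP
  have hP' : ∀ v w, ⟪v, P w⟫ = ⟪S v, S w⟫ := by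
    intro v w
    change ⟪v, (adjoint T) (T w)⟫ = _
    rw [adjoint_inner_right]; rfl
  have hsym : P.IsSymmetric := by
    intro v w
    rw [hP', ← inner_conj_symm, hP', inner_conj_symm]
  refine ⟨hsym.eigenvectorBasis hn, fun i j hij => ?_⟩
  rw [← hP', hsym.apply_eigenvectorBasis, inner_smul_right,
    (orthonormal_iff_ite.1 (hsym.eigenvectorBasis hn).orthonormal) i j, if_neg hij, mul_zero]

theorem a_expand {L0 : Submodule ℂ H} [FiniteDimensional ℂ L0] {n : ℕ} (e : OrthonormalBasis (Fin n) ℂ L0)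
    (a : H →ₗ[ℂ] (𝔹)) (ha : ∀ v ∈ L0ᗮ, a v = 0) (v : H) :
    a v = ∑ k, ⟪(e k : H), v⟫ • a (e k) := by
  have h1 : v - (∑ k, ⟪(e k : H), v⟫ • (e k : H)) ∈ L0ᗮ := by
    rw [mem_orthogonal]
    intro w hw
    have hw' := e.sum_repr' ⟨w, hw⟩
    have : w = ∑ i, ⟪(e i : H), w⟫ • (e i : H) := by
      have := congrArg (Subtype.val) hw'
      simpa using this.symm
    rw [inner_sub_right, inner_sum, sub_eq_zero]
    conv_lhs => rw [this]
    rw [sum_inner]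
    refine sum_congr rfl fun i _ => ?_
    rw [inner_smul_left, inner_smul_right, inner_conj_symm, mul_comm]
  have h2 := ha _ h1
  rw [map_sub, sub_eq_zero] at h2
  rw [h2]
  simp

theorem LL_A {Q : 𝔳𝔑} {Ω : H} (hT : TrV Q Ω) {U : Type} [Fintype U]
    (V : U → 𝔹) (hVQ : ∀ u, V u ∈ Q) {δ : ℝ} (hδ : 0 < δ)
    (L0 : Submodule ℂ H) [FiniteDimensional ℂ L0] (n : ℕ) (e0 : OrthonormalBasis (Fin n) ℂ L0)
    (a : H →ₗ[ℂ] (𝔹)) (haQ : ∀ v, a v ∈ Q) (ha0 : ∀ v ∈ L0ᗮ, a v = 0) (hne : ∃ v, a v ≠ 0)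
    (herr : ∑ u, ∑ j, ‖(V u * a (e0 j) - a (V u (e0 j))) Ω‖ ^ 2 ≤ δ * ∑ j, ‖a (e0 j) Ω‖ ^ 2) :
    ∃ t : ℝ, 0 < t ∧ ∀ κ : ℝ, 0 < κ → ∃ (e : OrthonormalBasis (Fin n) ℂ L0) (q : 𝔹),
      q ∈ Q ∧ IsStarProjection q ∧ q Ω ≠ 0 ∧
      (∀ i j, i ≠ j → ⟪a (e i) (q Ω), a (e j) (q Ω)⟫ = 0) ∧
      ∑ u, ∑ j, ‖(V u * a (e j) - a (V u (e j))) (q Ω)‖ ^ 2 ≤ 4 * δ * ∑ j, ‖a (e j) (q Ω)‖ ^ 2 ∧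
      t * ‖q Ω‖ ^ 2 ≤ ∑ j, ‖a (e j) (q Ω)‖ ^ 2 ∧
      ∀ i j, ‖q * (star (a (e i)) * a (e j)) * q -
        (⟪a (e i) (q Ω), a (e j) (q Ω)⟫ / (‖q Ω‖ ^ 2 : ℝ)) • q‖ ≤ κ := by
  classical
  set t := ∑ j, ‖a (e0 j) Ω‖ ^ 2 with ht
  have htp : 0 < t := by
    rw [ht]
    refine lt_of_le_of_ne (sum_nonneg fun j _ => by positivity) fun h0 => ?_
    have h1 := (Finset.sum_eq_zero_iff_of_nonneg fun j _ => by positivity).1 h0.symm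
    obtain ⟨v, hv⟩ := hne
    apply hv
    rw [a_expand e0 a ha0 v]
    refine sum_eq_zero fun k _ => ?_
    have := h1 k (Finset.mem_univ k)
    rw [hT.sep _ (haQ _) (norm_eq_zero.1 (by simpa using this)), smul_zero]
  refine ⟨t / 2, by positivity, fun κ hκ => ?_⟩
  set ε := κ / (2 * (n ^ 2 + 1)) with hε
  have hεp : 0 < ε := by positivity
  obtain ⟨ι, _, q, hq, hqs⟩ := pav_finset (Q := Q)
    (Finset.univ.image fun p : Fin n × Fin n => star (a (e0 p.1)) * a (e0 p.2)) (by
      intro y hy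
      obtain ⟨p, _, rfl⟩ := Finset.mem_image.1 hy
      exact mul_mem (star_mem (haQ _)) (haQ _)) hεp 1 (one_mem _) (IsStarProjection.one _)
  have hq2 : ∀ i, q i ∈ Q ∧ IsStarProjection (q i) := fun i => ⟨(hq i).1, (hq i).2.1⟩
  set d : U → Fin n → 𝔹 := fun u j => V u * a (e0 j) - a (V u (e0 j)) with hd
  have hdQ : ∀ u j, d u j ∈ Q := fun u j => sub_mem (mul_mem (hVQ u) (haQ _)) (haQ _)
  obtain ⟨k, hk⟩ : ∃ k, 0 < (∑ j, ‖a (e0 j) (q k Ω)‖ ^ 2) - t / 2 * ‖q k Ω‖ ^ 2 -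
      (∑ u, ∑ j, ‖d u j (q k Ω)‖ ^ 2) / (4 * δ) := by
    by_contra hcon
    push Not at hcon
    have h1 := Finset.sum_nonpos fun k (_ : k ∈ Finset.univ) => hcon k
    rw [sum_sub_distrib, sum_sub_distrib, ← mul_sum, ← Finset.sum_div] at h1
    rw [sum_comm, sum_comm (f := fun k u => ∑ j, ‖d u j (q k Ω)‖ ^ 2)] at h1
    have e1 : ∀ j, ∑ k, ‖a (e0 j) (q k Ω)‖ ^ 2 = ‖a (e0 j) Ω‖ ^ 2 := fun j =>
      hT.sum_partition hq2 (one_mem _) (IsStarProjection.one _) hqs (haQ _)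
    have e2 : ∀ u, ∑ k, ∑ j, ‖d u j (q k Ω)‖ ^ 2 = ∑ j, ‖d u j Ω‖ ^ 2 := by
      intro u
      rw [sum_comm]
      exact sum_congr rfl fun j _ =>
        hT.sum_partition hq2 (one_mem _) (IsStarProjection.one _) hqs (hdQ u j)
    have e3 : ∑ k, ‖q k Ω‖ ^ 2 = 1 := by
      have := hT.sum_partition hq2 (one_mem _) (IsStarProjection.one _) hqs (one_mem Q)
      simpa [hT.norm_one] using this
    simp only [e1, e2, e3, ← ht] at h1
    have h2 : (∑ u, ∑ j, ‖d u j Ω‖ ^ 2) / (4 * δ) ≤ t / 4 := by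
      rw [div_le_iff₀ (by positivity)]
      linarith
    linarith
  have hE0 : 0 ≤ (∑ u, ∑ j, ‖d u j (q k Ω)‖ ^ 2) / (4 * δ) :=
    div_nonneg (sum_nonneg fun u _ => sum_nonneg fun j _ => by positivity) (by positivity)
  have hqΩ : q k Ω ≠ 0 := by
    intro h0
    simp [h0] at hk
  set ξ := q k Ω with hξ
  set S : L0 →ₗ[ℂ] H := { toFun := fun v => a v ξ, map_add' := by intro v w; simp,
                            map_smul' := by intro c v; simp } with hS
  obtain ⟨e, he⟩ := diag_onb S e0
  set Sd : U → L0 →ₗ[ℂ] H := fun u => { toFun := fun v => (V u * a v - a (V u v)) ξ,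
                                          map_add' := by intro v w; simp [mul_add]; abel,
                                          map_smul' := by intro c v; simp [smul_sub] } with hSd
  have hb1 : ∑ j, ‖a (e j) ξ‖ ^ 2 = ∑ j, ‖a (e0 j) ξ‖ ^ 2 := sum_sq_onb S e e0
  have hb2 : ∀ u, ∑ j, ‖(V u * a (e j) - a (V u (e j))) ξ‖ ^ 2 = ∑ j, ‖d u j ξ‖ ^ 2 :=
    fun u => sum_sq_onb (Sd u) e e0
  refine ⟨e, q k, (hq k).1, (hq k).2.1, hqΩ, he, ?_, ?_, ?_⟩
  · rw [hb1]
    rw [sum_congr rfl fun u _ => hb2 u]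
    have h3 : (∑ u, ∑ j, ‖d u j ξ‖ ^ 2) / (4 * δ) ≤ ∑ j, ‖a (e0 j) ξ‖ ^ 2 := by
      have : 0 ≤ t / 2 * ‖ξ‖ ^ 2 := by positivity
      linarith
    rw [div_le_iff₀ (by positivity)] at h3
    linarith
  · rw [hb1]; linarith
  · intro i j
    have hexp := fun l => a_expand e0 a ha0 (e l)
    have hns : ∀ p p', ‖q k * (star (a (e0 p)) * a (e0 p')) * q k -
        (⟪a (e0 p) ξ, a (e0 p') ξ⟫ / (‖ξ‖ ^ 2 : ℝ)) • q k‖ ≤ 2 * ε := by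
      intro p p'
      have := NS_vec (hq k).2.1 Ω hqΩ ((hq k).2.2.2 (star (a (e0 p)) * a (e0 p'))
        (Finset.mem_image.2 ⟨(p, p'), Finset.mem_univ _, rfl⟩))
      rw [mul_apply_eq_comp, star_inner_right] at this
      exact this
    set c : Fin n → Fin n → ℂ := fun p l => ⟪(e0 p : H), (e l : H)⟫ with hc
    have hc1 : ∀ p l, ‖c p l‖ ≤ 1 := by
      intro p l
      refine (norm_inner_le_norm _ _).trans ?_
      have h1 : ‖(e0 p : H)‖ = 1 := e0.orthonormal.1 p
      have h2 : ‖(e l : H)‖ = 1 := e.orthonormal.1 l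
      rw [h1, h2]; norm_num
    have hform : q k * (star (a (e i)) * a (e j)) * q k -
        (⟪a (e i) ξ, a (e j) ξ⟫ / (‖ξ‖ ^ 2 : ℝ)) • q k =
        ∑ p, ∑ p', (star (c p i) * c p' j) • (q k * (star (a (e0 p)) * a (e0 p')) * q k -
        (⟪a (e0 p) ξ, a (e0 p') ξ⟫ / (‖ξ‖ ^ 2 : ℝ)) • q k) := by
      rw [hexp i, hexp j]
      simp only [smul_sub, sum_sub_distrib]
      congr 1
      · simp only [star_sum, star_smul, sum_mul, mul_sum, smul_mul_assoc, mul_smul_comm, smul_smul, smul_sum]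
        rw [sum_comm]
        refine sum_congr rfl fun p _ => sum_congr rfl fun p' _ => ?_
        rw [mul_comm]
      · simp only [sum_apply, smul_apply, sum_inner, inner_sum, inner_smul_left,
          inner_smul_right, mul_sum, Finset.sum_div, Finset.sum_smul, smul_smul]
        rw [sum_comm]
        refine sum_congr rfl fun p _ => sum_congr rfl fun p' _ => ?_
        congr 1
        rw [hc]; simp only [RCLike.star_def]; ring
    rw [hform]
    have hle : ∀ p p', ‖(star (c p i) * c p' j) • (q k * (star (a (e0 p)) * a (e0 p')) * q k -
        (⟪a (e0 p) ξ, a (e0 p') ξ⟫ / (‖ξ‖ ^ 2 : ℝ)) • q k)‖ ≤ 2 * ε := by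
      intro p p'
      rw [norm_smul, norm_mul, norm_star]
      calc ‖c p i‖ * ‖c p' j‖ * _ ≤ 1 * 1 * (2 * ε) := by
            gcongr
            · exact hc1 _ _
            · exact hc1 _ _
            · exact hns p p'
        _ = _ := by ring
    have h5 : ∀ p ∈ Finset.univ, ‖∑ p', (star (c p i) * c p' j) • (q k * (star (a (e0 p)) * a (e0 p')) * q k -
        (⟪a (e0 p) ξ, a (e0 p') ξ⟫ / (‖ξ‖ ^ 2 : ℝ)) • q k)‖ ≤ n * (2 * ε) := by
      intro p _
      refine (norm_sum_le _ _).trans ((sum_le_card_nsmul _ _ _ fun p' _ => hle p p').trans ?_)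
      simp
    refine (norm_sum_le _ _).trans ((sum_le_card_nsmul _ _ _ h5).trans ?_)
    rw [nsmul_eq_mul, card_univ, Fintype.card_fin, hε]
    rw [show (n : ℝ) * (n * (2 * (κ / (2 * (n ^ 2 + 1))))) = κ * (n ^ 2 / (n ^ 2 + 1)) by field_simp]
    have : (n : ℝ) ^ 2 / (n ^ 2 + 1) ≤ 1 := by
      rw [div_le_one (by positivity)]; linarith
    nlinarith

/-- a scalar contraction matrix acts contractively on vector tuples -/
theorem contraction_vec {ι : Type} [Fintype ι] (α : ι → ι → ℂ)
    (hα : ∀ c : ι → ℂ, ∑ i, ‖∑ j, α i j * c j‖ ^ 2 ≤ ∑ j, ‖c j‖ ^ 2) (η : ι → H) :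
    ∑ i, ‖∑ j, α i j • η j‖ ^ 2 ≤ ∑ j, ‖η j‖ ^ 2 := by
  classical
  set L : Submodule ℂ H := Submodule.span ℂ (Set.range η) with hL
  have : FiniteDimensional ℂ L := FiniteDimensional.span_of_finite ℂ (Set.finite_range η)
  have hη : ∀ j, η j ∈ L := fun j => subset_span ⟨j, rfl⟩
  set b := stdOrthonormalBasis ℂ L
  have hn : ∀ v (hv : v ∈ L), ‖v‖ ^ 2 = ∑ f, ‖⟪(b f : H), v⟫‖ ^ 2 := by
    intro v hv
    have := b.sum_sq_norm_inner_right ⟨v, hv⟩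
    exact this.symm
  have h1 : ∀ i, ∑ j, α i j • η j ∈ L := fun i => sum_mem fun j _ => L.smul_mem _ (hη j)
  calc ∑ i, ‖∑ j, α i j • η j‖ ^ 2 = ∑ i, ∑ f, ‖∑ j, α i j * ⟪(b f : H), η j⟫‖ ^ 2 := by
        refine sum_congr rfl fun i _ => ?_
        rw [hn _ (h1 i)]
        refine sum_congr rfl fun f _ => ?_
        rw [inner_sum]; simp only [inner_smul_right]
    _ = ∑ f, ∑ i, ‖∑ j, α i j * ⟪(b f : H), η j⟫‖ ^ 2 := sum_comm
    _ ≤ ∑ f, ∑ j, ‖⟪(b f : H), η j⟫‖ ^ 2 := sum_le_sum fun f _ => hα _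
    _ = ∑ j, ∑ f, ‖⟪(b f : H), η j⟫‖ ^ 2 := sum_comm
    _ = ∑ j, ‖η j‖ ^ 2 := sum_congr rfl fun j _ => (hn _ (hη j)).symm

theorem gram_contraction {ι : Type} [Fintype ι] (x : ι → H) (hx : Orthonormal ℂ x) (V : 𝔹)
    (hV : ∀ v, ‖V v‖ = ‖v‖) (c : ι → ℂ) :
    ∑ i, ‖∑ j, ⟪x i, V (x j)⟫ * c j‖ ^ 2 ≤ ∑ j, ‖c j‖ ^ 2 := by
  have h1 := hx.sum_inner_products_le (x := V (∑ j, c j • x j)) (s := Finset.univ)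
  rw [hV] at h1
  have h2 : ‖∑ j, c j • x j‖ ^ 2 = ∑ j, ‖c j‖ ^ 2 := by
    rw [norm_sq_sum_orth x fun i j hij => hx.2 hij]
    simp [hx.1]
  rw [h2] at h1
  refine le_trans (le_of_eq (sum_congr rfl fun i _ => ?_)) h1
  simp [map_sum, inner_sum, inner_smul_right, mul_comm]

section MU

variable {ι : Type} [Fintype ι] [DecidableEq ι] {q : H →L[ℂ] H} {w : ι → H →L[ℂ] H}

theorem mu_norm (hq : IsStarProjection q) (hwq : ∀ i, w i * q = w i)
    (hw : ∀ i j, star (w i) * w j = if i = j then q else 0) (α : ι → ι → ℂ)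
    (hα : ∀ c : ι → ℂ, ∑ i, ‖∑ j, α i j * c j‖ ^ 2 ≤ ∑ j, ‖c j‖ ^ 2) :
    ‖∑ i, ∑ j, α i j • (w i * star (w j))‖ ≤ 1 := by
  have hww : ∀ i j v v', ⟪w i v, w j v'⟫ = if i = j then ⟪v, q v'⟫ else 0 := by
    intro i j v v'
    have := congrArg (fun f : 𝔹 => f v') (hw i j)
    simp only [mul_apply_eq_comp] at this
    rw [← star_inner_right, this]
    split_ifs <;> simp
  have hqw : ∀ j v, q (star (w j) v) = star (w j) v := by
    intro j v
    have := congrArg star (hwq j)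
    rw [star_mul, hq.isSelfAdjoint.star_eq] at this
    exact congrArg (fun f : 𝔹 => f v) this
  refine opNorm_le_bound _ zero_le_one fun v => ?_
  rw [one_mul]
  set η : ι → H := fun j => star (w j) v with hη
  set ξ : ι → H := fun i => ∑ j, α i j • η j with hξ
  have e1 : (∑ i, ∑ j, α i j • (w i * star (w j))) v = ∑ i, w i (ξ i) := by
    simp [sum_apply, hξ, hη, map_sum]
  have hqξ : ∀ i, q (ξ i) = ξ i := by
    intro i; simp only [hξ, map_sum, map_smul, hη, hqw]
  have e2 : ‖∑ i, w i (ξ i)‖ ^ 2 = ∑ i, ‖ξ i‖ ^ 2 := by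
    have := norm_sq_sum_orth (fun i => w i (ξ i)) (fun i j hij => by rw [hww, if_neg hij]) (fun _ => 1)
    simp only [one_smul, norm_one, one_pow, one_mul] at this
    rw [this]
    refine sum_congr rfl fun i _ => ?_
    have h := hww i i (ξ i) (ξ i)
    rw [if_pos rfl, hqξ, inner_sq, inner_sq] at h
    exact_mod_cast h
  have e3 : ∑ j, ‖η j‖ ^ 2 ≤ ‖v‖ ^ 2 := by
    have e4 : ((∑ j, ‖η j‖ ^ 2 : ℝ) : ℂ) = ⟪∑ j, w j (η j), v⟫ := by
      rw [sum_inner, Complex.ofReal_sum]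
      refine sum_congr rfl fun j _ => ?_
      rw [← star_inner_right]
      change _ = ⟪η j, η j⟫
      rw [inner_sq]; norm_num
    have e5 : ‖∑ j, w j (η j)‖ ^ 2 = ∑ j, ‖η j‖ ^ 2 := by
      have := norm_sq_sum_orth (fun i => w i (η i)) (fun i j hij => by rw [hww, if_neg hij]) (fun _ => 1)
      simp only [one_smul, norm_one, one_pow, one_mul] at this
      rw [this]
      refine sum_congr rfl fun i _ => ?_
      have h := hww i i (η i) (η i)
      rw [if_pos rfl, hη] at h
      simp only [hqw] at h
      rw [inner_sq, inner_sq] at h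
      exact_mod_cast h
    have e6 : ∑ j, ‖η j‖ ^ 2 ≤ ‖∑ j, w j (η j)‖ * ‖v‖ := by
      have h0 : 0 ≤ ∑ j, ‖η j‖ ^ 2 := sum_nonneg fun j _ => by positivity
      have := norm_inner_le_norm (𝕜 := ℂ) (∑ j, w j (η j)) v
      rw [← e4, norm_real, Real.norm_of_nonneg h0] at this
      exact this
    rw [← e5] at e6 ⊢
    rcases (norm_nonneg (∑ j, w j (η j))).eq_or_lt with h | h
    · rw [← h]; nlinarith [sq_nonneg ‖v‖]
    · have : ‖∑ j, w j (η j)‖ ≤ ‖v‖ := by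
        rw [sq] at e6; exact le_of_mul_le_mul_left e6 h
      gcongr
  rw [e1]
  have : ‖∑ i, w i (ξ i)‖ ^ 2 ≤ ‖v‖ ^ 2 := by
    rw [e2]; exact (contraction_vec α hα η).trans e3
  exact le_of_sq_le_sq this (norm_nonneg _)

theorem mu_trace {Q : 𝔳𝔑} {Ω : H} (hT : TrV Q Ω) (hqQ : q ∈ Q) (hq : IsStarProjection q)
    (hwQ : ∀ i, w i ∈ Q)
    (hw : ∀ i j, star (w i) * w j = if i = j then q else 0) (d : ι → 𝔹) (hd : ∀ i, d i ∈ Q) :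
    ‖(∑ j, d j * star (w j)) Ω‖ ^ 2 = ∑ j, ‖d j (q Ω)‖ ^ 2 := by
  have hpair : ∀ j k, ⟪(d j * star (w j)) Ω, (d k * star (w k)) Ω⟫ =
      if k = j then ((‖d j (q Ω)‖ ^ 2 : ℝ) : ℂ) else 0 := by
    intro j k
    have h1 : ⟪(d j * star (w j)) Ω, (d k * star (w k)) Ω⟫ =
        ⟪Ω, (w j) ((star (d j) * d k * star (w k)) Ω)⟫ := by
      simp only [mul_apply_eq_comp]
      rw [← star_inner_right, ← star_inner_right, star_star]
    have h2 := hT.tr _ (hwQ j) (star (d j) * d k * star (w k))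
      (mul_mem (mul_mem (star_mem (hd j)) (hd k)) (star_mem (hwQ k)))
    rw [h1, h2]
    have h3 : (star (d j) * d k * star (w k)) (w j Ω) = (star (d j) * d k) ((star (w k) * w j) Ω) := rfl
    rw [h3, hw]
    split_ifs with h
    · subst h
      exact hT.sq_eq (hd _) hqQ hq
    · simp
  have : ((‖(∑ j, d j * star (w j)) Ω‖ ^ 2 : ℝ) : ℂ) = ((∑ j, ‖d j (q Ω)‖ ^ 2 : ℝ) : ℂ) := by
    have h0 := inner_sq ((∑ j, d j * star (w j)) Ω)
    rw [Complex.ofReal_pow]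
    refine h0.symm.trans ?_
    rw [sum_apply, sum_inner]
    simp only [inner_sum, hpair]
    simp
  exact_mod_cast this

/-- matrix unit block -/
def muB (w : ι → 𝔹) : Submodule ℂ 𝔹 :=
  Submodule.span ℂ (Set.range fun p : ι × ι => w p.1 * star (w p.2))

theorem muB_fin (w : ι → 𝔹) : FiniteDimensional ℂ (muB w) :=
  FiniteDimensional.span_of_finite ℂ (Set.finite_range _)

theorem muB_mem (w : ι → 𝔹) (i j : ι) : w i * star (w j) ∈ muB w :=
  subset_span ⟨(i, j), rfl⟩

theorem muB_mul (hq : IsStarProjection q) (hwq : ∀ i, w i * q = w i)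
    (hw : ∀ i j, star (w i) * w j = if i = j then q else 0) {x y : 𝔹} (hx : x ∈ muB w)
    (hy : y ∈ muB w) : x * y ∈ muB w := by
  induction hx using span_induction with
  | mem x hx =>
    obtain ⟨p, rfl⟩ := hx
    induction hy using span_induction with
    | mem y hy =>
      obtain ⟨p', rfl⟩ := hy
      have : w p.1 * star (w p.2) * (w p'.1 * star (w p'.2)) =
          w p.1 * (star (w p.2) * w p'.1) * star (w p'.2) := by noncomm_ring
      simp only
      rw [this, hw]
      split_ifs
      · rw [hwq]; exact muB_mem w _ _
      · simp
    | zero => simp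
    | add y y' _ _ h1 h2 => rw [mul_add]; exact add_mem h1 h2
    | smul c y _ h1 => rw [mul_smul_comm]; exact Submodule.smul_mem _ _ h1
  | zero => simp
  | add y y' _ _ h1 h2 => rw [add_mul]; exact add_mem h1 h2
  | smul c y _ h1 => rw [smul_mul_assoc]; exact Submodule.smul_mem _ _ h1

theorem muB_star {x : 𝔹} (hx : x ∈ muB w) : star x ∈ muB w := by
  induction hx using span_induction with
  | mem x hx =>
    obtain ⟨p, rfl⟩ := hx
    simp only [star_mul, star_star]
    exact muB_mem w _ _
  | zero => simp
  | add y y' _ _ h1 h2 => rw [star_add]; exact add_mem h1 h2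
  | smul c y _ h1 => rw [star_smul]; exact Submodule.smul_mem _ _ h1

theorem muB_left (p : 𝔹) (h : ∀ i, p * w i = w i) {x : 𝔹} (hx : x ∈ muB w) :
    p * x = x := by
  induction hx using span_induction with
  | mem x hx =>
    obtain ⟨p, rfl⟩ := hx
    simp only
    rw [← mul_assoc, h]
  | zero => simp
  | add y y' _ _ h1 h2 => rw [mul_add, h1, h2]
  | smul c y _ h1 => rw [mul_smul_comm, h1]

theorem muB_sub {Q : 𝔳𝔑} (h : ∀ i, w i ∈ Q) {x : 𝔹} (hx : x ∈ muB w) :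
    x ∈ Q := by
  induction hx using span_induction with
  | mem x hx =>
    obtain ⟨p, rfl⟩ := hx
    exact mul_mem (h _) (star_mem (h _))
  | zero => exact zero_mem _
  | add y y' _ _ h1 h2 => exact add_mem h1 h2
  | smul c y _ h1 => exact smul_mem' c h1

end MU

/-- output of the local lemma -/
def LLOut (Q : 𝔳𝔑) (Ω : H) (B0 : Set 𝔹) (r : 𝔹) {U : Type}
    (V : U → 𝔹) (ε : ℝ) : Prop :=
  ∃ s ∈ Q, IsStarProjection s ∧ s ≠ 0 ∧ r * s = s ∧ (∀ b ∈ B0, b * s = s * b) ∧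
    ∃ B : Submodule ℂ 𝔹, FiniteDimensional ℂ B ∧
      (∀ x ∈ B, x ∈ Q ∧ s * x = x ∧ x * s = x ∧ star x ∈ B) ∧ (∀ x ∈ B, ∀ y ∈ B, x * y ∈ B) ∧
      s ∈ B ∧ (∀ b ∈ B0, b * s ∈ B) ∧
      ∀ u, ∃ b ∈ B, ‖b‖ ≤ 1 ∧ ‖(V u * s - b) Ω‖ ^ 2 ≤ ε * ‖s Ω‖ ^ 2

/-- distance to span of orthonormal family -/
theorem dist_orth {ι : Type} [Fintype ι] (x : ι → H) (hx : Orthonormal ℂ x) (v : H) :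
    ‖v - ∑ i, ⟪x i, v⟫ • x i‖ ^ 2 = ‖v‖ ^ 2 - ∑ i, ‖⟪x i, v⟫‖ ^ 2 := by
  classical
  set p := ∑ i, ⟪x i, v⟫ • x i with hp
  have h0 : ∀ i, ⟪x i, v - p⟫ = 0 := by
    intro i
    rw [inner_sub_right, hp, hx.inner_right_fintype, sub_self]
  have h1 : ⟪p, v - p⟫ = 0 := by
    conv_lhs => rw [hp]
    rw [sum_inner]
    refine sum_eq_zero fun i _ => ?_
    rw [inner_smul_left, h0, mul_zero]
  have h2 := norm_add_sq_eq_norm_sq_add_norm_sq_of_inner_eq_zero p (v - p) h1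
  have h3 : ‖p‖ ^ 2 = ∑ i, ‖⟪x i, v⟫‖ ^ 2 := by
    rw [hp, norm_sq_sum_orth x fun i j hij => hx.2 hij]
    simp [hx.1]
  rw [add_sub_cancel] at h2
  rw [← h3]; nlinarith

theorem LL_C {Q : 𝔳𝔑} {Ω : H} (hT : TrV Q Ω) {B0 : StarSubalgebra ℂ 𝔹}
    {r : 𝔹} (hr : IsStarProjection r) {U : Type} {V : U → 𝔹} (hVQ : ∀ u, V u ∈ Q)
    (hV : ∀ u v, ‖V u v‖ = ‖v‖) {q : 𝔹} (hqQ : q ∈ Q) (hq : IsStarProjection q) (hqΩ : q Ω ≠ 0)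
    {ι : Type} [Fintype ι] [DecidableEq ι] [Nonempty ι] {m : ℕ} (hm : Fintype.card ι ≤ m)
    {a : ι → 𝔹} (haQ : ∀ i, a i ∈ Q) (haq : ∀ i, a i * q = a i) (hra : ∀ i, r * a i = a i)
    (D : 𝔹 → ι → ι → ℂ) (hD : ∀ b ∈ B0, ∀ i, b * a i = ∑ k, D b k i • a k)
    (hDs : ∀ b ∈ B0, ∀ i k, star (D (star b) i k) = D b k i)
    {g : 𝔹} (hgQ : g ∈ Q) (hg : IsSelfAdjoint g)
    (hgc : ∀ y, Commute (∑ i, a i * star (a i)) y → Commute g y)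
    (hgw : ∀ i j, star (g * a i) * (g * a j) = if i = j then q else 0)
    {η : ℝ} (hη : 0 < η) (hga : ∀ i, ‖g * a i - a i‖ ≤ η)
    {x : ι → H} (hx : Orthonormal ℂ x) (hxa : ∀ i, a i (q Ω) = (‖q Ω‖ : ℂ) • x i)
    {ε1 ε : ℝ} (hε : 2 * ε1 + 2 * ((1 + m) * η) ^ 2 ≤ ε)
    (hA : ∀ u, ∑ j, (1 - ∑ i, ‖⟪x i, V u (x j)⟫‖ ^ 2) ≤ ε1 * Fintype.card ι) :
    LLOut Q Ω B0 r V ε := by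
  set w : ι → 𝔹 := fun i => g * a i with hw
  clear_value w
  have hwi : ∀ i, w i = g * a i := fun i => congrFun hw i
  have hww : ∀ i j, star (w i) * w j = if i = j then q else 0 := by
    intro i j; rw [hwi, hwi, hgw]
  have hwQ : ∀ i, w i ∈ Q := fun i => by rw [hwi]; exact mul_mem hgQ (haQ i)
  have hwq : ∀ i, w i * q = w i := fun i => by rw [hwi, mul_assoc, haq]
  have hga' : ∀ i, ‖w i - a i‖ ≤ η := fun i => by rw [hwi]; exact hga i
  have hXr : Commute (∑ i, a i * star (a i)) r := by
    have h1 : ∀ i, star (a i) * r = star (a i) := by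
      intro i
      have := congrArg star (hra i)
      rwa [star_mul, hr.isSelfAdjoint.star_eq] at this
    change _ * _ = _ * _
    rw [sum_mul, mul_sum]
    refine sum_congr rfl fun i _ => ?_
    rw [mul_assoc, h1, ← mul_assoc, hra]
  have hrw : ∀ i, r * w i = w i := by
    intro i
    rw [hwi, ← mul_assoc, ← (hgc r hXr).eq, mul_assoc, hra]
  have hXb : ∀ b ∈ B0, Commute (∑ i, a i * star (a i)) b := by
    intro b hb
    change _ * _ = _ * _
    rw [sum_mul, mul_sum]
    have h1 : ∀ k, a k * star (a k) * b = ∑ i, D b k i • (a k * star (a i)) := by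
      intro k
      have h2 : star (a k) * b = star (star b * a k) := by rw [star_mul, star_star]
      rw [mul_assoc, h2, hD _ (star_mem hb), star_sum, mul_sum]
      refine sum_congr rfl fun i _ => ?_
      rw [star_smul, hDs b hb, mul_smul_comm]
    have h2 : ∀ i, b * (a i * star (a i)) = ∑ k, D b k i • (a k * star (a i)) := by
      intro i
      rw [← mul_assoc, hD b hb, sum_mul]
      simp only [smul_mul_assoc]
    rw [sum_congr rfl fun k _ => h1 k, sum_congr rfl fun k _ => h2 k, sum_comm]
  have hbw : ∀ b ∈ B0, ∀ i, b * w i = ∑ k, D b k i • w k := by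
    intro b hb i
    rw [hwi, ← mul_assoc, ← (hgc b (hXb b hb)).eq, mul_assoc, hD b hb, mul_sum]
    refine sum_congr rfl fun k _ => ?_
    rw [mul_smul_comm, hwi]
  set s := ∑ i, w i * star (w i) with hs
  have hsB : s ∈ muB w := sum_mem fun i _ => muB_mem w i i
  have hsw : ∀ j, s * w j = w j := by
    intro j
    rw [hs, sum_mul]
    rw [sum_congr rfl fun i _ => (by rw [mul_assoc, hww, mul_ite, mul_zero, hwq] :
      w i * star (w i) * w j = if i = j then w i else 0)]
    simp
  have hssa : star s = s := by
    rw [hs, star_sum]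
    simp only [star_mul, star_star]
  have hsp : IsStarProjection s := ⟨muB_left s hsw hsB, hssa⟩
  have hρ : 0 < ‖q Ω‖ := norm_pos_iff.2 hqΩ
  have hqq : q (q Ω) = q Ω := proj_idem hq _
  have hwn : ∀ j, ‖w j (q Ω)‖ ^ 2 = ‖q Ω‖ ^ 2 := by
    intro j
    have h1 : ⟪w j (q Ω), w j (q Ω)⟫ = ⟪q Ω, q Ω⟫ := by
      rw [← star_inner_right]
      have := congrArg (fun f : 𝔹 => f (q Ω)) (hww j j)
      simp only [mul_apply_eq_comp, if_true] at this
      rw [this, hqq]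
    rw [inner_sq, inner_sq] at h1
    exact_mod_cast h1
  have hsn : ‖s Ω‖ ^ 2 = Fintype.card ι * ‖q Ω‖ ^ 2 := by
    rw [hs, mu_trace hT hqQ hq hwQ hww w hwQ, sum_congr rfl fun j _ => hwn j]
    simp
  have hcard : (0 : ℝ) < Fintype.card ι := by exact_mod_cast Fintype.card_pos
  have hxs : ∀ y ∈ muB w, y * s = y := by
    intro y hy
    have := congrArg star (muB_left s hsw (muB_star hy))
    rwa [star_mul, star_star, hssa] at this
  have hbs : ∀ b ∈ B0, b * s ∈ muB w := by
    intro b hb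
    rw [hs, mul_sum]
    refine sum_mem fun i _ => ?_
    rw [← mul_assoc, hbw b hb, sum_mul]
    refine sum_mem fun k _ => ?_
    rw [smul_mul_assoc]
    exact Submodule.smul_mem _ _ (muB_mem w _ _)
  refine ⟨s, muB_sub hwQ hsB, hsp, ?_, muB_left r hrw hsB, ?_, muB w, muB_fin w, ?_, ?_, hsB, hbs, ?_⟩
  · intro h0
    rw [h0] at hsn
    simp at hsn
    exact hqΩ hsn
  · intro b hb
    have h1 : s * (b * s) = b * s := muB_left s hsw (hbs b hb)
    have h2 : s * (star b * s) = star b * s := muB_left s hsw (hbs _ (star_mem hb))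
    have h3 := congrArg star h2
    simp only [star_mul, star_star, hssa] at h3
    rw [← h1, ← mul_assoc, h3]
  · intro y hy
    exact ⟨muB_sub hwQ hy, muB_left s hsw hy, hxs y hy, muB_star hy⟩
  · intro y hy z hz
    exact muB_mul hq hwq hww hy hz
  · intro u
    set α : ι → ι → ℂ := fun i j => ⟪x i, V u (x j)⟫ with hα
    refine ⟨∑ i, ∑ j, α i j • (w i * star (w j)), ?_, ?_, ?_⟩
    · exact sum_mem fun i _ => sum_mem fun j _ => Submodule.smul_mem _ _ (muB_mem w _ _)
    · exact mu_norm hq hwq hww α (gram_contraction x hx (V u) (hV u))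
    · have e1 : V u * s - ∑ i, ∑ j, α i j • (w i * star (w j)) =
          ∑ j, (V u * w j - ∑ i, α i j • w i) * star (w j) := by
        rw [sum_comm, hs, mul_sum, ← sum_sub_distrib]
        refine sum_congr rfl fun j _ => ?_
        rw [sub_mul, sum_mul, mul_assoc]
        simp only [smul_mul_assoc]
      rw [e1, mu_trace hT hqQ hq hwQ hww _ fun j => sub_mem (mul_mem (hVQ u) (hwQ j))
        (sum_mem fun i _ => smul_mem' _ (hwQ i)), hsn]
      have hαn : ∀ i j, ‖α i j‖ ≤ 1 := by
        intro i j
        have := norm_inner_le_norm (𝕜 := ℂ) (x i) (V u (x j))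
        rwa [hV, hx.1, hx.1, one_mul] at this
      have hdj : ∀ j, ‖(V u * w j - ∑ i, α i j • w i) (q Ω)‖ ^ 2 ≤
          2 * ‖q Ω‖ ^ 2 * (1 - ∑ i, ‖α i j‖ ^ 2) + 2 * ((1 + m) * η) ^ 2 * ‖q Ω‖ ^ 2 := by
        intro j
        have h1 : (V u * w j - ∑ i, α i j • w i) (q Ω) =
            (‖q Ω‖ : ℂ) • (V u (x j) - ∑ i, ⟪x i, V u (x j)⟫ • x i) +
            (V u ((w j - a j) (q Ω)) - ∑ i, α i j • ((w i - a i) (q Ω))) := by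
          have h2 : (‖q Ω‖ : ℂ) • (V u (x j) - ∑ i, ⟪x i, V u (x j)⟫ • x i) =
              V u (a j (q Ω)) - ∑ i, α i j • (a i (q Ω)) := by
            simp only [hxa, map_smul, smul_sub, smul_sum, hα]
            congr 1
            refine sum_congr rfl fun i _ => ?_
            rw [smul_comm]
          rw [h2]
          simp only [sub_apply, sum_apply, smul_apply, mul_apply_eq_comp, map_sub,
            smul_sub, sum_sub_distrib]
          abel
        have h3 : ‖V u ((w j - a j) (q Ω)) - ∑ i, α i j • ((w i - a i) (q Ω))‖ ≤ (1 + m) * η * ‖q Ω‖ := by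
          have hk : ∀ k, ‖(w k - a k) (q Ω)‖ ≤ η * ‖q Ω‖ := fun k =>
            ((w k - a k).le_opNorm _).trans (by gcongr; exact hga' k)
          calc _ ≤ ‖V u ((w j - a j) (q Ω))‖ + ‖∑ i, α i j • ((w i - a i) (q Ω))‖ := norm_sub_le _ _
            _ ≤ η * ‖q Ω‖ + ∑ i : ι, η * ‖q Ω‖ := by
              rw [hV]
              refine add_le_add (hk j) ((norm_sum_le _ _).trans (sum_le_sum fun i _ => ?_))
              rw [norm_smul]
              calc _ ≤ 1 * (η * ‖q Ω‖) := by gcongr; exact hαn i j; exact hk i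
                _ = _ := one_mul _
            _ ≤ _ := by
              rw [sum_const, card_univ, nsmul_eq_mul]
              have : (Fintype.card ι : ℝ) ≤ m := by exact_mod_cast hm
              have h9 : 0 ≤ η * ‖q Ω‖ := by positivity
              nlinarith [mul_le_mul_of_nonneg_right this h9]
        have h4 : ‖(‖q Ω‖ : ℂ) • (V u (x j) - ∑ i, ⟪x i, V u (x j)⟫ • x i)‖ ^ 2 =
            ‖q Ω‖ ^ 2 * (1 - ∑ i, ‖α i j‖ ^ 2) := by
          rw [norm_smul, mul_pow, dist_orth x hx, hV, hx.1]
          simp [hα]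
        rw [h1]
        have h5 := norm_add_le ((‖q Ω‖ : ℂ) • (V u (x j) - ∑ i, ⟪x i, V u (x j)⟫ • x i))
          (V u ((w j - a j) (q Ω)) - ∑ i, α i j • ((w i - a i) (q Ω)))
        generalize ‖(‖q Ω‖ : ℂ) • (V u (x j) - ∑ i, ⟪x i, V u (x j)⟫ • x i)‖ = A at h4 h5
        generalize hB : ‖V u ((w j - a j) (q Ω)) - ∑ i, α i j • ((w i - a i) (q Ω))‖ = B at h3 h5
        have hB0 : 0 ≤ B := by rw [← hB]; positivity
        have h6 := pow_le_pow_left₀ (norm_nonneg _) h5 2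
        have h7 := pow_le_pow_left₀ hB0 h3 2
        nlinarith [sq_nonneg (A - B)]
      refine (sum_le_sum fun j _ => hdj j).trans ?_
      rw [sum_add_distrib, ← mul_sum, sum_const, card_univ, nsmul_eq_mul]
      have h8 := hA u
      have h9 := mul_le_mul_of_nonneg_left h8 (by positivity : 0 ≤ 2 * ‖q Ω‖ ^ 2)
      have h10 := mul_le_mul_of_nonneg_right hε (by positivity : 0 ≤ Fintype.card ι * ‖q Ω‖ ^ 2)
      refine (add_le_add_left h9 _).trans ?_
      refine le_trans (le_of_eq ?_) h10
      ring

theorem sum_sub_filter {ι : Type} [Fintype ι] {p : ι → Prop} [DecidablePred p] {E : Type*} [AddCommMonoid E]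
    (f : ι → E) : ∑ k : {j // p j}, f k = ∑ k with p k, f k :=
  (Finset.sum_subtype (Finset.univ.filter p) (by simp) f).symm

set_option maxHeartbeats 1000000 in
theorem LL {Q : 𝔳𝔑} {Ω : H} (hT : TrV Q Ω) {B0 : StarSubalgebra ℂ 𝔹}
    {r : 𝔹} (hr : IsStarProjection r) {U : Type} [Fintype U] {V : U → 𝔹}
    (hVQ : ∀ u, V u ∈ Q)
    (hV : ∀ u v, ‖V u v‖ = ‖v‖) (hV' : ∀ u v, ‖star (V u) v‖ = ‖v‖) {ε : ℝ} (hε : 0 < ε)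
    (hI : ∀ δ : ℝ, 0 < δ → I1 Q Ω B0 r V δ) : LLOut Q Ω B0 r V ε := by
  classical
  set c : ℝ := (Fintype.card U : ℝ) with hc
  have hc0 : 0 ≤ c := Nat.cast_nonneg _
  set μ : ℝ := min 1 (ε / 4 / (44 * (c + 1))) with hμd
  have hμ : 0 < μ := lt_min one_pos (by positivity)
  have hμ1 : μ ≤ 1 := min_le_left _ _
  have hμε : 22 * μ * c < ε / 4 := by
    have h1 : μ * (44 * (c + 1)) ≤ ε / 4 := (le_div_iff₀ (by positivity)).1 (min_le_right _ _)
    nlinarith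
  obtain ⟨L0, _, n, e0, a, haQ, hra, ha0, hb0, hne, herr⟩ := hI (μ ^ 4 / 4) (by positivity)
  obtain ⟨t, ht, hLA⟩ := LL_A hT V hVQ (by positivity) L0 n e0 a haQ ha0 hne herr
  set θ : ℝ := min 1 (ε / 4) with hθd
  have hθ : 0 < θ := lt_min one_pos (by positivity)
  have hθ1 : θ ≤ 1 := min_le_left _ _
  have hθε : θ ≤ ε / 4 := min_le_right _ _
  set η : ℝ := θ / (1 + n) with hηd
  have hη : 0 < η := by positivity
  have hηθ : (1 + n) * η = θ := by rw [hηd]; field_simp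
  obtain ⟨κ0, hκ0, hmu⟩ := mu_perturb (H := H) n hη
  obtain ⟨e, q, hqQ, hq, hqΩ, horth, herr2, htr, hnear⟩ := hLA (κ0 * t / (2 * (n + 1))) (by positivity)
  set ρ := ‖q Ω‖ with hρd
  have hρ : 0 < ρ := norm_pos_iff.2 hqΩ
  set y : Fin n → H := fun j => a (e j) (q Ω) with hy
  have heo : Orthonormal ℂ (fun k => (e k : H)) := by
    have := e.orthonormal
    rw [orthonormal_iff_ite] at this ⊢
    intro i j; exact this i j
  have hexp : ∀ (b : 𝔹) j, a (b (e j)) (q Ω) = ∑ k, ⟪(e k : H), b (e j)⟫ • y k := by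
    intro b j
    rw [a_expand e a ha0 (b (e j))]
    simp [sum_apply, hy]
  have hs : 0 < ∑ j, ‖y j‖ ^ 2 := lt_of_lt_of_le (by positivity) htr
  obtain ⟨t', ht', hne', hsum⟩ := LL_B (μ := μ) (ε := ε / 4) hμ hμ1 hμε V hV hV' y horth
    (fun u k j => ⟪(e k : H), V u (e j)⟫)
    (by
      intro u j
      have := heo.sum_inner_products_le (x := V u (e j)) (s := Finset.univ)
      rw [hV, heo.1] at this; simpa using this)
    (by
      intro u k
      have := heo.sum_inner_products_le (x := star (V u) (e k)) (s := Finset.univ)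
      rw [hV', heo.1] at this
      have h2 : ∀ j, ‖⟪(e j : H), star (V u) (e k)⟫‖ = ‖⟪(e k : H), V u (e j)⟫‖ := by
        intro j; rw [star_inner_right, norm_inner_symm]
      simp only [h2] at this; simpa using this)
    (by
      refine le_trans (le_of_eq ?_) (herr2.trans (le_of_eq (by ring)))
      refine sum_congr rfl fun u _ => sum_congr rfl fun j _ => ?_
      rw [sub_apply, hexp, mul_apply_eq_comp]) hs
  rw [Fintype.card_fin] at ht'
  have hn0 : (0 : ℝ) < n := by
    obtain ⟨j, _⟩ := hne'
    have := j.2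
    exact_mod_cast (by omega : 0 < n)
  have ht'2 : t * ρ ^ 2 / (2 * n) ≤ t' := le_trans (by gcongr) ht'
  have ht'p : 0 < t' := lt_of_lt_of_le (by positivity) ht'2
  set ι := {j : Fin n // t' < ‖y j‖ ^ 2} with hι
  have : Nonempty ι := by
    obtain ⟨j, hj⟩ := hne'
    exact ⟨⟨j, (mem_filter.1 hj).2⟩⟩
  have hyp : ∀ i : ι, 0 < ‖y i‖ := by
    intro i
    rcases (norm_nonneg (y i)).eq_or_lt with h | h
    · have := i.2; rw [← h] at this; nlinarith
    · exact h
  have hcardι : Fintype.card ι = (Finset.univ.filter fun j => t' < ‖y j‖ ^ 2).card := Fintype.card_subtype _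
  have hcard : Fintype.card ι ≤ n := by
    rw [hcardι]; exact (Finset.card_filter_le _ _).trans (by simp)
  set A : ι → 𝔹 := fun i => ((ρ / ‖y i‖ : ℝ) : ℂ) • (a (e i) * q) with hA
  have hAQ : ∀ i, A i ∈ Q := fun i => smul_mem' _ (mul_mem (haQ _) hqQ)
  have hAq : ∀ i, A i * q = A i := by
    intro i; simp only [hA]; rw [smul_mul_assoc, mul_assoc, hq.isIdempotentElem]
  have hrA : ∀ i, r * A i = A i := by
    intro i; simp only [hA]; rw [mul_smul_comm, ← mul_assoc, hra]
  have hAA : ∀ i j, ‖star (A i) * A j - (if i = j then q else 0)‖ ≤ κ0 := by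
    intro i j
    have hyi := hyp i
    have hyj := hyp j
    have h1 : star (A i) * A j - (if i = j then q else 0) = ((ρ / ‖y i‖ * (ρ / ‖y j‖) : ℝ) : ℂ) •
        (q * (star (a (e i)) * a (e j)) * q - (⟪y i, y j⟫ / (ρ ^ 2 : ℝ)) • q) := by
      have h2 : (if i = j then q else 0) = ((ρ / ‖y i‖ * (ρ / ‖y j‖) : ℝ) : ℂ) •
          (⟪y i, y j⟫ / (ρ ^ 2 : ℝ)) • q := by
        split_ifs with h
        · subst h
          have h3 : ⟪y i, y i⟫ = ((‖y i‖ ^ 2 : ℝ) : ℂ) := by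
            rw [inner_sq]; norm_num
          rw [h3, smul_smul, ← Complex.ofReal_div, ← Complex.ofReal_mul]
          have : ρ / ‖y i‖ * (ρ / ‖y i‖) * (‖y i‖ ^ 2 / ρ ^ 2) = 1 := by field_simp
          rw [this]; simp
        · have h3 : ⟪y i, y j⟫ = 0 := horth i j fun hij => h (Subtype.ext hij)
          rw [h3]; simp
      rw [h2, smul_sub]
      congr 1
      simp only [hA, star_smul, star_mul, hq.isSelfAdjoint.star_eq]
      rw [smul_mul_smul_comm]
      have h5 : star ((ρ / ‖y i‖ : ℝ) : ℂ) = ((ρ / ‖y i‖ : ℝ) : ℂ) := conj_ofReal _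
      rw [h5, ← Complex.ofReal_mul]
      congr 1
    rw [h1, norm_smul, norm_real, Real.norm_of_nonneg (by positivity)]
    have h4 : t' ≤ ‖y i‖ * ‖y j‖ := by
      have hi := i.2
      have hj := j.2
      by_contra hlt
      push Not at hlt
      have : (‖y i‖ * ‖y j‖) ^ 2 < t' ^ 2 := by gcongr
      nlinarith [mul_lt_mul'' hi hj ht'p.le ht'p.le]
    have h5 : ρ / ‖y i‖ * (ρ / ‖y j‖) ≤ 2 * n / t := by
      rw [div_mul_div_comm, div_le_div_iff₀ (by positivity) ht]
      rw [div_le_iff₀ (by positivity)] at ht'2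
      have h6 : t' * (2 * n) ≤ ‖y i‖ * ‖y j‖ * (2 * n) := by gcongr
      nlinarith
    calc _ ≤ 2 * n / t * (κ0 * t / (2 * (n + 1))) := by
          gcongr
          exact hnear i j
      _ = κ0 * (n / (n + 1)) := by field_simp
      _ ≤ κ0 * 1 := by
          gcongr
          rw [div_le_one (by positivity)]; linarith
      _ = κ0 := mul_one _
  obtain ⟨g, hgQ, hg, hgc, hgw, hga⟩ := hmu Q ι hcard q A hq hAQ hAq hAA
  set x : ι → H := fun i => ((‖y i‖⁻¹ : ℝ) : ℂ) • y i with hx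
  have hxo : Orthonormal ℂ x := by
    rw [orthonormal_iff_ite]
    intro i j
    simp only [hx, inner_smul_left, inner_smul_right]
    split_ifs with h
    · subst h
      have h3 : ⟪y i, y i⟫ = ((‖y i‖ ^ 2 : ℝ) : ℂ) := by
        rw [inner_sq]; norm_num
      have hyi := hyp i
      rw [h3, conj_ofReal, ← Complex.ofReal_mul, ← Complex.ofReal_mul]
      have : ‖y i‖⁻¹ * (‖y i‖⁻¹ * ‖y i‖ ^ 2) = 1 := by field_simp
      rw [this]; simp
    · have h3 : ⟪y i, y j⟫ = 0 := horth i j fun hij => h (Subtype.ext hij)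
      rw [h3]; simp
  have hD0 : ∀ b ∈ B0, ∀ i k, ⟪(e i : H), star b (e k)⟫ = star ⟪(e k : H), b (e i)⟫ := by
    intro b _ i k
    rw [star_inner_right]
    exact (inner_conj_symm _ _).symm
  have hC : ∀ b ∈ B0, ∀ i k, ⟪(e k : H), b (e i)⟫ ≠ 0 → ‖y k‖ = ‖y i‖ := by
    intro b hb i k hne0
    have h1 : ∀ b ∈ B0, ∀ i k, ⟪y k, b (y i)⟫ = ⟪(e k : H), b (e i)⟫ * ((‖y k‖ ^ 2 : ℝ) : ℂ) := by
      intro b hb i k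
      have h2 : b (y i) = ∑ k, ⟪(e k : H), b (e i)⟫ • y k := by
        rw [← hexp, ← hb0 b hb]; rfl
      rw [h2, inner_sum, sum_eq_single k]
      · rw [inner_smul_right, inner_sq]; norm_num
      · intro l _ hl
        rw [inner_smul_right, horth k l hl.symm, mul_zero]
      · simp
    have h2 := h1 b hb i k
    have h3 := h1 (star b) (star_mem hb) k i
    rw [star_inner_right, hD0 b hb] at h3
    have h4 := congrArg star h3
    rw [star_mul, star_star] at h4
    have h5 : star ⟪b (y i), y k⟫ = ⟪y k, b (y i)⟫ := inner_conj_symm _ _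
    have h6 : star (((‖y i‖ ^ 2 : ℝ) : ℂ)) = ((‖y i‖ ^ 2 : ℝ) : ℂ) := conj_ofReal _
    rw [h5, h6, h2, mul_comm] at h4
    have h7 := mul_right_cancel₀ hne0 h4
    have h8 : ‖y k‖ ^ 2 = ‖y i‖ ^ 2 := by exact_mod_cast h7
    exact (sq_eq_sq₀ (norm_nonneg _) (norm_nonneg _)).1 h8
  refine LL_C hT hr hVQ hV hqQ hq hqΩ hcard hAQ hAq hrA
    (fun b k i => ⟪((e k : L0) : H), b (e i)⟫) ?_ ?_ hgQ hg hgc hgw hη hga hxo ?_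
    (ε1 := ε / 4) (ε := ε) ?_ ?_
  · intro b hb i
    rw [sum_sub_filter (p := fun j => t' < ‖y j‖ ^ 2)
      (fun k => ⟪((e k : L0) : H), b (e i)⟫ • ((ρ / ‖y k‖ : ℝ) : ℂ) • (a (e k) * q))]
    rw [Finset.sum_filter_of_ne]
    · simp only [hA]
      rw [mul_smul_comm, ← mul_assoc, hb0 b hb, a_expand e a ha0 (b (e i)), sum_mul, smul_sum]
      refine sum_congr rfl fun k _ => ?_
      by_cases h : ⟪((e k : L0) : H), b (e i)⟫ = 0
      · rw [h]; simp
      · rw [hC b hb i k h, smul_mul_assoc, smul_comm]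
    · intro k _ hk
      by_cases h : ⟪((e k : L0) : H), b (e i)⟫ = 0
      · rw [h] at hk; simp at hk
      · rw [hC b hb i k h]; exact i.2
  · intro b hb i k
    rw [hD0 b hb, star_star]
  · intro i
    have hyi := hyp i
    simp only [hA, hx, smul_apply, mul_apply_eq_comp, proj_idem hq]
    rw [smul_smul]
    congr 1
    rw [← Complex.ofReal_mul, div_eq_mul_inv]
  · rw [hηθ]; nlinarith
  · intro u
    have hterm : ∀ u j, 0 ≤ 1 - ∑ i, ‖⟪x i, V u (x j)⟫‖ ^ 2 := by
      intro u j
      have := hxo.sum_inner_products_le (x := V u (x j)) (s := Finset.univ)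
      rw [hV, hxo.1] at this
      linarith
    have hconv : ∀ u, ∑ j, (1 - ∑ i, ‖⟪x i, V u (x j)⟫‖ ^ 2) = ∑ j with t' < ‖y j‖ ^ 2,
        (1 - ∑ i with t' < ‖y i‖ ^ 2, (‖⟪y i, V u (y j)⟫‖ / (‖y i‖ * ‖y j‖)) ^ 2) := by
      intro u
      rw [← sum_sub_filter (p := fun j => t' < ‖y j‖ ^ 2) (fun j =>
        (1 - ∑ i with t' < ‖y i‖ ^ 2, (‖⟪y i, V u (y j)⟫‖ / (‖y i‖ * ‖y j‖)) ^ 2))]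
      refine sum_congr rfl fun j _ => ?_
      rw [← sum_sub_filter (p := fun j => t' < ‖y j‖ ^ 2) (fun i =>
        (‖⟪y i, V u (y j)⟫‖ / (‖y i‖ * ‖y j‖)) ^ 2)]
      congr 1
      refine sum_congr rfl fun i _ => ?_
      simp only [hx, map_smul, inner_smul_left, inner_smul_right, norm_mul, conj_ofReal,
        norm_real, norm_inv, norm_norm]
      congr 1
      have hyi := hyp i
      have hyj := hyp j
      field_simp
    rw [hcardι]
    refine le_trans ?_ hsum.le
    rw [← sum_congr rfl fun u _ => hconv u]
    exact single_le_sum (f := fun u => ∑ j, (1 - ∑ i, ‖⟪x i, V u (x j)⟫‖ ^ 2))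
      (fun u _ => sum_nonneg fun j _ => hterm u j) (Finset.mem_univ u)

/-- a selfadjoint contraction is the real part of a unitary -/
theorem sa_unitary {Q : 𝔳𝔑} {h : 𝔹} (hs : IsSelfAdjoint h) (hQ : h ∈ Q)
    (hn : ‖h‖ ≤ 1) : ∃ w ∈ Q, star w * w = 1 ∧ w * star w = 1 ∧ h = (1 / 2 : ℂ) • (w + star w) ∧
      ∀ y, Commute h y → Commute w y := by
  set k := cfc (fun t : ℝ => Real.sqrt (1 - t ^ 2)) h with hk
  have hkQ : k ∈ Q := cfc_mem_vn hs hQ _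
  have hks : star k = k := (cfc_predicate (fun t : ℝ => Real.sqrt (1 - t ^ 2)) h).star_eq
  have hkc : ∀ y, Commute h y → Commute k y := fun y hy => hy.cfc_real _
  have hkk : k * k = 1 - h * h := by
    rw [hk, ← cfc_mul (fun t : ℝ => Real.sqrt (1 - t ^ 2)) (fun t : ℝ => Real.sqrt (1 - t ^ 2)) h
      (by fun_prop) (by fun_prop)]
    have h1 : cfc (fun t : ℝ => 1 - t * t) h = 1 - h * h := by
      rw [cfc_sub (fun _ : ℝ => (1 : ℝ)) (fun t : ℝ => t * t) h (by fun_prop) (by fun_prop),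
        cfc_mul (fun t : ℝ => t) (fun t : ℝ => t) h (by fun_prop) (by fun_prop),
        cfc_const_one ℝ h, cfc_id' ℝ h]
    rw [← h1]
    refine cfc_congr fun t ht => ?_
    have ht1 : |t| ≤ 1 := by
      have := spectrum.norm_le_norm_mul_of_mem ht
      have h1 : ‖(1 : 𝔹)‖ ≤ 1 := norm_id_le
      rw [Real.norm_eq_abs] at this
      calc |t| ≤ ‖h‖ * ‖(1 : 𝔹)‖ := this
        _ ≤ 1 * 1 := by gcongr
        _ = 1 := by norm_num
    have : 0 ≤ 1 - t ^ 2 := by nlinarith [abs_le.1 ht1]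
    change √(1 - t ^ 2) * √(1 - t ^ 2) = _
    rw [Real.mul_self_sqrt this, sq]
  have hkh : k * h = h * k := (hkc h (Commute.refl h)).eq
  have hsw : star (h + Complex.I • k) = h - Complex.I • k := by
    rw [star_add, star_smul, hks, hs.star_eq]
    simp [sub_eq_add_neg]
  have hII : ∀ z : 𝔹, Complex.I • Complex.I • z = -z := by
    intro z; rw [smul_smul, Complex.I_mul_I, neg_smul, one_smul]
  refine ⟨h + Complex.I • k, add_mem hQ (smul_mem' _ hkQ), ?_, ?_, ?_, ?_⟩
  · rw [hsw]
    simp only [sub_mul, mul_add, smul_mul_assoc, mul_smul_comm, smul_add, smul_sub, hII, hkk, hkh]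
    abel
  · rw [hsw]
    simp only [add_mul, mul_sub, smul_mul_assoc, mul_smul_comm, smul_add, smul_sub, hII, hkk, hkh]
    abel
  · rw [hsw, add_add_sub_cancel, ← two_smul ℂ, smul_smul]; norm_num
  · intro y hy
    exact hy.add_left ((hkc y hy).smul_left _)

theorem unitary_norm {w : 𝔹} (hw : star w * w = 1) (v : H) : ‖w v‖ = ‖v‖ := by
  have h1 : ⟪w v, w v⟫ = ⟪v, v⟫ := by
    rw [← star_inner_right]
    have := congrArg (fun f : 𝔹 => f v) hw
    simp only [mul_apply_eq_comp] at this
    rw [this]; rfl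
  rw [inner_sq, inner_sq] at h1
  have : ‖w v‖ ^ 2 = ‖v‖ ^ 2 := by exact_mod_cast h1
  exact (sq_eq_sq₀ (norm_nonneg _) (norm_nonneg _)).1 this

/-- the hypothesis feeding the exhaustion -/
def HI (Q : 𝔳𝔑) (Ω : H) : Prop :=
  ∀ (B0 : StarSubalgebra ℂ 𝔹), FiniteDimensional ℂ B0 → (∀ b ∈ B0, b ∈ Q) →
    ∀ r ∈ Q, IsStarProjection r → r ≠ 0 → (∀ b ∈ B0, b * r = r * b) →
    ∀ (U : Type) (_ : Fintype U) (V : U → 𝔹), (∀ u, V u ∈ Q) → (∀ u, V u * r = r * V u) →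
      (∀ u v, ‖V u v‖ = ‖v‖) → (∀ u v, ‖star (V u) v‖ = ‖v‖) → ∀ δ : ℝ, 0 < δ → I1 Q Ω B0 r V δ

/-- step A -/
theorem stepA {Q : 𝔳𝔑} {Ω : H} (hT : TrV Q Ω) (hI : HI Q Ω)
    {B0 : StarSubalgebra ℂ 𝔹} (hf : FiniteDimensional ℂ B0) (hB0 : ∀ b ∈ B0, b ∈ Q)
    {r : 𝔹} (hrQ : r ∈ Q) (hr : IsStarProjection r) (hr0 : r ≠ 0) (hrB : ∀ b ∈ B0, b * r = r * b)
    {U : Type} [Fintype U] (x : U → 𝔹) (hxQ : ∀ u, x u ∈ Q) (hx : ∀ u, ‖x u‖ ≤ 1)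
    {ε : ℝ} (hε : 0 < ε) :
  ∃ s ∈ Q, IsStarProjection s ∧ s ≠ 0 ∧ r * s = s ∧ (∀ b ∈ B0, b * s = s * b) ∧
    ∃ B : Submodule ℂ 𝔹, FiniteDimensional ℂ B ∧
      (∀ x ∈ B, x ∈ Q ∧ s * x = x ∧ x * s = x ∧ star x ∈ B) ∧ (∀ x ∈ B, ∀ y ∈ B, x * y ∈ B) ∧
      s ∈ B ∧ (∀ b ∈ B0, b * s ∈ B) ∧
      ∀ u, ∃ b ∈ B, ‖b‖ ≤ 2 ∧ ‖(r * x u * s - b) Ω‖ ^ 2 ≤ ε * ‖s Ω‖ ^ 2 := by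
  have hdec : ∀ u, ∃ w : Bool → 𝔹, (∀ i, w i ∈ Q ∧ star (w i) * w i = 1 ∧ w i * star (w i) = 1 ∧
      Commute (w i) r) ∧ r * x u * r = (1 / 2 : ℂ) • (w true + star (w true)) +
        (Complex.I / 2) • (w false + star (w false)) := by
    intro u
    set y := r * x u * r with hy
    have hyQ : y ∈ Q := mul_mem (mul_mem hrQ (hxQ u)) hrQ
    have hrn := norm_proj_le hr
    have hyn : ‖y‖ ≤ 1 := by
      calc ‖y‖ ≤ ‖r‖ * ‖x u‖ * ‖r‖ := (norm_mul_le _ _).trans (by gcongr; exact norm_mul_le _ _)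
        _ ≤ 1 * 1 * 1 := by gcongr; exact hx u
        _ = 1 := by norm_num
    have hys : ‖star y‖ ≤ 1 := by rw [norm_star]; exact hyn
    have hry : r * y = y := by rw [hy, ← mul_assoc, ← mul_assoc, hr.isIdempotentElem]
    have hyr : y * r = y := by rw [hy, mul_assoc, hr.isIdempotentElem]
    have hry' : r * star y = star y := by
      have := congrArg star hyr; rwa [star_mul, hr.isSelfAdjoint.star_eq] at this
    have hyr' : star y * r = star y := by
      have := congrArg star hry; rwa [star_mul, hr.isSelfAdjoint.star_eq] at this
    set h1 := (1 / 2 : ℂ) • (y + star y) with hh1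
    set h2 := (-(Complex.I / 2)) • (y - star y) with hh2
    have s1 : IsSelfAdjoint h1 := by
      rw [IsSelfAdjoint, hh1, star_smul, star_add, star_star, add_comm]; simp
    have s2 : IsSelfAdjoint h2 := by
      rw [IsSelfAdjoint, hh2, star_smul, star_sub, star_star, ← neg_sub y, smul_neg, ← neg_smul]
      congr 1
      simp [neg_div]
    have n1 : ‖h1‖ ≤ 1 := by
      rw [hh1, norm_smul]
      have := norm_add_le y (star y)
      norm_num; linarith
    have n2 : ‖h2‖ ≤ 1 := by
      rw [hh2, norm_smul]
      have := norm_sub_le y (star y)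
      norm_num; linarith
    have c1 : Commute h1 r := by
      change h1 * r = r * h1
      rw [hh1, smul_mul_assoc, mul_smul_comm, add_mul, mul_add, hyr, hry, hyr', hry']
    have c2 : Commute h2 r := by
      change h2 * r = r * h2
      rw [hh2, smul_mul_assoc, mul_smul_comm, sub_mul, mul_sub, hyr, hry, hyr', hry']
    obtain ⟨w1, q1, u1, v1, e1, d1⟩ := sa_unitary s1 (smul_mem' _ (add_mem hyQ (star_mem hyQ))) n1
    obtain ⟨w2, q2, u2, v2, e2, d2⟩ := sa_unitary s2 (smul_mem' _ (sub_mem hyQ (star_mem hyQ))) n2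
    refine ⟨fun i => if i then w1 else w2, fun i => ?_, ?_⟩
    · cases i
      · exact ⟨q2, u2, v2, d2 r c2⟩
      · exact ⟨q1, u1, v1, d1 r c1⟩
    · have h3 : y = h1 + Complex.I • h2 := by
        rw [hh1, hh2, smul_smul, smul_add, smul_sub]
        have : Complex.I * (-(Complex.I / 2)) = 1 / 2 := by
          rw [mul_neg, mul_div_assoc', Complex.I_mul_I]; norm_num
        rw [this, add_add_sub_cancel, ← add_smul]; norm_num
      rw [h3, e1, e2, smul_smul]
      simp [div_eq_mul_inv]
  choose w hw hxw using hdec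
  have hVn : ∀ (p : U × Bool × Bool) v,
      ‖(if p.2.2 then w p.1 p.2.1 else star (w p.1 p.2.1)) v‖ = ‖v‖ := by
    intro p v
    obtain ⟨_, h1, h2, _⟩ := hw p.1 p.2.1
    split_ifs
    · exact unitary_norm h1 v
    · exact unitary_norm (by rw [star_star]; exact h2) v
  have hVn' : ∀ (p : U × Bool × Bool) v,
      ‖star (if p.2.2 then w p.1 p.2.1 else star (w p.1 p.2.1)) v‖ = ‖v‖ := by
    intro p v
    obtain ⟨_, h1, h2, _⟩ := hw p.1 p.2.1
    split_ifs
    · exact unitary_norm (by rw [star_star]; exact h2) v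
    · rw [star_star]; exact unitary_norm h1 v
  have hVQ : ∀ (p : U × Bool × Bool), (if p.2.2 then w p.1 p.2.1 else star (w p.1 p.2.1)) ∈ Q := by
    intro p
    split_ifs
    · exact (hw _ _).1
    · exact star_mem (hw _ _).1
  have hVr : ∀ (p : U × Bool × Bool), (if p.2.2 then w p.1 p.2.1 else star (w p.1 p.2.1)) * r =
      r * (if p.2.2 then w p.1 p.2.1 else star (w p.1 p.2.1)) := by
    intro p
    split_ifs
    · exact (hw _ _).2.2.2
    · have := congrArg star (hw p.1 p.2.1).2.2.2.eq
      simp only [star_mul, hr.isSelfAdjoint.star_eq] at this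
      exact this.symm
  obtain ⟨s, hsQ, hs, hs0, hrs, hbs, B, hBf, hB, hBm, hsB, hB0B, hap⟩ :=
    LL hT hr hVQ hVn hVn' (by positivity : 0 < ε / 4)
      (hI B0 hf hB0 r hrQ hr hr0 hrB _ inferInstance _ hVQ hVr hVn hVn')
  refine ⟨s, hsQ, hs, hs0, hrs, hbs, B, hBf, hB, hBm, hsB, hB0B, fun u => ?_⟩
  choose b hbB hb1 hb using hap
  refine ⟨(1 / 2 : ℂ) • (b (u, true, true) + b (u, true, false)) +
    (Complex.I / 2) • (b (u, false, true) + b (u, false, false)), ?_, ?_, ?_⟩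
  · exact add_mem (Submodule.smul_mem _ _ (add_mem (hbB _) (hbB _)))
      (Submodule.smul_mem _ _ (add_mem (hbB _) (hbB _)))
  · have n1 := norm_add_le (b (u, true, true)) (b (u, true, false))
    have n2 := norm_add_le (b (u, false, true)) (b (u, false, false))
    have n3 := hb1 (u, true, true)
    have n4 := hb1 (u, true, false)
    have n5 := hb1 (u, false, true)
    have n6 := hb1 (u, false, false)
    refine (norm_add_le _ _).trans ?_
    rw [norm_smul, norm_smul]
    norm_num
    linarith
  · have hkey : ∀ p, ‖((if p.2.2 then w p.1 p.2.1 else star (w p.1 p.2.1)) * s - b p) Ω‖ ≤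
        Real.sqrt ε / 2 * ‖s Ω‖ := by
      intro p
      refine (sq_le_sq₀ (norm_nonneg _) (by positivity)).1 ?_
      refine (hb p).trans (le_of_eq ?_)
      rw [mul_pow, div_pow, Real.sq_sqrt hε.le]; norm_num
    have e1 : r * x u * s = (r * x u * r) * s := by rw [mul_assoc _ r s, hrs]
    have e2 : (r * x u * s - ((1 / 2 : ℂ) • (b (u, true, true) + b (u, true, false)) +
        (Complex.I / 2) • (b (u, false, true) + b (u, false, false)))) Ω =
        (1 / 2 : ℂ) • ((w u true * s - b (u, true, true)) Ω + (star (w u true) * s - b (u, true, false)) Ω) +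
        (Complex.I / 2) • ((w u false * s - b (u, false, true)) Ω +
          (star (w u false) * s - b (u, false, false)) Ω) := by
      rw [e1, hxw]
      simp only [sub_apply, add_apply, smul_apply, mul_apply_eq_comp, smul_add, smul_sub]
      abel
    have k1 := hkey (u, true, true)
    have k2 := hkey (u, true, false)
    have k3 := hkey (u, false, true)
    have k4 := hkey (u, false, false)
    simp only [if_true, Bool.false_eq_true, if_false] at k1 k2 k3 k4
    have hfin : ‖(r * x u * s - ((1 / 2 : ℂ) • (b (u, true, true) + b (u, true, false)) +
        (Complex.I / 2) • (b (u, false, true) + b (u, false, false)))) Ω‖ ≤ Real.sqrt ε * ‖s Ω‖ := by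
      rw [e2]
      refine (norm_add_le _ _).trans ?_
      rw [norm_smul, norm_smul]
      have m1 := norm_add_le ((w u true * s - b (u, true, true)) Ω)
        ((star (w u true) * s - b (u, true, false)) Ω)
      have m2 := norm_add_le ((w u false * s - b (u, false, true)) Ω)
          ((star (w u false) * s - b (u, false, false)) Ω)
      have o1 : ‖(1 / 2 : ℂ)‖ = 1 / 2 := by norm_num
      have o2 : ‖(Complex.I / 2 : ℂ)‖ = 1 / 2 := by norm_num
      rw [o1, o2]
      linarith
    have := pow_le_pow_left₀ (norm_nonneg _) hfin 2
    rwa [mul_pow, Real.sq_sqrt hε.le] at this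

theorem TrV.norm_star {Q : 𝔳𝔑} {Ω : H} (hT : TrV Q Ω) {a : 𝔹} (ha : a ∈ Q) :
    ‖star a Ω‖ = ‖a Ω‖ := by
  have h1 := hT.tr (star a) (star_mem ha) a ha
  rw [star_inner_right] at h1
  have h2 := star_inner_right (star a) Ω (star a Ω)
  rw [star_star] at h2
  rw [h2, inner_sq, inner_sq] at h1
  have : ‖a Ω‖ ^ 2 = ‖star a Ω‖ ^ 2 := by exact_mod_cast h1
  exact ((sq_eq_sq₀ (norm_nonneg _) (norm_nonneg _)).1 this).symm

theorem TrV.orth_right {Q : 𝔳𝔑} {Ω : H} (hT : TrV Q Ω) {a b p : 𝔹} (ha : a ∈ Q)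
    (hb : b ∈ Q) (hp : p ∈ Q) (hbp : b * p = b) (h : p * star a * b = 0) : ⟪a Ω, b Ω⟫ = 0 := by
  have h1 : ⟪a Ω, b Ω⟫ = ⟪Ω, (star a * b) (p Ω)⟫ := by
    have : (star a * b) (p Ω) = star a ((b * p) Ω) := rfl
    rw [this, star_inner_right, hbp]
  rw [h1, hT.tr _ (mul_mem (star_mem ha) hb) p hp]
  have : p ((star a * b) Ω) = (p * star a * b) Ω := rfl
  rw [this, h]; simp

/-- exhaustion state -/
structure St (Q : 𝔳𝔑) (Ω : H) (B0 : Set 𝔹) {U : Type} (x : U → 𝔹)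
    (ε : ℝ) (s : 𝔹) (B : Submodule ℂ 𝔹) : Prop where
  sQ : s ∈ Q
  sp : IsStarProjection s
  comm : ∀ b ∈ B0, b * s = s * b
  fin : FiniteDimensional ℂ B
  mem : ∀ y ∈ B, y ∈ Q ∧ s * y = y ∧ y * s = y ∧ star y ∈ B
  mul : ∀ y ∈ B, ∀ z ∈ B, y * z ∈ B
  sB : s ∈ B
  b0 : ∀ b ∈ B0, b * s ∈ B
  app : ∀ u, ∃ b ∈ B, ‖b‖ ≤ 2 ∧ ‖(x u - (1 - s) * x u * (1 - s) - b) Ω‖ ^ 2 ≤ 2 * ε * ‖s Ω‖ ^ 2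

theorem norm_add_blocks {s t b c : 𝔹} (hs : IsStarProjection s) (ht : IsStarProjection t)
    (hst : s * t = 0) (hb1 : s * b = b) (hb2 : b * s = b) (hc1 : t * c = c) (hc2 : c * t = c) {K : ℝ}
    (hK : 0 ≤ K) (hb : ‖b‖ ≤ K) (hc : ‖c‖ ≤ K) : ‖b + c‖ ≤ K := by
  refine opNorm_le_bound _ hK fun v => ?_
  have hts : t * s = 0 := by
    have := congrArg star hst
    rwa [star_mul, hs.isSelfAdjoint.star_eq, ht.isSelfAdjoint.star_eq, star_zero] at this
  have e1 : ∀ v w, ⟪s v, t w⟫ = 0 := by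
    intro v w
    rw [proj_inner hs]
    have := congrArg (fun f : 𝔹 => f w) hst
    simp only [mul_apply_eq_comp] at this
    rw [this]; simp
  have hbv : s (b v) = b v := congrArg (fun f : 𝔹 => f v) hb1
  have hcv : t (c v) = c v := congrArg (fun f : 𝔹 => f v) hc1
  have hbv2 : b (s v) = b v := congrArg (fun f : 𝔹 => f v) hb2
  have hcv2 : c (t v) = c v := congrArg (fun f : 𝔹 => f v) hc2
  have e2 : ‖b v + c v‖ * ‖b v + c v‖ = ‖b v‖ * ‖b v‖ + ‖c v‖ * ‖c v‖ :=
    norm_add_sq_eq_norm_sq_add_norm_sq_of_inner_eq_zero _ _ (by rw [← hbv, ← hcv]; exact e1 _ _)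
  have e3 : ‖s v + t v‖ * ‖s v + t v‖ = ‖s v‖ * ‖s v‖ + ‖t v‖ * ‖t v‖ :=
    norm_add_sq_eq_norm_sq_add_norm_sq_of_inner_eq_zero _ _ (e1 _ _)
  have hp : IsStarProjection (s + t) := by
    refine ⟨?_, hs.isSelfAdjoint.add ht.isSelfAdjoint⟩
    change (s + t) * (s + t) = s + t
    rw [add_mul, mul_add, mul_add, hst, hts, hs.isIdempotentElem.eq, ht.isIdempotentElem.eq]; simp
  have e4 : ‖s v + t v‖ ≤ ‖v‖ := by
    have := (s + t).le_opNorm v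
    have h1 := norm_proj_le hp
    refine this.trans ?_
    nlinarith [norm_nonneg v]
  have e5 : ‖b v‖ ≤ K * ‖s v‖ := by
    rw [← hbv2]; exact (b.le_opNorm _).trans (by gcongr)
  have e6 : ‖c v‖ ≤ K * ‖t v‖ := by
    rw [← hcv2]; exact (c.le_opNorm _).trans (by gcongr)
  rw [add_apply]
  refine (sq_le_sq₀ (norm_nonneg _) (by positivity)).1 ?_
  have e7 := pow_le_pow_left₀ (norm_nonneg _) e5 2
  have e8 := pow_le_pow_left₀ (norm_nonneg _) e6 2
  have e9 := pow_le_pow_left₀ (norm_nonneg _) e4 2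
  have e10 := mul_le_mul_of_nonneg_left e9 (sq_nonneg K)
  nlinarith

theorem norm_sq_add_orth {v w : H} (h : ⟪v, w⟫ = 0) : ‖v + w‖ ^ 2 = ‖v‖ ^ 2 + ‖w‖ ^ 2 := by
  have := norm_add_sq_eq_norm_sq_add_norm_sq_of_inner_eq_zero v w h
  nlinarith

theorem stepB {Q : 𝔳𝔑} {Ω : H} (hT : TrV Q Ω) {B0 : Set 𝔹} {U : Type}
    {x : U → 𝔹} (hxQ : ∀ u, x u ∈ Q) (hst : ∀ u, ∃ u', x u' = star (x u)) {ε : ℝ}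
    {s : 𝔹} {B : Submodule ℂ 𝔹} (h : St Q Ω B0 x ε s B)
    {s' : 𝔹} {B' : Submodule ℂ 𝔹} (s'Q : s' ∈ Q) (hs' : IsStarProjection s')
    (hrs : (1 - s) * s' = s') (hcomm : ∀ b ∈ B0, b * s' = s' * b) (hfin : FiniteDimensional ℂ B')
    (hmem : ∀ y ∈ B', y ∈ Q ∧ s' * y = y ∧ y * s' = y ∧ star y ∈ B') (hmul : ∀ y ∈ B', ∀ z ∈ B', y * z ∈ B')
    (hsB : s' ∈ B') (hb0 : ∀ b ∈ B0, b * s' ∈ B')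
    (happ : ∀ u, ∃ b ∈ B', ‖b‖ ≤ 2 ∧ ‖((1 - s) * x u * s' - b) Ω‖ ^ 2 ≤ ε * ‖s' Ω‖ ^ 2) :
    St Q Ω B0 x ε (s + s') (B ⊔ B') ∧ ‖(s + s') Ω‖ ^ 2 = ‖s Ω‖ ^ 2 + ‖s' Ω‖ ^ 2 ∧ (s + s') * s = s := by
  have hs := h.sp
  have hss : s * s = s := hs.isIdempotentElem
  have hss' : s' * s' = s' := hs'.isIdempotentElem
  have h1 : s * s' = 0 := by
    rw [sub_mul, one_mul, sub_eq_self] at hrs; exact hrs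
  have h2 : s' * s = 0 := by
    have := congrArg star h1
    rwa [star_mul, hs.isSelfAdjoint.star_eq, hs'.isSelfAdjoint.star_eq, star_zero] at this
  have sstar : star s = s := hs.isSelfAdjoint.star_eq
  have sstar' : star s' = s' := hs'.isSelfAdjoint.star_eq
  have hcross : ∀ y ∈ B, ∀ z ∈ B', y * z = 0 ∧ z * y = 0 := by
    intro y hy z hz
    obtain ⟨_, y1, y2, _⟩ := h.mem y hy
    obtain ⟨_, z1, z2, _⟩ := hmem z hz
    constructor
    · rw [← y2, ← z1, mul_assoc, ← mul_assoc s, h1]; simp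
    · rw [← z2, ← y1, mul_assoc, ← mul_assoc s', h2]; simp
  have hsum : ‖(s + s') Ω‖ ^ 2 = ‖s Ω‖ ^ 2 + ‖s' Ω‖ ^ 2 := by
    rw [add_apply]
    exact norm_sq_add_orth (hT.orth_right h.sQ s'Q s'Q hss' (by rw [sstar, h2, zero_mul]))
  refine ⟨⟨add_mem h.sQ s'Q, ?_, ?_, ?_, ?_, ?_, ?_, ?_, ?_⟩, hsum, by rw [add_mul, h2, hss, add_zero]⟩
  · refine ⟨?_, hs.isSelfAdjoint.add hs'.isSelfAdjoint⟩
    change (s + s') * (s + s') = s + s'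
    rw [add_mul, mul_add, mul_add, h1, h2, hss, hss']; simp
  · intro b hb
    rw [mul_add, add_mul, h.comm b hb, hcomm b hb]
  · have := h.fin
    exact Submodule.finiteDimensional_sup _ _
  · intro y hy
    obtain ⟨b, hb, c, hc, rfl⟩ := Submodule.mem_sup.1 hy
    obtain ⟨b1, b2, b3, b4⟩ := h.mem b hb
    obtain ⟨c1, c2, c3, c4⟩ := hmem c hc
    have k1 := hcross _ h.sB c hc
    have k2 := hcross b hb _ hsB
    refine ⟨add_mem b1 c1, ?_, ?_, ?_⟩
    · rw [add_mul, mul_add, mul_add, b2, c2, k1.1, k2.2]; simp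
    · rw [add_mul, mul_add, mul_add, b3, c3, k1.2, k2.1]; simp
    · rw [star_add]
      exact add_mem (mem_sup_left b4) (mem_sup_right c4)
  · intro y hy z hz
    obtain ⟨b, hb, c, hc, rfl⟩ := Submodule.mem_sup.1 hy
    obtain ⟨b', hb', c', hc', rfl⟩ := Submodule.mem_sup.1 hz
    rw [add_mul, mul_add, mul_add, (hcross b hb c' hc').1, (hcross b' hb' c hc).2, add_zero, zero_add]
    exact add_mem (mem_sup_left (h.mul _ hb _ hb')) (mem_sup_right (hmul _ hc _ hc'))
  · exact add_mem (mem_sup_left h.sB) (mem_sup_right hsB)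
  · intro b hb
    rw [mul_add]
    exact add_mem (mem_sup_left (h.b0 b hb)) (mem_sup_right (hb0 b hb))
  · intro u
    obtain ⟨b, hb, hbn, hbE⟩ := h.app u
    obtain ⟨c, hc, hcn, hcE⟩ := happ u
    obtain ⟨u', hu'⟩ := hst u
    obtain ⟨c', hc', _, hcE'⟩ := happ u'
    obtain ⟨b1, b2, b3, b4⟩ := h.mem b hb
    obtain ⟨c1, c2, c3, c4⟩ := hmem c hc
    obtain ⟨c1', c2', _, _⟩ := hmem c' hc'
    refine ⟨b + c, add_mem (mem_sup_left hb) (mem_sup_right hc),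
      norm_add_blocks hs hs' h1 b2 b3 c2 c3 (by norm_num) hbn hcn, ?_⟩
    set r := 1 - s with hr
    have rQ : r ∈ Q := sub_mem (one_mem _) h.sQ
    have hrs0 : r * s = 0 := by rw [hr, sub_mul, one_mul, hss, sub_self]
    have hsr0 : s * r = 0 := by rw [hr, mul_sub, mul_one, hss, sub_self]
    have hrr : r * r = r := by nth_rewrite 2 [hr]; rw [mul_sub, mul_one, hrs0, sub_zero]
    have hs'r : s' * r = s' := by rw [hr, mul_sub, mul_one, h2, sub_zero]
    have hrstar : star r = r := by rw [hr, star_sub, star_one, sstar]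
    set r' := r - s' with hr'
    have r'Q : r' ∈ Q := sub_mem rQ s'Q
    have e0 : 1 - (s + s') = r' := by rw [hr', hr]; abel
    have hrsp : r' * s' = 0 := by rw [hr', sub_mul, hrs, hss', sub_self]
    have hsrp : s' * r' = 0 := by rw [hr', mul_sub, hs'r, hss', sub_self]
    have hr'r : r' * r = r' := by rw [hr', sub_mul, hrr, hs'r]
    have hrr' : r * r' = r' := by rw [hr', mul_sub, hrr, hrs]
    have hrrp : r' * r' = r' := by nth_rewrite 2 [hr']; rw [mul_sub, hr'r, hrsp, sub_zero]
    have hr'star : star r' = r' := by rw [hr', star_sub, hrstar, sstar']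
    clear_value r'
    clear_value r
    set X := x u with hX
    have XQ : X ∈ Q := hxQ u
    set E := X - r * X * r - b with hE
    set D1 := r * X * s' - c with hD1
    set D2 := s' * X * r' with hD2
    have EQ : E ∈ Q := sub_mem (sub_mem XQ (mul_mem (mul_mem rQ XQ) rQ)) b1
    have D1Q : D1 ∈ Q := sub_mem (mul_mem (mul_mem rQ XQ) s'Q) c1
    have D2Q : D2 ∈ Q := mul_mem (mul_mem s'Q XQ) r'Q
    have hdec : X - (1 - (s + s')) * X * (1 - (s + s')) - (b + c) = E + (D1 + D2) := by
      have hrd : r = r' + s' := by rw [hr']; abel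
      rw [e0, hE, hD1, hD2]
      have : r * X * r = r * X * s' + s' * X * r' + r' * X * r' := by
        nth_rewrite 2 [hrd]
        rw [mul_add]
        nth_rewrite 1 [hrd]
        noncomm_ring
      rw [this]; abel
    have rD1 : r * D1 = D1 := by
      rw [hD1, mul_sub, ← mul_assoc, ← mul_assoc, hrr]
      have : r * c = c := by rw [← c2, ← mul_assoc, hrs]
      rw [this]
    have D1r : D1 * r = D1 := by
      rw [hD1, sub_mul, mul_assoc _ s' r, hs'r]
      have : c * r = c := by rw [← c3, mul_assoc, hs'r]
      rw [this]
    have D1r' : D1 * r' = 0 := by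
      rw [hD1, sub_mul, mul_assoc _ s' r', hsrp]
      have : c * r' = 0 := by rw [← c3, mul_assoc, hsrp, mul_zero]
      rw [this]; simp
    have rD2 : r * D2 = D2 := by rw [hD2, ← mul_assoc, ← mul_assoc, hrs]
    have D2r : D2 * r = D2 := by rw [hD2, mul_assoc, hr'r]
    have rEr : r * E * r = 0 := by
      have e1 : r * b = 0 := by rw [← b2, ← mul_assoc, hrs0, zero_mul]
      have e2 : r * (r * X * r) * r = r * X * r := by
        have : r * (r * X * r) * r = (r * r) * X * (r * r) := by noncomm_ring
        rw [this, hrr]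
      rw [hE, mul_sub, mul_sub, sub_mul, sub_mul, e1, e2]; simp
    have o1 : ⟪E Ω, (D1 + D2) Ω⟫ = 0 := by
      refine hT.orth_right EQ (add_mem D1Q D2Q) rQ (by rw [add_mul, D1r, D2r]) ?_
      have e1 : r * (D1 + D2) = D1 + D2 := by rw [mul_add, rD1, rD2]
      have e2 : r * star E * r = 0 := by
        have := congrArg star rEr
        simpa only [star_mul, hrstar, star_zero, mul_assoc] using this
      rw [← e1, ← mul_assoc, e2, zero_mul]
    have o2 : ⟪D1 Ω, D2 Ω⟫ = 0 := by
      refine hT.orth_right D1Q D2Q r'Q (by rw [hD2, mul_assoc, hrrp]) ?_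
      have : r' * star D1 = 0 := by
        have := congrArg star D1r'
        rwa [star_mul, hr'star, star_zero] at this
      rw [this, zero_mul]
    have n2 : ‖D2 Ω‖ ^ 2 ≤ ε * ‖s' Ω‖ ^ 2 := by
      have e1 : star D2 = r' * (r * x u' * s' - c') := by
        rw [hu', mul_sub, hD2, star_mul, star_mul, hr'star, sstar']
        have e2 : r' * c' = 0 := by rw [← c2', ← mul_assoc, hrsp, zero_mul]
        rw [e2, sub_zero, ← mul_assoc, ← mul_assoc r', ← mul_assoc r' r, hr'r]
      rw [← hT.norm_star D2Q, e1]
      refine le_trans ?_ hcE'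
      gcongr
      rw [mul_apply_eq_comp]
      have e3 := norm_proj_le (p := r') ⟨hrrp, hr'star⟩
      refine (r'.le_opNorm _).trans ?_
      nlinarith [norm_nonneg ((r * x u' * s' - c') Ω)]
    rw [hdec, add_apply, norm_sq_add_orth o1, add_apply D1 D2, norm_sq_add_orth o2, hsum]
    change ‖D1 Ω‖ ^ 2 ≤ _ at hcE
    change ‖E Ω‖ ^ 2 ≤ _ at hbE
    nlinarith

theorem exhaust {X : Type*} (R : X → X → Prop) (hrefl : ∀ x, R x x) (htrans : ∀ x y z, R x y → R y z → R x z)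
    (f : X → ℝ) (hf : ∀ x, f x ≤ 1) (x0 : X) : ∃ x : ℕ → X, (∀ n, R (x n) (x (n + 1))) ∧
      ∀ ε : ℝ, 0 < ε → ∃ N, ∀ n ≥ N, ∀ y, R (x n) y → f y ≤ f (x n) + ε := by
  have step : ∀ (n : ℕ) (x : X), ∃ x', R x x' ∧ ∀ y, R x y → f y ≤ f x' + 1 / (n + 1) := by
    intro n x
    set S := f '' {y | R x y} with hS
    have hne : S.Nonempty := ⟨f x, x, hrefl x, rfl⟩
    have hbd : BddAbove S := ⟨1, by rintro _ ⟨y, _, rfl⟩; exact hf y⟩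
    obtain ⟨_, ⟨x', hx', rfl⟩, hlt⟩ := exists_lt_of_lt_csSup hne
      (show sSup S - 1 / ((n : ℝ) + 1) < sSup S by
        have : (0 : ℝ) < 1 / ((n : ℝ) + 1) := by positivity
        linarith)
    refine ⟨x', hx', fun y hy => ?_⟩
    have := le_csSup hbd (⟨y, hy, rfl⟩ : f y ∈ S)
    linarith
  choose g hg1 hg2 using step
  set x : ℕ → X := fun n => Nat.rec x0 (fun n y => g n y) n with hx
  have hxs : ∀ n, x (n + 1) = g n (x n) := fun n => rfl
  refine ⟨x, fun n => by rw [hxs]; exact hg1 _ _, fun ε hε => ?_⟩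
  obtain ⟨N, hN⟩ := exists_nat_one_div_lt hε
  refine ⟨N + 1, fun n hn y hy => ?_⟩
  obtain ⟨m, rfl⟩ : ∃ m, n = m + 1 := ⟨n - 1, by omega⟩
  have h1 := hg2 m (x m) y (htrans _ _ _ (hg1 m (x m)) hy)
  rw [← hxs] at h1
  have h2 : 1 / ((m : ℝ) + 1) ≤ 1 / ((N : ℝ) + 1) := by
    have : (N : ℝ) ≤ m := by exact_mod_cast (by omega : N ≤ m)
    gcongr
  linarith

theorem mkStar (W : Submodule ℂ 𝔹) (h1 : (1 : 𝔹) ∈ W)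
    (hm : ∀ x ∈ W, ∀ y ∈ W, x * y ∈ W) (hs : ∀ x ∈ W, star x ∈ W) :
    ∃ S : StarSubalgebra ℂ 𝔹, (∀ y, y ∈ S ↔ y ∈ W) ∧
      (FiniteDimensional ℂ W → FiniteDimensional ℂ S) := by
  refine ⟨{ carrier := W, mul_mem' := fun {a b} ha hb => hm a ha b hb,
            add_mem' := fun {a b} ha hb => W.add_mem ha hb,
            algebraMap_mem' := fun c => ?_, star_mem' := fun {a} ha => hs a ha }, fun y => Iff.rfl, fun h => ?_⟩
  · rw [Algebra.algebraMap_eq_smul_one]; exact W.smul_mem _ h1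
  · exact h

theorem St.toStar {Q : 𝔳𝔑} {Ω : H} {B0 : StarSubalgebra ℂ 𝔹}
    (hf : FiniteDimensional ℂ B0) (hB0 : ∀ b ∈ B0, b ∈ Q) {U : Type} {x : U → 𝔹}
    {ε : ℝ} {s : 𝔹} {B : Submodule ℂ 𝔹} (h : St Q Ω B0 x ε s B) :
    ∃ S : StarSubalgebra ℂ 𝔹, FiniteDimensional ℂ S ∧ B0 ≤ S ∧ (∀ y ∈ S, y ∈ Q) ∧ ∀ y ∈ B, y ∈ S := by
  set B1 : Submodule ℂ 𝔹 :=
    (Subalgebra.toSubmodule B0.toSubalgebra).map (LinearMap.mulRight ℂ (1 - s)) with hB1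
  have hmem : ∀ y, y ∈ B1 ↔ ∃ b ∈ B0, b * (1 - s) = y := by
    intro y; rw [hB1, Submodule.mem_map]; rfl
  have hss : s * s = s := h.sp.isIdempotentElem
  have sstar : star s = s := h.sp.isSelfAdjoint.star_eq
  have hcom : ∀ b ∈ B0, (1 - s) * b = b * (1 - s) := by
    intro b hb; rw [sub_mul, mul_sub, h.comm b hb, one_mul, mul_one]
  have hrr : (1 - s) * (1 - s) = 1 - s := by rw [sub_mul, one_mul, mul_sub, mul_one, hss, sub_self, sub_zero]
  have hfB := h.fin
  have hfB1 : FiniteDimensional ℂ B1 := by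
    have : FiniteDimensional ℂ (Subalgebra.toSubmodule B0.toSubalgebra) := hf
    exact inferInstance
  have hB0in : ∀ b ∈ B0, b ∈ B ⊔ B1 := by
    intro b hb
    have : b = b * s + b * (1 - s) := by rw [mul_sub, mul_one]; abel
    rw [this]
    exact add_mem (mem_sup_left (h.b0 b hb)) (mem_sup_right ((hmem _).2 ⟨b, hb, rfl⟩))
  obtain ⟨S, hS, hSf⟩ := mkStar (B ⊔ B1) (hB0in 1 (one_mem _)) (by
    intro y hy z hz
    obtain ⟨b, hb, c, hc, rfl⟩ := Submodule.mem_sup.1 hy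
    obtain ⟨b', hb', c', hc', rfl⟩ := Submodule.mem_sup.1 hz
    obtain ⟨d, hd, rfl⟩ := (hmem _).1 hc
    obtain ⟨d', hd', rfl⟩ := (hmem _).1 hc'
    have e1 : b * (d' * (1 - s)) = 0 := by
      rw [← hcom _ hd', ← (h.mem b hb).2.2.1, mul_assoc, ← mul_assoc s, mul_sub, mul_one, hss, sub_self]
      simp
    have e2 : d * (1 - s) * b' = 0 := by
      rw [← (h.mem b' hb').2.1, mul_assoc, ← mul_assoc (1 - s), sub_mul, one_mul, hss, sub_self]
      simp
    have e3 : d * (1 - s) * (d' * (1 - s)) = d * d' * (1 - s) := by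
      rw [mul_assoc, ← mul_assoc (1 - s), hcom _ hd', mul_assoc d', hrr, mul_assoc]
    rw [add_mul, mul_add, mul_add, e1, e2, e3, add_zero, zero_add]
    exact add_mem (mem_sup_left (h.mul _ hb _ hb'))
      (mem_sup_right ((hmem _).2 ⟨_, mul_mem hd hd', rfl⟩))) (by
    intro y hy
    obtain ⟨b, hb, c, hc, rfl⟩ := Submodule.mem_sup.1 hy
    obtain ⟨d, hd, rfl⟩ := (hmem _).1 hc
    rw [star_add, star_mul, star_sub, star_one, sstar, hcom _ (star_mem hd)]
    exact add_mem (mem_sup_left (h.mem b hb).2.2.2)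
      (mem_sup_right ((hmem _).2 ⟨_, star_mem hd, rfl⟩)))
  refine ⟨S, hSf (Submodule.finiteDimensional_sup _ _), fun b hb => (hS b).2 (hB0in b hb), ?_,
    fun y hy => (hS y).2 (mem_sup_left hy)⟩
  intro y hy
  obtain ⟨b, hb, c, hc, rfl⟩ := Submodule.mem_sup.1 ((hS y).1 hy)
  obtain ⟨d, hd, rfl⟩ := (hmem _).1 hc
  exact add_mem (h.mem b hb).1 (mul_mem (hB0 d hd) (sub_mem (one_mem _) h.sQ))

theorem proj_limit (s : ℕ → 𝔹) (hs : ∀ n, IsStarProjection (s n)) (hm : ∀ n, s (n + 1) * s n = s n) :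
    ∃ p : 𝔹, IsStarProjection p ∧ (∀ v, Tendsto (fun n => s n v) atTop (nhds (p v))) ∧
      ∀ n, s n * p = s n := by
  choose _ hK using fun n => isStarProjection_iff_eq_starProjection_range.1 (hs n)
  set K : ℕ → Submodule ℂ H := fun n => (s n).range with hKd
  have hmono : Monotone K := by
    refine monotone_nat_of_le_succ fun n => ?_
    rintro _ ⟨v, rfl⟩
    exact ⟨s n v, congrArg (fun f : 𝔹 => f v) (hm n)⟩
  have hp := isStarProjection_starProjection (U := (⨆ i, K i).topologicalClosure)
  refine ⟨_, hp, fun v => ?_, fun n => ?_⟩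
  · have := Submodule.starProjection_tendsto_closure_iSup K hmono v
    refine this.congr fun n => ?_
    rw [← hK n]
  · have h1 : (⨆ i, K i).topologicalClosure.starProjection * s n = s n := by
      ext v
      rw [mul_apply_eq_comp]
      refine starProjection_eq_self_iff.2 (le_topologicalClosure _ ?_)
      exact le_iSup K n ⟨v, rfl⟩
    have := congrArg star h1
    rwa [star_mul, (hs n).isSelfAdjoint.star_eq, hp.isSelfAdjoint.star_eq] at this

theorem approxFin {Q : 𝔳𝔑} {Ω : H} (hT : TrV Q Ω) (hI : HI Q Ω)
    {B0 : StarSubalgebra ℂ 𝔹} (hf : FiniteDimensional ℂ B0) (hB0 : ∀ b ∈ B0, b ∈ Q)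
    {U : Type} [Fintype U] (x : U → 𝔹) (hxQ : ∀ u, x u ∈ Q) (hx : ∀ u, ‖x u‖ ≤ 1)
    (hst : ∀ u, ∃ u', x u' = star (x u)) {ε : ℝ} (hε : 0 < ε) :
    ∃ S : StarSubalgebra ℂ 𝔹, FiniteDimensional ℂ S ∧ B0 ≤ S ∧ (∀ y ∈ S, y ∈ Q) ∧
      ∀ u, ∃ b ∈ S, ‖b‖ ≤ 2 ∧ ‖(x u - b) Ω‖ ≤ ε := by
  set ε1 := ε ^ 2 / 8 with hε1
  have hε1p : 0 < ε1 := by positivity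
  let X := {p : 𝔹 × Submodule ℂ 𝔹 // St Q Ω B0 x ε1 p.1 p.2}
  have hX0 : St Q Ω B0 x ε1 0 ⊥ := by
    refine ⟨zero_mem _, ⟨by simp [IsIdempotentElem], by simp⟩, by simp, inferInstance, ?_, ?_, by simp, by simp, ?_⟩
    · intro y hy; rw [Submodule.mem_bot] at hy; subst hy; simp
    · intro y hy z hz; rw [Submodule.mem_bot] at hy; subst hy; simp
    · intro u; exact ⟨0, by simp, by simp, by simp⟩
  obtain ⟨p, hR, hex⟩ := exhaust (X := X) (fun p q => q.1.1 * p.1.1 = p.1.1)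
    (fun p => p.2.sp.isIdempotentElem)
    (fun p q r h1 h2 => by
      change r.1.1 * p.1.1 = p.1.1
      rw [← h1, ← mul_assoc, h2])
    (fun p => ‖p.1.1 Ω‖ ^ 2)
    (fun p => by
      have h1 := norm_proj_le p.2.sp
      have h2 := (p.1.1).le_opNorm Ω
      rw [hT.norm_one] at h2
      have h3 : ‖p.1.1 Ω‖ ≤ 1 := by linarith
      have := pow_le_pow_left₀ (norm_nonneg _) h3 2
      simpa using this)
    ⟨(0, ⊥), hX0⟩
  set s : ℕ → 𝔹 := fun n => (p n).1.1 with hs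
  have hS : ∀ n, St Q Ω B0 x ε1 (s n) (p n).1.2 := fun n => (p n).2
  obtain ⟨P, hP, hlim, hsP⟩ := proj_limit s (fun n => (hS n).sp) hR
  have hPcomm : ∀ y : 𝔹, (∀ n, y * s n = s n * y) → y * P = P * y := by
    intro y hy
    ext v
    have h1 : Tendsto (fun n => y (s n v)) atTop (nhds (y (P v))) :=
      (y.continuous.tendsto _).comp (hlim v)
    have h2 := hlim (y v)
    refine tendsto_nhds_unique h1 (h2.congr fun n => ?_)
    exact (congrArg (fun f : 𝔹 => f v) (hy n)).symm
  have hPQ : P ∈ Q := mem_of_comm fun y hy => hPcomm y fun n => (comm_of_mem (hS n).sQ hy).symm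
  have hPB : ∀ b ∈ B0, b * P = P * b := fun b hb => hPcomm b fun n => (hS n).comm b hb
  by_cases hP1 : P = 1
  · have h1 : Tendsto (fun n => ‖Ω - s n Ω‖) atTop (nhds 0) := by
      have := (tendsto_const_nhds (x := Ω)).sub (hlim Ω)
      rw [hP1] at this
      simpa using this.norm
    obtain ⟨n, hn⟩ := (h1.eventually (gt_mem_nhds (by positivity : (0 : ℝ) < ε / 2))).exists
    obtain ⟨S, hSf, hSB, hSQ, hSin⟩ := (hS n).toStar hf hB0
    refine ⟨S, hSf, hSB, hSQ, fun u => ?_⟩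
    obtain ⟨b, hb, hbn, hbE⟩ := (hS n).app u
    refine ⟨b, hSin b hb, hbn, ?_⟩
    have hsn : ‖s n Ω‖ ≤ 1 := by
      have h1 := norm_proj_le (hS n).sp
      have h2 := (s n).le_opNorm Ω
      rw [hT.norm_one] at h2
      linarith
    have e1 : ‖(x u - (1 - s n) * x u * (1 - s n) - b) Ω‖ ≤ ε / 2 := by
      refine (sq_le_sq₀ (norm_nonneg _) (by positivity)).1 (hbE.trans ?_)
      have := pow_le_pow_left₀ (norm_nonneg _) hsn 2
      rw [hε1]
      nlinarith [sq_nonneg ε]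
    have hrp : IsStarProjection (1 - s n) := (hS n).sp.one_sub
    have e2 : ‖((1 - s n) * x u * (1 - s n)) Ω‖ ≤ ε / 2 := by
      have h2 : ‖(1 - s n) * x u‖ ≤ 1 := by
        calc _ ≤ ‖1 - s n‖ * ‖x u‖ := norm_mul_le _ _
          _ ≤ 1 * 1 := by gcongr; exact norm_proj_le hrp; exact hx u
          _ = 1 := by norm_num
      have h3 : ((1 - s n) * x u * (1 - s n)) Ω = ((1 - s n) * x u) (Ω - s n Ω) := rfl
      rw [h3]
      refine (le_opNorm _ _).trans ?_
      nlinarith [norm_nonneg (Ω - s n Ω)]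
    have e3 : (x u - b) Ω = (x u - (1 - s n) * x u * (1 - s n) - b) Ω + ((1 - s n) * x u * (1 - s n)) Ω := by
      rw [← add_apply]; congr 1; abel
    rw [e3]
    exact (norm_add_le _ _).trans (by linarith)
  · exfalso
    obtain ⟨t, htQ, ht, ht0, hrt, htB, B', hBf, hBm, hBmul, htB', hb0B', happ⟩ :=
      stepA hT hI hf hB0 (sub_mem (one_mem _) hPQ) hP.one_sub (sub_ne_zero.2 fun h => hP1 h.symm)
        (fun b hb => by rw [mul_sub, sub_mul, hPB b hb, mul_one, one_mul]) x hxQ hx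
        (by positivity : 0 < ε1 / 4)
    have htΩ : 0 < ‖t Ω‖ := norm_pos_iff.2 fun h => ht0 (hT.sep t htQ h)
    have hPt : P * t = 0 := by rw [sub_mul, one_mul, sub_eq_self] at hrt; exact hrt
    have hst0 : ∀ n, s n * t = 0 := fun n => by rw [← hsP n, mul_assoc, hPt, mul_zero]
    choose b hbB hbn hbE using happ
    have hev : ∀ᶠ n in atTop, ∀ u, ‖(P - s n) (x u (t Ω))‖ < Real.sqrt ε1 / 2 * ‖t Ω‖ := by
      rw [eventually_all]
      intro u
      have := (tendsto_const_nhds (x := P (x u (t Ω)))).sub (hlim (x u (t Ω)))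
      rw [sub_self] at this
      have h0 := this.norm
      rw [norm_zero] at h0
      exact h0.eventually (gt_mem_nhds (by positivity))
    obtain ⟨N, hN⟩ := hex (‖t Ω‖ ^ 2 / 2) (by positivity)
    obtain ⟨n, hn1, hn2⟩ := (hev.and (eventually_ge_atTop N)).exists
    obtain ⟨hnew, hsum, hRn⟩ := stepB hT hxQ hst (hS n) htQ ht
      (by rw [sub_mul, one_mul, hst0, sub_zero]) htB hBf hBm hBmul htB' hb0B' (by
        intro u
        refine ⟨b u, hbB u, hbn u, ?_⟩
        have k1 : ‖((1 - P) * x u * t - b u) Ω‖ ≤ Real.sqrt ε1 / 2 * ‖t Ω‖ := by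
          refine (sq_le_sq₀ (norm_nonneg _) (by positivity)).1 ((hbE u).trans (le_of_eq ?_))
          rw [mul_pow, div_pow, Real.sq_sqrt hε1p.le]; norm_num
        have k2 := hn1 u
        have k3 : ((1 - s n) * x u * t - b u) Ω = ((1 - P) * x u * t - b u) Ω + (P - s n) (x u (t Ω)) := by
          simp only [sub_apply, mul_apply_eq_comp, one_apply]
          abel
        have k4 : ‖((1 - s n) * x u * t - b u) Ω‖ ≤ Real.sqrt ε1 * ‖t Ω‖ := by
          rw [k3]; exact (norm_add_le _ _).trans (by linarith)
        have := pow_le_pow_left₀ (norm_nonneg _) k4 2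
        rwa [mul_pow, Real.sq_sqrt hε1p.le] at this)
    have hbad := hN n hn2 ⟨(s n + t, (p n).1.2 ⊔ B'), hnew⟩ hRn
    change ‖(s n + t) Ω‖ ^ 2 ≤ ‖s n Ω‖ ^ 2 + _ at hbad
    rw [hsum] at hbad
    nlinarith

theorem commutant_cyclic {Q : 𝔳𝔑} {Ω : H} (hsep : ∀ a ∈ Q, a Ω = 0 → a = 0) (v : H) {ε : ℝ}
    (hε : 0 < ε) : ∃ m ∈ Q.commutant, ‖v - m Ω‖ < ε := by
  let K0 : Submodule ℂ H :=
    { carrier := {w | ∃ m ∈ Q.commutant, m Ω = w}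
      add_mem' := by
        rintro a b ⟨m, hm, rfl⟩ ⟨n, hn, rfl⟩
        exact ⟨m + n, add_mem hm hn, rfl⟩
      zero_mem' := ⟨0, zero_mem _, rfl⟩
      smul_mem' := by
        rintro c a ⟨m, hm, rfl⟩
        exact ⟨c • m, smul_mem' c hm, rfl⟩ }
  let K := K0.topologicalClosure
  have hKc : IsClosed (K : Set H) := K0.isClosed_topologicalClosure
  have : CompleteSpace K := hKc.completeSpace_coe
  have hp : K.starProjection ∈ Q := by
    apply starProjection_mem
    intro y hy w hw
    have hw' : w ∈ closure (K0 : Set H) := hw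
    have : y w ∈ closure (K0 : Set H) := by
      refine map_mem_closure y.continuous hw' ?_
      rintro _ ⟨m, hm, rfl⟩
      exact ⟨y * m, mul_mem hy hm, rfl⟩
    exact this
  have hΩ : Ω ∈ K := K0.le_topologicalClosure ⟨1, one_mem _, rfl⟩
  have h1 : K.starProjection Ω = Ω := starProjection_eq_self_iff.2 hΩ
  have h0 : (1 : 𝔹) - K.starProjection = 0 := by
    apply hsep _ (sub_mem (one_mem _) hp)
    rw [sub_apply, h1]; exact sub_self Ω
  have hv : v ∈ K := by
    rw [← starProjection_eq_self_iff]
    have := congrArg (fun f : 𝔹 => f v) h0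
    rw [sub_apply] at this
    exact (sub_eq_zero.1 this).symm
  have hv' : v ∈ closure (K0 : Set H) := hv
  obtain ⟨w, ⟨m, hm, rfl⟩, hd⟩ := Metric.mem_closure_iff.1 hv' ε hε
  exact ⟨m, hm, by rwa [← dist_eq_norm]⟩

theorem chain_step {Q : 𝔳𝔑} {Ω : H} (hT : TrV Q Ω) (hI : HI Q Ω) (x : ℕ → 𝔹)
    (hxQ : ∀ n, x n ∈ Q) (hx : ∀ n, ‖x n‖ ≤ 1) :
    ∃ B : ℕ → StarSubalgebra ℂ 𝔹, Monotone B ∧ (∀ n, FiniteDimensional ℂ (B n)) ∧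
      (∀ n, ∀ y ∈ B n, y ∈ Q) ∧
      ∀ n, ∀ k ≤ n, ∃ b ∈ B (n + 1), ‖b‖ ≤ 2 ∧ ‖(x k - b) Ω‖ ≤ 1 / ((n : ℝ) + 1) := by
  let T := {S : StarSubalgebra ℂ 𝔹 // FiniteDimensional ℂ S ∧ ∀ y ∈ S, y ∈ Q}
  have step : ∀ n : ℕ, ∀ S : T, ∃ S' : T, S.1 ≤ S'.1 ∧
      ∀ k ≤ n, ∃ b ∈ S'.1, ‖b‖ ≤ 2 ∧ ‖(x k - b) Ω‖ ≤ 1 / ((n : ℝ) + 1) := by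
    intro n S
    obtain ⟨S', h1, h2, h3, h4⟩ := approxFin hT hI S.2.1 S.2.2 (U := Fin (n + 1) ⊕ Fin (n + 1))
      (Sum.elim (fun k => x k) (fun k => star (x k)))
      (by rintro (k | k) <;> simp only [Sum.elim_inl, Sum.elim_inr]
          · exact hxQ _
          · exact star_mem (hxQ _))
      (by rintro (k | k) <;> simp only [Sum.elim_inl, Sum.elim_inr]
          · exact hx _
          · rw [norm_star]; exact hx _)
      (by rintro (k | k)
          · exact ⟨Sum.inr k, rfl⟩
          · exact ⟨Sum.inl k, by simp⟩) (ε := 1 / ((n : ℝ) + 1)) (by positivity)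
    refine ⟨⟨S', h1, h3⟩, h2, fun k hk => ?_⟩
    exact h4 (Sum.inl ⟨k, by omega⟩)
  choose f hf1 hf2 using step
  have hbot : FiniteDimensional ℂ (⊥ : StarSubalgebra ℂ 𝔹) := by
    have : (⊥ : StarSubalgebra ℂ 𝔹).toSubalgebra = ⊥ := rfl
    have h2 : FiniteDimensional ℂ (⊥ : Subalgebra ℂ 𝔹) := inferInstance
    rw [← this] at h2
    exact h2
  let S0 : T := ⟨⊥, hbot, by
    intro y hy
    rw [StarSubalgebra.mem_bot] at hy
    obtain ⟨c, rfl⟩ := hy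
    rw [Algebra.algebraMap_eq_smul_one]
    exact smul_mem' c (one_mem _)⟩
  let B : ℕ → T := fun n => Nat.rec S0 (fun n S => f n S) n
  refine ⟨fun n => (B n).1, monotone_nat_of_le_succ fun n => hf1 n (B n), fun n => (B n).2.1,
    fun n => (B n).2.2, fun n => hf2 n (B n)⟩

theorem amenable_of_HI [TopologicalSpace.SeparableSpace H] {Q : 𝔳𝔑} {Ω : H} (hT : TrV Q Ω)
    (hI : HI Q Ω) : IsAmenableSet (Q : Set 𝔹) := by
  let D : Set H := {w | ∃ x ∈ Q, ‖x‖ ≤ 1 ∧ x Ω = w}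
  obtain ⟨t, htD, htc, hd⟩ := (TopologicalSpace.IsSeparable.of_separableSpace D).exists_countable_dense_subset
  have hne : t.Nonempty := by
    by_contra h
    rw [Set.not_nonempty_iff_eq_empty] at h
    rw [h, closure_empty] at hd
    exact hd (⟨0, zero_mem _, by simp, rfl⟩ : (0 : 𝔹) Ω ∈ D)
  obtain ⟨w, hw⟩ := htc.exists_eq_range hne
  have hwD : ∀ n, ∃ x ∈ Q, ‖x‖ ≤ 1 ∧ x Ω = w n := fun n => htD (hw ▸ Set.mem_range_self n)
  choose x hxQ hx hxw using hwD
  obtain ⟨B, hm, hfin, hBQ, hap⟩ := chain_step hT hI x hxQ hx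
  refine ⟨Set.range B, ?_, ?_, ?_⟩
  · rintro _ ⟨n, rfl⟩
    exact ⟨fun y hy => hBQ n y hy, hfin n⟩
  · rintro _ ⟨n, rfl⟩ _ ⟨k, rfl⟩
    exact ⟨B (max n k), ⟨_, rfl⟩, hm (le_max_left _ _), hm (le_max_right _ _)⟩
  -- L2 approximation of contractions
  have key : ∀ y ∈ Q, ‖y‖ ≤ 1 → ∀ ε > 0, ∃ n, ∃ b ∈ B n, ‖b‖ ≤ 2 ∧ ‖(y - b) Ω‖ ≤ ε := by
    intro y hy hy1 ε hε
    have hyD : y Ω ∈ closure t := hd ⟨y, hy, hy1, rfl⟩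
    obtain ⟨z, hz, hyz⟩ := Metric.mem_closure_iff.1 hyD (ε / 2) (by positivity)
    rw [hw] at hz
    obtain ⟨k, rfl⟩ := hz
    obtain ⟨N, hN⟩ := exists_nat_one_div_lt (show (0 : ℝ) < ε / 2 by positivity)
    obtain ⟨b, hb, hb2, hbe⟩ := hap (max N k) k (le_max_right _ _)
    refine ⟨_, b, hb, hb2, ?_⟩
    have e1 : (1 : ℝ) / (((max N k : ℕ) : ℝ) + 1) ≤ 1 / ((N : ℝ) + 1) := by
      apply one_div_le_one_div_of_le (by positivity)
      have : (N : ℝ) ≤ ((max N k : ℕ) : ℝ) := by exact_mod_cast le_max_left _ _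
      linarith
    have e2 : (y - b) Ω = (y Ω - w k) + (x k - b) Ω := by
      simp only [sub_apply, hxw]; abel
    rw [e2]
    rw [dist_eq_norm] at hyz
    have := norm_add_le (y Ω - w k) ((x k - b) Ω)
    linarith
  have key2 : ∀ y ∈ Q, ‖y‖ ≤ 1 → ∀ (F : Finset H) (ε : ℝ), 0 < ε → ∃ n, ∃ b ∈ B n, ∀ v ∈ F, ‖y v - b v‖ < ε := by
    intro y hy hy1 F ε hε
    have hc := fun v : H => commutant_cyclic (Q := Q) hT.sep v (show 0 < ε / 6 by positivity)
    choose m hmc hmv using hc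
    let C : ℝ := 1 + ∑ v ∈ F, ‖m v‖
    have hC : 0 < C := by
      have : 0 ≤ ∑ v ∈ F, ‖m v‖ := sum_nonneg fun _ _ => norm_nonneg _
      simp only [C]; linarith
    obtain ⟨n, b, hb, hb2, hbe⟩ := key y hy hy1 (ε / (4 * C)) (by positivity)
    refine ⟨n, b, hb, fun v hv => ?_⟩
    have hbQ := hBQ n b hb
    have e : y v - b v = (y - b) (v - m v Ω) + m v ((y - b) Ω) := by
      have h1 := congrArg (fun f : 𝔹 => f Ω) (comm_of_mem (sub_mem hy hbQ) (hmc v))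
      simp only [mul_apply_eq_comp] at h1
      rw [← h1, map_sub, sub_add_cancel, sub_apply]
    have n1 : ‖(y - b) (v - m v Ω)‖ ≤ 3 * (ε / 6) := by
      refine ((y - b).le_opNorm _).trans ?_
      have : ‖y - b‖ ≤ 3 := (norm_sub_le _ _).trans (by linarith)
      exact mul_le_mul this (hmv v).le (norm_nonneg _) (by norm_num)
    have n2 : ‖m v ((y - b) Ω)‖ ≤ C * (ε / (4 * C)) := by
      refine ((m v).le_opNorm _).trans ?_
      have : ‖m v‖ ≤ C := by
        have := single_le_sum (f := fun v => ‖m v‖) (fun _ _ => norm_nonneg _) hv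
        simp only [C]; linarith
      exact mul_le_mul this hbe (norm_nonneg _) hC.le
    have e3 : C * (ε / (4 * C)) = ε / 4 := by field_simp
    rw [e]
    refine (norm_add_le _ _).trans_lt ?_
    rw [e3] at n2
    linarith
  intro y hy F ε hε
  have hy' : y ∈ Q := hy
  have hpos : (0 : ℝ) < ‖y‖ + 1 := by positivity
  obtain ⟨n, b, hb, hbe⟩ := key2 (((‖y‖ + 1 : ℝ)⁻¹ : ℝ) • y) (rsmul_mem' _ hy') (by
    rw [norm_smul, Real.norm_of_nonneg (by positivity), inv_mul_le_iff₀ hpos]; linarith) F (ε / (‖y‖ + 1))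
    (by positivity)
  refine ⟨((‖y‖ + 1 : ℝ) : ℂ) • b, ?_, fun v hv => ?_⟩
  · rw [Set.mem_iUnion₂]
    exact ⟨B n, ⟨n, rfl⟩, (B n).smul_mem hb _⟩
  · have h := hbe v hv
    rw [lt_div_iff₀ hpos] at h
    have e : y v - (((‖y‖ + 1 : ℝ) : ℂ) • b) v
        = (‖y‖ + 1 : ℝ) • ((((‖y‖ + 1 : ℝ)⁻¹ : ℝ) • y) v - b v) := by
      rw [smul_sub, smul_apply, smul_apply, smul_smul, mul_inv_cancel₀ hpos.ne', one_smul, Complex.coe_smul]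
    rw [e, norm_smul, Real.norm_of_nonneg hpos.le, mul_comm]
    exact h

section HS
variable {E F G : Type*} [NormedAddCommGroup E] [InnerProductSpace ℂ E] [CompleteSpace E]
  [NormedAddCommGroup F] [InnerProductSpace ℂ F] [CompleteSpace F]
  [NormedAddCommGroup G] [InnerProductSpace ℂ G] [CompleteSpace G]
variable {ι κ : Type*}

theorem hb_parseval_real (b : HilbertBasis ι ℂ E) (v : E) : HasSum (fun i => ‖⟪b i, v⟫‖ ^ 2) (‖v‖ ^ 2) := by
  have h := b.hasSum_inner_mul_inner v v
  have h2 := Complex.hasSum_re h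
  have e1 : (fun i => (⟪v, b i⟫ * ⟪b i, v⟫).re) = fun i => ‖⟪b i, v⟫‖ ^ 2 := by
    funext i
    rw [← inner_conj_symm v (b i), mul_comm, Complex.mul_conj, Complex.normSq_eq_norm_sq]
    norm_cast
  have e2 : (⟪v, v⟫).re = ‖v‖ ^ 2 := by
    rw [inner_sq]; norm_cast
  rw [e2] at h2
  rw [← e1]
  exact h2

theorem enorm_sq_ofReal (v : E) : ‖v‖ₑ ^ 2 = ENNReal.ofReal (‖v‖ ^ 2) := by
  rw [ENNReal.ofReal_pow (norm_nonneg _), ofReal_norm]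

theorem hb_parseval (b : HilbertBasis ι ℂ E) (v : E) : ∑' i, ‖⟪b i, v⟫‖ₑ ^ 2 = ‖v‖ₑ ^ 2 := by
  have h := hb_parseval_real b v
  rw [enorm_sq_ofReal, ← h.tsum_eq, ENNReal.ofReal_tsum_of_nonneg (fun _ => by positivity) h.summable]
  congr 1; funext i; rw [enorm_sq_ofReal]

/-- squared Hilbert-Schmidt norm -/
def hs (b : HilbertBasis ι ℂ E) (T : E →L[ℂ] F) : ℝ≥0∞ := ∑' i, ‖T (b i)‖ₑ ^ 2

theorem enorm_inner_symm (v w : E) : ‖⟪v, w⟫‖ₑ = ‖⟪w, v⟫‖ₑ := by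
  rw [← ofReal_norm, ← ofReal_norm, norm_inner_symm]

theorem hs_adj (b : HilbertBasis ι ℂ E) (c : HilbertBasis κ ℂ F) (T : E →L[ℂ] F) :
    hs b T = hs c (adjoint T) := by
  unfold hs
  calc ∑' i, ‖T (b i)‖ₑ ^ 2 = ∑' i, ∑' k, ‖⟪c k, T (b i)⟫‖ₑ ^ 2 := by
        congr 1; funext i; rw [hb_parseval]
    _ = ∑' k, ∑' i, ‖⟪c k, T (b i)⟫‖ₑ ^ 2 := ENNReal.tsum_comm
    _ = _ := by
        congr 1; funext k; rw [← hb_parseval b]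
        congr 1; funext i
        rw [← adjoint_inner_left, enorm_inner_symm]

theorem hs_basis (b : HilbertBasis ι ℂ E) (b' : HilbertBasis κ ℂ E) (T : E →L[ℂ] F) : hs b T = hs b' T := by
  obtain ⟨w, c, -⟩ := exists_hilbertBasis ℂ F
  rw [hs_adj b c, hs_adj b' c]

theorem enorm_apply_sq_le (a : E →L[ℂ] F) (v : E) : ‖a v‖ₑ ^ 2 ≤ ‖a‖ₑ ^ 2 * ‖v‖ₑ ^ 2 := by
  rw [← mul_pow]; exact pow_le_pow_left' (le_opNorm_enorm a v) 2

theorem hs_left (b : HilbertBasis ι ℂ E) (a : F →L[ℂ] G) (T : E →L[ℂ] F) :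
    hs b (a ∘L T) ≤ ‖a‖ₑ ^ 2 * hs b T := by
  unfold hs
  rw [← ENNReal.tsum_mul_left]
  exact ENNReal.tsum_le_tsum fun i => enorm_apply_sq_le a _

theorem enorm_adj (T : E →L[ℂ] F) : ‖adjoint T‖ₑ = ‖T‖ₑ := by
  rw [← ofReal_norm, ← ofReal_norm, LinearIsometryEquiv.norm_map]

theorem hs_right (b : HilbertBasis ι ℂ E) (c : HilbertBasis κ ℂ F) (T : F →L[ℂ] G) (a : E →L[ℂ] F) :
    hs b (T ∘L a) ≤ ‖a‖ₑ ^ 2 * hs c T := by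
  obtain ⟨w, d, -⟩ := exists_hilbertBasis ℂ G
  rw [hs_adj b d, hs_adj c d, adjoint_comp]
  refine (hs_left d _ _).trans ?_
  rw [enorm_adj]

theorem enorm_add_sq_le (v w : E) : ‖v + w‖ₑ ^ 2 ≤ 2 * ‖v‖ₑ ^ 2 + 2 * ‖w‖ₑ ^ 2 := by
  simp only [enorm_sq_ofReal]
  rw [show (2 : ℝ≥0∞) = ENNReal.ofReal 2 by simp, ← ENNReal.ofReal_mul (by norm_num), ← ENNReal.ofReal_mul (by norm_num),
    ← ENNReal.ofReal_add (by positivity) (by positivity)]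
  apply ofReal_le_ofReal
  have := norm_add_le v w
  nlinarith [sq_nonneg (‖v‖ - ‖w‖), norm_nonneg (v + w), norm_nonneg v, norm_nonneg w]

theorem hs_add (b : HilbertBasis ι ℂ E) (S T : E →L[ℂ] F) : hs b (S + T) ≤ 2 * hs b S + 2 * hs b T := by
  unfold hs
  rw [← ENNReal.tsum_mul_left, ← ENNReal.tsum_mul_left, ← ENNReal.tsum_add]
  exact ENNReal.tsum_le_tsum fun i => enorm_add_sq_le _ _

theorem hs_neg (b : HilbertBasis ι ℂ E) (T : E →L[ℂ] F) : hs b (-T) = hs b T := by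
  unfold hs; congr 1; funext i; rw [neg_apply, enorm_neg]

theorem hs_sub (b : HilbertBasis ι ℂ E) (S T : E →L[ℂ] F) : hs b (S - T) ≤ 2 * hs b S + 2 * hs b T := by
  rw [sub_eq_add_neg, ← hs_neg b T]; exact hs_add b S (-T)

theorem enorm_sum_sq_le {K : Type*} (s : Finset K) (v : K → E) :
    ‖∑ k ∈ s, v k‖ₑ ^ 2 ≤ (s.card : ℝ≥0∞) * ∑ k ∈ s, ‖v k‖ₑ ^ 2 := by
  simp only [enorm_sq_ofReal]
  rw [← ofReal_sum_of_nonneg (fun _ _ => by positivity), ← ENNReal.ofReal_natCast,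
    ← ENNReal.ofReal_mul (by positivity)]
  apply ofReal_le_ofReal
  calc ‖∑ k ∈ s, v k‖ ^ 2 ≤ (∑ k ∈ s, ‖v k‖) ^ 2 :=
        pow_le_pow_left₀ (norm_nonneg _) (norm_sum_le _ _) 2
    _ ≤ _ := sq_sum_le_card_mul_sum_sq

theorem hs_sum (b : HilbertBasis ι ℂ E) {K : Type*} (s : Finset K) (T : K → E →L[ℂ] F) :
    hs b (∑ k ∈ s, T k) ≤ (s.card : ℝ≥0∞) * ∑ k ∈ s, hs b (T k) := by
  unfold hs
  rw [← Summable.tsum_finsetSum (fun _ _ => ENNReal.summable), ← ENNReal.tsum_mul_left]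
  refine ENNReal.tsum_le_tsum fun i => ?_
  rw [sum_apply]
  exact enorm_sum_sq_le s _

theorem hs_eq_zero {b : HilbertBasis ι ℂ E} {T : E →L[ℂ] F} : hs b T = 0 ↔ T = 0 := by
  constructor
  · intro h
    have h1 : ∀ i, T (b i) = 0 := by
      intro i
      have := ENNReal.tsum_eq_zero.1 h i
      simpa using this
    ext v
    have h2 := (b.hasSum_repr v).mapL T
    simp only [map_smul, h1, smul_zero] at h2
    rw [← h2.tsum_eq]; simp
  · rintro rfl; simp [hs]

/-- a family with `∑ ‖θ_i v‖² = ‖v‖²` splits the Hilbert-Schmidt norm -/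
theorem hs_split (b : HilbertBasis ι ℂ E) {K : Type*} (θ : K → F →L[ℂ] G)
    (h : ∀ v, ∑' k, ‖θ k v‖ₑ ^ 2 = ‖v‖ₑ ^ 2) (T : E →L[ℂ] F) : ∑' k, hs b (θ k ∘L T) = hs b T := by
  unfold hs
  rw [ENNReal.tsum_comm]
  congr 1; funext i; rw [← h]; rfl

end HS

/-- the property produced from approximate commutation -/
def PropP (Q : 𝔳𝔑) {ι : Type*} (b : HilbertBasis ι ℂ H) : Prop :=
  ∀ F : Finset (𝔹), (∀ x ∈ F, x ∈ Q) → ∀ r ∈ Q, IsStarProjection r → r ≠ 0 → ∀ δ : ℝ≥0∞, δ ≠ 0 →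
    ∃ T : 𝔹, hs b T ≠ ∞ ∧ hs b (r * T) ≠ 0 ∧ ∑ x ∈ F, hs b (x * T - T * x) ≤ δ * hs b (r * T)

theorem orbit_submodule (Q : 𝔳𝔑) (Ω : H) :
    ∃ K0 : Submodule ℂ H, (∀ w, w ∈ K0 ↔ ∃ a ∈ Q, a Ω = w) := by
  refine ⟨{ carrier := {w | ∃ m ∈ Q, m Ω = w}
            add_mem' := ?_
            zero_mem' := ⟨0, zero_mem _, rfl⟩
            smul_mem' := ?_ }, fun w => Iff.rfl⟩
  · rintro a b ⟨m, hm, rfl⟩ ⟨n, hn, rfl⟩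
    exact ⟨m + n, add_mem hm hn, rfl⟩
  · rintro c a ⟨m, hm, rfl⟩
    exact ⟨c • m, smul_mem' c hm, rfl⟩

theorem theta_family {Q : 𝔳𝔑} {Ω : H} (hsep : ∀ a ∈ Q, a Ω = 0 → a = 0) :
    ∃ (S : Set 𝔹) (θ : S → 𝔹), (∀ k, θ k ∈ Q.commutant) ∧
      (∀ k v, ∀ ε > 0, ∃ a ∈ Q, ‖θ k v - a Ω‖ < ε) ∧ ∀ v, ∑' k, ‖θ k v‖ₑ ^ 2 = ‖v‖ₑ ^ 2 := by
  obtain ⟨K0, hK0⟩ := orbit_submodule Q Ω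
  let K := K0.topologicalClosure
  have hKc : IsClosed (K : Set H) := K0.isClosed_topologicalClosure
  have : CompleteSpace K := hKc.completeSpace_coe
  set P := K.starProjection with hP
  have hPc : P ∈ Q.commutant := by
    apply starProjection_mem
    intro y hy w hw
    rw [VonNeumannAlgebra.commutant_commutant] at hy
    have hw' : w ∈ closure (K0 : Set H) := hw
    have : y w ∈ closure (K0 : Set H) := by
      refine map_mem_closure y.continuous hw' ?_
      intro z hz
      obtain ⟨m, hm, rfl⟩ := (hK0 z).1 hz
      exact (hK0 _).2 ⟨y * m, mul_mem hy hm, rfl⟩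
    exact this
  have hPsp : IsStarProjection P := isStarProjection_starProjection
  have hPapp : ∀ v, ∀ ε > 0, ∃ a ∈ Q, ‖P v - a Ω‖ < ε := by
    intro v ε hε
    have h1 : P v ∈ K := K.starProjection_apply_mem v
    have h2 : P v ∈ closure (K0 : Set H) := h1
    obtain ⟨w, hw, hd⟩ := Metric.mem_closure_iff.1 h2 ε hε
    obtain ⟨m, hm, rfl⟩ := (hK0 w).1 hw
    exact ⟨m, hm, by rwa [← dist_eq_norm]⟩
  have hPΩ : P Ω = Ω := starProjection_eq_self_iff.2
    (K0.le_topologicalClosure ((hK0 _).2 ⟨1, one_mem _, rfl⟩))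
  -- nonvanishing
  have hnv : ∀ p ∈ Q.commutant, p ≠ 0 → ∃ R ∈ Q.commutant, P * R * p ≠ 0 := by
    intro p hp hp0
    by_contra hcon
    push Not at hcon
    apply hp0
    ext v
    have hz : ∀ R ∈ Q.commutant, ⟪R Ω, p v⟫ = 0 := by
      intro R hR
      have h1 := congrArg (fun f : 𝔹 => f v) (hcon (star R) (star_mem hR))
      have h2 : ⟪Ω, P (star R (p v))⟫ = 0 := by
        have : P (star R (p v)) = 0 := h1
        rw [this, inner_zero_right]
      rw [← proj_inner hPsp, hPΩ, star_inner_right] at h2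
      exact h2
    have h3 : ∀ ε > 0, ‖p v‖ ^ 2 ≤ ε * ‖p v‖ := by
      intro ε hε
      obtain ⟨m, hm, hme⟩ := commutant_cyclic hsep (p v) hε
      have e : ⟪p v, p v⟫ = ⟪p v - m Ω, p v⟫ := by rw [inner_sub_left, hz m hm, sub_zero]
      have e2 : ‖p v‖ ^ 2 = ‖⟪p v, p v⟫‖ := by
        rw [inner_sq]; norm_num
      rw [e2, e]
      refine (norm_inner_le_norm _ _).trans ?_
      gcongr
    by_contra hne
    have hpos : 0 < ‖p v‖ := norm_pos_iff.2 hne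
    have := h3 (‖p v‖ / 2) (by positivity)
    nlinarith
  obtain ⟨S, hS1, hS2, hS3⟩ := zorn_partition Q.commutant
    (fun q => ∃ θ ∈ Q.commutant, P * θ = θ ∧ star θ * θ = q) (by
      intro p hp hpp hp0
      obtain ⟨R, hR, hne⟩ := hnv p hp hp0
      obtain ⟨k, hk, e, he, hesp, he0, h1, h2, h3⟩ :=
        polar_lemma (mul_mem (mul_mem hPc hR) hp) hne
      refine ⟨e, he, hesp, he0, ?_, P * R * p * k, mul_mem (mul_mem (mul_mem hPc hR) hp) hk, ?_, h1⟩
      · apply h3 p hpp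
        rw [mul_assoc, hpp.isIdempotentElem.eq]
      · rw [← mul_assoc, ← mul_assoc, ← mul_assoc, hPsp.isIdempotentElem.eq])
  have hθ : ∀ q : S, ∃ θ ∈ Q.commutant, P * θ = θ ∧ star θ * θ = (q : 𝔹) := fun q => (hS1 q q.2).2.2.2
  choose θ hθ1 hθ2 hθ3 using hθ
  refine ⟨S, θ, hθ1, ?_, ?_⟩
  · intro k v ε hε
    have : θ k v = P (θ k v) := (congrArg (fun f : 𝔹 => f v) (hθ2 k)).symm
    rw [this]
    exact hPapp _ ε hε
  · intro v
    have h1 : ∀ k : S, ‖θ k v‖ ^ 2 = (⟪v, (k : 𝔹) v⟫).re := by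
      intro k
      rw [← hθ3 k, mul_apply_eq_comp, star_inner_right, inner_sq]; norm_cast
    have h2 : HasSum (fun k : S => ‖θ k v‖ ^ 2) (‖v‖ ^ 2) := by
      have h3 := Complex.hasSum_re ((hS3 v).mapL (innerSL ℂ v))
      simp only [innerSL_apply_apply] at h3
      have e2 : (⟪v, v⟫).re = ‖v‖ ^ 2 := by
        rw [inner_sq]; norm_cast
      rw [e2] at h3
      simpa only [h1] using h3
    rw [enorm_sq_ofReal, ← h2.tsum_eq, ENNReal.ofReal_tsum_of_nonneg (fun _ => by positivity) h2.summable]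
    congr 1; funext i; rw [enorm_sq_ofReal]

theorem casimir {Q : 𝔳𝔑} {Ω : H} (hsep : ∀ a ∈ Q, a Ω = 0 → a = 0)
    (B0 : StarSubalgebra ℂ 𝔹) (hf : FiniteDimensional ℂ B0) (hB0 : ∀ b ∈ B0, b ∈ Q) :
    ∃ (n : ℕ) (b : Fin n → 𝔹) (d : 𝔹), (∀ k, b k ∈ B0) ∧ d ∈ B0 ∧
      (∀ x ∈ B0, d * x = x * d) ∧ ((∑ k, b k * star (b k)) * d = 1) ∧
      ∀ x ∈ B0, ∃ m : Fin n → Fin n → ℂ, (∀ k, x * b k = ∑ l, m k l • b l) ∧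
        ∀ l, star (b l) * x = ∑ k, m k l • star (b k) := by
  let ev : 𝔹 →ₗ[ℂ] H :=
    { toFun := fun a => a Ω, map_add' := fun _ _ => rfl, map_smul' := fun _ _ => rfl }
  let B0s : Submodule ℂ 𝔹 := Subalgebra.toSubmodule B0.toSubalgebra
  have : FiniteDimensional ℂ B0s := hf
  let W : Submodule ℂ H := B0s.map ev
  have hW : ∀ w, w ∈ W ↔ ∃ a ∈ B0, a Ω = w := fun w => Submodule.mem_map
  have : FiniteDimensional ℂ W := inferInstance
  let f := stdOrthonormalBasis ℂ W
  have hfb : ∀ k, ∃ a ∈ B0, a Ω = (f k : H) := fun k => (hW _).1 (f k).2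
  choose b hbB hbf using hfb
  have hexp : ∀ y ∈ B0, y = ∑ l, ⟪b l Ω, y Ω⟫ • b l := by
    intro y hy
    have hyW : y Ω ∈ W := (hW _).2 ⟨y, hy, rfl⟩
    have h1 := congrArg (fun w : W => (w : H)) (f.sum_repr' ⟨y Ω, hyW⟩)
    simp only [Submodule.coe_sum, Submodule.coe_smul, Submodule.coe_inner] at h1
    rw [← sub_eq_zero]
    apply hsep
    · exact sub_mem (hB0 y hy) (sum_mem fun l _ => smul_mem' _ (hB0 _ (hbB l)))
    · rw [sub_apply, sum_apply, sub_eq_zero]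
      simp only [smul_apply, hbf]
      exact h1.symm
  have hm : ∀ x ∈ B0, ∃ m : Fin (Module.finrank ℂ W) → Fin (Module.finrank ℂ W) → ℂ,
      (∀ k, x * b k = ∑ l, m k l • b l) ∧ ∀ l, star (b l) * x = ∑ k, m k l • star (b k) := by
    intro x hx
    refine ⟨fun k l => ⟪b l Ω, (x * b k) Ω⟫, fun k => hexp _ (mul_mem hx (hbB k)), fun l => ?_⟩
    have h1 := hexp _ (mul_mem (star_mem hx) (hbB l))
    have h2 := congrArg star h1
    rw [star_mul, star_star, star_sum] at h2
    rw [h2]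
    refine sum_congr rfl fun k _ => ?_
    rw [star_smul]
    congr 1
    rw [Complex.star_def, inner_conj_symm, mul_apply_eq_comp, star_inner_left]; rfl
  set c := ∑ k, b k * star (b k) with hc
  have hcB : c ∈ B0 := sum_mem fun k _ => mul_mem (hbB k) (star_mem (hbB k))
  have hcc : ∀ x ∈ B0, x * c = c * x := by
    intro x hx
    obtain ⟨m, h1, h2⟩ := hm x hx
    rw [hc, mul_sum, sum_mul]
    simp only [← mul_assoc, h1]
    simp only [mul_assoc, h2]
    simp only [sum_mul, mul_sum]
    rw [sum_comm]
    refine sum_congr rfl fun k _ => sum_congr rfl fun l _ => ?_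
    rw [smul_mul_assoc, mul_smul_comm]
  have hinj : ∀ v, c v = 0 → v = 0 := by
    intro v hv
    have h0 : ∑ k, ‖star (b k) v‖ ^ 2 = 0 := by
      have h1 : (⟪c v, v⟫).re = ∑ k, ‖star (b k) v‖ ^ 2 := by
        rw [hc, sum_apply, sum_inner, Complex.re_sum]
        refine sum_congr rfl fun k _ => ?_
        rw [mul_apply_eq_comp]
        have := star_inner_right (b k) (star (b k) v) v
        rw [← this, inner_sq]; norm_cast
      rw [← h1, hv, inner_zero_left]; rfl
    have h2 : ∀ k, star (b k) v = 0 := by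
      intro k
      have := (Finset.sum_eq_zero_iff_of_nonneg (fun k _ => by positivity)).1 h0 k (Finset.mem_univ _)
      simpa using this
    have h3 := congrArg star (hexp 1 (one_mem _))
    rw [star_one, star_sum] at h3
    have h4 := congrArg (fun g : 𝔹 => g v) h3
    simp only [sum_apply, star_smul, smul_apply, h2, smul_zero, sum_const_zero] at h4
    exact h4
  have hinj2 : ∀ y : 𝔹, c * y = 0 → y = 0 := by
    intro y hy
    ext v
    exact hinj _ (congrArg (fun g : 𝔹 => g v) hy)
  let Lc : B0s →ₗ[ℂ] B0s := (LinearMap.mulLeft ℂ c).restrict (fun y hy => mul_mem (s := B0) hcB hy)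
  have hLc : Function.Injective Lc := by
    rw [injective_iff_map_eq_zero]
    intro y hy
    have h1 : c * (y : 𝔹) = 0 := congrArg Subtype.val hy
    exact Subtype.ext (hinj2 _ h1)
  obtain ⟨⟨d, hd⟩, hdc⟩ := LinearMap.surjective_of_injective hLc ⟨1, one_mem B0⟩
  have hcd : c * d = 1 := congrArg Subtype.val hdc
  have hdB : d ∈ B0 := hd
  refine ⟨_, b, d, hbB, hdB, ?_, hcd, hm⟩
  intro x hx
  rw [← sub_eq_zero]
  apply hinj2
  rw [mul_sub, ← mul_assoc, ← mul_assoc, hcd, ← hcc x hx, mul_assoc, hcd, one_mul, mul_one, sub_self]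

theorem small_mul (C κ : ℝ≥0∞) (hC : C ≠ ∞) (hκ : κ ≠ 0) : ∃ x : ℝ≥0∞, x ≠ 0 ∧ x ≠ ∞ ∧ ∀ y ≤ x, C * y ≤ κ := by
  by_cases hκi : κ = ∞
  · exact ⟨1, one_ne_zero, ENNReal.one_ne_top, fun y _ => by rw [hκi]; exact le_top⟩
  refine ⟨κ / (C + 1), ?_, ?_, ?_⟩
  · exact (ENNReal.div_pos hκ (by simp [hC])).ne'
  · exact ENNReal.div_ne_top hκi (by simp)
  · intro y hy
    calc C * y ≤ (C + 1) * (κ / (C + 1)) := mul_le_mul' le_self_add hy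
      _ = κ := ENNReal.mul_div_cancel (by simp) (by simp [hC])

theorem pick_ratio {K : Type*} (f g : K → ℝ≥0∞) (δ : ℝ≥0∞) (hδ : δ ≠ 0) (hδ' : δ ≠ ∞)
    (hg0 : ∑' k, g k ≠ 0) (hgi : ∑' k, g k ≠ ∞) (h : ∑' k, f k ≤ δ * ∑' k, g k) :
    ∃ k, g k ≠ 0 ∧ f k ≤ 2 * δ * g k := by
  by_contra hcon
  push Not at hcon
  have h1 : ∀ k, 2 * δ * g k ≤ f k := by
    intro k
    by_cases hk : g k = 0
    · rw [hk, mul_zero]; exact zero_le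
    · exact (hcon k hk).le
  have h2 : 2 * (δ * ∑' k, g k) ≤ δ * ∑' k, g k := by
    refine le_trans ?_ h
    rw [← mul_assoc, ← ENNReal.tsum_mul_left]
    exact ENNReal.tsum_le_tsum h1
  have h3 : δ * ∑' k, g k ≠ 0 := mul_ne_zero hδ hg0
  have h4 : δ * ∑' k, g k ≠ ∞ := mul_ne_top hδ' hgi
  rw [two_mul] at h2
  have h5 : δ * ∑' k, g k < δ * ∑' k, g k + δ * ∑' k, g k := ENNReal.lt_add_right h4 h3
  exact absurd h2 (not_le.2 h5)

theorem hs_onb_le {ι : Type*} (b : HilbertBasis ι ℂ H) {n : ℕ} (e : Fin n → H) (he : Orthonormal ℂ e)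
    (T : 𝔹) : ∑ j, ‖T (e j)‖ₑ ^ 2 ≤ hs b T := by
  obtain ⟨w, b', hw, hb'⟩ := he.toSubtypeRange.exists_hilbertBasis_extension
  rw [hs_basis b b']
  unfold hs
  let g : Fin n → w := fun j => ⟨e j, hw (Set.mem_range_self j)⟩
  have hg : Function.Injective g := fun i j h => he.linearIndependent.injective (congrArg Subtype.val h)
  have := ENNReal.tsum_comp_le_tsum_of_injective hg (fun x : w => ‖T (b' x)‖ₑ ^ 2)
  rw [tsum_fintype] at this
  simpa only [hb'] using this

theorem hs_onb_eq {ι : Type*} (b : HilbertBasis ι ℂ H) {n : ℕ} (e : Fin n → H) (he : Orthonormal ℂ e)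
    (T : 𝔹) (hT : ∀ v, (∀ j, ⟪e j, v⟫ = 0) → T v = 0) : hs b T ≤ ∑ j, ‖T (e j)‖ₑ ^ 2 := by
  obtain ⟨w, b', hw, hb'⟩ := he.toSubtypeRange.exists_hilbertBasis_extension
  rw [hs_basis b b']
  unfold hs
  let g : Fin n → w := fun j => ⟨e j, hw (Set.mem_range_self j)⟩
  have hg : Function.Injective g := fun i j h => he.linearIndependent.injective (congrArg Subtype.val h)
  have h2 : Function.support (fun x : w => ‖T (b' x)‖ₑ ^ 2) ⊆ Set.range g := by
    intro x hx
    by_contra hcon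
    apply hx
    have : T (b' x) = 0 := by
      apply hT
      intro j
      have h3 := b'.orthonormal.2 (i := g j) (j := x) (fun h => hcon ⟨j, h⟩)
      rw [hb'] at h3 ⊢
      exact h3
    simp [this]
  rw [← hg.tsum_eq h2, tsum_fintype]
  simp only [hb', g]; exact le_rfl

/-- averaging -/
def avg {n : ℕ} (bk : Fin n → 𝔹) (d : 𝔹) (A : 𝔹) : 𝔹 :=
  ∑ k, bk k * A * (star (bk k) * d)

theorem hs_mul_le {ι : Type*} (b : HilbertBasis ι ℂ H) (x T y : 𝔹) :
    hs b (x * T * y) ≤ ‖x‖ₑ ^ 2 * ‖y‖ₑ ^ 2 * hs b T := by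
  have h1 := hs_right b b (x * T) y
  have h2 := hs_left b x T
  calc hs b (x * T * y) ≤ ‖y‖ₑ ^ 2 * hs b (x * T) := h1
    _ ≤ ‖y‖ₑ ^ 2 * (‖x‖ₑ ^ 2 * hs b T) := mul_le_mul_right h2 _
    _ = _ := by ring

theorem avg_bound {ι : Type*} (b : HilbertBasis ι ℂ H) {n : ℕ} (bk : Fin n → 𝔹) (d : 𝔹) :
    ∃ C : ℝ≥0∞, C ≠ ∞ ∧ (∀ A, hs b (avg bk d A) ≤ C * hs b A) ∧
      ((∑ k, bk k * star (bk k)) * d = 1 → ∀ T, ∀ h : ℝ≥0∞, (∀ k, hs b (bk k * T - T * bk k) ≤ h) →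
        hs b (T - avg bk d T) ≤ C * h) := by
  refine ⟨(n : ℝ≥0∞) * (∑ k, ‖bk k‖ₑ ^ 2 * ‖star (bk k) * d‖ₑ ^ 2) + (n : ℝ≥0∞) * (∑ k, ‖star (bk k) * d‖ₑ ^ 2),
    ?_, ?_, ?_⟩
  · refine ENNReal.add_ne_top.2 ⟨mul_ne_top (ENNReal.natCast_ne_top n) ?_, mul_ne_top (ENNReal.natCast_ne_top n) ?_⟩
    · exact ENNReal.sum_ne_top.2 fun k _ => mul_ne_top (ENNReal.pow_ne_top enorm_ne_top) (ENNReal.pow_ne_top enorm_ne_top)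
    · exact ENNReal.sum_ne_top.2 fun k _ => ENNReal.pow_ne_top enorm_ne_top
  · intro A
    refine le_trans ?_ (mul_le_mul_left le_self_add _)
    refine (hs_sum b _ _).trans ?_
    rw [card_univ, Fintype.card_fin, mul_assoc, sum_mul]
    gcongr with k
    exact hs_mul_le b _ _ _
  · intro h1 T h hh
    refine le_trans ?_ (mul_le_mul_left le_add_self _)
    have e : T - avg bk d T = ∑ k, (-(bk k * T - T * bk k)) * (star (bk k) * d) := by
      have h2 : T = T * ((∑ k, bk k * star (bk k)) * d) := by rw [h1, mul_one]
      have h3 : T - avg bk d T = T * ((∑ k, bk k * star (bk k)) * d) - avg bk d T := by rw [← h2]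
      rw [h3]
      unfold avg
      rw [sum_mul, mul_sum, ← sum_sub_distrib]
      refine sum_congr rfl fun k _ => ?_
      noncomm_ring
    rw [e]
    refine (hs_sum b _ _).trans ?_
    rw [card_univ, Fintype.card_fin, mul_assoc, sum_mul]
    gcongr with k
    refine (hs_right b b _ _).trans ?_
    rw [hs_neg]
    gcongr
    exact hh k

/-- finite rank approximation of a Hilbert-Schmidt operator with values in `closure (Q Ω)` -/
theorem finrank_approx {Q : 𝔳𝔑} {Ω : H} {ι : Type*} (b : HilbertBasis ι ℂ H) (T : 𝔹)
    (hT : hs b T ≠ ∞) (hr : ∀ v, ∀ ε > 0, ∃ a ∈ Q, ‖T v - a Ω‖ < ε) {η : ℝ≥0∞} (hη : η ≠ 0) :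
    ∃ (s : Finset ι) (a : ι → 𝔹), (∀ i, a i ∈ Q) ∧
      hs b (T - ∑ i ∈ s, (innerSL ℂ (b i)).smulRight (a i Ω)) ≤ η := by
  classical
  have hη2 : η / 2 ≠ 0 := (ENNReal.div_pos hη (by simp)).ne'
  have ht := ENNReal.tendsto_tsum_compl_atTop_zero hT
  obtain ⟨s, hs1⟩ := ((ENNReal.tendsto_nhds_zero.1 ht) (η / 2) (pos_iff_ne_zero.2 hη2)).exists
  obtain ⟨x, hx0, hxi, hx⟩ := small_mul (s.card : ℝ≥0∞) (η / 2) (ENNReal.natCast_ne_top _) hη2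
  have hxr : 0 < x.toReal := ENNReal.toReal_pos hx0 hxi
  have hch : ∀ i, ∃ a ∈ Q, ‖T (b i) - a Ω‖ < Real.sqrt x.toReal := fun i => hr _ _ (Real.sqrt_pos.2 hxr)
  choose a haQ ha using hch
  refine ⟨s, a, haQ, ?_⟩
  have hval : ∀ i, (T - ∑ i ∈ s, (innerSL ℂ (b i)).smulRight (a i Ω)) (b i)
      = if i ∈ s then T (b i) - a i Ω else T (b i) := by
    intro i
    rw [sub_apply, sum_apply]
    have h1 : ∀ j, ((innerSL ℂ (b j)).smulRight (a j Ω)) (b i) = if j = i then a j Ω else 0 := by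
      intro j
      rw [smulRight_apply, innerSL_apply_apply]
      have := orthonormal_iff_ite.1 b.orthonormal j i
      rw [this]; split_ifs <;> simp
    rw [sum_congr rfl fun j _ => h1 j, Finset.sum_ite_eq']
    split_ifs <;> simp
  have hsplit : ∀ f : ι → ℝ≥0∞, ∑' i, f i = ∑ i ∈ s, f i + ∑' i : {i // i ∉ s}, f i := by
    intro f
    have h1 := Summable.tsum_add_tsum_compl (f := f) (s := (s : Set ι)) ENNReal.summable ENNReal.summable
    have h2 : ∑' x : (s : Set ι), f x = ∑ i ∈ s, f i := Finset.tsum_subtype' s f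
    rw [h2] at h1
    exact h1.symm
  unfold hs
  rw [hsplit]
  have e1 : ∑ i ∈ s, ‖(T - ∑ i ∈ s, (innerSL ℂ (b i)).smulRight (a i Ω)) (b i)‖ₑ ^ 2 ≤ η / 2 := by
    refine le_trans ?_ (hx x le_rfl)
    rw [← nsmul_eq_mul]
    refine sum_le_card_nsmul _ _ _ fun i hi => ?_
    rw [hval, if_pos hi, enorm_sq_ofReal, ← ENNReal.ofReal_toReal hxi]
    apply ofReal_le_ofReal
    have := (ha i).le
    calc ‖T (b i) - a i Ω‖ ^ 2 ≤ (Real.sqrt x.toReal) ^ 2 := pow_le_pow_left₀ (norm_nonneg _) this 2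
      _ = _ := Real.sq_sqrt hxr.le
  have e2 : ∑' i : {i // i ∉ s}, ‖(T - ∑ i ∈ s, (innerSL ℂ (b i)).smulRight (a i Ω)) (b i)‖ₑ ^ 2 ≤ η / 2 := by
    refine le_trans (le_of_eq ?_) hs1
    congr 1; funext i
    rw [hval, if_neg i.2]
  calc _ ≤ η / 2 + η / 2 := add_le_add e1 e2
    _ = η := ENNReal.add_halves η

theorem pick_theta {Q : 𝔳𝔑} {Ω : H} (hsep : ∀ a ∈ Q, a Ω = 0 → a = 0) {ι : Type*}
    (b : HilbertBasis ι ℂ H) (F : Finset (𝔹)) (hF : ∀ x ∈ F, x ∈ Q) {r : 𝔹} (hr : r ∈ Q)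
    (T : 𝔹) (hT : hs b T ≠ ∞) (hT0 : hs b (r * T) ≠ 0) {δ : ℝ≥0∞} (hδ : δ ≠ 0) (hδi : δ ≠ ∞)
    (h : ∑ x ∈ F, hs b (x * T - T * x) ≤ δ * hs b (r * T)) :
    ∃ T' : 𝔹, hs b T' ≠ ∞ ∧ hs b (r * T') ≠ 0 ∧
      ∑ x ∈ F, hs b (x * T' - T' * x) ≤ 2 * δ * hs b (r * T') ∧
      ∀ v, ∀ ε > 0, ∃ a ∈ Q, ‖T' v - a Ω‖ < ε := by
  obtain ⟨S, θ, h1, h2, h3⟩ := theta_family hsep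
  have hfin : ∀ a : 𝔹, hs b (a * T) ≠ ∞ := fun a =>
    ne_top_of_le_ne_top (mul_ne_top (ENNReal.pow_ne_top enorm_ne_top) hT) (hs_left b a T)
  have hsp : ∀ X : 𝔹, ∑' k, hs b (θ k * X) = hs b X := fun X => hs_split b θ h3 X
  have hcr : ∀ k, r * (θ k * T) = θ k * (r * T) := fun k => by
    rw [← mul_assoc, comm_of_mem hr (h1 k), mul_assoc]
  have hcx : ∀ k, ∀ x ∈ F, x * (θ k * T) - θ k * T * x = θ k * (x * T - T * x) := fun k x hx => by
    rw [← mul_assoc, comm_of_mem (hF x hx) (h1 k), mul_sub, mul_assoc, mul_assoc]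
  obtain ⟨k, hk0, hk⟩ := pick_ratio (fun k => ∑ x ∈ F, hs b (x * (θ k * T) - θ k * T * x))
    (fun k => hs b (r * (θ k * T))) δ hδ hδi
    (by simp only [hcr, hsp]; exact hT0) (by simp only [hcr, hsp]; exact hfin r)
    (by
      simp only [hcr, hsp]
      refine le_trans (le_of_eq ?_) h
      rw [Summable.tsum_finsetSum (fun _ _ => ENNReal.summable)]
      refine sum_congr rfl fun x hx => ?_
      simp only [hcx _ x hx, hsp])
  exact ⟨θ k * T, hfin _, hk0, hk, fun v => h2 k (T v)⟩

set_option maxHeartbeats 800000 in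
theorem HI_of_PropP {Q : 𝔳𝔑} {Ω : H} (hsep : ∀ a ∈ Q, a Ω = 0 → a = 0) {ι : Type*}
    (b : HilbertBasis ι ℂ H) (hP : PropP Q b) : HI Q Ω := by
  classical
  intro B0 hf hB0 r hrQ hr hr0 hrB U _ V hVQ hVr hV1 hV2 δ hδ
  obtain ⟨n, bk, d, hbB, hdB, hdc, hcd, hm⟩ := casimir hsep B0 hf hB0
  obtain ⟨C, hC, hCa, hCb⟩ := avg_bound b bk d
  have hCb := hCb hcd
  set δE := ENNReal.ofReal δ with hδE
  have hδE0 : δE ≠ 0 := (ENNReal.ofReal_pos.2 hδ).ne'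
  set c : ℝ≥0∞ := (Fintype.card U : ℝ≥0∞) with hc
  have hci : c ≠ ∞ := ENNReal.natCast_ne_top _
  have hδ2 : δE / 2 ≠ 0 := (ENNReal.div_pos hδE0 (by simp)).ne'
  have h14 : (1 / 4 : ℝ≥0∞) ≠ 0 := by simp
  -- κ
  obtain ⟨κ1, hκ1, hκ1i, hκ1'⟩ := small_mul (c * 32) (δE / 2) (mul_ne_top hci (by simp)) hδ2
  set κ := min κ1 (1 / 4) with hκ
  have hκ0 : κ ≠ 0 := by
    rw [hκ]; exact (lt_min (pos_iff_ne_zero.2 hκ1) (pos_iff_ne_zero.2 h14)).ne'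
  have hκi : κ ≠ ∞ := ne_top_of_le_ne_top hκ1i (min_le_left _ _)
  have hκ2 : κ / 2 ≠ 0 := (ENNReal.div_pos hκ0 (by simp)).ne'
  obtain ⟨d1, hd1, hd1i, hd1'⟩ := small_mul (c * 16) (δE / 2) (mul_ne_top hci (by simp)) hδ2
  obtain ⟨d2, hd2, hd2i, hd2'⟩ := small_mul (4 * C) (κ / 2) (mul_ne_top (by simp) hC) hκ2
  obtain ⟨η, hη, hηi, hη'⟩ := small_mul (2 * C) (κ / 2) (mul_ne_top (by simp) hC) hκ2
  set δ' := min d1 d2 with hδ'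
  have hδ'0 : δ' ≠ 0 := by
    rw [hδ']; exact (lt_min (pos_iff_ne_zero.2 hd1) (pos_iff_ne_zero.2 hd2)).ne'
  have hδ'i : δ' ≠ ∞ := ne_top_of_le_ne_top hd1i (min_le_left _ _)
  let F : Finset (𝔹) := Finset.univ.image V ∪ Finset.univ.image bk
  have hFQ : ∀ x ∈ F, x ∈ Q := by
    intro x hx
    simp only [F, Finset.mem_union, Finset.mem_image, Finset.mem_univ, true_and] at hx
    rcases hx with ⟨u, rfl⟩ | ⟨k, rfl⟩
    · exact hVQ u
    · exact hB0 _ (hbB k)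
  have hFV : ∀ u, V u ∈ F := fun u => by simp [F]
  have hFb : ∀ k, bk k ∈ F := fun k => by simp [F]
  obtain ⟨T0, hT0i, hT00, hT0⟩ := hP F hFQ r hrQ hr hr0 δ' hδ'0
  obtain ⟨T, hTi, hTr0, hTF, hTa⟩ := pick_theta hsep b F hFQ hrQ T0 hT0i hT00 hδ'0 hδ'i hT0
  set N := hs b (r * T) with hN
  have hrn : ‖r‖ₑ ≤ 1 := by
    rw [← ofReal_norm]; exact ofReal_le_one.2 (norm_proj_le hr)
  have hrle : ∀ X, hs b (r * X) ≤ hs b X := fun X => by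
    refine (hs_left b r X).trans ?_
    calc ‖r‖ₑ ^ 2 * hs b X ≤ 1 * hs b X := mul_le_mul_left (pow_le_one' hrn 2) _
      _ = _ := one_mul _
  have hNi : N ≠ ∞ := ne_top_of_le_ne_top hTi (hrle T)
  have hVn : ∀ u, ‖V u‖ₑ ≤ 1 := fun u => by
    rw [← ofReal_norm]
    refine ofReal_le_one.2 (opNorm_le_bound _ zero_le_one fun v => ?_)
    rw [hV1, one_mul]
  have hcomm : ∀ x ∈ F, hs b (x * T - T * x) ≤ 2 * δ' * N := fun x hx =>
    le_trans (single_le_sum (f := fun x => hs b (x * T - T * x)) (fun _ _ => zero_le) hx) hTF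
  obtain ⟨s, a0, ha0Q, ha0⟩ := finrank_approx b T hTi hTa (η := η * N) (mul_ne_zero hη hTr0)
  set A0 := ∑ i ∈ s, (innerSL ℂ (b i)).smulRight (a0 i Ω) with hA0
  set A1 := avg bk d A0 with hA1
  have hD : hs b (T - A1) ≤ κ * N := by
    have e : T - A1 = (T - avg bk d T) + avg bk d (T - A0) := by
      rw [hA1]; unfold avg
      simp only [mul_sub, sub_mul, sum_sub_distrib]; abel
    rw [e]
    refine (hs_add b _ _).trans ?_
    calc 2 * hs b (T - avg bk d T) + 2 * hs b (avg bk d (T - A0))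
        ≤ 2 * (C * (2 * δ' * N)) + 2 * (C * (η * N)) := by
          gcongr
          · exact hCb T _ fun k => hcomm _ (hFb k)
          · exact (hCa _).trans (by gcongr)
      _ = (4 * C * δ') * N + (2 * C * η) * N := by ring
      _ ≤ (κ / 2) * N + (κ / 2) * N := by
          gcongr
          · exact hd2' _ (min_le_right _ _)
          · exact hη' _ le_rfl
      _ = κ * N := by rw [← add_mul, ENNReal.add_halves]
  have hN4 : N ≤ 4 * hs b (r * A1) := by
    have e : r * T = r * A1 + r * (T - A1) := by rw [mul_sub]; abel
    have h1 : N ≤ 2 * hs b (r * A1) + N / 2 := by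
      calc N ≤ 2 * hs b (r * A1) + 2 * hs b (r * (T - A1)) := by rw [hN, e]; exact hs_add b _ _
        _ ≤ 2 * hs b (r * A1) + 2 * (1 / 4 * N) := by
            gcongr
            exact (hrle _).trans (hD.trans (by gcongr; exact min_le_right _ _))
        _ = _ := by
            congr 1
            have h24 : (2 : ℝ≥0∞) * (1 / 4) = 2⁻¹ := by
              rw [one_div, show (4 : ℝ≥0∞) = 2 * 2 by norm_num, ENNReal.mul_inv (by simp) (by simp), ← mul_assoc,
                ENNReal.mul_inv_cancel (by simp) (by simp), one_mul]
            rw [← mul_assoc, h24, mul_comm]; rfl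
    have h2 : N / 2 ≤ 2 * hs b (r * A1) := by
      have h3 : N / 2 + N / 2 ≤ 2 * hs b (r * A1) + N / 2 := by rw [ENNReal.add_halves]; exact h1
      exact (ENNReal.add_le_add_iff_right (ENNReal.div_ne_top hNi (by simp))).1 h3
    calc N = N / 2 + N / 2 := (ENNReal.add_halves N).symm
      _ ≤ 2 * hs b (r * A1) + 2 * hs b (r * A1) := add_le_add h2 h2
      _ = _ := by ring
  have hVc : ∀ u, hs b (V u * (r * A1) - r * A1 * V u) ≤ (4 * δ' + 8 * κ) * N := by
    intro u
    have e1 : V u * (r * A1) - r * A1 * V u = r * (V u * A1 - A1 * V u) := by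
      rw [← mul_assoc, hVr, mul_sub, mul_assoc, mul_assoc]
    have e2 : V u * A1 - A1 * V u = (V u * T - T * V u) - (V u * (T - A1) - (T - A1) * V u) := by
      rw [mul_sub, sub_mul]; abel
    have hu2 : ‖V u‖ₑ ^ 2 ≤ 1 := pow_le_one' (hVn u) 2
    have h1 : hs b (V u * (T - A1)) ≤ κ * N :=
      (hs_left b _ _).trans ((mul_le_mul_left hu2 _).trans (by rw [one_mul]; exact hD))
    have h2 : hs b ((T - A1) * V u) ≤ κ * N :=
      (hs_right b b _ _).trans ((mul_le_mul_left hu2 _).trans (by rw [one_mul]; exact hD))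
    rw [e1]
    refine (hrle _).trans ?_
    rw [e2]
    calc _ ≤ 2 * hs b (V u * T - T * V u) + 2 * hs b (V u * (T - A1) - (T - A1) * V u) := hs_sub b _ _
      _ ≤ 2 * (2 * δ' * N) + 2 * (2 * (κ * N) + 2 * (κ * N)) := by
          gcongr
          · exact hcomm _ (hFV u)
          · exact (hs_sub b _ _).trans (by gcongr)
      _ = _ := by ring
  have hsum : ∑ u, hs b (V u * (r * A1) - r * A1 * V u) ≤ δE * hs b (r * A1) := by
    calc ∑ u, hs b (V u * (r * A1) - r * A1 * V u) ≤ ∑ _u : U, (4 * δ' + 8 * κ) * N :=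
          sum_le_sum fun u _ => hVc u
      _ = c * ((4 * δ' + 8 * κ) * N) := by rw [sum_const, card_univ, nsmul_eq_mul]
      _ ≤ c * ((4 * δ' + 8 * κ) * (4 * hs b (r * A1))) := by gcongr
      _ = (c * 16 * δ' + c * 32 * κ) * hs b (r * A1) := by ring
      _ ≤ (δE / 2 + δE / 2) * hs b (r * A1) := by
          gcongr
          · exact hd1' _ (min_le_left _ _)
          · exact hκ1' _ (min_le_left _ _)
      _ = _ := by rw [ENNReal.add_halves]
  -- the linear map
  let w : Fin n × ι → H := fun p => star (star (bk p.1) * d) (b p.2)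
  let L0 : Submodule ℂ H := Submodule.span ℂ (w '' ((Finset.univ ×ˢ s : Finset (Fin n × ι)) : Set (Fin n × ι)))
  have hL0f : FiniteDimensional ℂ L0 := FiniteDimensional.span_of_finite ℂ ((Finset.finite_toSet _).image _)
  let a : H →ₗ[ℂ] (𝔹) := ∑ k, ∑ i ∈ s,
    LinearMap.smulRight (((innerSL ℂ (b i)) ∘L (star (bk k) * d) : H →L[ℂ] ℂ) : H →ₗ[ℂ] ℂ) (r * bk k * a0 i)
  have ha : ∀ v, a v = ∑ k, ∑ i ∈ s, ⟪b i, (star (bk k) * d) v⟫ • (r * bk k * a0 i) := by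
    intro v
    simp only [a, LinearMap.sum_apply, LinearMap.smulRight_apply]
    rfl
  have haΩ : ∀ v, a v Ω = (r * A1) v := by
    intro v
    rw [ha, mul_apply_eq_comp, hA1]
    unfold avg
    simp only [sum_apply, smul_apply, map_sum]
    refine sum_congr rfl fun k _ => ?_
    have hh : r ((bk k * A0 * (star (bk k) * d)) v) = r (bk k (A0 ((star (bk k) * d) v))) := rfl
    rw [hh, hA0, sum_apply, map_sum, map_sum]
    refine sum_congr rfl fun i _ => ?_
    rw [smulRight_apply, map_smul, map_smul]
    rfl
  let e0 := stdOrthonormalBasis ℂ L0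
  have he0 : Orthonormal ℂ (fun j => (e0 j : H)) := e0.orthonormal.comp_linearIsometry L0.subtypeₗᵢ
  have hL0z : ∀ v ∈ L0ᗮ, a v = 0 := by
    intro v hv
    rw [ha]
    refine sum_eq_zero fun k _ => sum_eq_zero fun i hi => ?_
    have h1 : w (k, i) ∈ L0 := subset_span ⟨(k, i), by simpa using hi, rfl⟩
    have h2 : ⟪w (k, i), v⟫ = 0 := (mem_orthogonal _ _).1 hv _ h1
    simp only [w] at h2
    rw [star_inner_left] at h2
    rw [h2, zero_smul]
  have hA1z : ∀ v, (∀ j, ⟪(e0 j : H), v⟫ = 0) → (r * A1) v = 0 := by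
    intro v hv
    rw [← haΩ, hL0z v, zero_apply]
    rw [mem_orthogonal]
    intro x hx
    have h1 := congrArg (fun y : L0 => (y : H)) (e0.sum_repr ⟨x, hx⟩)
    simp only [Submodule.coe_sum, Submodule.coe_smul] at h1
    rw [← h1, sum_inner]
    refine sum_eq_zero fun j _ => ?_
    rw [inner_smul_left, hv, mul_zero]
  have hNle := hs_onb_eq b _ he0 (r * A1) hA1z
  refine ⟨L0, hL0f, _, e0, a, ?_, ?_, hL0z, ?_, ?_, ?_⟩
  · intro v
    rw [ha]
    exact sum_mem fun k _ => sum_mem fun i _ => smul_mem' _ (mul_mem (mul_mem hrQ (hB0 _ (hbB k))) (ha0Q i))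
  · intro v
    rw [ha]
    simp only [mul_sum, mul_smul_comm, ← mul_assoc, hr.isIdempotentElem.eq]
  · intro x hx v
    have hx' : x ∈ B0 := hx
    obtain ⟨m, hm1, hm2⟩ := hm x hx'
    have e1 : ∀ k i, x * (r * bk k * a0 i) = ∑ l, m k l • (r * bk l * a0 i) := by
      intro k i
      rw [← mul_assoc, ← mul_assoc, hrB x hx', mul_assoc r, hm1, mul_sum, sum_mul]
      simp only [mul_smul_comm, smul_mul_assoc]
    have e2 : ∀ l i, ⟪b i, (star (bk l) * d) (x v)⟫ = ∑ k, m k l * ⟪b i, (star (bk k) * d) v⟫ := by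
      intro l i
      have : (star (bk l) * d) (x v) = ∑ k, m k l • (star (bk k) * d) v := by
        rw [← mul_apply_eq_comp, mul_assoc, hdc x hx', ← mul_assoc, hm2, sum_mul, sum_apply]
        simp only [smul_mul_assoc, smul_apply]
      rw [this, inner_sum]
      simp only [inner_smul_right]
    rw [ha, ha]
    simp only [mul_sum, mul_smul_comm, e1, e2, smul_sum, Finset.sum_smul]
    -- reorder
    have l1 : ∑ k, ∑ i ∈ s, ∑ l, ⟪b i, (star (bk k) * d) v⟫ • m k l • (r * bk l * a0 i)
        = ∑ k, ∑ l, ∑ i ∈ s, ⟪b i, (star (bk k) * d) v⟫ • m k l • (r * bk l * a0 i) :=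
      sum_congr rfl fun k _ => sum_comm
    have l2 : ∑ l, ∑ i ∈ s, ∑ k, (m k l * ⟪b i, (star (bk k) * d) v⟫) • (r * bk l * a0 i)
        = ∑ l, ∑ k, ∑ i ∈ s, (m k l * ⟪b i, (star (bk k) * d) v⟫) • (r * bk l * a0 i) :=
      sum_congr rfl fun k _ => sum_comm
    rw [l1, l2, sum_comm]
    refine sum_congr rfl fun l _ => sum_congr rfl fun k _ => sum_congr rfl fun i _ => ?_
    rw [smul_smul, mul_comm]
  · by_contra hcon
    push Not at hcon
    have : hs b (r * A1) = 0 := by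
      rw [hs_eq_zero]; ext v; rw [← haΩ, hcon]; rfl
    rw [this, mul_zero] at hN4
    exact hTr0 (le_antisymm hN4 zero_le)
  · have h1 : ∀ u, ∑ j, ‖(V u * a (e0 j) - a (V u (e0 j))) Ω‖ₑ ^ 2 ≤ hs b (V u * (r * A1) - r * A1 * V u) := by
      intro u
      refine le_trans (le_of_eq ?_) (hs_onb_le b _ he0 _)
      refine sum_congr rfl fun j _ => ?_
      rw [sub_apply, sub_apply, mul_apply_eq_comp, haΩ, haΩ]
      rfl
    have h2 : ∑ u, ∑ j, ‖(V u * a (e0 j) - a (V u (e0 j))) Ω‖ₑ ^ 2 ≤ δE * ∑ j, ‖a (e0 j) Ω‖ₑ ^ 2 := by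
      refine (sum_le_sum fun u _ => h1 u).trans (hsum.trans ?_)
      gcongr
      simpa only [haΩ] using hNle
    simp only [enorm_sq_ofReal] at h2
    have h3 : ∀ u, ∑ j, ENNReal.ofReal (‖(V u * a (e0 j) - a (V u (e0 j))) Ω‖ ^ 2)
        = ENNReal.ofReal (∑ j, ‖(V u * a (e0 j) - a (V u (e0 j))) Ω‖ ^ 2) := fun u =>
      (ofReal_sum_of_nonneg fun _ _ => by positivity).symm
    rw [sum_congr rfl fun u _ => h3 u, ← ofReal_sum_of_nonneg (fun _ _ => by positivity),
      ← ofReal_sum_of_nonneg (fun _ _ => by positivity), hδE, ← ENNReal.ofReal_mul hδ.le] at h2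
    exact (ofReal_le_ofReal_iff (by positivity)).1 h2

theorem relComm_vn (Mw : 𝔳𝔑) (D : Set 𝔹) (hD : ∀ x ∈ D, star x ∈ D) :
    ∃ C : 𝔳𝔑, ∀ z, z ∈ C ↔ z ∈ relComm Mw D := by
  let s : Set 𝔹 := (Mw.commutant : Set 𝔹) ∪ D
  have hs : ∀ x ∈ s, star x ∈ s := by
    rintro x (hx | hx)
    · exact Or.inl (star_mem (S := 𝔳𝔑) hx)
    · exact Or.inr (hD x hx)
  let A : StarSubalgebra ℂ 𝔹 := StarSubalgebra.centralizer ℂ s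
  have hA : (A : Set 𝔹) = (s ∪ star s).centralizer := StarSubalgebra.coe_centralizer ℂ s
  let C : 𝔳𝔑 :=
    { toStarSubalgebra := A
      centralizer_centralizer' := by
        change (A : Set 𝔹).centralizer.centralizer = A
        rw [hA, Set.centralizer_centralizer_centralizer] }
  refine ⟨C, fun z => ?_⟩
  have h1 : z ∈ C ↔ z ∈ (s ∪ star s).centralizer := by
    rw [← hA]; rfl
  rw [h1, Set.mem_centralizer_iff]
  constructor
  · intro h
    refine ⟨mem_of_comm fun y hy => h y (Or.inl (Or.inl hy)), fun x hx => (h x (Or.inl (Or.inr hx))).symm⟩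
  · rintro ⟨hz, hzD⟩ m hm
    have hm' : m ∈ s := by
      rcases hm with hm | hm
      · exact hm
      · have := hs _ hm; rwa [star_star] at this
    rcases hm' with hm' | hm'
    · exact (comm_of_mem hz hm').symm
    · exact (hzD m hm').symm

theorem small_proj {C : 𝔳𝔑} {Ω : H} (hd : DiffuseSet (C : Set 𝔹)) (n : ℕ) :
    ∀ p ∈ C, IsStarProjection p → p ≠ 0 → ∃ q ∈ C, IsStarProjection q ∧ q ≠ 0 ∧ p * q = q ∧
      2 ^ n * ‖q Ω‖ ^ 2 ≤ ‖p Ω‖ ^ 2 := by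
  induction n with
  | zero => intro p hp hpp hp0; exact ⟨p, hp, hpp, hp0, hpp.isIdempotentElem, by simp⟩
  | succ n ih =>
    intro p hp hpp hp0
    obtain ⟨p1, hp1, hpp1, hp10, hpn, hpm⟩ := ih p hp hpp hp0
    obtain ⟨q, hq, hqp, hq0, hqne, hqp1⟩ := hd p1 hp1 (isProj_iff.2 hpp1) hp10
    have hqq : IsStarProjection q := isProj_iff.1 hqp
    have hpq : p1 * q = q := by
      have h1 := congrArg star hqp1
      rwa [star_mul, hqq.isSelfAdjoint.star_eq, hpp1.isSelfAdjoint.star_eq] at h1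
    have hrC : p1 - q ∈ C := sub_mem hp1 hq
    have hrr : IsStarProjection (p1 - q) := by
      refine ⟨?_, hpp1.isSelfAdjoint.sub hqq.isSelfAdjoint⟩
      change (p1 - q) * (p1 - q) = p1 - q
      rw [sub_mul, mul_sub, mul_sub, hqp1, hpq, hpp1.isIdempotentElem.eq, hqq.isIdempotentElem.eq]; abel
    have hr0 : p1 - q ≠ 0 := fun h => hqne (sub_eq_zero.1 h).symm
    have hpr : p1 * (p1 - q) = p1 - q := by rw [mul_sub, hpq, hpp1.isIdempotentElem.eq]
    have hsum : ‖p1 Ω‖ ^ 2 = ‖q Ω‖ ^ 2 + ‖(p1 - q) Ω‖ ^ 2 := by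
      have e : p1 Ω = q Ω + (p1 - q) Ω := by rw [sub_apply]; abel
      have h0 : ⟪q Ω, (p1 - q) Ω⟫ = 0 := by
        apply inner_eq_zero_of_mul hqq
        rw [mul_sub, hqp1, hqq.isIdempotentElem.eq, sub_self]
      rw [e]
      have := norm_add_sq_eq_norm_sq_add_norm_sq_of_inner_eq_zero (𝕜 := ℂ) (q Ω) ((p1 - q) Ω) h0
      simpa only [sq] using this
    rcases le_total (‖q Ω‖ ^ 2) (‖(p1 - q) Ω‖ ^ 2) with h | h
    · refine ⟨q, hq, hqq, hq0, ?_, ?_⟩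
      · rw [← hpq, ← mul_assoc, hpn]
      · rw [pow_succ]
        have : (2 : ℝ) ^ n * (2 * ‖q Ω‖ ^ 2) ≤ 2 ^ n * ‖p1 Ω‖ ^ 2 := by
          gcongr; linarith
        linarith
    · refine ⟨p1 - q, hrC, hrr, hr0, ?_, ?_⟩
      · rw [← hpr, ← mul_assoc, hpn]
      · rw [pow_succ]
        have : (2 : ℝ) ^ n * (2 * ‖(p1 - q) Ω‖ ^ 2) ≤ 2 ^ n * ‖p1 Ω‖ ^ 2 := by
          gcongr; linarith
        linarith

theorem small_partition {C : 𝔳𝔑} {Ω : H} (hΩ : ‖Ω‖ = 1)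
    (hd : DiffuseSet (C : Set 𝔹)) {η : ℝ} (hη : 0 < η) :
    ∃ s : Finset (𝔹), (∀ q ∈ s, q ∈ C ∧ IsStarProjection q ∧ ‖q Ω‖ ^ 2 ≤ η) ∧
      (∀ q ∈ s, ∀ q' ∈ s, q ≠ q' → q * q' = 0) ∧ ∑ q ∈ s, q = 1 := by
  classical
  obtain ⟨S, h1, h2, h3⟩ := zorn_partition C (fun q => ‖q Ω‖ ^ 2 ≤ η) (by
    intro p hp hpp hp0
    obtain ⟨n, hn⟩ := pow_unbounded_of_one_lt (1 / η) (one_lt_two (α := ℝ))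
    obtain ⟨q, hq, hqq, hq0, hpq, hle⟩ := small_proj (Ω := Ω) hd n p hp hpp hp0
    refine ⟨q, hq, hqq, hq0, hpq, ?_⟩
    have hp1 : ‖p Ω‖ ^ 2 ≤ 1 := by
      have := (p.le_opNorm Ω).trans (mul_le_mul_of_nonneg_right (norm_proj_le hpp) (norm_nonneg _))
      rw [hΩ, mul_one] at this
      exact pow_le_one₀ (norm_nonneg _) this
    have h4 : 1 < 2 ^ n * η := by rwa [div_lt_iff₀ hη] at hn
    by_contra hcon
    push Not at hcon
    have : 2 ^ n * η < 2 ^ n * ‖q Ω‖ ^ 2 := by gcongr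
    linarith)
  have hsqrt : 0 < Real.sqrt η := Real.sqrt_pos.2 hη
  obtain ⟨t, ht⟩ := ((Metric.tendsto_nhds.1 (h3 Ω)) (Real.sqrt η) hsqrt).exists
  let s0 : Finset (𝔹) := t.image Subtype.val
  have hs0S : ∀ q ∈ s0, q ∈ S := by
    intro q hq
    obtain ⟨x, _, rfl⟩ := Finset.mem_image.1 hq
    exact x.2
  have hs0 : ∑ q ∈ s0, q Ω = ∑ q ∈ t, (q : 𝔹) Ω := by
    simp only [s0]
    rw [Finset.sum_image (fun x _ y _ h => Subtype.ext h)]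
  set P := ∑ q ∈ s0, q with hP
  have hPq : ∀ q ∈ s0, P * q = q := by
    intro q hq
    rw [hP, sum_mul, sum_eq_single q]
    · exact (h1 q (hs0S q hq)).2.1.isIdempotentElem
    · intro q' hq' hne; exact h2 _ (hs0S _ hq') _ (hs0S _ hq) hne
    · intro h; exact absurd hq h
  have hPC : P ∈ C := sum_mem fun q hq => (h1 q (hs0S q hq)).1
  have hPsa : star P = P := by
    rw [hP, star_sum]
    exact sum_congr rfl fun q hq => (h1 q (hs0S q hq)).2.1.isSelfAdjoint
  have hPP : P * P = P := by
    conv_lhs => rw [hP, ← hP]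
    conv_lhs => rhs; rw [hP]
    rw [mul_sum]
    exact sum_congr rfl hPq
  have hr : IsStarProjection (1 - P) := by
    refine ⟨?_, ?_⟩
    · change (1 - P) * (1 - P) = 1 - P
      rw [sub_mul, one_mul, mul_sub, mul_one, hPP, sub_self, sub_zero]
    · change star (1 - P) = 1 - P
      rw [star_sub, star_one, hPsa]
  have hrΩ : ‖(1 - P) Ω‖ ^ 2 ≤ η := by
    rw [dist_eq_norm, ← hs0, norm_sub_rev] at ht
    have e : (1 - P) Ω = Ω - ∑ q ∈ s0, q Ω := by
      rw [sub_apply, hP, sum_apply]; rfl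
    rw [e]
    calc _ ≤ (Real.sqrt η) ^ 2 := pow_le_pow_left₀ (norm_nonneg _) ht.le 2
      _ = η := Real.sq_sqrt hη.le
  have hqP : ∀ q ∈ s0, q * (1 - P) = 0 ∧ (1 - P) * q = 0 := by
    intro q hq
    have e2 : (1 - P) * q = 0 := by rw [sub_mul, one_mul, hPq q hq, sub_self]
    exact ⟨mul_eq_zero_symm hr (h1 q (hs0S q hq)).2.1 e2, e2⟩
  have hnot : (1 - P) ∉ s0 := by
    intro hmem
    have := (hqP _ hmem).1
    rw [hr.isIdempotentElem.eq] at this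
    exact (h1 _ (hs0S _ hmem)).2.2.1 this
  refine ⟨insert (1 - P) s0, ?_, ?_, ?_⟩
  · intro q hq
    rcases Finset.mem_insert.1 hq with rfl | hq
    · exact ⟨sub_mem (one_mem _) hPC, hr, hrΩ⟩
    · obtain ⟨a, b, _, c⟩ := h1 q (hs0S q hq); exact ⟨a, b, c⟩
  · intro q hq q' hq' hne
    rcases Finset.mem_insert.1 hq with rfl | hq <;> rcases Finset.mem_insert.1 hq' with rfl | hq'
    · exact absurd rfl hne
    · exact (hqP _ hq').2
    · exact (hqP _ hq).1
    · exact h2 _ (hs0S _ hq) _ (hs0S _ hq') hne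
  · rw [Finset.sum_insert hnot, ← hP, sub_add_cancel]

theorem greedy_signs {P G : Type*} [DecidableEq P] (g : Finset G) (β : P → G → ℂ) (s : Finset P) :
    ∃ ε : P → ℝ, (∀ p, ε p = 1 ∨ ε p = -1) ∧
      ∑ m ∈ g, ‖∑ p ∈ s, (ε p : ℂ) * β p m‖ ^ 2 ≤ ∑ p ∈ s, ∑ m ∈ g, ‖β p m‖ ^ 2 := by
  induction s using Finset.induction_on with
  | empty => exact ⟨fun _ => 1, fun _ => Or.inl rfl, by simp⟩
  | insert p s hp ih =>
    obtain ⟨ε, hε, h⟩ := ih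
    have key : ∀ σ : ℝ, ∑ m ∈ g, ‖∑ q ∈ insert p s, ((Function.update ε p σ q : ℝ) : ℂ) * β q m‖ ^ 2
        = ∑ m ∈ g, ‖(σ : ℂ) * β p m + ∑ q ∈ s, (ε q : ℂ) * β q m‖ ^ 2 := by
      intro σ
      refine sum_congr rfl fun m _ => ?_
      rw [Finset.sum_insert hp, Function.update_self]
      congr 3
      refine sum_congr rfl fun q hq => ?_
      have hne : q ≠ p := by
        rintro rfl
        exact hp hq
      rw [Function.update_of_ne hne]
    have hpar : ∑ m ∈ g, ‖((1 : ℝ) : ℂ) * β p m + ∑ q ∈ s, (ε q : ℂ) * β q m‖ ^ 2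
        + ∑ m ∈ g, ‖((-1 : ℝ) : ℂ) * β p m + ∑ q ∈ s, (ε q : ℂ) * β q m‖ ^ 2
        = 2 * (∑ m ∈ g, ‖β p m‖ ^ 2 + ∑ m ∈ g, ‖∑ q ∈ s, (ε q : ℂ) * β q m‖ ^ 2) := by
      rw [← sum_add_distrib, ← sum_add_distrib, mul_sum]
      refine sum_congr rfl fun m _ => ?_
      have := parallelogram_law_with_norm ℂ (∑ q ∈ s, (ε q : ℂ) * β q m) (β p m)
      have e1 : ((1 : ℝ) : ℂ) * β p m + ∑ q ∈ s, (ε q : ℂ) * β q m = ∑ q ∈ s, (ε q : ℂ) * β q m + β p m := by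
        push_cast; ring
      have e2 : ((-1 : ℝ) : ℂ) * β p m + ∑ q ∈ s, (ε q : ℂ) * β q m = ∑ q ∈ s, (ε q : ℂ) * β q m - β p m := by
        push_cast; ring
      rw [e1, e2]
      linarith
    have hupd : ∀ σ : ℝ, (σ = 1 ∨ σ = -1) → ∀ q, Function.update ε p σ q = 1 ∨ Function.update ε p σ q = -1 := by
      intro σ hσ q
      by_cases hq : q = p
      · subst hq; rw [Function.update_self]; exact hσ
      · rw [Function.update_of_ne hq]; exact hε q
    rw [Finset.sum_insert hp]
    by_cases hc : ∑ m ∈ g, ‖((1 : ℝ) : ℂ) * β p m + ∑ q ∈ s, (ε q : ℂ) * β q m‖ ^ 2 ≤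
        ∑ m ∈ g, ‖β p m‖ ^ 2 + ∑ m ∈ g, ‖∑ q ∈ s, (ε q : ℂ) * β q m‖ ^ 2
    · refine ⟨Function.update ε p 1, hupd 1 (Or.inl rfl), ?_⟩
      rw [key]; linarith
    · push Not at hc
      refine ⟨Function.update ε p (-1), hupd (-1) (Or.inr rfl), ?_⟩
      rw [key]; linarith

theorem diffuse_sign {C : 𝔳𝔑} {Ω : H} (hΩ : ‖Ω‖ = 1)
    (hd : DiffuseSet (C : Set 𝔹)) (g : Finset H) {η : ℝ} (hη : 0 < η) :
    ∃ z ∈ C, IsSelfAdjoint z ∧ z * z = 1 ∧ ∀ m ∈ g, ‖⟪m, z Ω⟫‖ ^ 2 ≤ η := by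
  classical
  set η1 := η / (1 + ∑ m ∈ g, ‖m‖ ^ 2) with hη1
  have hS : 0 < 1 + ∑ m ∈ g, ‖m‖ ^ 2 := by
    have : 0 ≤ ∑ m ∈ g, ‖m‖ ^ 2 := sum_nonneg fun _ _ => by positivity
    linarith
  have hη1p : 0 < η1 := by positivity
  obtain ⟨s, h1, h2, h3⟩ := small_partition hΩ hd hη1p
  obtain ⟨ε, hε, hle⟩ := greedy_signs g (fun (p : 𝔹) (m : H) => ⟪m, p Ω⟫) s
  have hεs : ∀ p, ε p * ε p = 1 := by intro p; rcases hε p with h | h <;> rw [h] <;> norm_num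
  refine ⟨∑ p ∈ s, (ε p : ℂ) • p, sum_mem fun p hp => smul_mem' _ (h1 p hp).1, ?_, ?_, ?_⟩
  · change star _ = _
    rw [star_sum]
    refine sum_congr rfl fun p hp => ?_
    rw [star_smul, (h1 p hp).2.1.isSelfAdjoint.star_eq, Complex.star_def, conj_ofReal]
  · rw [sum_mul]
    rw [← h3]
    refine sum_congr rfl fun p hp => ?_
    rw [mul_sum, sum_eq_single p]
    · rw [smul_mul_smul_comm, (h1 p hp).2.1.isIdempotentElem.eq, ← Complex.ofReal_mul, hεs]; simp
    · intro q hq hne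
      rw [smul_mul_smul_comm, h2 p hp q hq hne.symm, smul_zero]
    · intro h; exact absurd hp h
  · intro m hm
    have e : ⟪m, (∑ p ∈ s, (ε p : ℂ) • p) Ω⟫ = ∑ p ∈ s, (ε p : ℂ) * ⟪m, p Ω⟫ := by
      rw [sum_apply, inner_sum]
      simp only [smul_apply, inner_smul_right]
    rw [e]
    have hb : ∑ p ∈ s, ∑ m ∈ g, ‖⟪m, p Ω⟫‖ ^ 2 ≤ ∑ m ∈ g, η1 * ‖m‖ ^ 2 := by
      rw [sum_comm]
      refine sum_le_sum fun m _ => ?_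
      have hpm : ∑ p ∈ s, ‖p m‖ ^ 2 = ‖m‖ ^ 2 := by
        have e1 : ⟪m, m⟫ = ∑ p ∈ s, ⟪p m, p m⟫ := by
          have : ⟪m, m⟫ = ⟪m, (∑ p ∈ s, p) m⟫ := by rw [h3]; rfl
          rw [this, sum_apply, inner_sum]
          refine sum_congr rfl fun p hp => ?_
          have hp' := (h1 p hp).2.1
          rw [proj_inner hp', proj_idem hp']
        have e2 := congrArg Complex.re e1
        rw [Complex.re_sum] at e2
        simp only [inner_sq] at e2
        norm_cast at e2
        exact_mod_cast e2.symm
      rw [← hpm, mul_sum]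
      refine sum_le_sum fun p hp => ?_
      obtain ⟨_, hp', hpη⟩ := h1 p hp
      have e3 : ⟪m, p Ω⟫ = ⟪p m, p Ω⟫ := by rw [proj_inner hp', proj_idem hp']
      rw [e3]
      calc ‖⟪p m, p Ω⟫‖ ^ 2 ≤ (‖p m‖ * ‖p Ω‖) ^ 2 :=
            pow_le_pow_left₀ (norm_nonneg _) (norm_inner_le_norm _ _) 2
        _ = ‖p Ω‖ ^ 2 * ‖p m‖ ^ 2 := by ring
        _ ≤ _ := by gcongr
    have hone : ‖∑ p ∈ s, (ε p : ℂ) * ⟪m, p Ω⟫‖ ^ 2 ≤ ∑ m ∈ g, ‖∑ p ∈ s, (ε p : ℂ) * ⟪m, p Ω⟫‖ ^ 2 :=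
      single_le_sum (f := fun m => ‖∑ p ∈ s, (ε p : ℂ) * ⟪m, p Ω⟫‖ ^ 2) (fun _ _ => by positivity) hm
    refine hone.trans (hle.trans (hb.trans ?_))
    rw [← mul_sum, hη1, div_mul_eq_mul_div, div_le_iff₀ hS]
    nlinarith

section
/-- Bounded sequences in `M`. -/
def Bd (M : 𝔳𝔑) (x : ℕ → 𝔹) : Prop :=
  (∀ k, x k ∈ M) ∧ BddAbove (Set.range fun k => ‖x k‖)

variable {M : VonNeumannAlgebra H} {Ω : H} {ω : Ultrafilter ℕ}

theorem bd_of {x : ℕ → 𝔹} (C : ℝ) (h : ∀ k, x k ∈ M) (h2 : ∀ k, ‖x k‖ ≤ C) : Bd M x :=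
  ⟨h, ⟨C, by rintro _ ⟨k, rfl⟩; exact h2 k⟩⟩

theorem Bd.bound {x : ℕ → 𝔹} (h : Bd M x) : ∃ C : ℝ, ∀ k, ‖x k‖ ≤ C := by
  obtain ⟨C, hC⟩ := h.2
  exact ⟨C, fun k => hC ⟨k, rfl⟩⟩

theorem Bd.mul {x y : ℕ → 𝔹} (hx : Bd M x) (hy : Bd M y) : Bd M (x * y) := by
  obtain ⟨C, hC⟩ := hx.bound
  obtain ⟨D, hD⟩ := hy.bound
  exact bd_of (C * D) (fun k => mul_mem (hx.1 k) (hy.1 k)) fun k =>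
    (norm_mul_le _ _).trans (mul_le_mul (hC k) (hD k) (norm_nonneg _) ((norm_nonneg _).trans (hC k)))

theorem Bd.add {x y : ℕ → 𝔹} (hx : Bd M x) (hy : Bd M y) : Bd M (x + y) := by
  obtain ⟨C, hC⟩ := hx.bound
  obtain ⟨D, hD⟩ := hy.bound
  exact bd_of (C + D) (fun k => add_mem (hx.1 k) (hy.1 k)) fun k =>
    (norm_add_le _ _).trans (add_le_add (hC k) (hD k))

theorem Bd.smul {x : ℕ → 𝔹} (c : ℂ) (hx : Bd M x) : Bd M (c • x) := by
  obtain ⟨C, hC⟩ := hx.bound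
  refine bd_of (‖c‖ * C) (fun k => ?_) fun k => ?_
  · rw [Pi.smul_apply]; exact smul_mem' c (hx.1 k)
  · rw [Pi.smul_apply, norm_smul]
    exact mul_le_mul_of_nonneg_left (hC k) (norm_nonneg c)

theorem Bd.star {x : ℕ → 𝔹} (hx : Bd M x) : Bd M (fun k => star (x k)) := by
  obtain ⟨C, hC⟩ := hx.bound
  exact bd_of C (fun k => star_mem (hx.1 k)) fun k => by rw [norm_star]; exact hC k

theorem bd_const {a : 𝔹} (ha : a ∈ M) : Bd M (fun _ => a) :=
  bd_of ‖a‖ (fun _ => ha) fun _ => le_rfl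

theorem bd_inner (U : Ultrapower M Ω ω) {x y : ℕ → 𝔹} (hx : Bd M x) (hy : Bd M y) :
    Tendsto (fun k => ⟪y k Ω, x k Ω⟫) (ω : Filter ℕ) (nhds ⟪U.Φ y U.vec, U.Φ x U.vec⟫) := by
  have h := U.trace_eq ((fun k => star (x k)) * y) (hx.star.mul hy).1 (hx.star.mul hy).2
  rw [U.map_mul _ _ hx.star.1 hx.star.2 hy.1 hy.2, U.map_star x hx.1 hx.2, mul_apply_eq_comp,
    star_inner_left] at h
  refine h.congr fun k => ?_
  rw [Pi.mul_apply, mul_apply_eq_comp, star_inner_left]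

theorem bd_norm (U : Ultrapower M Ω ω) {x : ℕ → 𝔹} (hx : Bd M x) :
    Tendsto (fun k => ‖x k Ω‖ ^ 2) (ω : Filter ℕ) (nhds (‖U.Φ x U.vec‖ ^ 2)) := by
  have h := (Complex.continuous_re.tendsto _).comp (bd_inner U hx hx)
  have e : ∀ {E : Type u} [NormedAddCommGroup E] [InnerProductSpace ℂ E] (v : E),
      (⟪v, v⟫).re = ‖v‖ ^ 2 := by
    intro E _ _ v
    rw [inner_sq]; norm_cast
  rw [e] at h
  exact h.congr fun k => e _

theorem contraction_fun {x : 𝔹} (hx : IsSelfAdjoint x) (hxM : x ∈ M) :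
    ∃ y ∈ M, IsSelfAdjoint y ∧ ‖y‖ ≤ 1 ∧ y + y * (x * x) = (2 : ℂ) • x := by
  have hpos : ∀ t : ℝ, (1 + t ^ 2) ≠ 0 := fun t => by positivity
  have hc : Continuous fun t : ℝ => 2 * t / (1 + t ^ 2) := by
    exact Continuous.div (by fun_prop) (by fun_prop) hpos
  refine ⟨cfc (fun t : ℝ => 2 * t / (1 + t ^ 2)) x, cfc_mem_vn hx hxM _, cfc_predicate _ _, ?_, ?_⟩
  · refine norm_cfc_le zero_le_one fun t _ => ?_
    rw [Real.norm_eq_abs, abs_div, abs_of_pos (by positivity : (0:ℝ) < 1 + t ^ 2),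
      div_le_one (by positivity), abs_le]
    constructor <;> nlinarith [sq_nonneg (t - 1), sq_nonneg (t + 1)]
  · have e1 : x * x = cfc (fun t : ℝ => t ^ 2) x := by
      rw [cfc_pow_id (R := ℝ) x 2, sq]
    have e2 : (2 : ℂ) • x = cfc (fun t : ℝ => 2 * t) x := by
      rw [cfc_const_mul (R := ℝ) 2 (fun t => t) x, cfc_id' ℝ x, two_smul, two_smul]
    rw [e2, e1, ← cfc_mul (R := ℝ) _ _ x hc.continuousOn (by fun_prop),
      ← cfc_add (R := ℝ) x _ (fun t => 2 * t / (1 + t ^ 2) * t ^ 2) hc.continuousOn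
        (hc.mul (by fun_prop : Continuous fun t : ℝ => t ^ 2)).continuousOn]
    refine cfc_congr fun t _ => ?_
    have := hpos t
    field_simp

/-- Lifting a symmetry from the ultrapower to a sequence of selfadjoint contractions. -/
theorem lift_symm (U : Ultrapower M Ω ω) {z : U.carrier →L[ℂ] U.carrier} (hz : z ∈ U.Mw)
    (hsa : IsSelfAdjoint z) (h1 : z * z = 1) :
    ∃ y : ℕ → 𝔹, Bd M y ∧ (∀ k, IsSelfAdjoint (y k)) ∧ (∀ k, ‖y k‖ ≤ 1) ∧ U.Φ y = z := by
  obtain ⟨x0, hx0, hx0b, rfl⟩ := U.surj z hz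
  have hB0 : Bd M x0 := ⟨hx0, hx0b⟩
  have hB1 := (hB0.add hB0.star).smul (1 / 2 : ℂ)
  set x := (1 / 2 : ℂ) • (x0 + fun k => star (x0 k)) with hx
  have hxz : U.Φ x = U.Φ x0 := by
    rw [hx, U.map_smul _ _ (hB0.add hB0.star).1 (hB0.add hB0.star).2,
      U.map_add _ _ hx0 hx0b hB0.star.1 hB0.star.2, U.map_star _ hx0 hx0b, hsa.star_eq, ← two_smul ℂ,
      smul_smul]
    norm_num
  have hxs : ∀ k, IsSelfAdjoint (x k) := by
    intro k
    change star ((1 / 2 : ℂ) • (x0 k + star (x0 k))) = (1 / 2 : ℂ) • (x0 k + star (x0 k))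
    rw [star_smul, star_add, star_star, add_comm]
    congr 1
    simp
  choose y hyM hys hyn hy using fun k => contraction_fun (hxs k) (hB1.1 k)
  have hBy : Bd M y := bd_of 1 hyM hyn
  refine ⟨y, hBy, hys, hyn, ?_⟩
  have e : y + y * (x * x) = (2 : ℂ) • x := funext hy
  have h2 := congrArg U.Φ e
  have hxx := hB1.mul hB1
  have hyxx := hBy.mul hxx
  rw [U.map_add _ _ hBy.1 hBy.2 hyxx.1 hyxx.2, U.map_mul _ _ hBy.1 hBy.2 hxx.1 hxx.2,
    U.map_mul _ _ hB1.1 hB1.2 hB1.1 hB1.2, U.map_smul _ _ hB1.1 hB1.2, hxz, h1, mul_one,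
    ← two_smul ℂ] at h2
  exact smul_right_injective _ (two_ne_zero (α := ℂ)) h2

theorem ultra_lift (U : Ultrapower M Ω ω) (Q : 𝔳𝔑) (hQ : Q ≤ M)
    (hdiff : DiffuseSet (relComm U.Mw {z : U.carrier →L[ℂ] U.carrier | ∃ a ∈ Q, z = U.Φ fun _ => a}))
    (F G : Finset (𝔹)) (hF : ∀ x ∈ F, x ∈ Q) (hG : ∀ m ∈ G, m ∈ M) {η : ℝ} (hη : 0 < η) :
    ∃ z ∈ M, IsSelfAdjoint z ∧ ‖z‖ ≤ 1 ∧ (∀ x ∈ F, ‖(x * z - z * x) Ω‖ ^ 2 ≤ η) ∧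
      (∀ m ∈ G, ‖⟪m Ω, z Ω⟫‖ ^ 2 ≤ η) ∧ ∀ x ∈ F, ‖x Ω‖ ^ 2 - η ≤ ‖x (z Ω)‖ ^ 2 := by
  classical
  have hQM : ∀ a ∈ Q, a ∈ M := fun a ha => hQ ha
  set D := {z : U.carrier →L[ℂ] U.carrier | ∃ a ∈ Q, z = U.Φ fun _ => a} with hD
  have hDs : ∀ d ∈ D, star d ∈ D := by
    rintro _ ⟨a, ha, rfl⟩
    exact ⟨star a, star_mem ha, (U.map_star _ (bd_const (hQM a ha)).1 (bd_const (hQM a ha)).2).symm⟩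
  obtain ⟨C, hC⟩ := relComm_vn U.Mw D hDs
  have hdC : DiffuseSet (C : Set (U.carrier →L[ℂ] U.carrier)) := by
    have : (C : Set (U.carrier →L[ℂ] U.carrier)) = relComm U.Mw D := Set.ext hC
    rw [this]; exact hdiff
  obtain ⟨z, hzC, hzs, hz1, hzg⟩ := diffuse_sign U.traceVec.norm_one hdC
    (G.image fun m => U.Φ (fun _ => m) U.vec) (half_pos hη)
  obtain ⟨hzM, hzD⟩ := (hC z).1 hzC
  obtain ⟨y, hBy, hys, hyn, hyz⟩ := lift_symm U hzM hzs hz1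
  have ev1 : ∀ x ∈ F, ∀ᶠ k in (ω : Filter ℕ), ‖(x * y k - y k * x) Ω‖ ^ 2 ≤ η := by
    intro x hx
    have hBx := bd_const (hQM x (hF x hx))
    have hB := (hBx.mul hBy).add ((hBy.mul hBx).smul (-1))
    have ht := bd_norm U hB
    rw [U.map_add _ _ (hBx.mul hBy).1 (hBx.mul hBy).2 ((hBy.mul hBx).smul (-1)).1
      ((hBy.mul hBx).smul (-1)).2, U.map_smul _ _ (hBy.mul hBx).1 (hBy.mul hBx).2,
      U.map_mul _ _ hBx.1 hBx.2 hBy.1 hBy.2, U.map_mul _ _ hBy.1 hBy.2 hBx.1 hBx.2, hyz,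
      hzD _ ⟨x, hF x hx, rfl⟩] at ht
    have h0 : ‖(U.Φ (fun _ => x) * z + (-1 : ℂ) • (U.Φ (fun _ => x) * z)) U.vec‖ ^ 2 = 0 := by simp
    rw [h0] at ht
    filter_upwards [ht.eventually (gt_mem_nhds hη)] with k hk
    have e : (((fun _ => x) * y + (-1 : ℂ) • (y * fun _ => x)) : ℕ → 𝔹) k = x * y k - y k * x := by
      simp [sub_eq_add_neg]
    rw [e] at hk
    exact hk.le
  have ev2 : ∀ m ∈ G, ∀ᶠ k in (ω : Filter ℕ), ‖⟪m Ω, y k Ω⟫‖ ^ 2 ≤ η := by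
    intro m hm
    have ht := ((bd_inner U hBy (bd_const (hG m hm))).norm).pow 2
    rw [hyz] at ht
    have hlt := (hzg _ (Finset.mem_image_of_mem _ hm)).trans_lt (half_lt_self hη)
    filter_upwards [ht.eventually (gt_mem_nhds hlt)] with k hk
    exact hk.le
  have ev3 : ∀ x ∈ F, ∀ᶠ k in (ω : Filter ℕ), ‖x Ω‖ ^ 2 - η ≤ ‖x (y k Ω)‖ ^ 2 := by
    intro x hx
    have hBx := bd_const (hQM x (hF x hx))
    have ht := bd_norm U (hBx.mul hBy)
    have ht2 := bd_norm U hBx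
    have hlim : ‖U.Φ ((fun _ => x) * y) U.vec‖ ^ 2 = ‖x Ω‖ ^ 2 := by
      rw [U.map_mul _ _ hBx.1 hBx.2 hBy.1 hBy.2, hyz, ← hzD _ ⟨x, hF x hx, rfl⟩, mul_apply_eq_comp]
      have : ‖z (U.Φ (fun _ => x) U.vec)‖ = ‖U.Φ (fun _ => x) U.vec‖ :=
        unitary_norm (by rw [hzs.star_eq, hz1]) _
      rw [this]
      exact tendsto_nhds_unique ht2 tendsto_const_nhds
    rw [hlim] at ht
    filter_upwards [ht.eventually (lt_mem_nhds (sub_lt_self _ hη))] with k hk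
    exact hk.le
  have hev := ((F.eventually_all).2 ev1).and (((G.eventually_all).2 ev2).and ((F.eventually_all).2 ev3))
  obtain ⟨k, h1, h2, h3⟩ := hev.exists
  exact ⟨y k, hBy.1 k, hys k, hyn k, h1, h2, h3⟩
end

section tools
variable {E : Type v} [NormedAddCommGroup E] [InnerProductSpace ℂ E] [CompleteSpace E]
  {F : Type w} [NormedAddCommGroup F] [InnerProductSpace ℂ F] [CompleteSpace F]
  {ι : Type*} {κ : Type*}

theorem ext_entries (b : HilbertBasis ι ℂ E) (c : HilbertBasis κ ℂ F) {S T : E →L[ℂ] F}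
    (h : ∀ i j, ⟪c j, S (b i)⟫ = ⟪c j, T (b i)⟫) : S = T := by
  refine ext_on (s := Set.range b) ?_ ?_
  · rw [dense_iff_topologicalClosure_eq_top]; exact b.dense_span
  · rintro _ ⟨i, rfl⟩
    refine c.repr.injective (lp.ext (funext fun j => ?_))
    rw [c.repr_apply_apply, c.repr_apply_apply, h]

theorem iso_onb (b : HilbertBasis ι ℂ E) {v : ι → F} (hv : Orthonormal ℂ v) :
    ∃ V : E →L[ℂ] F, (∀ i, V (b i) = v i) ∧ ∀ x y, ⟪V x, V y⟫ = ⟪x, y⟫ := by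
  classical
  let T := (hv.orthogonalFamily.linearIsometry).comp b.repr.toLinearIsometry
  refine ⟨T.toContinuousLinearMap, fun i => ?_, fun x y => T.inner_map_map x y⟩
  change hv.orthogonalFamily.linearIsometry (b.repr (b i)) = v i
  rw [b.repr_self, OrthogonalFamily.linearIsometry_apply_single]
  simp

theorem onb_inner_mul (b : HilbertBasis ι ℂ E) (Y Z : E →L[ℂ] E) (v w : E) :
    ⟪v, (Y * Z) w⟫ = ∑' c, ⟪v, Y (b c)⟫ * ⟪b c, Z w⟫ := by
  rw [mul_apply_eq_comp, ← star_inner_left, ← b.tsum_inner_mul_inner]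
  exact tsum_congr fun c => by rw [star_inner_left]

/-- Invariance of matrix entries under a permutation of the basis. -/
def Inv (b : HilbertBasis ι ℂ E) (σ : ι ≃ ι) (Y : E →L[ℂ] E) : Prop :=
  ∀ i j, ⟪b (σ i), Y (b (σ j))⟫ = ⟪b i, Y (b j)⟫

theorem Inv.mul {b : HilbertBasis ι ℂ E} {σ : ι ≃ ι} {Y Z : E →L[ℂ] E} (hY : Inv b σ Y)
    (hZ : Inv b σ Z) : Inv b σ (Y * Z) := by
  intro i j
  rw [onb_inner_mul b, onb_inner_mul b, ← σ.tsum_eq]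
  exact tsum_congr fun c => by rw [hY, hZ]

theorem Inv.sub {b : HilbertBasis ι ℂ E} {σ : ι ≃ ι} {Y Z : E →L[ℂ] E} (hY : Inv b σ Y)
    (hZ : Inv b σ Z) : Inv b σ (Y - Z) := by
  intro i j
  rw [sub_apply, sub_apply, inner_sub_right, inner_sub_right, hY, hZ]

end tools

section amp
variable {L : Type v} [NormedAddCommGroup L] [InnerProductSpace ℂ L] [CompleteSpace L]
  {S : Type w} {ι : Type*}

/-- The Hilbert space `ℓ²(S; L)`. -/
abbrev Amp (S : Type w) (L : Type v) [NormedAddCommGroup L] [InnerProductSpace ℂ L]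
    [CompleteSpace L] := lp (fun _ : S => L) 2

theorem amp_hasSum (ξ : Amp S L) : HasSum (fun A => ‖ξ A‖ ^ 2) (‖ξ‖ ^ 2) := by
  have h := lp.hasSum_norm (p := 2) (by norm_num) ξ
  simpa using h

theorem amp_exists (S : Type w) (x : L →L[ℂ] L) :
    ∃ T : Amp S L →L[ℂ] Amp S L, (∀ ξ A, T ξ A = x (ξ A)) ∧ ‖T‖ ≤ ‖x‖ := by
  have hm : ∀ ξ : Amp S L, Memℓp (fun A => x (ξ A)) 2 := by
    intro ξ
    refine memℓp_gen ?_
    have h : Summable fun A => ‖x‖ ^ 2 * ‖ξ A‖ ^ 2 := (amp_hasSum ξ).summable.mul_left _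
    refine Summable.of_nonneg_of_le (fun A => by positivity) (fun A => ?_) h
    have := x.le_opNorm (ξ A)
    rw [← mul_pow]
    simpa using pow_le_pow_left₀ (norm_nonneg _) this 2
  let T0 : Amp S L →ₗ[ℂ] Amp S L :=
    { toFun := fun ξ => ⟨fun A => x (ξ A), hm ξ⟩
      map_add' := fun ξ η => lp.ext (funext fun A => map_add x (ξ A) (η A))
      map_smul' := fun c ξ => lp.ext (funext fun A => map_smul x c (ξ A)) }
  have hb : ∀ ξ, ‖T0 ξ‖ ≤ ‖x‖ * ‖ξ‖ := by
    intro ξ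
    refine le_of_sq_le_sq ?_ (by positivity)
    rw [mul_pow]
    refine hasSum_le (fun A => ?_) (amp_hasSum (T0 ξ)) ((amp_hasSum ξ).mul_left _)
    rw [← mul_pow]
    exact pow_le_pow_left₀ (norm_nonneg _) (x.le_opNorm (ξ A)) 2
  exact ⟨T0.mkContinuous ‖x‖ hb, fun ξ A => rfl, T0.mkContinuous_norm_le (norm_nonneg _) hb⟩

/-- `x ⊗ 1` on `ℓ²(S; L)`. -/
def amp (S : Type w) (x : L →L[ℂ] L) : Amp S L →L[ℂ] Amp S L :=
  (amp_exists S x).choose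

theorem amp_apply (x : L →L[ℂ] L) (ξ : Amp S L) (A : S) : amp S x ξ A = x (ξ A) :=
  (amp_exists S x).choose_spec.1 ξ A

theorem amp_norm (x : L →L[ℂ] L) : ‖amp S x‖ ≤ ‖x‖ := (amp_exists S x).choose_spec.2

theorem amp_mul (x y : L →L[ℂ] L) : amp S (x * y) = amp S x * amp S y := by
  ext ξ A
  rw [mul_apply_eq_comp, amp_apply, amp_apply, amp_apply, mul_apply_eq_comp]

theorem amp_sub (x y : L →L[ℂ] L) : amp S (x - y) = amp S x - amp S y := by
  ext ξ A
  rw [sub_apply, lp.coeFn_sub, Pi.sub_apply, amp_apply, amp_apply, amp_apply, sub_apply]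

/-- The inclusion at `A`. -/
def inc (A : S) : L →L[ℂ] Amp S L :=
  let := Classical.decEq S
  lp.singleContinuousLinearMap ℂ (fun _ : S => L) 2 A

theorem inner_inc (A : S) (v : L) (ξ : Amp S L) : ⟪inc A v, ξ⟫ = ⟪v, ξ A⟫ := by
  let := Classical.decEq S
  exact lp.inner_single_left (𝕜 := ℂ) (G := fun _ : S => L) A v ξ

theorem adj_inc (A : S) (ξ : Amp S L) : adjoint (inc A) ξ = ξ A := by
  refine ext_inner_left ℂ fun v => ?_
  rw [adjoint_inner_right, inner_inc]

theorem inc_apply_self (A : S) (v : L) : (inc A v : Amp S L) A = v := by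
  let := Classical.decEq S
  exact lp.single_apply_self (E := fun _ : S => L) 2 A v

theorem inc_apply_ne {A B : S} (h : B ≠ A) (v : L) : (inc A v : Amp S L) B = 0 := by
  let := Classical.decEq S
  exact lp.single_apply_ne (E := fun _ : S => L) 2 A v h

theorem amp_inc (x : L →L[ℂ] L) (A : S) (v : L) : amp S x (inc A v) = inc A (x v) := by
  ext B
  rw [amp_apply]
  by_cases h : B = A
  · subst h; rw [inc_apply_self, inc_apply_self]
  · rw [inc_apply_ne h, inc_apply_ne h, map_zero]

theorem norm_inc (A : S) (v : L) : ‖(inc A v : Amp S L)‖ = ‖v‖ := by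
  let := Classical.decEq S
  exact lp.norm_single (E := fun _ : S => L) (p := 2) (by norm_num) A v

theorem inner_inc_inc [DecidableEq S] (A B : S) (v w : L) :
    ⟪(inc A v : Amp S L), inc B w⟫ = if A = B then ⟪v, w⟫ else 0 := by
  rw [inner_inc]
  split_ifs with h
  · subst h; rw [inc_apply_self]
  · rw [inc_apply_ne h, inner_zero_right]

theorem amp_onb (S : Type w) (b : HilbertBasis ι ℂ L) :
    ∃ d : HilbertBasis (ι × S) ℂ (Amp S L), ∀ a A, d (a, A) = inc A (b a) := by
  classical
  have ho : Orthonormal ℂ fun p : ι × S => (inc p.2 (b p.1) : Amp S L) := by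
    rw [orthonormal_iff_ite]
    rintro ⟨a, A⟩ ⟨c, B⟩
    rw [inner_inc_inc, (orthonormal_iff_ite.1 b.orthonormal)]
    by_cases h1 : A = B <;> by_cases h2 : a = c <;> simp [h1, h2]
  refine ⟨HilbertBasis.mkOfOrthogonalEqBot ho ?_, fun a A => ?_⟩
  · rw [Submodule.eq_bot_iff]
    intro ξ hξ
    ext A
    refine b.repr.injective (lp.ext (funext fun a => ?_))
    rw [b.repr_apply_apply, b.repr_apply_apply, ← inner_inc]
    have := (mem_orthogonal _ _).1 hξ _ (subset_span ⟨(a, A), rfl⟩)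
    rw [this]
    simp
  · rw [HilbertBasis.coe_mkOfOrthogonalEqBot]

end amp

open FreeGroup (mk of)
section core
variable {Γ : Type} [Group Γ] {S : Type} [MulAction Γ S] {J : Type u}
  {F : Type w} [NormedAddCommGroup F] [InnerProductSpace ℂ F] [CompleteSpace F]
  {L : Type v} [NormedAddCommGroup L] [InnerProductSpace ℂ L] [CompleteSpace L]
local notation "𝔉" => F →L[ℂ] F

/-- A cocycle deformation by unitaries on `ℓ²(S)`. -/
structure WD (Γ : Type) [Group Γ] {S : Type} [MulAction Γ S] (f : HilbertBasis S ℂ F) (o : S)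
    (τ : S → Equiv.Perm S) (W : Γ → 𝔉) : Prop where
  uni : ∀ k, star (W k) * W k = 1
  uni' : ∀ k, W k * star (W k) = 1
  one : W 1 = 1
  smul_o : ∀ g : Γ, g • o = o
  tau1 : ∀ A, τ A A = o
  tau2 : ∀ A, τ A o = A
  inv1 : ∀ (g h k : Γ) (A B : S),
    ⟪W (h * g⁻¹) (f (g • A)), W (k * g⁻¹) (f (g • B))⟫ = ⟪W h (f A), W k (f B)⟫
  inv2 : ∀ (C : S) (h k : Γ) (A B : S),
    ⟪W h (f (τ C A)), W k (f (τ C B))⟫ = ⟪W h (f A), W k (f B)⟫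

/-- Right translation. -/
def rho (J : Type u) (g : Γ) : (Γ × J) ≃ (Γ × J) := (Equiv.mulRight g⁻¹).prodCongr (Equiv.refl J)

/-- Right translation combined with the action on `S`. -/
def sig (S : Type) [MulAction Γ S] (J : Type u) (g : Γ) : ((Γ × J) × S) ≃ ((Γ × J) × S) :=
  (rho J g).prodCongr (MulAction.toPerm g)

/-- Translation of `S`. -/
def tau' (Γ : Type) (J : Type u) (t : Equiv.Perm S) : ((Γ × J) × S) ≃ ((Γ × J) × S) :=
  (Equiv.refl (Γ × J)).prodCongr t

theorem uni_inner {W : 𝔉} (h : star W * W = 1) (x y : F) : ⟪W x, W y⟫ = ⟪x, y⟫ := by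
  rw [← star_inner_right]
  have := congrArg (fun T : 𝔉 => T y) h
  simp only [mul_apply_eq_comp] at this
  rw [this]; rfl

theorem wd_ops (b : HilbertBasis (Γ × J) ℂ L) (f : HilbertBasis S ℂ F)
    (d : HilbertBasis ((Γ × J) × S) ℂ (Amp S L)) (hd : ∀ a A, d (a, A) = inc A (b a)) :
    ∃ V : Γ × J → F →L[ℂ] Amp S L, (∀ a A, V a (f A) = inc A (b a)) ∧
      (∀ a x A v, ⟪V a x, inc A v⟫ = ⟪x, f A⟫ * ⟪b a, v⟫) ∧
      ∀ a c x y (T : L →L[ℂ] L), ⟪V a x, amp S T (V c y)⟫ = ⟪b a, T (b c)⟫ * ⟪x, y⟫ := by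
  classical
  have h1 : ∀ a : Γ × J, ∃ V : F →L[ℂ] Amp S L, (∀ A, V (f A) = d (a, A)) ∧
      ∀ x y, ⟪V x, V y⟫ = ⟪x, y⟫ := fun a =>
    iso_onb f (d.orthonormal.comp (fun A => (a, A)) (fun A B h => (Prod.mk.inj h).2))
  choose V hV1 hV2 using h1
  have hadj : ∀ a A v, adjoint (V a) (inc A v) = ⟪b a, v⟫ • f A := by
    intro a A v
    refine f.repr.injective (lp.ext (funext fun B => ?_))
    rw [f.repr_apply_apply, f.repr_apply_apply, adjoint_inner_right, hV1, hd,
      inner_inc_inc, inner_smul_right, orthonormal_iff_ite.1 f.orthonormal]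
    split_ifs <;> simp
  refine ⟨V, fun a A => by rw [hV1, hd], fun a x A v => ?_, fun a c x y T => ?_⟩
  · rw [← adjoint_inner_right, hadj, inner_smul_right, mul_comm]
  · have e : adjoint (V a) ∘L amp S T ∘L V c
        = ⟪b a, T (b c)⟫ • ContinuousLinearMap.id ℂ F := by
      refine ext_on (s := Set.range f) ?_ ?_
      · rw [dense_iff_topologicalClosure_eq_top]; exact f.dense_span
      · rintro _ ⟨A, rfl⟩
        change adjoint (V a) (amp S T (V c (f A))) = ⟪b a, T (b c)⟫ • f A
        rw [hV1, hd, amp_inc, hadj]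
    have e2 := congrArg (fun g : 𝔉 => ⟪x, g y⟫) e
    change ⟪x, adjoint (V a) (amp S T (V c y))⟫ = ⟪x, ⟪b a, T (b c)⟫ • y⟫ at e2
    rwa [adjoint_inner_right, inner_smul_right] at e2

theorem wd_unitary {f : HilbertBasis S ℂ F} {o : S} {τ : S → Equiv.Perm S} {W : Γ → 𝔉}
    (hW : WD Γ f o τ W) (b : HilbertBasis (Γ × J) ℂ L)
    (d : HilbertBasis ((Γ × J) × S) ℂ (Amp S L)) (hd : ∀ a A, d (a, A) = inc A (b a))
    (V : Γ × J → F →L[ℂ] Amp S L) (hV : ∀ a A, V a (f A) = inc A (b a))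
    (hVi : ∀ a c x y (T : L →L[ℂ] L), ⟪V a x, amp S T (V c y)⟫ = ⟪b a, T (b c)⟫ * ⟪x, y⟫) :
    ∃ X : Amp S L →L[ℂ] Amp S L, star X * X = 1 ∧ X * star X = 1 ∧
      ∀ a x, X (V a x) = V a (W a.1 x) := by
  classical
  have hamp1 : amp S (1 : L →L[ℂ] L) = 1 := by
    ext ξ A; rw [amp_apply]; rfl
  have hVV : ∀ a c x y, ⟪V a x, V c y⟫ = (if a = c then 1 else 0) * ⟪x, y⟫ := by
    intro a c x y
    have := hVi a c x y 1
    rw [hamp1] at this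
    change ⟪V a x, V c y⟫ = ⟪b a, b c⟫ * ⟪x, y⟫ at this
    rwa [orthonormal_iff_ite.1 b.orthonormal] at this
  have mk : ∀ Z : Γ → 𝔉, (∀ k, star (Z k) * Z k = 1) → ∃ X : Amp S L →L[ℂ] Amp S L,
      star X * X = 1 ∧ ∀ a x, X (V a x) = V a (Z a.1 x) := by
    intro Z hZ
    have ho : Orthonormal ℂ fun p : (Γ × J) × S => V p.1 (Z p.1.1 (f p.2)) := by
      rw [orthonormal_iff_ite]
      rintro ⟨a, A⟩ ⟨c, B⟩
      rw [hVV]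
      by_cases h : a = c
      · subst h
        rw [uni_inner (hZ _), orthonormal_iff_ite.1 f.orthonormal]
        simp
      · simp [h]
    obtain ⟨X, hX1, hX2⟩ := iso_onb d ho
    refine ⟨X, ?_, ?_⟩
    · refine ext_entries d d fun i j => ?_
      rw [mul_apply_eq_comp, star_inner_right, hX2]; rfl
    · intro a x
      have e : X ∘L V a = V a ∘L Z a.1 := by
        refine ext_on (s := Set.range f) ?_ ?_
        · rw [dense_iff_topologicalClosure_eq_top]; exact f.dense_span
        · rintro _ ⟨A, rfl⟩
          change X (V a (f A)) = V a (Z a.1 (f A))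
          rw [hV, ← hd, hX1]
      exact congrArg (fun T : F →L[ℂ] Amp S L => T x) e
  obtain ⟨X, hX, hXV⟩ := mk W hW.uni
  obtain ⟨X', hX', hXV'⟩ := mk (fun k => star (W k)) (fun k => by rw [star_star]; exact hW.uni' k)
  have h3 : X * X' = 1 := by
    refine ext_entries d d fun i j => ?_
    obtain ⟨a, A⟩ := i
    rw [mul_apply_eq_comp, hd a A, ← hV a A, hXV', hXV, ← mul_apply_eq_comp, hW.uni']; rfl
  have h4 : star X = X' := by
    calc star X = star X * (X * X') := by rw [h3, mul_one]
      _ = X' := by rw [← mul_assoc, hX, one_mul]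
  exact ⟨X, hX, by rw [h4, h3], hXV⟩

end core

section core
variable {Γ : Type} [Group Γ] {S : Type} [MulAction Γ S] {J : Type u}
  {F : Type w} [NormedAddCommGroup F] [InnerProductSpace ℂ F] [CompleteSpace F]
  {L : Type v} [NormedAddCommGroup L] [InnerProductSpace ℂ L] [CompleteSpace L]
  {E : Type x} [NormedAddCommGroup E] [InnerProductSpace ℂ E] [CompleteSpace E]
local notation "𝔉" => F →L[ℂ] F

/-- Sum of squared norms of the images of a family of vectors. -/
def nn (ξ : J → E) (Z : E →L[ℂ] E) : ℝ≥0∞ := ∑' j, ‖Z (ξ j)‖ₑ ^ 2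

theorem tsum_prod2 {α β : Type*} (f : α × β → ℝ≥0∞) : ∑' p, f p = ∑' a, ∑' b, f (a, b) :=
  ENNReal.tsum_prod (f := fun a b => f (a, b))

theorem nn_left (ξ : J → E) (X Z : E →L[ℂ] E) (hX : ‖X‖ ≤ 1) : nn ξ (X * Z) ≤ nn ξ Z := by
  refine ENNReal.tsum_le_tsum fun j => ?_
  rw [mul_apply_eq_comp]
  refine (enorm_apply_sq_le _ _).trans ?_
  have h1 : ‖X‖ₑ ≤ 1 := by rw [← ofReal_norm]; exact ofReal_le_one.2 hX
  calc ‖X‖ₑ ^ 2 * ‖Z (ξ j)‖ₑ ^ 2 ≤ 1 * ‖Z (ξ j)‖ₑ ^ 2 := mul_le_mul_left (pow_le_one' h1 2) _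
    _ = _ := one_mul _

theorem nn_add (ξ : J → E) (X Z : E →L[ℂ] E) : nn ξ (X + Z) ≤ 2 * nn ξ X + 2 * nn ξ Z := by
  unfold nn
  rw [← ENNReal.tsum_mul_left, ← ENNReal.tsum_mul_left, ← ENNReal.tsum_add]
  exact ENNReal.tsum_le_tsum fun i => enorm_add_sq_le _ _

theorem nn_neg (ξ : J → E) (X : E →L[ℂ] E) : nn ξ (-X) = nn ξ X := by
  unfold nn; congr 1; funext i; rw [neg_apply, enorm_neg]

theorem nn_star {f : HilbertBasis S ℂ F} {o : S} {τ : S → Equiv.Perm S} {W : Γ → 𝔉}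
    (hW : WD Γ f o τ W) (d : HilbertBasis ((Γ × J) × S) ℂ E) {Z : E →L[ℂ] E}
    (h1 : ∀ g, Inv d (sig S J g) Z) (h2 : ∀ C, Inv d (tau' Γ J (τ C)) Z) :
    nn (fun j => d ((1, j), o)) (star Z) = nn (fun j => d ((1, j), o)) Z := by
  unfold nn
  have hflip : ∀ (h : Γ) (i j : J) (A : S), ⟪d ((h, i), A), Z (d ((1, j), o))⟫
      = ⟪d ((1, i), o), Z (d ((h⁻¹, j), h • A))⟫ := by
    intro h i j A
    have e1 := h1 h ((h, i), A) ((1, j), o)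
    have e2 := h2 (h • A) ((1, i), h • A) ((h⁻¹, j), o)
    simp only [sig, rho, tau', prodCongr_apply, Prod.map, coe_mulRight, refl_apply,
      MulAction.toPerm_apply, mul_inv_cancel, one_mul, hW.smul_o, hW.tau1, hW.tau2] at e1 e2
    rw [← e1, e2]
  calc ∑' j, ‖(star Z) (d ((1, j), o))‖ₑ ^ 2
      = ∑' j, ∑' p, ‖⟪d p, (star Z) (d ((1, j), o))⟫‖ₑ ^ 2 := tsum_congr fun j => (hb_parseval d _).symm
    _ = ∑' j, ∑' p, ‖⟪d ((1, j), o), Z (d p)⟫‖ₑ ^ 2 := by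
        refine tsum_congr fun j => tsum_congr fun p => ?_
        rw [star_inner_right, enorm_inner_symm]
    _ = ∑' i, ∑' j, ∑' h : Γ, ∑' A, ‖⟪d ((1, i), o), Z (d ((h⁻¹, j), h • A))⟫‖ₑ ^ 2 := by
        refine tsum_congr fun i => ?_
        rw [tsum_prod2, tsum_prod2, ENNReal.tsum_comm]
        refine tsum_congr fun j => ?_
        rw [← (Equiv.inv Γ).tsum_eq]
        refine tsum_congr fun h => ?_
        rw [← (MulAction.toPerm (α := Γ) (β := S) h).tsum_eq]
        rfl
    _ = ∑' j, ∑' p, ‖⟪d p, Z (d ((1, j), o))⟫‖ₑ ^ 2 := by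
        rw [ENNReal.tsum_comm]
        refine tsum_congr fun j => ?_
        rw [tsum_prod2, tsum_prod2, ENNReal.tsum_comm]
        exact tsum_congr fun h => tsum_congr fun i => tsum_congr fun A => by rw [hflip]
    _ = ∑' j, ‖Z (d ((1, j), o))‖ₑ ^ 2 := tsum_congr fun j => hb_parseval d _

theorem nn_weighted {o : S} (ho : ∀ g : Γ, g • o = o) (b : HilbertBasis (Γ × J) ℂ L)
    (d : HilbertBasis ((Γ × J) × S) ℂ (Amp S L)) (hd : ∀ a A, d (a, A) = inc A (b a))
    (c : S → ℝ≥0∞) (hc0 : c o = 0) (hc1 : ∀ B, B ≠ o → ∑' g : Γ, c (g⁻¹ • B) = 1)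
    {Z : Amp S L →L[ℂ] Amp S L} (h1 : ∀ g, Inv d (sig S J g) Z) :
    nn (fun j => d ((1, j), o)) Z
      = ∑' A, c A * hs b (adjoint (inc A) ∘L Z ∘L inc o)
        + ∑' j, ‖(Z (d ((1, j), o))) o‖ₑ ^ 2 := by
  classical
  set q : S → Γ → J → J → ℝ≥0∞ := fun B g i j => ‖⟪d ((g, i), B), Z (d ((1, j), o))⟫‖ₑ ^ 2 with hq
  have hent : ∀ A (a : Γ × J) (e : Γ × J),
      ‖⟪b a, (adjoint (inc A) ∘L Z ∘L inc o) (b e)⟫‖ₑ ^ 2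
        = q (e.1 • A) (a.1 * e.1⁻¹) a.2 e.2 := by
    rintro A ⟨h, i⟩ ⟨k, j⟩
    have e1 := h1 k ((h, i), A) ((k, j), o)
    simp only [sig, rho, prodCongr_apply, Prod.map, coe_mulRight, refl_apply,
      MulAction.toPerm_apply, mul_inv_cancel, ho] at e1
    simp only [hq]
    rw [e1, hd, hd]
    change ‖⟪b (h, i), adjoint (inc A) (Z (inc o (b (k, j))))⟫‖ₑ ^ 2 = _
    rw [adjoint_inner_right]
  have hhs : ∀ A, hs b (adjoint (inc A) ∘L Z ∘L inc o)
      = ∑' k : Γ, ∑' j, ∑' g : Γ, ∑' i, q (k • A) g i j := by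
    intro A
    unfold hs
    rw [tsum_prod2]
    refine tsum_congr fun k => tsum_congr fun j => ?_
    rw [← hb_parseval b, tsum_prod2, ← (Equiv.mulRight k).tsum_eq]
    refine tsum_congr fun g => tsum_congr fun i => ?_
    rw [hent]
    simp
  have hR : ∀ B, ∑' j, ∑' g : Γ, ∑' i, q B g i j = ∑' j, ‖(Z (d ((1, j), o))) B‖ₑ ^ 2 := by
    intro B
    refine tsum_congr fun j => ?_
    rw [← hb_parseval b, tsum_prod2]
    refine tsum_congr fun g => tsum_congr fun i => ?_
    rw [← inner_inc, ← hd]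
  set R : S → ℝ≥0∞ := fun B => ∑' j, ∑' g : Γ, ∑' i, q B g i j with hRd
  have hLHS : nn (fun j => d ((1, j), o)) Z = ∑' B, R B := by
    unfold nn
    rw [tsum_congr hR, ENNReal.tsum_comm]
    refine tsum_congr fun j => ?_
    rw [← hb_parseval d, tsum_prod2, ENNReal.tsum_comm]
    refine tsum_congr fun B => ?_
    rw [← hb_parseval b]
    refine tsum_congr fun a => ?_
    rw [← inner_inc, ← hd]
  have hsum : ∑' A, c A * hs b (adjoint (inc A) ∘L Z ∘L inc o)
      = ∑' B, (∑' g : Γ, c (g⁻¹ • B)) * R B := by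
    calc _ = ∑' A, ∑' k : Γ, c A * R (k • A) := by
          refine tsum_congr fun A => ?_
          rw [hhs, ENNReal.tsum_mul_left]
      _ = ∑' k : Γ, ∑' A, c A * R (k • A) := ENNReal.tsum_comm
      _ = ∑' k : Γ, ∑' B, c (k⁻¹ • B) * R B := by
          refine tsum_congr fun k => ?_
          rw [← (MulAction.toPerm (α := Γ) (β := S) k).tsum_eq (fun B => c (k⁻¹ • B) * R B)]
          refine tsum_congr fun A => ?_
          simp
      _ = _ := by
          rw [ENNReal.tsum_comm]
          exact tsum_congr fun B => ENNReal.tsum_mul_right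
  rw [hLHS, hsum, ← hR o]
  change _ = _ + R o
  rw [ENNReal.tsum_eq_add_tsum_ite o, ENNReal.tsum_eq_add_tsum_ite (f := fun B => _ * R B) o]
  have h0 : ∑' g : Γ, c (g⁻¹ • o) = 0 := by simp [ho, hc0]
  rw [h0, zero_mul, zero_add, add_comm]
  congr 1
  refine tsum_congr fun B => ?_
  split_ifs with h
  · rfl
  · rw [hc1 B h, one_mul]

end core

section core
variable {Γ : Type} [Group Γ] {S : Type} [MulAction Γ S] {J : Type u}
  {F : Type w} [NormedAddCommGroup F] [InnerProductSpace ℂ F] [CompleteSpace F]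
  {L : Type v} [NormedAddCommGroup L] [InnerProductSpace ℂ L] [CompleteSpace L]
local notation "𝔉" => F →L[ℂ] F

/-- The displacement of `T` under the deformation. -/
def dv (b : HilbertBasis (Γ × J) ℂ L) (φ : Γ → ℝ≥0∞) (T : L →L[ℂ] L) : ℝ≥0∞ :=
  ∑' j, ∑' a, ‖⟪b a, T (b (1, j))⟫‖ₑ ^ 2 * φ a.1

theorem isom_star {X : 𝔉} (h : X * star X = 1) (v : F) : ‖star X v‖ₑ = ‖v‖ₑ := by
  have h1 : ‖star X v‖ = ‖v‖ := unitary_norm (w := star X) (by rw [star_star]; exact h) v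
  rw [← ofReal_norm, ← ofReal_norm, h1]

set_option maxHeartbeats 800000 in
theorem core_lemma {f : HilbertBasis S ℂ F} {o : S} {τ : S → Equiv.Perm S} {W : Γ → 𝔉}
    (hW : WD Γ f o τ W) (b : HilbertBasis (Γ × J) ℂ L)
    (c : S → ℝ≥0∞) (hc0 : c o = 0) (hc1 : ∀ B, B ≠ o → ∑' g : Γ, c (g⁻¹ • B) = 1)
    (z : L →L[ℂ] L) (hz : ∀ g, Inv b (rho J g) z) (hz1 : ‖z‖ ≤ 1) :
    ∃ TA : S → L →L[ℂ] L, (∑' A, c A * hs b (TA A) ≤ nn (fun j => b (1, j)) z) ∧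
      (∀ T, (∀ g, Inv b (rho J g) T) → ∑' A, c A * hs b (T * TA A - TA A * T)
        ≤ 8 * dv b (fun g => ‖W g (f o) - f o‖ₑ ^ 2) T + 2 * nn (fun j => b (1, j)) (T * z - z * T)) ∧
      ∀ p, (∀ g, Inv b (rho J g) p) → ‖p‖ ≤ 1 → nn (fun j => b (1, j)) (p * z)
        ≤ 2 * ∑' A, c A * hs b (p * TA A) + 2 * dv b (fun g => ‖⟪W g (f o), f o⟫‖ₑ ^ 2) z
          + 2 * dv b (fun g => ‖W g (f o) - f o‖ₑ ^ 2) p := by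
  classical
  obtain ⟨d, hd⟩ := amp_onb S b
  obtain ⟨V, hV, hVinc, hVi⟩ := wd_ops b f d hd
  obtain ⟨X, hX, hX', hXV⟩ := wd_unitary hW b d hd V hV hVi
  set B : (L →L[ℂ] L) → (Amp S L →L[ℂ] Amp S L) := fun T => star X * amp S T * X with hB
  have hXV' : ∀ a x, star X (V a x) = V a (star (W a.1) x) := by
    intro a x
    have h1 : X (V a (star (W a.1) x)) = V a x := by
      rw [hXV, ← mul_apply_eq_comp, hW.uni']; rfl
    rw [← h1, ← mul_apply_eq_comp, hX]; rfl
  have hBent : ∀ T a A a' A', ⟪d (a, A), B T (d (a', A'))⟫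
      = ⟪b a, T (b a')⟫ * ⟪W a.1 (f A), W a'.1 (f A')⟫ := by
    intro T a A a' A'
    simp only [hB, mul_apply_eq_comp]
    rw [star_inner_right, hd, hd, ← hV, ← hV, hXV, hXV, hVi]
  have hAent : ∀ T a A a' A', ⟪d (a, A), amp S T (d (a', A'))⟫
      = ⟪b a, T (b a')⟫ * ⟪f A, f A'⟫ := by
    intro T a A a' A'
    rw [hd, hd, ← hV, ← hV, hVi]
  have hff : ∀ (e : Equiv.Perm S) A A', ⟪f (e A), f (e A')⟫ = ⟪f A, f A'⟫ := by
    intro e A A'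
    rw [orthonormal_iff_ite.1 f.orthonormal, orthonormal_iff_ite.1 f.orthonormal]
    simp
  have hBs : ∀ T, (∀ g, Inv b (rho J g) T) → ∀ g, Inv d (sig S J g) (B T) := by
    rintro T hT g ⟨⟨h, i⟩, A⟩ ⟨⟨k, j⟩, A'⟩
    have e := hT g (h, i) (k, j)
    simp only [sig, rho, prodCongr_apply, Prod.map, coe_mulRight, refl_apply,
      MulAction.toPerm_apply] at e ⊢
    rw [hBent, hBent, e, hW.inv1]
  have hBt : ∀ T C, Inv d (tau' Γ J (τ C)) (B T) := by
    rintro T C ⟨a, A⟩ ⟨a', A'⟩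
    simp only [tau', prodCongr_apply, Prod.map, refl_apply]
    rw [hBent, hBent, hW.inv2]
  have hAs : ∀ T, (∀ g, Inv b (rho J g) T) → ∀ g, Inv d (sig S J g) (amp S T) := by
    rintro T hT g ⟨⟨h, i⟩, A⟩ ⟨⟨k, j⟩, A'⟩
    have e := hT g (h, i) (k, j)
    have e2 := hff (MulAction.toPerm g) A A'
    simp only [sig, rho, prodCongr_apply, Prod.map, coe_mulRight, refl_apply,
      MulAction.toPerm_apply] at e e2 ⊢
    rw [hAent, hAent, e, e2]
  have hAt : ∀ T C, Inv d (tau' Γ J (τ C)) (amp S T) := by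
    rintro T C ⟨a, A⟩ ⟨a', A'⟩
    simp only [tau', prodCongr_apply, Prod.map, refl_apply]
    rw [hAent, hAent, hff]
  set ξ : J → Amp S L := fun j => d ((1, j), o) with hξ
  have hξi : ∀ j, ξ j = inc o (b (1, j)) := fun j => hd _ _
  have hXξ : ∀ j, X (ξ j) = ξ j := by
    intro j
    rw [hξi, ← hV, hXV, hW.one]; rfl
  have hBmul : ∀ T T', B T * B T' = B (T * T') := by
    intro T T'
    simp only [hB, amp_mul]
    calc _ = star X * amp S T * (X * star X) * amp S T' * X := by simp only [mul_assoc]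
      _ = _ := by rw [hX', mul_one]; simp only [mul_assoc]
  have hBsub : ∀ T T', B (T - T') = B T - B T' := by
    intro T T'
    simp only [hB, amp_sub, mul_sub, sub_mul]
  have hBnn : ∀ T, nn ξ (B T) = nn (fun j => b (1, j)) T := by
    intro T
    unfold nn
    refine tsum_congr fun j => ?_
    simp only [hB, mul_apply_eq_comp]
    rw [isom_star hX', hXξ, hξi, amp_inc, ← ofReal_norm, norm_inc, ofReal_norm]
  have hXn : ‖X‖ ≤ 1 := opNorm_le_bound _ zero_le_one fun v => by
    rw [unitary_norm hX, one_mul]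
  have hXn' : ‖star X‖ ≤ 1 := (LinearIsometryEquiv.norm_map adjoint X).trans_le hXn
  have hzB : ‖B z‖ ≤ 1 := by
    have h1 : ‖amp S z‖ ≤ 1 := (amp_norm _).trans hz1
    calc ‖B z‖ ≤ ‖star X * amp S z‖ * ‖X‖ := norm_mul_le _ _
      _ ≤ (‖star X‖ * ‖amp S z‖) * ‖X‖ := by gcongr; exact norm_mul_le _ _
      _ ≤ (1 * 1) * 1 := by gcongr
      _ = 1 := by norm_num
  have hzB' : ‖star (B z)‖ ≤ 1 :=
    (LinearIsometryEquiv.norm_map adjoint (B z)).trans_le hzB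
  -- displacement
  have hY : ∀ T, nn ξ (amp S T - B T) = dv b (fun g => ‖W g (f o) - f o‖ₑ ^ 2) T := by
    intro T
    unfold nn dv
    refine tsum_congr fun j => ?_
    set v := T (b (1, j)) with hv
    have e1 : (amp S T - B T) (ξ j) = star X ((X - 1) (inc o v)) := by
      rw [sub_apply, sub_apply, map_sub, ← mul_apply_eq_comp (star X) X, hX]
      simp only [hB, mul_apply_eq_comp]
      rw [hXξ, hξi, amp_inc]; rfl
    rw [e1, isom_star hX', ← hb_parseval d, tsum_prod2]
    refine tsum_congr fun a => ?_
    beta_reduce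
    rw [← hb_parseval f (W a.1 (f o) - f o), ← ENNReal.tsum_mul_left]
    refine tsum_congr fun A => ?_
    have e2 : ⟪d (a, A), (X - 1) (inc o v)⟫ = ⟪b a, v⟫ * ⟪f A, W a.1 (f o) - f o⟫ := by
      rw [sub_apply, inner_sub_right, inner_sub_right, ← star_inner_left, hd, ← hV, hXV', hVinc,
        star_inner_left]
      have e3 := hVinc a (f A) o v
      change _ - ⟪V a (f A), inc o v⟫ = _
      rw [e3]; ring
    rw [e2, enorm_mul, mul_pow]
  have hYz : ∀ T, (∀ g, Inv b (rho J g) T) → nn ξ ((amp S T - B T) * B z)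
      ≤ dv b (fun g => ‖W g (f o) - f o‖ₑ ^ 2) T := by
    intro T hT
    have i1 : ∀ g, Inv d (sig S J g) (amp S T - B T) := fun g => (hAs T hT g).sub (hBs T hT g)
    have i2 : ∀ C, Inv d (tau' Γ J (τ C)) (amp S T - B T) := fun C => (hAt T C).sub (hBt T C)
    have j1 : ∀ g, Inv d (sig S J g) ((amp S T - B T) * B z) := fun g => (i1 g).mul (hBs z hz g)
    have j2 : ∀ C, Inv d (tau' Γ J (τ C)) ((amp S T - B T) * B z) := fun C => (i2 C).mul (hBt z C)
    rw [← hY T, ← nn_star hW d i1 i2, ← nn_star hW d j1 j2, star_mul]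
    exact nn_left _ _ _ hzB'
  set TA : S → L →L[ℂ] L := fun A => adjoint (inc A) ∘L B z ∘L inc o with hTA
  have hTAl : ∀ T A, T * TA A = adjoint (inc A) ∘L (amp S T * B z) ∘L inc o := by
    intro T A
    ext v
    change T (adjoint (inc A) (B z (inc o v)))
      = adjoint (inc A) (amp S T (B z (inc o v)))
    rw [adj_inc, adj_inc, amp_apply]
  have hTAr : ∀ T A, TA A * T = adjoint (inc A) ∘L (B z * amp S T) ∘L inc o := by
    intro T A
    ext v
    change adjoint (inc A) (B z (inc o (T v)))
      = adjoint (inc A) (B z (amp S T (inc o v)))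
    rw [amp_inc]
  have hwt := fun (Z : Amp S L →L[ℂ] Amp S L) (h1 : ∀ g, Inv d (sig S J g) Z) =>
    nn_weighted hW.smul_o b d hd c hc0 hc1 h1
  refine ⟨TA, ?_, fun T hT => ?_, fun p hp hp1 => ?_⟩
  · rw [← hBnn z]
    have := hwt (B z) (hBs z hz)
    change nn ξ (B z) = _ at this
    rw [this]
    exact le_self_add
  · have e1 : ∀ A, T * TA A - TA A * T = adjoint (inc A) ∘L
        (amp S T * B z - B z * amp S T) ∘L inc o := by
      intro A
      rw [hTAl, hTAr]
      ext v
      simp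
    have h1 : ∑' A, c A * hs b (T * TA A - TA A * T) ≤ nn ξ (amp S T * B z - B z * amp S T) := by
      have := hwt (amp S T * B z - B z * amp S T)
        (fun g => ((hAs T hT g).mul (hBs z hz g)).sub ((hBs z hz g).mul (hAs T hT g)))
      change nn ξ _ = _ at this
      rw [this]
      simp only [e1]
      exact le_self_add
    refine h1.trans ?_
    have e2 : amp S T * B z - B z * amp S T = ((amp S T - B T) * B z + -(B z * (amp S T - B T)))
        + B (T * z - z * T) := by
      rw [hBsub, ← hBmul, ← hBmul]; noncomm_ring
    rw [e2]
    refine (nn_add _ _ _).trans ?_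
    rw [hBnn]
    have h2 : nn ξ ((amp S T - B T) * B z + -(B z * (amp S T - B T)))
        ≤ 4 * dv b (fun g => ‖W g (f o) - f o‖ₑ ^ 2) T := by
      refine (nn_add _ _ _).trans ?_
      rw [nn_neg]
      have h3 := nn_left ξ (B z) (amp S T - B T) hzB
      rw [hY] at h3
      calc _ ≤ 2 * dv b (fun g => ‖W g (f o) - f o‖ₑ ^ 2) T + 2 * dv b (fun g => ‖W g (f o) - f o‖ₑ ^ 2) T := by
            gcongr; exact hYz T hT
        _ = _ := by ring
    calc _ ≤ 2 * (4 * dv b (fun g => ‖W g (f o) - f o‖ₑ ^ 2) T) + 2 * nn (fun j => b (1, j)) (T * z - z * T) := by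
          gcongr
      _ = _ := by ring
  · have e1 : B (p * z) = amp S p * B z + -((amp S p - B p) * B z) := by
      rw [← hBmul]; noncomm_ring
    rw [← hBnn, e1]
    refine (nn_add _ _ _).trans ?_
    rw [nn_neg]
    have := hwt (amp S p * B z) (fun g => (hAs p hp g).mul (hBs z hz g))
    change nn ξ _ = _ at this
    have h2 : ∑' j, ‖((amp S p * B z) (d ((1, j), o))) o‖ₑ ^ 2
        ≤ dv b (fun g => ‖⟪W g (f o), f o⟫‖ₑ ^ 2) z := by
      refine ENNReal.tsum_le_tsum fun j => ?_
      rw [mul_apply_eq_comp, amp_apply]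
      refine (enorm_apply_sq_le _ _).trans ?_
      have hp2 : ‖p‖ₑ ≤ 1 := by rw [← ofReal_norm]; exact ofReal_le_one.2 hp1
      refine (mul_le_mul_left (pow_le_one' hp2 2) _).trans ?_
      rw [one_mul, ← hb_parseval b]
      refine ENNReal.tsum_le_tsum fun a => le_of_eq ?_
      rw [← inner_inc, ← hd, hBent, enorm_mul, mul_pow, hW.one]; rfl
    rw [this]
    simp only [← hTAl]
    calc _ ≤ 2 * (∑' A, c A * hs b (p * TA A) + dv b (fun g => ‖⟪W g (f o), f o⟫‖ₑ ^ 2) z)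
          + 2 * dv b (fun g => ‖W g (f o) - f o‖ₑ ^ 2) p := by
          gcongr; exact hYz p hp
      _ = _ := by ring

end core

section deform
open scoped Pointwise symmDiff

/-- Edges of the Cayley graph of the free group. -/
def Edge (r : ℕ) : Type := FreeGroup (Fin r) × Fin r

instance (r : ℕ) : DecidableEq (Edge r) := inferInstanceAs (DecidableEq (FreeGroup (Fin r) × Fin r))

instance (r : ℕ) : MulAction (FreeGroup (Fin r)) (Edge r) where
  smul g e := (g * e.1, e.2)
  one_smul e := by change ((1 * e.1, e.2) : FreeGroup (Fin r) × Fin r) = e; rw [one_mul]; rfl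
  mul_smul g h e := by
    change ((g * h * e.1, e.2) : FreeGroup (Fin r) × Fin r) = (g * (h * e.1), e.2); rw [mul_assoc]

variable {r : ℕ} {F : Type w} [NormedAddCommGroup F] [InnerProductSpace ℂ F] [CompleteSpace F]
local notation "𝔉" => F →L[ℂ] F

theorem perm_op {S : Type} (f : HilbertBasis S ℂ F) : ∃ p : Equiv.Perm S →* unitary 𝔉,
    ∀ σ A, (p σ : 𝔉) (f A) = f (σ A) := by
  have h1 : ∀ σ : Equiv.Perm S, ∃ V : 𝔉, (∀ A, V (f A) = f (σ A)) ∧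
      ∀ x y, ⟪V x, V y⟫ = ⟪x, y⟫ := fun σ =>
    iso_onb f (f.orthonormal.comp σ σ.injective)
  choose V hV1 hV2 using h1
  have hmul : ∀ σ τ, V (σ * τ) = V σ * V τ := fun σ τ => ext_entries f f fun i j => by
    rw [mul_apply_eq_comp, hV1, hV1, hV1]; rfl
  have hone : V 1 = 1 := ext_entries f f fun i j => by rw [hV1]; rfl
  have h2 : ∀ σ, star (V σ) * V σ = 1 := fun σ => ext_entries f f fun i j => by
    rw [mul_apply_eq_comp, star_inner_right, hV2]; rfl
  have h3 : ∀ σ, V σ * star (V σ) = 1 := by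
    intro σ
    have e : V σ * V σ⁻¹ = 1 := by rw [← hmul, mul_inv_cancel, hone]
    have e2 : star (V σ) = V σ⁻¹ := by
      calc star (V σ) = star (V σ) * (V σ * V σ⁻¹) := by rw [e, mul_one]
        _ = V σ⁻¹ := by rw [← mul_assoc, h2, one_mul]
    rw [e2, e]
  exact ⟨⟨⟨fun σ => ⟨V σ, h2 σ, h3 σ⟩, Subtype.ext hone⟩, fun σ τ => Subtype.ext (hmul σ τ)⟩, hV1⟩

/-- The flip by `C`. -/
def flipP (C : Finset (Edge r)) : Equiv.Perm (Finset (Edge r)) where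
  toFun A := A ∆ C
  invFun A := A ∆ C
  left_inv A := by simp
  right_inv A := by simp

/-- Rotation in the direction of the involution `P`. -/
def rot (s : ℝ) (P : 𝔉) : 𝔉 :=
  ((Real.cos s : ℝ) : ℂ) • (1 : 𝔉) + (Complex.I * ((Real.sin s : ℝ) : ℂ)) • P

theorem rot_star (s : ℝ) {P : 𝔉} (h : star P = P) : star (rot s P) = rot (-s) P := by
  simp only [rot, star_add, star_smul, star_one, h, Real.cos_neg, Real.sin_neg,
    star_mul, RCLike.star_def, conj_ofReal, Complex.conj_I]
  push_cast
  congr 2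
  ring

theorem rot_mul (s : ℝ) {P : 𝔉} (h : P * P = 1) : rot s P * rot (-s) P = 1 := by
  simp only [rot, Real.cos_neg, Real.sin_neg, add_mul, mul_add, smul_mul_assoc, mul_smul_comm, h,
    one_mul, mul_one, smul_add, smul_smul]
  have e : ((Real.cos s : ℝ) : ℂ) ^ 2 + ((Real.sin s : ℝ) : ℂ) ^ 2 = 1 := by
    exact_mod_cast Real.cos_sq_add_sin_sq s
  have e2 : ∀ x y z w : ℂ, y + z = 0 → x + w = 1 →
      (x • (1 : 𝔉) + y • P) + (z • P + w • (1 : 𝔉)) = 1 := by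
    intro x y z w h1 h2
    calc _ = (x + w) • (1 : 𝔉) + (y + z) • P := by rw [add_smul, add_smul]; abel
      _ = 1 := by rw [h1, h2]; simp
  have e3 := Complex.I_sq
  refine e2 _ _ _ _ ?_ ?_
  · push_cast; ring
  · push_cast at e ⊢; linear_combination e - (Complex.sin s)^2 * e3

/-- The length of an edge. -/
def ln (e : Edge r) : ℕ := max (FreeGroup.norm e.1) (FreeGroup.norm (e.1 * of e.2))

/-- The edge traversed by a letter. -/
def eps (a : Fin r × Bool) : Edge r := (bif a.2 then 1 else (of a.1)⁻¹, a.1)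

theorem ln_le (g : FreeGroup (Fin r)) (a : Fin r × Bool) (n : ℕ) (hg : FreeGroup.norm g ≤ n) :
    ln (g • eps a) ≤ n + 1 := by
  obtain ⟨i, b⟩ := a
  cases b
  · change max (FreeGroup.norm (g * (of i)⁻¹))
      (FreeGroup.norm (g * (of i)⁻¹ * of i)) ≤ _
    have := FreeGroup.norm_mul_le g (of i)⁻¹
    rw [FreeGroup.norm_inv_eq, FreeGroup.norm_of] at this
    rw [inv_mul_cancel_right]
    omega
  · change max (FreeGroup.norm (g * 1)) (FreeGroup.norm (g * 1 * of i)) ≤ _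
    have := FreeGroup.norm_mul_le g (of i)
    rw [FreeGroup.norm_of] at this
    rw [mul_one]
    omega

theorem le_ln (g : FreeGroup (Fin r)) (a : Fin r × Bool) :
    FreeGroup.norm (g * mk [a]) ≤ ln (g • eps a) := by
  obtain ⟨i, b⟩ := a
  cases b
  · exact le_max_left _ _
  · change _ ≤ max (FreeGroup.norm (g * 1)) (FreeGroup.norm (g * 1 * of i))
    rw [mul_one]
    exact le_max_right _ _

set_option maxHeartbeats 800000 in
theorem fg_deform (f : HilbertBasis (Finset (Edge r)) ℂ F) : ∃ (W : ℝ → FreeGroup (Fin r) → 𝔉),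
    (∀ s, WD (FreeGroup (Fin r)) f ∅ flipP (W s)) ∧
    (∀ g, Continuous fun s => W s g) ∧ (∀ g, W 0 g = 1) ∧
    ∀ s g, ‖⟪W s g (f ∅), f ∅⟫‖ = |Real.cos s| ^ FreeGroup.norm g := by
  classical
  obtain ⟨p, hp⟩ := perm_op f
  set π : FreeGroup (Fin r) →* unitary 𝔉 :=
    p.comp (MulAction.toPermHom (FreeGroup (Fin r)) (Finset (Edge r))) with hπ
  have hπf : ∀ g A, (π g : 𝔉) (f A) = f (g • A) := fun g A => hp _ _
  set P : Finset (Edge r) → 𝔉 := fun C => (p (flipP C) : 𝔉) with hP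
  have hPf : ∀ C A, P C (f A) = f (A ∆ C) := fun C A => hp _ _
  have hPP : ∀ C, P C * P C = 1 := fun C => ext_entries f f fun i j => by
    rw [mul_apply_eq_comp, hPf, hPf]; simp
  have hPc : ∀ C D, P C * P D = P D * P C := fun C D => ext_entries f f fun i j => by
    rw [mul_apply_eq_comp, mul_apply_eq_comp, hPf, hPf, hPf, hPf, symmDiff_right_comm]
  have hPs : ∀ C, star (P C) = P C := by
    intro C
    have e : star (P C) * P C = 1 := (p (flipP C)).2.1
    calc star (P C) = star (P C) * (P C * P C) := by rw [hPP, mul_one]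
      _ = P C := by rw [← mul_assoc, e, one_mul]
  have hπP : ∀ g C, (π g : 𝔉) * P C = P (g • C) * (π g : 𝔉) := fun g C =>
    ext_entries f f fun i j => by
      rw [mul_apply_eq_comp, mul_apply_eq_comp, hPf, hπf, hπf, hPf, Finset.smul_finset_symmDiff]
  have hrot : ∀ s C, rot s (P C) ∈ unitary 𝔉 := by
    intro s C
    rw [Unitary.mem_iff, rot_star _ (hPs C)]
    refine ⟨?_, rot_mul _ (hPP C)⟩
    have := rot_mul (-s) (hPP C)
    rwa [neg_neg] at this
  have hπrot : ∀ s g C, (π g : 𝔉) * rot s (P C) = rot s (P (g • C)) * (π g : 𝔉) := by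
    intro s g C
    simp only [rot, mul_add, add_mul, mul_smul_comm, smul_mul_assoc, mul_one, one_mul, hπP]
  set G : ℝ → Finset (Edge r) → unitary 𝔉 := fun s C => ⟨rot s (P C), hrot s C⟩ with hG
  set β : ℝ → FreeGroup (Fin r) →* unitary 𝔉 := fun s =>
    FreeGroup.lift fun i => G s {eps (i, true)} * π (of i) with hβ
  have hβof : ∀ s i, β s (of i) = G s {eps (i, true)} * π (of i) := fun s i =>
    FreeGroup.lift_apply_of
  -- letters
  have hβl : ∀ s (a : Fin r × Bool), ∃ s' : ℝ, (s' = s ∨ s' = -s) ∧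
      β s (mk [a]) = G s' {eps a} * π (mk [a]) := by
    rintro s ⟨i, b⟩
    cases b
    · refine ⟨-s, Or.inr rfl, ?_⟩
      have e : mk [(i, false)] = (of i)⁻¹ := by
        rw [of, FreeGroup.inv_mk]; rfl
      rw [e, map_inv, hβof, mul_inv_rev, ← map_inv]
      apply Subtype.ext
      have e2 : ((G s {eps (i, true)})⁻¹ : unitary 𝔉) = G (-s) {eps (i, true)} := by
        apply Subtype.ext
        rw [← Unitary.star_eq_inv, Unitary.coe_star]
        exact rot_star _ (hPs _)
      rw [e2]
      change (π (of i)⁻¹ : 𝔉) * rot (-s) (P _) = rot (-s) (P _) * _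
      rw [hπrot, Finset.smul_finset_singleton]
      have e3 : (of i)⁻¹ • eps (i, true) = eps (i, false) := by
        change (((of i)⁻¹ * 1, i) : FreeGroup (Fin r) × Fin r) = ((of i)⁻¹, i)
        rw [mul_one]
      rw [e3]
    · exact ⟨s, Or.inl rfl, hβof s i⟩
  have hβP : ∀ s g C, (β s g : 𝔉) * P C = P (g • C) * (β s g : 𝔉) := by
    intro s g
    induction g using FreeGroup.induction_on with
    | C1 => intro C; simp
    | of i =>
      intro C
      have e : Commute (rot s (P {eps (i, true)})) (P ((of i) • C)) := by
        change rot _ _ * _ = _ * rot _ _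
        simp only [rot, mul_add, add_mul, mul_smul_comm, smul_mul_assoc, mul_one, one_mul]
        rw [hPc]
      rw [hβof]
      change rot s (P _) * (π _ : 𝔉) * _ = _ * (rot s (P _) * (π _ : 𝔉))
      rw [mul_assoc, hπP, ← mul_assoc, e.eq, mul_assoc]
    | inv_of i ih =>
      intro C
      have e := ih ((of i)⁻¹ • C)
      rw [smul_inv_smul] at e
      have e1 : ((β s (of i)⁻¹ : unitary 𝔉) : 𝔉)
          * (β s (of i) : 𝔉) = 1 := by
        rw [← Submonoid.coe_mul, ← map_mul, inv_mul_cancel, map_one]; rfl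
      have e2 : (β s (of i) : 𝔉)
          * ((β s (of i)⁻¹ : unitary 𝔉) : 𝔉) = 1 := by
        rw [← Submonoid.coe_mul, ← map_mul, mul_inv_cancel, map_one]; rfl
      set B := (β s (of i) : 𝔉)
      set B' := ((β s (of i)⁻¹ : unitary 𝔉) : 𝔉)
      calc B' * P C = B' * (P C * B) * B' := by rw [mul_assoc, mul_assoc, e2, mul_one]
        _ = (B' * B) * P ((of i)⁻¹ • C) * B' := by rw [← e]; simp only [mul_assoc]
        _ = _ := by rw [e1, one_mul]
    | mul g h ihg ihh =>
      intro C
      rw [map_mul, Submonoid.coe_mul, mul_assoc, ihh, ← mul_assoc, ihg, mul_assoc, mul_smul]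
  have hβG : ∀ s s' g C, (β s g : 𝔉) * rot s' (P C) = rot s' (P (g • C)) * (β s g : 𝔉) := by
    intro s s' g C
    simp only [rot, mul_add, add_mul, mul_smul_comm, smul_mul_assoc, mul_one, one_mul, hβP]
  have hπo : ∀ g, (π g : 𝔉) (f ∅) = f ∅ := fun g => by rw [hπf, Finset.smul_finset_empty]
  -- word recursion
  have hrec : ∀ s (L : List (Fin r × Bool)) a, ∃ s' : ℝ, (s' = s ∨ s' = -s) ∧
      ∀ A, ⟪f A, (β s (mk (L ++ [a])) : 𝔉) (f ∅)⟫
      = (Real.cos s : ℂ) * ⟪f A, (β s (mk L) : 𝔉) (f ∅)⟫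
        + Complex.I * (Real.sin s' : ℂ) *
          ⟪f (A ∆ {mk L • eps a}), (β s (mk L) : 𝔉) (f ∅)⟫ := by
    intro s L a
    obtain ⟨s', hs', e⟩ := hβl s a
    refine ⟨s', hs', fun A => ?_⟩
    have hcos : Real.cos s' = Real.cos s := by
      rcases hs' with h | h <;> rw [h]
      exact Real.cos_neg s
    rw [← FreeGroup.mul_mk, map_mul, e]
    have e1 : ((β s (mk L) * (G s' {eps a} * π (mk [a])) : unitary 𝔉) : 𝔉)
        (f ∅) = rot s' (P {mk L • eps a}) ((β s (mk L) : 𝔉) (f ∅)) := by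
      change (β s (mk L) : 𝔉) (rot s' (P {eps a}) ((π (mk [a]) : 𝔉) (f ∅))) = _
      rw [hπo, ← mul_apply_eq_comp, hβG, mul_apply_eq_comp, Finset.smul_finset_singleton]
    rw [e1]
    simp only [rot, add_apply, smul_apply, inner_add_right, inner_smul_right, hcos]
    have e2 : ∀ v, ⟪f A, P {mk L • eps a} v⟫ = ⟪f (A ∆ {mk L • eps a}), v⟫ := by
      intro v
      rw [← hPf, ← star_inner_right, hPs]
    rw [e2]; rfl
  have hsupp : ∀ s (L : List (Fin r × Bool)) A,
      ⟪f A, (β s (mk L) : 𝔉) (f ∅)⟫ ≠ 0 → ∀ e ∈ A, ln e ≤ L.length := by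
    intro s L
    induction L using List.reverseRecOn with
    | nil =>
      intro A hA e he
      exfalso; apply hA
      rw [← FreeGroup.one_eq_mk, map_one]
      change ⟪f A, f ∅⟫ = 0
      rw [orthonormal_iff_ite.1 f.orthonormal, if_neg]
      rintro rfl; simp at he
    | append_singleton L a ih =>
      intro A hA e he
      obtain ⟨s', -, h⟩ := hrec s L a
      rw [h] at hA
      rw [List.length_append, List.length_singleton]
      by_cases h1 : ⟪f A, (β s (mk L) : 𝔉) (f ∅)⟫ = 0
      · have h2 : ⟪f (A ∆ {mk L • eps a}), (β s (mk L) : 𝔉) (f ∅)⟫ ≠ 0 := by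
          intro h3; apply hA; rw [h1, h3]; simp
        by_cases h4 : e = mk L • eps a
        · rw [h4]; exact ln_le _ _ _ FreeGroup.norm_mk_le
        · exact (ih _ h2 e (by rw [Finset.mem_symmDiff]; left; exact ⟨he, by simpa using h4⟩)).trans (by omega)
      · exact (ih _ h1 e he).trans (by omega)
  have hcos : ∀ s (L : List (Fin r × Bool)), FreeGroup.IsReduced L →
      ‖⟪f ∅, (β s (mk L) : 𝔉) (f ∅)⟫‖ = |Real.cos s| ^ L.length := by
    intro s L
    induction L using List.reverseRecOn with
    | nil =>
      intro _
      rw [← FreeGroup.one_eq_mk, map_one]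
      change ‖⟪f ∅, f ∅⟫‖ = _
      rw [orthonormal_iff_ite.1 f.orthonormal]; simp
    | append_singleton L a ih =>
      intro hL
      obtain ⟨s', -, h⟩ := hrec s L a
      have hL1 : FreeGroup.IsReduced L := List.IsChain.left_of_append hL
      have h0 : ⟪f (∅ ∆ {mk L • eps a}), (β s (mk L) : 𝔉) (f ∅)⟫ = 0 := by
        by_contra hne
        have h1 := hsupp s L _ hne (mk L • eps a)
          (by rw [Finset.mem_symmDiff]; right; exact ⟨Finset.mem_singleton_self _, Finset.notMem_empty _⟩)
        have h2 := le_ln (mk L) a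
        rw [FreeGroup.mul_mk, FreeGroup.norm, FreeGroup.toWord_mk, hL.reduce_eq] at h2
        simp at h2
        omega
      rw [h, h0, mul_zero, add_zero, norm_mul, ih hL1, List.length_append, List.length_singleton, pow_succ,
        mul_comm, norm_real, Real.norm_eq_abs]
  have hcont : ∀ g, Continuous fun s => (β s g : 𝔉) := by
    intro g
    induction g using FreeGroup.induction_on with
    | C1 => simpa using continuous_const
    | of i =>
      have : (fun s => (β s (of i) : 𝔉))
          = fun s => rot s (P {eps (i, true)}) * (π (of i) : 𝔉) := by
        funext s; rw [hβof]; rfl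
      rw [this]
      unfold rot
      fun_prop
    | inv_of i ih =>
      have : (fun s => (β s (of i)⁻¹ : 𝔉))
          = fun s => star (β s (of i) : 𝔉) := by
        funext s; rw [map_inv, ← Unitary.star_eq_inv, Unitary.coe_star]
      rw [this]
      exact (adjoint (𝕜 := ℂ) (E := F) (F := F)).continuous.comp ih
    | mul g h ihg ihh =>
      have : (fun s => (β s (g * h) : 𝔉))
          = fun s => (β s g : 𝔉) * (β s h : 𝔉) := by
        funext s; rw [map_mul]; rfl
      rw [this]
      exact ihg.mul ihh
  have hβ0 : β 0 = π := by
    refine FreeGroup.ext_hom _ _ fun i => ?_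
    rw [hβof]
    apply Subtype.ext
    change rot 0 _ * (π _ : 𝔉) = _
    simp [rot]
  refine ⟨fun s g => (((β s g)⁻¹ * π g : unitary 𝔉) : 𝔉), fun s => ?_, fun g => ?_,
    fun g => ?_, fun s g => ?_⟩
  · have hinner : ∀ (q : unitary 𝔉) x y, ⟪(q : 𝔉) x, (q : 𝔉) y⟫ = ⟪x, y⟫ :=
      fun q x y => uni_inner q.2.1 x y
    have hc : ∀ g h A, (((β s (h * g⁻¹))⁻¹ * π (h * g⁻¹) : unitary 𝔉) : 𝔉) (f (g • A))
        = (β s g : 𝔉) ((((β s h)⁻¹ * π h : unitary 𝔉) : 𝔉) (f A)) := by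
      intro g h A
      rw [← hπf, ← mul_apply_eq_comp, ← Submonoid.coe_mul, ← mul_apply_eq_comp, ← Submonoid.coe_mul]
      congr 2
      simp only [map_mul, map_inv]
      group
    have hPW : ∀ C h, (((β s h)⁻¹ * π h : unitary 𝔉) : 𝔉) * P C
        = P C * (((β s h)⁻¹ * π h : unitary 𝔉) : 𝔉) := by
      intro C h
      rw [Submonoid.coe_mul, mul_assoc, hπP, ← mul_assoc, ← map_inv, hβP, inv_smul_smul, mul_assoc]
    constructor
    · intro k; exact ((β s k)⁻¹ * π k).2.1
    · intro k; exact ((β s k)⁻¹ * π k).2.2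
    · simp
    · intro g; exact Finset.smul_finset_empty g
    · intro A; exact symmDiff_self A
    · intro A; exact bot_symmDiff A
    · intro g h k A B
      rw [hc, hc, hinner]
    · intro C h k A B
      change ⟪(_ : 𝔉) (f (A ∆ C)), (_ : 𝔉) (f (B ∆ C))⟫ = _
      rw [← hPf, ← hPf, ← mul_apply_eq_comp, hPW, mul_apply_eq_comp, ← mul_apply_eq_comp _ (P C), hPW,
        mul_apply_eq_comp]
      exact hinner (p (flipP C)) _ _
  · have : (fun s => (((β s g)⁻¹ * π g : unitary 𝔉) : 𝔉))
        = fun s => (β s g⁻¹ : 𝔉) * (π g : 𝔉) := by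
      funext s; rw [map_inv]; rfl
    rw [this]
    exact (hcont g⁻¹).mul continuous_const
  · beta_reduce
    rw [hβ0, inv_mul_cancel]; rfl
  · have e : (((β s g)⁻¹ * π g : unitary 𝔉) : 𝔉) (f ∅)
        = star (β s g : 𝔉) (f ∅) := by
      rw [Submonoid.coe_mul, mul_apply_eq_comp, hπo, ← Unitary.star_eq_inv, Unitary.coe_star]
    beta_reduce
    rw [e, star_inner_left]
    have h := hcos s g.toWord FreeGroup.isReduced_toWord
    rw [FreeGroup.mk_toWord] at h
    exact h

end deform

theorem tail_small {α : Type*} [DecidableEq α] (q : α → ℝ≥0∞) (hq : ∑' x, q x ≠ ∞) (κ : ℝ≥0∞) (hκ : κ ≠ 0) :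
    ∃ K : Finset α, ∑' x, (if x ∈ K then 0 else q x) ≤ κ := by
  have h := ENNReal.tendsto_tsum_compl_atTop_zero hq
  obtain ⟨K, hK⟩ := ((tendsto_order.1 h).2 κ (pos_iff_ne_zero.2 hκ)).exists
  refine ⟨K, le_trans (le_of_eq ?_) hK.le⟩
  change _ = ∑' b : ↥({x | x ∉ K} : Set α), q b
  rw [tsum_subtype]
  refine tsum_congr fun x => ?_
  by_cases hx : x ∈ K <;> simp [hx]

theorem dom_conv {α : Type*} (q : α → ℝ≥0∞) (hq : ∑' x, q x ≠ ∞) (φ : ℝ → α → ℝ≥0∞)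
    (hφ : ∀ s x, φ s x ≤ 4) (hφ0 : ∀ x, Tendsto (fun s => φ s x) (nhds 0) (nhds 0)) (κ : ℝ≥0∞) (hκ : κ ≠ 0) :
    ∀ᶠ s in nhds 0, ∑' x, q x * φ s x ≤ κ := by
  classical
  obtain ⟨κ', hκ', -, h1⟩ := small_mul 8 κ (by simp) hκ
  obtain ⟨K, hK⟩ := tail_small q hq κ' hκ'
  have h2 : Tendsto (fun s => ∑ x ∈ K, q x * φ s x) (nhds 0) (nhds 0) := by
    have : Tendsto (fun s => ∑ x ∈ K, q x * φ s x) (nhds 0) (nhds (∑ x ∈ K, q x * 0)) :=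
      tendsto_finset_sum _ fun x _ => ENNReal.Tendsto.const_mul (hφ0 x)
        (Or.inr (ENNReal.ne_top_of_tsum_ne_top hq x))
    simpa using this
  have h3 : κ / 2 ≠ 0 := by simp [hκ]
  filter_upwards [(tendsto_order.1 h2).2 (κ / 2) (pos_iff_ne_zero.2 h3)] with s hs
  have h4 : ∀ x, q x * φ s x ≤ (if x ∈ K then q x * φ s x else 0) + 4 * (if x ∈ K then 0 else q x) := by
    intro x
    by_cases hx : x ∈ K
    · simp [hx]
    · simp only [hx, if_false, zero_add]
      rw [mul_comm]
      exact mul_le_mul_left (hφ s x) _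
  refine (ENNReal.tsum_le_tsum h4).trans ?_
  rw [ENNReal.tsum_add, ENNReal.tsum_mul_left, tsum_eq_sum (s := K) (fun x hx => by simp [hx]),
    sum_congr rfl (fun x hx => if_pos hx)]
  have h5 : 4 * κ' ≤ κ / 2 := by
    rw [ENNReal.le_div_iff_mul_le (by simp) (by simp)]
    calc 4 * κ' * 2 = 8 * κ' := by ring
      _ ≤ κ := h1 _ le_rfl
  calc _ ≤ κ / 2 + 4 * κ' := by gcongr
    _ ≤ κ / 2 + κ / 2 := by gcongr
    _ = κ := ENNReal.add_halves κ

/-- The identification of edges with pairs. -/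
def mkE (r : ℕ) : FreeGroup (Fin r) × Fin r ≃ Edge r := Equiv.refl _

/-- The weight of a finite set of edges. -/
def cw {r : ℕ} (A : Finset (Edge r)) : ℝ≥0∞ :=
  (∑ i : Fin r, if mkE r (1, i) ∈ A then 1 else 0) / (A.card : ℝ≥0∞)

theorem cw_ne_top {r : ℕ} (A : Finset (Edge r)) : cw A ≠ ∞ := by
  unfold cw
  by_cases hA : A = ∅
  · subst hA; simp
  · refine ENNReal.div_ne_top ?_ (by simpa using hA)
    refine (ENNReal.sum_lt_top.2 fun i _ => ?_).ne
    split_ifs <;> simp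

theorem cw_empty {r : ℕ} : cw (∅ : Finset (Edge r)) = 0 := by
  simp [cw]

open scoped Pointwise in
theorem cw_sum {r : ℕ} (B : Finset (Edge r)) (hB : B ≠ ∅) : ∑' g : FreeGroup (Fin r), cw (g⁻¹ • B) = 1 := by
  have h1 : ∀ g : FreeGroup (Fin r), cw (g⁻¹ • B)
      = (∑' i : Fin r, if mkE r (g, i) ∈ B then 1 else 0) * (B.card : ℝ≥0∞)⁻¹ := by
    intro g
    unfold cw
    rw [Finset.card_smul_finset, tsum_fintype, ENNReal.div_eq_inv_mul, mul_comm]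
    congr 1
    refine sum_congr rfl fun i _ => ?_
    have e : g • mkE r (1, i) = mkE r (g, i) := by
      change ((g * 1, i) : FreeGroup (Fin r) × Fin r) = (g, i); rw [mul_one]
    have : mkE r (1, i) ∈ g⁻¹ • B ↔ mkE r (g, i) ∈ B := by
      rw [Finset.mem_inv_smul_finset_iff, e]
    simp only [this]
  rw [tsum_congr h1, ENNReal.tsum_mul_right,
    ← tsum_prod2 (fun p : FreeGroup (Fin r) × Fin r => if mkE r p ∈ B then (1 : ℝ≥0∞) else 0)]
  have h2 : ∑' p : FreeGroup (Fin r) × Fin r, (if mkE r p ∈ B then (1 : ℝ≥0∞) else 0) = B.card := by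
    rw [(mkE r).tsum_eq (fun p => if p ∈ B then (1 : ℝ≥0∞) else 0), tsum_eq_sum (s := B)]
    · rw [sum_congr rfl (fun x hx => if_pos hx)]; simp
    · intro x hx; exact if_neg hx
  rw [h2]
  exact ENNReal.mul_inv_cancel (by simpa using hB) (by simp)

section cz
open scoped Pointwise
variable {L : Type v} [NormedAddCommGroup L] [InnerProductSpace ℂ L] [CompleteSpace L]

theorem nn_le_of {J : Type u} (ξ : J → L) {z e : L →L[ℂ] L} (hze : z * e = z) (hz1 : ‖z‖ ≤ 1) (j : J) :
    ‖z (ξ j)‖ₑ ^ 2 ≤ ‖e (ξ j)‖ₑ ^ 2 := by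
  rw [← hze, mul_apply_eq_comp]
  refine (enorm_apply_sq_le _ _).trans ?_
  have hp2 : ‖z‖ₑ ≤ 1 := by rw [← ofReal_norm]; exact ofReal_le_one.2 hz1
  exact (mul_le_mul_left (pow_le_one' hp2 2) _).trans (by rw [one_mul])

theorem cz_bound {Γ : Type} [Group Γ] {J : Type u} (b : HilbertBasis (Γ × J) ℂ L) (e : L →L[ℂ] L)
    (hne : nn (fun j => b (1, j)) e ≠ ∞) (ψ : Γ → ℝ≥0∞) (hψ1 : ∀ g, ψ g ≤ 1)
    (hψf : ∀ κ : ℝ≥0∞, κ ≠ 0 → {g | ¬ ψ g ≤ κ}.Finite) (κ : ℝ≥0∞) (hκ : κ ≠ 0) :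
    ∃ G0 : Finset (J × Γ × J), ∃ η : ℝ≥0∞, η ≠ 0 ∧ ∀ z, (∀ g, Inv b (rho J g) z) → star z = z →
      z * e = z → ‖z‖ ≤ 1 → (∀ p ∈ G0, ‖⟪b p.2, z (b (1, p.1))⟫‖ₑ ^ 2 ≤ η) → dv b ψ z ≤ κ := by
  classical
  set N := nn (fun j => b (1, j)) e with hN
  have hκ4 : κ / 4 ≠ 0 := by simp [hκ]
  obtain ⟨J0, hJ0⟩ := tail_small (fun j => ‖e (b (1, j))‖ₑ ^ 2) hne (κ / 4) hκ4
  obtain ⟨κ', hκ', -, hk⟩ := small_mul N (κ / 4) hne hκ4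
  set B := (hψf κ' hκ').toFinset with hB
  set G0 : Finset (J × Γ × J) := J0 ×ˢ B ×ˢ J0 with hG0
  obtain ⟨η, hη, -, hη2⟩ := small_mul (G0.card : ℝ≥0∞) (κ / 4) (by simp) hκ4
  refine ⟨G0, η, hη, fun z hz hzs hze hz1 hent => ?_⟩
  set q : J → Γ × J → ℝ≥0∞ := fun j a => ‖⟪b a, z (b (1, j))⟫‖ₑ ^ 2 with hq
  have hzn : ∀ j, ‖z (b (1, j))‖ₑ ^ 2 ≤ ‖e (b (1, j))‖ₑ ^ 2 := fun j =>
    nn_le_of (fun j => b (1, j)) hze hz1 j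
  have hrow : ∀ j, ∑' a, q j a = ‖z (b (1, j))‖ₑ ^ 2 := fun j => hb_parseval b _
  have hcol : ∀ i, ∑' j, ∑' h, q j (h, i) = ‖z (b (1, i))‖ₑ ^ 2 := by
    intro i
    rw [← hrow i, tsum_prod2, ENNReal.tsum_comm, ← (Equiv.inv Γ).tsum_eq]
    refine tsum_congr fun h => tsum_congr fun j => ?_
    have e1 := hz h⁻¹ (h⁻¹, i) (1, j)
    simp only [rho, prodCongr_apply, Prod.map, coe_mulRight, refl_apply, inv_inv,
      inv_mul_cancel, one_mul] at e1
    simp only [hq, Equiv.inv_apply]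
    rw [← e1, ← star_inner_left, hzs, enorm_inner_symm]
  have hpt : ∀ j a, q j a * ψ a.1 ≤ (if j ∈ J0 then 0 else q j a) + (if a.2 ∈ J0 then 0 else q j a)
      + κ' * q j a + (if (j, a) ∈ G0 then η else 0) := by
    rintro j ⟨h, i⟩
    have hle : q j (h, i) * ψ h ≤ q j (h, i) := mul_le_of_le_one_right' (hψ1 h)
    by_cases hj : j ∈ J0
    · by_cases hi : i ∈ J0
      · by_cases hh : ψ h ≤ κ'
        · refine le_trans ?_ le_self_add
          refine le_trans ?_ le_add_self
          rw [mul_comm]; exact mul_le_mul_left hh _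
        · have hG : (j, h, i) ∈ G0 := by
            simp only [hG0, hB, Finset.mem_product, hj, hi, true_and, and_true, Set.Finite.mem_toFinset,
              Set.mem_setOf_eq]
            exact hh
          simp only [hG, if_true]
          have h5 : q j (h, i) ≤ η := hent (j, h, i) hG
          exact (hle.trans h5).trans le_add_self
      · simp only [hi, if_false]
        refine le_trans ?_ le_self_add
        refine le_trans ?_ le_self_add
        exact hle.trans le_add_self
    · simp only [hj, if_false]
      refine le_trans ?_ le_self_add
      refine le_trans ?_ le_self_add
      exact hle.trans le_self_add
  have hdv : dv b ψ z ≤ ∑' j, ∑' a, ((if j ∈ J0 then 0 else q j a) + (if a.2 ∈ J0 then 0 else q j a)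
      + κ' * q j a + (if (j, a) ∈ G0 then η else 0)) :=
    ENNReal.tsum_le_tsum fun j => ENNReal.tsum_le_tsum fun a => hpt j a
  refine hdv.trans ?_
  simp only [ENNReal.tsum_add]
  have t1 : ∑' j, ∑' a, (if j ∈ J0 then 0 else q j a) ≤ κ / 4 := by
    refine le_trans (ENNReal.tsum_le_tsum fun j => ?_) hJ0
    by_cases hj : j ∈ J0
    · simp [hj]
    · simp only [hj, if_false]
      rw [hrow]; exact hzn j
  have t2 : ∑' j, ∑' a : Γ × J, (if a.2 ∈ J0 then 0 else q j a) ≤ κ / 4 := by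
    have : ∑' j, ∑' a : Γ × J, (if a.2 ∈ J0 then 0 else q j a)
        = ∑' i, if i ∈ J0 then 0 else ‖z (b (1, i))‖ₑ ^ 2 := by
      calc _ = ∑' j, ∑' i, ∑' h, (if i ∈ J0 then 0 else q j (h, i)) :=
            tsum_congr fun j => by rw [tsum_prod2, ENNReal.tsum_comm]
        _ = ∑' i, ∑' j, ∑' h, (if i ∈ J0 then 0 else q j (h, i)) := ENNReal.tsum_comm
        _ = _ := by
            refine tsum_congr fun i => ?_
            by_cases hi : i ∈ J0
            · simp [hi]
            · simp only [hi, if_false]; exact hcol i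
    rw [this]
    refine le_trans (ENNReal.tsum_le_tsum fun j => ?_) hJ0
    split_ifs
    · exact le_rfl
    · exact hzn j
  have t3 : ∑' j, ∑' a, κ' * q j a ≤ κ / 4 := by
    simp only [ENNReal.tsum_mul_left, hrow]
    rw [mul_comm]
    refine le_trans (mul_le_mul_left (ENNReal.tsum_le_tsum hzn) _) (hk κ' le_rfl)
  have t4 : ∑' j, ∑' a, (if (j, a) ∈ G0 then η else 0) ≤ κ / 4 := by
    rw [← tsum_prod2 (fun p : J × Γ × J => if p ∈ G0 then η else 0),
      tsum_eq_sum (s := G0) (fun x hx => if_neg hx), sum_congr rfl (fun x hx => if_pos hx),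
      sum_const, nsmul_eq_mul]
    exact hη2 η le_rfl
  calc _ ≤ κ / 4 + κ / 4 + κ / 4 + κ / 4 := by gcongr
    _ = κ / 4 * 4 := by ring
    _ = κ := ENNReal.div_mul_cancel (by simp) (by simp)

theorem ball_finite {r : ℕ} (n : ℕ) : {g : FreeGroup (Fin r) | FreeGroup.norm g < n}.Finite := by
  have h := (List.finite_length_lt (Fin r × Bool) n).preimage
    (f := FreeGroup.toWord (α := Fin r)) (FreeGroup.toWord_injective.injOn)
  exact h

set_option maxHeartbeats 800000 in
theorem deform_main {r : ℕ} {J : Type u} (b : HilbertBasis (FreeGroup (Fin r) × J) ℂ L) (e p : L →L[ℂ] L)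
    (hne : nn (fun j => b (1, j)) e ≠ ∞) {K : Type*} (F : Finset K) (X : K → L →L[ℂ] L)
    (hF : ∀ x ∈ F, (∀ g, Inv b (rho J g) (X x)) ∧ nn (fun j => b (1, j)) (X x) ≠ ∞) (k0 : K) (hk0 : k0 ∈ F)
    (hpX : p = X k0) (hp1 : ‖p‖ ≤ 1)
    (hp0 : nn (fun j => b (1, j)) p ≠ 0)
    (hz : ∀ (G0 : Finset (J × FreeGroup (Fin r) × J)) (κ : ℝ≥0∞), κ ≠ 0 → ∃ z : L →L[ℂ] L,
      (∀ g, Inv b (rho J g) z) ∧ star z = z ∧ z * e = z ∧ ‖z‖ ≤ 1 ∧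
      (∀ q ∈ G0, ‖⟪b q.2, z (b (1, q.1))⟫‖ₑ ^ 2 ≤ κ) ∧
      (∀ x ∈ F, nn (fun j => b (1, j)) (X x * z - z * X x) ≤ κ) ∧
      nn (fun j => b (1, j)) p ≤ nn (fun j => b (1, j)) (p * z) + κ)
    (δ : ℝ≥0∞) (hδ : δ ≠ 0) (hδ' : δ ≠ ∞) :
    ∃ T : L →L[ℂ] L, hs b T ≠ ∞ ∧ hs b (p * T) ≠ 0 ∧
      ∑ x ∈ F, hs b (X x * T - T * X x) ≤ δ * hs b (p * T) := by
  classical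
  set n : (L →L[ℂ] L) → ℝ≥0∞ := nn (fun j => b (1, j)) with hn
  have hpX' := hF k0 hk0
  rw [← hpX] at hpX'
  set FF := lp (fun _ : Finset (Edge r) => ℂ) 2
  let f : HilbertBasis (Finset (Edge r)) ℂ FF := HilbertBasis.ofRepr (LinearIsometryEquiv.refl ℂ FF)
  obtain ⟨W, hW, hWc, hW0, hWcos⟩ := fg_deform f
  -- smallness constants
  have hm : min (n p) (δ / 8 * n p) ≠ 0 := by
    refine (lt_min (pos_iff_ne_zero.2 hp0) (pos_iff_ne_zero.2 (mul_ne_zero ?_ hp0))).ne'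
    simp [hδ]
  obtain ⟨κ, hκ, hκt, hκ2⟩ := small_mul (10 * (F.card + 1 : ℝ≥0∞)) _
    (mul_ne_top (by simp) (by simp)) hm
  have hk1 : 10 * κ ≤ n p := by
    refine le_trans ?_ ((hκ2 κ le_rfl).trans (min_le_left _ _))
    rw [mul_assoc]
    gcongr
    calc κ = 1 * κ := (one_mul _).symm
      _ ≤ _ := by gcongr; exact le_add_self
  have hk2 : F.card * (10 * κ) ≤ δ / 8 * n p := by
    refine le_trans ?_ ((hκ2 κ le_rfl).trans (min_le_right _ _))
    calc (F.card : ℝ≥0∞) * (10 * κ) = 10 * F.card * κ := by ring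
      _ ≤ _ := by gcongr; exact le_self_add
  -- choose s
  have hφ : ∀ x ∈ F, ∀ᶠ s in nhds (0 : ℝ), dv b (fun g => ‖W s g (f ∅) - f ∅‖ₑ ^ 2) (X x) ≤ κ := by
    intro x hx
    have h1 := dom_conv (fun q : J × FreeGroup (Fin r) × J => ‖⟪b q.2, X x (b (1, q.1))⟫‖ₑ ^ 2) ?_
      (fun s q => ‖W s q.2.1 (f ∅) - f ∅‖ₑ ^ 2) ?_ ?_ κ hκ
    · filter_upwards [h1] with s hs
      rwa [tsum_prod2] at hs
    · rw [tsum_prod2]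
      have h5 := (hF x hx).2
      simp only [hb_parseval]
      exact h5
    · intro s q
      have h2 : ‖W s q.2.1 (f ∅) - f ∅‖ ≤ 2 := by
        refine (norm_sub_le _ _).trans ?_
        rw [unitary_norm ((hW s).uni _), f.orthonormal.1]; norm_num
      calc ‖W s q.2.1 (f ∅) - f ∅‖ₑ ^ 2 ≤ 2 ^ 2 := by
            gcongr
            rw [← ofReal_norm]
            exact (ofReal_le_ofReal h2).trans (by simp)
        _ = 4 := by norm_num
    · intro q
      have h2 : Continuous fun s => ‖W s q.2.1 (f ∅) - f ∅‖ₑ ^ 2 := by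
        have := hWc q.2.1
        fun_prop
      have h3 := h2.tendsto 0
      rw [hW0] at h3
      have h4 : ‖(1 : FF →L[ℂ] FF) (f ∅) - f ∅‖ₑ ^ 2 = 0 := by
        have : (1 : FF →L[ℂ] FF) (f ∅) - f ∅ = 0 := sub_self _
        rw [this]; simp
      rwa [h4] at h3
  have hall : ∀ᶠ s in nhds (0 : ℝ), ∀ x ∈ F, dv b (fun g => ‖W s g (f ∅) - f ∅‖ₑ ^ 2) (X x) ≤ κ :=
    (Finset.eventually_all F).2 hφ
  obtain ⟨ε, hε, hball⟩ := Metric.eventually_nhds_iff.1 hall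
  set s : ℝ := min (ε / 2) 1 with hsd
  have hs0 : 0 < s := lt_min (by linarith) one_pos
  have hs1 : s ≤ 1 := min_le_right _ _
  have hsdv := hball (y := s) (by
    rw [Real.dist_eq, sub_zero, abs_of_pos hs0]
    exact (min_le_left _ _).trans_lt (by linarith))
  have hcos : |Real.cos s| < 1 := by
    have h1 : 0 < Real.cos s := Real.cos_pos_of_le_one (by rw [abs_of_pos hs0]; exact hs1)
    rw [abs_of_pos h1]
    have h2 : Real.cos s < Real.cos 0 := Real.cos_lt_cos_of_nonneg_of_le_pi_div_two le_rfl
      (by linarith [Real.pi_gt_three]) hs0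
    simpa using h2
  set ψ : FreeGroup (Fin r) → ℝ≥0∞ := fun g => ‖⟪W s g (f ∅), f ∅⟫‖ₑ ^ 2 with hψ
  have hψe : ∀ g, ψ g = (ENNReal.ofReal |Real.cos s| ^ 2) ^ FreeGroup.norm g := by
    intro g
    simp only [hψ]
    rw [← ofReal_norm, hWcos, ENNReal.ofReal_pow (abs_nonneg _), ← pow_mul, ← pow_mul, mul_comm]
  have hρ : ENNReal.ofReal |Real.cos s| ^ 2 < 1 := pow_lt_one₀ zero_le (ENNReal.ofReal_lt_one.2 hcos) two_ne_zero
  have hψ1 : ∀ g, ψ g ≤ 1 := fun g => by rw [hψe]; exact pow_le_one' hρ.le _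
  have hψf : ∀ κ : ℝ≥0∞, κ ≠ 0 → {g | ¬ ψ g ≤ κ}.Finite := by
    intro κ hκ
    obtain ⟨m, hm⟩ := ((tendsto_order.1 (ENNReal.tendsto_pow_atTop_nhds_zero_of_lt_one hρ)).2 κ
      (pos_iff_ne_zero.2 hκ)).exists
    refine (ball_finite m).subset fun g hg => ?_
    by_contra hcon
    apply hg
    rw [hψe]
    exact (pow_le_pow_right_of_le_one' hρ.le (not_lt.1 hcon)).trans hm.le
  obtain ⟨G0, η, hη, hcz⟩ := cz_bound b e hne ψ hψ1 hψf κ hκ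
  obtain ⟨z, hz1, hz2, hz3, hz4, hz5, hz6, hz7⟩ := hz G0 (min η κ)
    (lt_min (pos_iff_ne_zero.2 hη) (pos_iff_ne_zero.2 hκ)).ne'
  have hczz := hcz z hz1 hz2 hz3 hz4 (fun q hq => (hz5 q hq).trans (min_le_left _ _))
  obtain ⟨TA, hA1, hA2, hA3⟩ := core_lemma (hW s) b cw cw_empty (fun B hB => cw_sum B hB) z hz1 hz4
  have hnz : n z ≠ ∞ := ne_top_of_le_ne_top hne
    (ENNReal.tsum_le_tsum fun j => nn_le_of (fun j => b (1, j)) hz3 hz4 j)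
  set Sg := ∑' A, cw A * hs b (p * TA A) with hSg
  have hSgt : Sg ≠ ∞ := by
    refine ne_top_of_le_ne_top hnz (le_trans (ENNReal.tsum_le_tsum fun A => ?_) hA1)
    gcongr
    refine (hs_left b p (TA A)).trans ?_
    have hp2 : ‖p‖ₑ ≤ 1 := by rw [← ofReal_norm]; exact ofReal_le_one.2 hp1
    exact (mul_le_mul_left (pow_le_one' hp2 2) _).trans (by rw [one_mul])
  have h1 : n p ≤ 2 * Sg + 5 * κ := by
    calc n p ≤ n (p * z) + κ := hz7.trans (by gcongr; exact min_le_right _ _)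
      _ ≤ (2 * Sg + 2 * κ + 2 * κ) + κ := by
          gcongr
          refine (hA3 p hpX'.1 hp1).trans ?_
          gcongr
          rw [hpX]; exact hsdv k0 hk0
      _ = _ := by ring
  have h2 : n p ≤ 4 * Sg := by
    have h3 : 2 * n p ≤ 4 * Sg + n p := by
      calc 2 * n p ≤ 2 * (2 * Sg + 5 * κ) := by gcongr
        _ = 4 * Sg + 10 * κ := by ring
        _ ≤ _ := by gcongr
    have hpt : n p ≠ ∞ := hpX'.2
    rw [two_mul] at h3
    exact (ENNReal.add_le_add_iff_right hpt).1 h3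
  have hSg0 : Sg ≠ 0 := by
    intro h; rw [h, mul_zero] at h2; exact hp0 (le_antisymm h2 zero_le)
  have h4 : ∑' A, ∑ x ∈ F, cw A * hs b (X x * TA A - TA A * X x) ≤ δ / 2 * Sg := by
    rw [Summable.tsum_finsetSum (fun _ _ => ENNReal.summable)]
    calc _ ≤ ∑ x ∈ F, 10 * κ := by
          refine sum_le_sum fun x hx => (hA2 (X x) (hF x hx).1).trans ?_
          calc _ ≤ 8 * κ + 2 * κ := by
                gcongr
                · exact hsdv x hx
                · exact (hz6 x hx).trans (min_le_right _ _)
            _ = _ := by ring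
      _ = F.card * (10 * κ) := by rw [sum_const, nsmul_eq_mul]
      _ ≤ δ / 8 * n p := hk2
      _ ≤ δ / 8 * (4 * Sg) := by gcongr
      _ = δ / 8 * 4 * Sg := by rw [mul_assoc]
      _ = δ / 2 * Sg := by
          congr 1
          rw [ENNReal.div_eq_inv_mul, ENNReal.div_eq_inv_mul]
          have : (8 : ℝ≥0∞) = 2 * 4 := by norm_num
          rw [this, ENNReal.mul_inv (by simp) (by simp)]
          calc (2 : ℝ≥0∞)⁻¹ * 4⁻¹ * δ * 4 = 2⁻¹ * δ * (4⁻¹ * 4) := by ring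
            _ = _ := by rw [ENNReal.inv_mul_cancel (by simp) (by simp), mul_one]
  obtain ⟨A, hA0, hAf⟩ := pick_ratio (fun A => ∑ x ∈ F, cw A * hs b (X x * TA A - TA A * X x))
    (fun A => cw A * hs b (p * TA A)) (δ / 2) (by simp [hδ]) (ENNReal.div_ne_top hδ' (by simp)) hSg0 hSgt h4
  have hc0 : cw A ≠ 0 := left_ne_zero_of_mul hA0
  have hct : cw A ≠ ∞ := cw_ne_top A
  refine ⟨TA A, ?_, right_ne_zero_of_mul hA0, ?_⟩
  · intro hcon
    have := (ENNReal.le_tsum (f := fun A => cw A * hs b (TA A)) A).trans hA1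
    rw [hcon, ENNReal.mul_top hc0, top_le_iff] at this
    exact hnz this
  · rw [← mul_sum, ENNReal.mul_div_cancel (by simp) (by simp)] at hAf
    rw [mul_left_comm] at hAf
    exact (ENNReal.mul_le_mul_iff_right hc0 hct).1 hAf

end cz

section
/-- The data of free Haar unitaries in a corner. -/
structure FD (M : 𝔳𝔑) (Ω : H) (e : 𝔹) {r : ℕ} (U : Fin r → 𝔹) : Prop where
  hT : IsTraceVector M Ω
  eM : e ∈ M
  he : IsStarProjection e
  uM : ∀ i, U i ∈ M
  eu : ∀ i, e * U i = U i
  ue : ∀ i, U i * e = U i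
  haar : ∀ i, IsHaarUnitaryAt Ω e (U i)
  free : IsFreeFamilyAt Ω e U
  gen : corner e (M : Set 𝔹) ⊆ wstarGen (insert e (⋃ i, {U i, star (U i)}))

variable {M : VonNeumannAlgebra H} {Ω : H} {e : H →L[ℂ] H} {r : ℕ} {U : Fin r → H →L[ℂ] H}

namespace FD

theorem ee (h : FD M Ω e U) : e * e = e := h.he.isIdempotentElem
theorem se (h : FD M Ω e U) : star e = e := h.he.isSelfAdjoint
theorem esu (h : FD M Ω e U) (i) : e * star (U i) = star (U i) := by
  have := congrArg star (h.ue i); rwa [star_mul, h.se] at this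
theorem sue (h : FD M Ω e U) (i) : star (U i) * e = star (U i) := by
  have := congrArg star (h.eu i); rwa [star_mul, h.se] at this

theorem mem_un (h : FD M Ω e U) (i : Fin r) : U i + (1 - e) ∈ unitary 𝔹 := by
  obtain ⟨h1, h2, -⟩ := h.haar i
  have a1 := h.eu i; have a2 := h.ue i; have a3 := h.esu i; have a4 := h.sue i; have a5 := h.ee
  rw [Unitary.mem_iff]
  simp only [star_add, star_sub, star_one, h.se, add_mul, mul_add, mul_sub, sub_mul, mul_one, one_mul, a1, a2, a3, a4, a5, h1, h2]
  constructor <;> abel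

/-- The unitary representation of the free group. -/
def lam (h : FD M Ω e U) : FreeGroup (Fin r) →* unitary 𝔹 :=
  FreeGroup.lift fun i => ⟨U i + (1 - e), h.mem_un i⟩

theorem uh_e (h : FD M Ω e U) (i) : (U i + (1 - e)) * e = U i := by
  rw [add_mul, sub_mul, h.ue, one_mul, h.ee, sub_self, add_zero]
theorem e_uh (h : FD M Ω e U) (i) : e * (U i + (1 - e)) = U i := by
  rw [mul_add, mul_sub, h.eu, mul_one, h.ee, sub_self, add_zero]
theorem suh_e (h : FD M Ω e U) (i) : star (U i + (1 - e)) * e = star (U i) := by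
  have := congrArg star (h.e_uh i); rwa [star_mul, h.se] at this
theorem e_suh (h : FD M Ω e U) (i) : e * star (U i + (1 - e)) = star (U i) := by
  have := congrArg star (h.uh_e i); rwa [star_mul, h.se] at this

theorem lam_of (h : FD M Ω e U) (i) : (h.lam (FreeGroup.of i) : 𝔹) = U i + (1 - e) := by
  simp [lam]

theorem lam_inv (h : FD M Ω e U) (g) : (h.lam g⁻¹ : 𝔹) = star (h.lam g : 𝔹) := by
  rw [map_inv, ← Unitary.star_eq_inv, Unitary.coe_star]

theorem lam_ind (h : FD M Ω e U) {P : 𝔹 → Prop} (h1 : P 1) (hm : ∀ a b, P a → P b → P (a * b))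
    (hu : ∀ i, P (U i + (1 - e))) (hs : ∀ i, P (star (U i + (1 - e)))) (g) : P (h.lam g) := by
  induction g using FreeGroup.induction_on with
  | C1 => simpa using h1
  | of i => rw [h.lam_of]; exact hu i
  | inv_of i ih => rw [h.lam_inv, h.lam_of]; exact hs i
  | mul g k ihg ihk => rw [map_mul, Submonoid.coe_mul]; exact hm _ _ ihg ihk

theorem lamM (h : FD M Ω e U) (g) : (h.lam g : 𝔹) ∈ M :=
  have a : ∀ i, U i + (1 - e) ∈ M := fun i => add_mem (h.uM i) (sub_mem (one_mem _) h.eM)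
  h.lam_ind (P := fun x => x ∈ M) (one_mem _) (fun _ _ => mul_mem) a (fun i => star_mem (a i)) g

theorem lam_e (h : FD M Ω e U) (g) : (h.lam g : 𝔹) * e = e * h.lam g :=
  h.lam_ind (P := fun x => x * e = e * x) (by rw [one_mul, mul_one])
    (fun a b ha hb => by rw [mul_assoc, hb, ← mul_assoc, ha, mul_assoc])
    (fun i => by rw [h.uh_e, h.e_uh]) (fun i => by rw [h.suh_e, h.e_suh]) g

/-- letters -/
def ltr (U : Fin r → 𝔹) (x : Fin r × Bool) : 𝔹 := if x.2 then U x.1 else star (U x.1)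

theorem e_ltr (h : FD M Ω e U) (x) : e * ltr U x = ltr U x := by
  unfold ltr; split_ifs; exacts [h.eu _, h.esu _]

theorem lam_mk (h : FD M Ω e U) (L : List (Fin r × Bool)) :
    (h.lam (FreeGroup.mk L) : 𝔹) * e = (L.map (ltr U)).prod * e ∧
      e * ((L.map (ltr U)).prod * e) = (L.map (ltr U)).prod * e := by
  induction L with
  | nil =>
    rw [← FreeGroup.one_eq_mk, map_one]; simp [h.ee]
  | cons a L ih =>
    have e1 : FreeGroup.mk (a :: L) = FreeGroup.mk [a] * FreeGroup.mk L := by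
      rw [FreeGroup.mul_mk]; rfl
    have e2 : (h.lam (FreeGroup.mk [a]) : 𝔹) * e = ltr U a := by
      obtain ⟨i, s⟩ := a
      cases s with
      | true =>
        have : FreeGroup.mk [(i, true)] = FreeGroup.of i := rfl
        rw [this, h.lam_of, h.uh_e]; rfl
      | false =>
        have : FreeGroup.mk [(i, false)] = (FreeGroup.of i)⁻¹ := rfl
        rw [this, h.lam_inv, h.lam_of, h.suh_e]; rfl
    rw [List.map_cons, List.prod_cons, e1, map_mul, Submonoid.coe_mul, mul_assoc, ih.1, ← ih.2, ← mul_assoc, e2]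
    refine ⟨(mul_assoc _ _ _).symm, ?_⟩
    rw [← mul_assoc, ← mul_assoc, h.e_ltr]

/-- syllables -/
def syl (U : Fin r → 𝔹) (x : Fin r × Bool × ℕ) : 𝔹 := ltr U (x.1, x.2.1) ^ (x.2.2 + 1)

theorem syl_exists (U : Fin r → 𝔹) (L : List (Fin r × Bool)) : ∀ (i : Fin r) (s : Bool),
    List.IsChain (fun a b : Fin r × Bool => a.1 = b.1 → a.2 = b.2) ((i, s) :: L) →
    ∃ (n : ℕ) (S : List (Fin r × Bool × ℕ)), List.IsChain (fun a b => a.1 ≠ b.1) ((i, s, n) :: S) ∧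
      ((((i, s) :: L).map (ltr U)).prod) = (((i, s, n) :: S).map (syl U)).prod := by
  induction L with
  | nil => intro i s _; exact ⟨0, [], List.isChain_singleton _, by simp [syl]⟩
  | cons a L ih =>
    obtain ⟨j, t⟩ := a
    intro i s hc
    rw [List.isChain_cons_cons] at hc
    obtain ⟨n, S, h1, h2⟩ := ih j t hc.2
    by_cases hij : i = j
    · have hst : s = t := hc.1 hij
      subst hij; subst hst
      refine ⟨n + 1, S, ?_, ?_⟩
      · cases S with
        | nil => exact List.isChain_singleton _
        | cons b S => rw [List.isChain_cons_cons] at h1 ⊢; exact h1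
      · rw [List.map_cons, List.prod_cons, h2, List.map_cons, List.prod_cons, List.map_cons, List.prod_cons,
          ← mul_assoc]
        congr 1
        exact (pow_succ' _ _).symm
    · refine ⟨0, (j, t, n) :: S, ?_, ?_⟩
      · rw [List.isChain_cons_cons]; exact ⟨hij, h1⟩
      · rw [List.map_cons, List.prod_cons, h2, List.map_cons, List.prod_cons]
        congr 1

theorem tr0 (h : FD M Ω e U) {g : FreeGroup (Fin r)} (hg : g ≠ 1) : ⟪((h.lam g : 𝔹) * e) Ω, Ω⟫ = 0 := by
  have hr : List.IsChain (fun a b : Fin r × Bool => a.1 = b.1 → a.2 = b.2) g.toWord := FreeGroup.isReduced_toWord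
  have hne : g.toWord ≠ [] := by rwa [Ne, FreeGroup.toWord_eq_nil_iff]
  have hmk := FreeGroup.mk_toWord (x := g)
  rw [← hmk]
  generalize g.toWord = L at hr hne
  obtain ⟨⟨i, s⟩, L', rfl⟩ := List.exists_cons_of_ne_nil hne
  rw [(h.lam_mk _).1]
  have hlM : ∀ x, ltr U x ∈ M := fun x => by
    unfold ltr; split_ifs; exacts [h.uM _, star_mem (h.uM _)]
  have hM' : (((i, s) :: L').map (ltr U)).prod ∈ M := by
    refine list_prod_mem fun x hx => ?_
    obtain ⟨y, -, rfl⟩ := List.mem_map.1 hx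
    exact hlM y
  rw [h.hT.tracial _ _ hM' h.eM]
  have : e * (((i, s) :: L').map (ltr U)).prod = (((i, s) :: L').map (ltr U)).prod := by
    rw [List.map_cons, List.prod_cons, ← mul_assoc, h.e_ltr]
  rw [this]
  obtain ⟨n, S, h1, h2⟩ := syl_exists U L' i s hr
  rw [h2]
  set S' := (i, s, n) :: S with hS'
  have hof : List.ofFn (fun l : Fin (S.length + 1) => syl U (S'.get l)) = S'.map (syl U) := by
    have := List.ofFn_get S'
    conv_rhs => rw [← this, List.map_ofFn]
    rfl
  rw [← hof]
  refine h.free S.length (fun l => (S'.get l).1) _ (fun l => ?_) (fun l => ?_)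
  · have := (List.isChain_iff_getElem.1 h1) l.1 (Nat.succ_lt_succ l.2)
    exact this
  · set a := S'.get l
    obtain ⟨-, -, hz⟩ := h.haar a.1
    have hz := hz (a.2.2 + 1) (Nat.succ_pos _)
    unfold syl ltr
    dsimp only
    split_ifs
    · exact ⟨subset_span (Or.inr ⟨_, Nat.succ_pos _, Or.inl rfl⟩), hz.1⟩
    · exact ⟨subset_span (Or.inr ⟨_, Nat.succ_pos _, Or.inr rfl⟩), hz.2⟩

end FD
end

section
variable {M : VonNeumannAlgebra H} {Ω : H} {e : H →L[ℂ] H} {r : ℕ} {U : Fin r → H →L[ℂ] H}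

theorem tr2 (hT : IsTraceVector M Ω) {a b : 𝔹} (ha : a ∈ M) (hb : b ∈ M) :
    ⟪a Ω, b Ω⟫ = ⟪star b Ω, star a Ω⟫ := by
  rw [← star_inner_left b, ← mul_apply_eq_comp, hT.tracial _ _ (star_mem hb) ha, mul_apply_eq_comp, star_inner_right]

theorem enorm_tr (hT : IsTraceVector M Ω) {a : 𝔹} (ha : a ∈ M) : ‖star a Ω‖ₑ = ‖a Ω‖ₑ := by
  have h := tr2 hT ha ha
  rw [inner_sq, inner_sq] at h
  norm_cast at h
  rw [← ofReal_norm, ← ofReal_norm, (pow_left_inj₀ (norm_nonneg _) (norm_nonneg _) two_ne_zero).1 h]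

theorem on_parseval {ι : Type*} {v : ι → H} (hv : Orthonormal ℂ v) {x : H}
    (hx : x ∈ (Submodule.span ℂ (Set.range v)).topologicalClosure) : ∑' i, ‖⟪v i, x⟫‖ₑ ^ 2 = ‖x‖ₑ ^ 2 := by
  let b : HilbertBasis ι ℂ (lp (fun _ : ι => ℂ) 2) := default
  obtain ⟨V, hV, hi⟩ := iso_onb b hv
  have hn : ∀ y, ‖V y‖ = ‖y‖ := fun y => by
    have h := hi y y
    rw [inner_sq, inner_sq] at h
    norm_cast at h
    exact (pow_left_inj₀ (norm_nonneg _) (norm_nonneg _) two_ne_zero).1 h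
  have hiso : Isometry V := AddMonoidHomClass.isometry_of_norm V hn
  have hc : IsClosed ((LinearMap.range V.toLinearMap : Submodule ℂ H) : Set H) := by
    have := hiso.isClosedEmbedding.isClosed_range
    rw [LinearMap.coe_range]
    exact this
  have hle : (Submodule.span ℂ (Set.range v)).topologicalClosure ≤ LinearMap.range V.toLinearMap := by
    refine Submodule.topologicalClosure_minimal _ (Submodule.span_le.2 ?_) hc
    rintro _ ⟨i, rfl⟩
    exact ⟨b i, hV i⟩
  obtain ⟨y, rfl⟩ := hle hx
  change ∑' i, ‖⟪v i, V y⟫‖ₑ ^ 2 = ‖V y‖ₑ ^ 2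
  rw [← ofReal_norm, hn, ofReal_norm, ← hb_parseval b]
  exact tsum_congr fun i => by rw [← hV, hi]

theorem on_bessel {ι : Type*} {v : ι → H} (hv : Orthonormal ℂ v) (x : H) : ∑' i, ‖⟪v i, x⟫‖ₑ ^ 2 ≤ ‖x‖ₑ ^ 2 := by
  refine ENNReal.summable.tsum_le_of_sum_le fun s => ?_
  simp only [enorm_sq_ofReal]
  rw [← ofReal_sum_of_nonneg (fun _ _ => by positivity)]
  exact ofReal_le_ofReal (hv.sum_inner_products_le x)

theorem commute_starProjection (K : Submodule ℂ H) [K.HasOrthogonalProjection] {a : 𝔹}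
    (h1 : ∀ v ∈ K, a v ∈ K) (h2 : ∀ v ∈ K, star a v ∈ K) : a * K.starProjection = K.starProjection * a := by
  set P := K.starProjection with hP
  have hs : star P = P := isStarProjection_starProjection.isSelfAdjoint
  have key : ∀ a : 𝔹, (∀ v ∈ K, a v ∈ K) → P * (a * P) = a * P := fun a h => by
    ext v
    exact starProjection_eq_self_iff.2 (h _ (starProjection_apply_mem K v))
  have e1 := key a h1
  have e2 := congrArg star (key _ h2)
  rw [star_mul, star_mul, star_star, hs] at e2
  rw [← e1, ← e2]
  simp only [mul_assoc]

namespace FD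

/-- The normalized orthonormal family. -/
def wg (h : FD M Ω e U) (g : FreeGroup (Fin r)) : H := (‖e Ω‖⁻¹ : ℂ) • ((h.lam g).1 (e Ω))

theorem lam_mul_apply (h : FD M Ω e U) (g k) (v : H) : (h.lam (g * k) : 𝔹) v = (h.lam g).1 ((h.lam k).1 v) := by
  rw [map_mul, Submonoid.coe_mul, mul_apply_eq_comp]

theorem lam_uni (h : FD M Ω e U) (g) : star (h.lam g).1 * (h.lam g).1 = 1 := Unitary.coe_star_mul_self _

theorem eIne (h : FD M Ω e U) (v : H) : ⟪e v, e Ω⟫ = ⟪e v, Ω⟫ := by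
  rw [← star_inner_left, h.se, ← mul_apply_eq_comp, h.ee]

theorem orth (h : FD M Ω e U) (h0 : e Ω ≠ 0) : Orthonormal ℂ h.wg := by
  classical
  have hn : (‖e Ω‖ : ℂ) ≠ 0 := by exact_mod_cast norm_ne_zero_iff.2 h0
  rw [orthonormal_iff_ite]
  intro g k
  unfold wg
  rw [inner_smul_left, inner_smul_right]
  have e1 : ⟪(h.lam g).1 (e Ω), (h.lam k).1 (e Ω)⟫ = ⟪((h.lam (k⁻¹ * g) : 𝔹) * e) Ω, Ω⟫ := by
    rw [mul_apply_eq_comp, h.lam_mul_apply, h.lam_inv, star_inner_left]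
    have := h.lam_e g
    rw [← mul_apply_eq_comp, ← mul_apply_eq_comp (h.lam k).1 e Ω, h.lam_e k, mul_apply_eq_comp e, ← star_inner_left e, h.se,
      ← mul_apply_eq_comp e, ← mul_assoc, ← h.lam_e, mul_assoc, h.ee]
  rw [e1]
  split_ifs with hgk
  · subst hgk
    rw [inv_mul_cancel, map_one]
    have : ⟪e Ω, Ω⟫ = (‖e Ω‖ : ℂ) ^ 2 := by rw [← h.eIne, inner_sq]; rfl
    simp only [OneMemClass.coe_one, one_mul, this]
    rw [map_inv₀, conj_ofReal]
    field_simp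
  · rw [h.tr0 (fun h' => hgk (inv_mul_eq_one.1 h').symm)]; simp

theorem parseval (h : FD M Ω e U) (h0 : e Ω ≠ 0) {x : 𝔹} (hx : x ∈ M) (h1 : e * x * e = x) :
    ∑' g, ‖⟪h.wg g, x Ω⟫‖ₑ ^ 2 = ‖x Ω‖ₑ ^ 2 := by
  refine on_parseval (h.orth h0) ?_
  set K := (Submodule.span ℂ (Set.range h.wg)).topologicalClosure with hK
  have : CompleteSpace K := (isClosed_topologicalClosure _).completeSpace_coe
  have hinv : ∀ a : 𝔹, (∀ g, ∃ k, a ((h.lam g).1 (e Ω)) = (h.lam k).1 (e Ω)) → ∀ v ∈ K, a v ∈ K := by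
    intro a ha
    have hc : IsClosed ((K.comap a.toLinearMap : Submodule ℂ H) : Set H) :=
      (isClosed_topologicalClosure _).preimage a.continuous
    refine Submodule.topologicalClosure_minimal (t := K.comap a.toLinearMap) _ (Submodule.span_le.2 ?_) hc
    rintro _ ⟨g, rfl⟩
    obtain ⟨k, hk⟩ := ha g
    change a (h.wg g) ∈ K
    have : a (h.wg g) = h.wg k := by unfold wg; rw [map_smul, hk]
    rw [this]
    exact le_topologicalClosure _ (subset_span ⟨k, rfl⟩)
  have hel : ∀ g, e ((h.lam g).1 (e Ω)) = (h.lam g).1 (e Ω) := fun g => by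
    rw [← mul_apply_eq_comp, ← mul_apply_eq_comp, ← h.lam_e, mul_assoc, h.ee, mul_apply_eq_comp]
  have he := hinv e (fun g => ⟨g, hel g⟩)
  have hu : ∀ i, ∀ v ∈ K, U i v ∈ K := fun i => hinv _ fun g => ⟨FreeGroup.of i * g, by
    rw [h.lam_mul_apply, h.lam_of, ← hel g, ← mul_apply_eq_comp (U i) e, ← mul_apply_eq_comp (U i + (1 - e)) e, h.uh_e, h.ue]⟩
  have hsu : ∀ i, ∀ v ∈ K, star (U i) v ∈ K := fun i => hinv _ fun g => ⟨(FreeGroup.of i)⁻¹ * g, by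
    rw [h.lam_mul_apply, h.lam_inv, h.lam_of, ← hel g, ← mul_apply_eq_comp (star (U i)) e, ← mul_apply_eq_comp (star (U i + (1 - e))) e, h.suh_e, h.sue]⟩
  have hcent : K.starProjection ∈ Set.centralizer (insert e (⋃ i, {U i, star (U i)})) := by
    intro a ha
    rcases ha with rfl | ha
    · exact commute_starProjection K he (by rw [h.se]; exact he)
    · obtain ⟨i, hi⟩ := Set.mem_iUnion.1 ha
      rcases hi with rfl | hi
      · exact commute_starProjection K (hu i) (hsu i)
      · rw [Set.mem_singleton_iff.1 hi]
        exact commute_starProjection K (hsu i) (by rw [star_star]; exact hu i)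
  have hxg := h.gen ⟨x, hx, h1⟩
  have hcom := hxg _ hcent
  have heK : e Ω ∈ K := by
    have hn : (‖e Ω‖ : ℂ) ≠ 0 := by exact_mod_cast norm_ne_zero_iff.2 h0
    have : e Ω = (‖e Ω‖ : ℂ) • h.wg 1 := by
      unfold wg; rw [smul_smul, mul_inv_cancel₀ hn, one_smul, map_one]; rfl
    rw [this]
    exact K.smul_mem _ (le_topologicalClosure _ (subset_span ⟨1, rfl⟩))
  have hxe : x * e = x := by rw [← h1, mul_assoc, h.ee]
  have : x Ω = K.starProjection (x (e Ω)) := by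
    rw [← mul_apply_eq_comp K.starProjection, hcom, mul_apply_eq_comp, starProjection_eq_self_iff.2 heK,
      ← mul_apply_eq_comp, hxe]
  rw [this]
  exact starProjection_apply_mem K _

end FD
end

section
variable {M : VonNeumannAlgebra H} {Ω : H} {e : H →L[ℂ] H}

theorem factor_ne (hF : IsFactorSet (M : Set 𝔹)) (he : e ∈ M) (h0 : e ≠ 0)
    {p : 𝔹} (hp0 : p ≠ 0) : ∃ x ∈ M, p * x * e ≠ 0 := by
  by_contra! hcon
  set s : Set H := {y | ∃ x ∈ M, ∃ v, y = x (e v)} with hs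
  set K := (Submodule.span ℂ s).topologicalClosure with hK
  have : CompleteSpace K := (isClosed_topologicalClosure _).completeSpace_coe
  have hsK : ∀ y ∈ s, y ∈ K := fun y hy => le_topologicalClosure _ (subset_span hy)
  have gen : ∀ (a : 𝔹) (N : Submodule ℂ H), IsClosed (N : Set H) → (∀ y ∈ s, a y ∈ N) → ∀ v ∈ K, a v ∈ N := by
    intro a N hN ha
    exact Submodule.topologicalClosure_minimal (t := N.comap a.toLinearMap) _ (Submodule.span_le.2 ha)
      (hN.preimage a.continuous)
  have hKc : IsClosed (K : Set H) := isClosed_topologicalClosure _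
  have h1 : ∀ a ∈ M, ∀ v ∈ K, a v ∈ K := fun a ha => gen a K hKc (by
    rintro _ ⟨x, hx, v, rfl⟩
    exact hsK _ ⟨a * x, mul_mem ha hx, v, rfl⟩)
  have h2 : ∀ a ∈ M.commutant, ∀ v ∈ K, a v ∈ K := fun a ha => gen a K hKc (by
    rintro _ ⟨x, hx, v, rfl⟩
    have e1 := comm_of_mem (mul_mem hx he) ha
    refine hsK _ ⟨x, hx, a v, ?_⟩
    exact (congrArg (fun f : 𝔹 => f v) e1).symm)
  have hPM : K.starProjection ∈ M := starProjection_mem K h2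
  obtain ⟨c, hc⟩ := hF _ hPM fun x hx => (commute_starProjection K (h1 x hx) (h1 _ (star_mem hx))).symm
  obtain ⟨v, hv⟩ : ∃ v, e v ≠ 0 := by
    by_contra! h; exact h0 (by ext v; exact h v)
  have h3 : K.starProjection (e v) = e v :=
    starProjection_eq_self_iff.2 (hsK _ ⟨1, one_mem _, v, rfl⟩)
  have hc1 : c = 1 := by
    rw [hc, smul_apply] at h3
    have h4 : c • e v = (1 : ℂ) • e v := by rw [one_smul]; exact h3
    exact smul_left_injective ℂ hv h4
  apply hp0
  ext y
  have hy : y ∈ K := by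
    have := starProjection_apply_mem K y
    rw [hc, hc1, one_smul] at this
    exact this
  have := gen p ⊥ isClosed_singleton (by
    rintro _ ⟨x, hx, v, rfl⟩
    rw [Submodule.mem_bot]
    exact congrArg (fun f : 𝔹 => f v) (hcon x hx)) y hy
  exact (Submodule.mem_bot _).1 this

theorem factor_part (hF : IsFactorSet (M : Set 𝔹)) (he : e ∈ M) (hee : IsStarProjection e) (h0 : e ≠ 0) :
    ∃ (J : Type u) (v : J → 𝔹), (∀ j, v j ∈ M ∧ v j * e = v j ∧ v j ≠ 0) ∧
      ∀ w, ∑' j, ‖star (v j) w‖ₑ ^ 2 = ‖w‖ₑ ^ 2 := by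
  obtain ⟨S, hS, -, hsum⟩ := zorn_partition M (fun f => ∃ v ∈ M, v * e = v ∧ v * star v = f) (by
    intro p hpM hp hp0
    obtain ⟨x, hx, hne⟩ := factor_ne hF he h0 hp0
    set a := star (p * x * e) with ha
    have haM : a ∈ M := star_mem (mul_mem (mul_mem hpM hx) he)
    have ha0 : a ≠ 0 := fun h => hne (by rw [← star_star (p * x * e), ← ha, h, star_zero])
    obtain ⟨k, hk, f, hf, hfp, hf0, h1, -, h2⟩ := polar_lemma haM ha0
    refine ⟨f, hf, hfp, hf0, h2 p hp ?_, star (a * k), star_mem (mul_mem haM hk), ?_, by rw [star_star, h1]⟩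
    · rw [ha, star_mul, star_mul, hp.isSelfAdjoint.star_eq, mul_assoc, mul_assoc, hp.isIdempotentElem.eq]
    · have : e * (a * k) = a * k := by
        rw [ha, star_mul, hee.isSelfAdjoint.star_eq, mul_assoc, ← mul_assoc e e, hee.isIdempotentElem.eq]
      have := congrArg star this
      rwa [star_mul, hee.isSelfAdjoint.star_eq] at this)
  choose hSM hSp hS0 v hv1 hv2 hv3 using hS
  refine ⟨S, fun f => v f.1 f.2, fun f => ⟨hv1 _ _, hv2 _ _, fun h => hS0 f.1 f.2 ?_⟩, fun w => ?_⟩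
  · have h' : v f.1 f.2 = 0 := h
    rw [← hv3 f.1 f.2, h', zero_mul]
  · have h1 := Complex.hasSum_re ((hsum w).mapL (innerSL ℂ w))
    have h2 : HasSum (fun f : S => ‖star (v f.1 f.2) w‖ ^ 2) (‖w‖ ^ 2) := by
      convert h1 using 1
      · funext f
        have e1 : ⟪w, f.1 w⟫ = ⟪star (v f.1 f.2) w, star (v f.1 f.2) w⟫ := by
          rw [star_inner_left, ← mul_apply_eq_comp, hv3]
        rw [innerSL_apply_apply, e1]
        exact (inner_self_eq_norm_sq (𝕜 := ℂ) _).symm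
      · rw [innerSL_apply_apply]; exact (inner_self_eq_norm_sq (𝕜 := ℂ) _).symm
    rw [enorm_sq_ofReal, ← h2.tsum_eq, ENNReal.ofReal_tsum_of_nonneg (fun _ => by positivity) h2.summable]
    exact tsum_congr fun i => by rw [enorm_sq_ofReal]

/-- Bessel operator of a frame. -/
theorem frame_op {ι : Type v} {L : Type w} [NormedAddCommGroup L] [InnerProductSpace ℂ L] [CompleteSpace L]
    (b : HilbertBasis ι ℂ L) (B : ι → H) (hB : ∀ w, ∑' p, ‖⟪B p, w⟫‖ₑ ^ 2 ≤ ‖w‖ₑ ^ 2) :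
    ∃ V : H →L[ℂ] L, (∀ p w, ⟪b p, V w⟫ = ⟪B p, w⟫) ∧ (∀ w, ‖V w‖ₑ ≤ ‖w‖ₑ) := by
  have hs : ∀ w, Summable fun p => ‖⟪B p, w⟫‖ ^ 2 := fun w => by
    have h1 : ∑' p, ENNReal.ofReal (‖⟪B p, w⟫‖ ^ 2) ≠ ∞ := by
      simp only [← enorm_sq_ofReal]
      exact ne_top_of_le_ne_top (by simp) (hB w)
    have h2 := ENNReal.summable_toReal h1
    exact h2.congr fun p => ENNReal.toReal_ofReal (by positivity)
  have hm : ∀ w, Memℓp (fun p => ⟪B p, w⟫) 2 := fun w => memℓp_gen (by simpa using hs w)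
  let f : H →ₗ[ℂ] L :=
    { toFun := fun w => b.repr.symm ⟨_, hm w⟩
      map_add' := fun w w' => by
        rw [← map_add]; congr 1; ext p; exact inner_add_right _ _ _
      map_smul' := fun c w => by
        rw [RingHom.id_apply, ← map_smul]; congr 1; ext p; exact inner_smul_right _ _ _ }
  have hf : ∀ p w, ⟪b p, f w⟫ = ⟪B p, w⟫ := fun p w => by
    rw [← b.repr_apply_apply]
    change b.repr (b.repr.symm _) p = _
    rw [LinearIsometryEquiv.apply_symm_apply]
  have hn : ∀ w, ‖f w‖ₑ ≤ ‖w‖ₑ := fun w => by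
    have := hb_parseval b (f w)
    simp only [hf] at this
    have h2 := hB w
    rw [this] at h2
    exact (ENNReal.pow_le_pow_left_iff two_ne_zero).1 h2
  refine ⟨f.mkContinuous 1 (fun w => ?_), hf, hn⟩
  have := hn w
  rw [← ofReal_norm, ← ofReal_norm, ofReal_le_ofReal_iff (norm_nonneg _)] at this
  rwa [one_mul]

theorem frame_sep {ι : Type v} [Countable ι] (D : ι → H) {A : Set H} (hA : Dense A) (c : ℝ) (hc : 0 < c)
    (h : ∀ w ∈ A, ∑' p, ‖⟪D p, w⟫‖ₑ ^ 2 = ENNReal.ofReal c * ‖w‖ₑ ^ 2) : TopologicalSpace.SeparableSpace H := by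
  have hle : ∀ w, ∑' p, ‖⟪D p, w⟫‖ₑ ^ 2 ≤ ENNReal.ofReal c * ‖w‖ₑ ^ 2 := fun w => by
    refine ENNReal.summable.tsum_le_of_sum_le fun s => ?_
    have key : ∀ w, ∑ p ∈ s, ‖⟪D p, w⟫‖ ^ 2 ≤ c * ‖w‖ ^ 2 := by
      refine isClosed_property hA.denseRange_val ?_ ?_
      · exact isClosed_le (by fun_prop) (by fun_prop)
      · rintro ⟨w, hw⟩
        have h1 := (ENNReal.sum_le_tsum s).trans (h w hw).le
        simp only [enorm_sq_ofReal] at h1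
        rw [← ofReal_sum_of_nonneg (fun _ _ => by positivity), ← ENNReal.ofReal_mul hc.le] at h1
        exact (ofReal_le_ofReal_iff (by positivity)).1 h1
    simp only [enorm_sq_ofReal]
    rw [← ofReal_sum_of_nonneg (fun _ _ => by positivity), ← ENNReal.ofReal_mul hc.le]
    exact ofReal_le_ofReal (key w)
  set K := (Submodule.span ℂ (Set.range D)).topologicalClosure with hK
  have : CompleteSpace K := (isClosed_topologicalClosure _).completeSpace_coe
  have hKt : K = ⊤ := by
    rw [← Submodule.orthogonal_eq_bot_iff, Submodule.eq_bot_iff]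
    intro y hy
    have hyD : ∀ p, ⟪D p, y⟫ = 0 := fun p => hy _ (le_topologicalClosure _ (subset_span ⟨p, rfl⟩))
    have h2 : ∀ w ∈ A, ‖w‖ ≤ ‖w - y‖ := fun w hw => by
      have h1 := hle (w - y)
      simp only [inner_sub_right, hyD, sub_zero] at h1
      rw [h w hw, enorm_sq_ofReal, enorm_sq_ofReal, ← ENNReal.ofReal_mul hc.le, ← ENNReal.ofReal_mul hc.le,
        ofReal_le_ofReal_iff (by positivity)] at h1
      exact (pow_le_pow_iff_left₀ (norm_nonneg _) (norm_nonneg _) two_ne_zero).1 (le_of_mul_le_mul_left h1 hc)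
    have h3 : ∀ w, ‖w‖ ≤ ‖w - y‖ := by
      refine isClosed_property hA.denseRange_val (isClosed_le (by fun_prop) (by fun_prop)) ?_
      rintro ⟨w, hw⟩; exact h2 w hw
    have := h3 y
    rwa [sub_self, norm_zero, norm_le_zero_iff] at this
  have h4 : TopologicalSpace.IsSeparable (K : Set H) :=
    ((Set.countable_range D).isSeparable.span (R := ℂ)).closure
  rw [hKt] at h4
  exact TopologicalSpace.isSeparable_univ_iff.1 h4
end

section
variable {M : VonNeumannAlgebra H} {Ω : H} {e : H →L[ℂ] H} {r : ℕ} {U : Fin r → H →L[ℂ] H}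
variable {L : Type v} [NormedAddCommGroup L] [InnerProductSpace ℂ L] [CompleteSpace L] {J : Type u}

/-- frame data -/
structure FR (h : FD M Ω e U) (v : J → 𝔹) (b : HilbertBasis (FreeGroup (Fin r) × J) ℂ L)
    (V : H →L[ℂ] L) : Prop where
  h0 : e Ω ≠ 0
  vM : ∀ j, v j ∈ M
  ve : ∀ j, v j * e = v j
  vs : ∀ w, ∑' j, ‖star (v j) w‖ₑ ^ 2 = ‖w‖ₑ ^ 2
  hb : ∀ p w, ⟪b p, V w⟫ = ⟪v p.2 (h.wg p.1), w⟫
  hn : ∀ w, ‖V w‖ₑ ≤ ‖w‖ₑ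

theorem FR_exists (h : FD M Ω e U) (h0 : e Ω ≠ 0) {v : J → 𝔹} (vM : ∀ j, v j ∈ M) (ve : ∀ j, v j * e = v j)
    (vs : ∀ w, ∑' j, ‖star (v j) w‖ₑ ^ 2 = ‖w‖ₑ ^ 2) (b : HilbertBasis (FreeGroup (Fin r) × J) ℂ L) :
    ∃ V : H →L[ℂ] L, FR h v b V := by
  obtain ⟨V, h1, h2⟩ := frame_op b (fun p => v p.2 (h.wg p.1)) (fun w => by
    rw [tsum_prod2, ENNReal.tsum_comm, ← vs w]
    refine ENNReal.tsum_le_tsum fun j => ?_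
    simp only [← star_inner_right (v j)]
    exact on_bessel (h.orth h0) _)
  exact ⟨V, h0, vM, ve, vs, h1, h2⟩

namespace FR
variable {h : FD M Ω e U} {v : J → H →L[ℂ] H} {b : HilbertBasis (FreeGroup (Fin r) × J) ℂ L} {V : H →L[ℂ] L}

theorem wg1 (h : FD M Ω e U) : h.wg 1 = (‖e Ω‖⁻¹ : ℂ) • e Ω := by unfold FD.wg; rw [map_one]; rfl

theorem adj_b (k : FR h v b V) (p) : adjoint V (b p) = v p.2 (h.wg p.1) :=
  ext_inner_right ℂ fun w => by rw [adjoint_inner_left, k.hb]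

theorem iso (k : FR h v b V) {y : 𝔹} (hy : y ∈ M) : ‖V (y (e Ω))‖ₑ ^ 2 = ‖y (e Ω)‖ₑ ^ 2 := by
  rw [← hb_parseval b, ← k.vs, tsum_prod2, ENNReal.tsum_comm]
  refine tsum_congr fun j => ?_
  have h1 : e * (star (v j) * y * e) * e = star (v j) * y * e := by
    have h2 := congrArg star (k.ve j)
    rw [star_mul, h.se] at h2
    rw [mul_assoc e, mul_assoc _ e e, h.ee, mul_assoc (star (v j)), ← mul_assoc, h2]
  have h3 := h.parseval k.h0 (mul_mem (mul_mem (star_mem (k.vM j)) hy) h.eM) h1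
  simp only [mul_apply_eq_comp] at h3
  rw [← h3]
  exact tsum_congr fun g => by rw [k.hb, star_inner_right]

theorem fix (k : FR h v b V) {y : 𝔹} (hy : y ∈ M) :
    adjoint V (V (y (e Ω))) = y (e Ω) := by
  set w := y (e Ω) with hw
  have h1 : ‖V w‖ = ‖w‖ := by
    have := k.iso hy
    rw [← hw] at this
    rw [enorm_sq_ofReal, enorm_sq_ofReal, ENNReal.ofReal_eq_ofReal_iff (by positivity) (by positivity)] at this
    exact (pow_left_inj₀ (norm_nonneg _) (norm_nonneg _) two_ne_zero).1 this
  have hV1 : ‖V‖ ≤ 1 := V.opNorm_le_bound zero_le_one fun w => by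
    have := k.hn w
    rw [← ofReal_norm, ← ofReal_norm, ofReal_le_ofReal_iff (norm_nonneg _)] at this
    rwa [one_mul]
  have h2 : ‖adjoint V (V w)‖ ≤ ‖w‖ := by
    refine (le_opNorm _ _).trans ?_
    rw [LinearIsometryEquiv.norm_map, h1]
    exact mul_le_of_le_one_left (norm_nonneg _) hV1
  have h3 := @norm_sub_sq ℂ H _ _ _ (adjoint V (V w)) w
  rw [adjoint_inner_left, inner_self_eq_norm_sq, h1] at h3
  have h4 : ‖adjoint V (V w) - w‖ ^ 2 ≤ 0 := by
    nlinarith [norm_nonneg (adjoint V (V w))]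
  have h5 := pow_eq_zero_iff (two_ne_zero) |>.1 (le_antisymm h4 (sq_nonneg _))
  exact sub_eq_zero.1 (norm_eq_zero.1 h5)

/-- compressed operator -/
def hat (V : H →L[ℂ] L) (y : 𝔹) : L →L[ℂ] L := V ∘L (y ∘L adjoint V)

theorem adj_hat (k : FR h v b V) {y : 𝔹} (hy : y ∈ M) (ξ : L) :
    adjoint V (hat V y ξ) = y (adjoint V ξ) := by
  have : adjoint V ∘L hat V y = y ∘L adjoint V := by
    refine ext_on (s := Set.range b) ?_ ?_
    · rw [dense_iff_topologicalClosure_eq_top]; exact b.dense_span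
    · rintro _ ⟨p, rfl⟩
      change adjoint V (V (y (adjoint V (b p)))) = y (adjoint V (b p))
      rw [k.adj_b, FD.wg, map_smul, map_smul, map_smul, map_smul]
      congr 1
      have h5 := k.fix (mul_mem hy (mul_mem (k.vM p.2) (h.lamM p.1)))
      simpa only [mul_apply_eq_comp] using h5
  exact congrArg (fun f : L →L[ℂ] H => f ξ) this

theorem hat_mul (k : FR h v b V) (x : 𝔹) {y : 𝔹} (hy : y ∈ M) : hat V x * hat V y = hat V (x * y) := by
  ext ξ
  change V (x (adjoint V (hat V y ξ))) = _
  rw [k.adj_hat hy]; rfl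

theorem hat_star (V : H →L[ℂ] L) (y : 𝔹) : star (hat V y) = hat V (star y) := by
  change adjoint _ = _
  unfold hat
  rw [adjoint_comp, adjoint_comp, adjoint_adjoint]; rfl

theorem hat_V (k : FR h v b V) {y : 𝔹} (hy : y ∈ M) (w : H) : hat V y (V w) = V (y w) := by
  refine ext_inner_left ℂ fun ξ => ?_
  rw [← star_inner_left, hat_star, ← adjoint_inner_left, k.adj_hat (star_mem hy), star_inner_left,
    adjoint_inner_left]

theorem hat_entry (k : FR h v b V) (x : 𝔹) (p q) :
    ⟪b p, hat V x (b q)⟫ = (‖e Ω‖⁻¹ : ℂ) * ((‖e Ω‖⁻¹ : ℂ) * ⟪(v p.2 * (h.lam p.1).1 * e) Ω, (x * v q.2 * (h.lam q.1).1 * e) Ω⟫) := by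
  change ⟪b p, V (x (adjoint V (b q)))⟫ = _
  rw [k.hb, k.adj_b, FD.wg, FD.wg, map_smul, map_smul, map_smul, inner_smul_left, inner_smul_right, map_inv₀, conj_ofReal]
  rfl

theorem hat_inv (k : FR h v b V) {x : 𝔹} (hx : x ∈ M) (g) : Inv b (rho J g) (hat V x) := by
  rintro ⟨s, i⟩ ⟨t, j⟩
  simp only [rho, prodCongr_apply, Prod.map, coe_mulRight, refl_apply]
  rw [k.hat_entry, k.hat_entry]
  congr 2
  have key : ∀ a ∈ M, ∀ c ∈ M, ⟪(a * (h.lam g⁻¹).1 * e) Ω, (c * (h.lam g⁻¹).1 * e) Ω⟫ = ⟪(a * e) Ω, (c * e) Ω⟫ := by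
    intro a ha c hc
    have hl := h.lamM g⁻¹
    have e1 : ∀ a, star (a * (h.lam g⁻¹).1 * e) = (h.lam g).1 * star (a * e) := fun a => by
      rw [star_mul, star_mul, star_mul, h.lam_inv, star_star, h.se, ← mul_assoc, ← mul_assoc, h.lam_e]
    rw [tr2 h.hT (mul_mem (mul_mem ha hl) h.eM) (mul_mem (mul_mem hc hl) h.eM), e1, e1, mul_apply_eq_comp, mul_apply_eq_comp,
      uni_inner (h.lam_uni g), ← tr2 h.hT (mul_mem ha h.eM) (mul_mem hc h.eM)]
  have := key (v i * (h.lam s).1) (mul_mem (k.vM i) (h.lamM s)) (x * v j * (h.lam t).1) (mul_mem (mul_mem hx (k.vM j)) (h.lamM t))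
  rw [← this, map_mul, map_mul, Submonoid.coe_mul, Submonoid.coe_mul]
  simp only [mul_assoc]

/-- normalization constant -/
def cst (e : 𝔹) (Ω : H) : ℝ≥0∞ := ENNReal.ofReal (‖e Ω‖ ^ 2)

theorem cst_ne (k : FR h v b V) : cst e Ω ≠ 0 := by
  have := norm_pos_iff.2 k.h0
  exact (ENNReal.ofReal_pos.2 (by positivity)).ne'

theorem cst_mul (k : FR h v b V) : ‖(‖e Ω‖⁻¹ : ℂ)‖ₑ ^ 2 * cst e Ω = 1 := by
  have := norm_pos_iff.2 k.h0
  rw [enorm_sq_ofReal, cst, ← ENNReal.ofReal_mul (by positivity), norm_inv, norm_real, norm_norm]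
  rw [← mul_pow, inv_mul_cancel₀ this.ne']; simp

theorem nn_hat (k : FR h v b V) {x : 𝔹} (hx : x ∈ M) :
    nn (fun j => b (1, j)) (hat V x) * cst e Ω = ‖x Ω‖ₑ ^ 2 := by
  rw [← enorm_tr h.hT hx, ← k.vs (star x Ω)]
  unfold nn
  rw [← ENNReal.tsum_mul_right]
  refine tsum_congr fun j => ?_
  have e1 : hat V x (b (1, j)) = (‖e Ω‖⁻¹ : ℂ) • V ((x * v j) (e Ω)) := by
    change V (x (adjoint V (b (1, j)))) = _
    rw [k.adj_b, wg1, map_smul, map_smul, map_smul]; rfl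
  rw [e1, enorm_smul, mul_pow, mul_right_comm, k.cst_mul, one_mul, k.iso (mul_mem hx (k.vM j)), ← mul_apply_eq_comp, mul_assoc, k.ve,
    ← enorm_tr h.hT (mul_mem hx (k.vM j)), star_mul]
  rfl

theorem entry_hat (k : FR h v b V) {x : 𝔹} (hx : x ∈ M) (g i j) :
    ‖⟪b (g, i), hat V x (b (1, j))⟫‖ₑ ^ 2 * (cst e Ω * cst e Ω) =
      ‖⟪(v i * (h.lam g).1 * e * star (v j)) Ω, x Ω⟫‖ₑ ^ 2 := by
  rw [k.hat_entry, enorm_mul, enorm_mul, mul_pow, mul_pow]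
  have hm := mul_mem (mul_mem (k.vM i) (h.lamM g)) h.eM
  have e1 : (x * v j * (h.lam 1).1 * e) = x * v j := by
    rw [map_one, OneMemClass.coe_one, mul_one, mul_assoc, k.ve]
  dsimp only
  rw [e1]
  have e2 : ⟪(v i * (h.lam g).1 * e) Ω, (x * v j) Ω⟫ = ⟪(v i * (h.lam g).1 * e * star (v j)) Ω, x Ω⟫ := by
    rw [tr2 h.hT hm (mul_mem hx (k.vM j)), tr2 h.hT (mul_mem hm (star_mem (k.vM j))) hx]
    generalize v i * (h.lam g).1 * e = m
    rw [star_mul, star_mul, star_star, mul_apply_eq_comp, star_inner_left]; rfl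
  rw [e2]
  generalize ‖⟪(v i * (h.lam g).1 * e * star (v j)) Ω, x Ω⟫‖ₑ ^ 2 = A
  have := k.cst_mul
  generalize ‖(‖e Ω‖⁻¹ : ℂ)‖ₑ ^ 2 = c at this ⊢
  calc c * (c * A) * (cst e Ω * cst e Ω) = (c * cst e Ω) * (c * cst e Ω) * A := by ring
    _ = A := by rw [this]; simp

theorem sep (k : FR h v b V) (hne : ∀ j, v j ≠ 0) : TopologicalSpace.SeparableSpace H := by
  have hJ : Countable J := by
    have h1 : ∑' j, ‖star (v j) Ω‖ₑ ^ 2 ≠ ∞ := by rw [k.vs]; simp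
    have h2 := Summable.countable_support_ennreal h1
    have h3 : Function.support (fun j => ‖star (v j) Ω‖ₑ ^ 2) = Set.univ := by
      refine Set.eq_univ_of_forall fun j => ?_
      have : v j Ω ≠ 0 := fun h' => hne j (h.hT.separating _ (k.vM j) h')
      rw [Function.mem_support, enorm_tr h.hT (k.vM j)]
      simpa using this
    rw [h3] at h2
    exact Set.countable_univ_iff.1 h2
  have : Countable (FreeGroup (Fin r)) := FreeGroup.toWord_injective.countable
  have hpos := norm_pos_iff.2 k.h0
  refine frame_sep (fun p : J × FreeGroup (Fin r) × J => (v p.2.2 * (h.lam p.2.1).1 * e * star (v p.1)) Ω) h.hT.cyclic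
    (‖e Ω‖ ^ 2) (by positivity) ?_
  rintro _ ⟨x, hx, rfl⟩
  rw [tsum_prod2]
  change _ = cst e Ω * ‖x Ω‖ₑ ^ 2
  rw [← k.nn_hat hx, mul_left_comm, nn, ← ENNReal.tsum_mul_right]
  refine tsum_congr fun j => ?_
  rw [← hb_parseval b, ← ENNReal.tsum_mul_right]
  exact tsum_congr fun p => (k.entry_hat hx p.1 p.2 j).symm

end FR
end

section
variable {M : VonNeumannAlgebra H} {Ω : H} {e : H →L[ℂ] H} {r : ℕ} {W : Fin r → H →L[ℂ] H}
variable {L : Type v} [NormedAddCommGroup L] [InnerProductSpace ℂ L] [CompleteSpace L] {J : Type u}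

namespace FR
variable {h : FD M Ω e W} {v : J → H →L[ℂ] H} {b : HilbertBasis (FreeGroup (Fin r) × J) ℂ L} {V : H →L[ℂ] L}

theorem norm_V (k : FR h v b V) : ‖V‖ ≤ 1 := V.opNorm_le_bound zero_le_one fun w => by
  have := k.hn w
  rw [← ofReal_norm, ← ofReal_norm, ofReal_le_ofReal_iff (norm_nonneg _)] at this
  rwa [one_mul]

theorem norm_hat (k : FR h v b V) {z : 𝔹} (hz : ‖z‖ ≤ 1) : ‖hat V z‖ ≤ 1 := by
  have h1 := k.norm_V
  have h2 : ‖adjoint V‖ ≤ 1 := by rw [LinearIsometryEquiv.norm_map]; exact h1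
  refine (opNorm_comp_le _ _).trans (mul_le_one₀ h1 (norm_nonneg _) ?_)
  exact (opNorm_comp_le _ _).trans (mul_le_one₀ hz (norm_nonneg _) h2)

theorem hat_sub (V : H →L[ℂ] L) (x y : 𝔹) : hat V (x - y) = hat V x - hat V y := by
  ext ξ
  change V ((x - y) _) = V (x _) - V (y _)
  rw [sub_apply, map_sub]

theorem cst_top : cst e Ω ≠ ∞ := ENNReal.ofReal_ne_top

theorem hz (k : FR h v b V) {ω : Ultrafilter ℕ} (U : Ultrapower M Ω ω) (Q : 𝔳𝔑) (hQ : Q ≤ M)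
    (hdiff : DiffuseSet (relComm U.Mw {z : U.carrier →L[ℂ] U.carrier | ∃ a ∈ Q, z = U.Φ fun _ => a}))
    (F : Finset (𝔹)) (hF : ∀ x ∈ F, x ∈ Q) {p : 𝔹} (hp : p ∈ F)
    (G0 : Finset (J × FreeGroup (Fin r) × J)) (κ : ℝ≥0∞) (hκ : κ ≠ 0) :
    ∃ z, (∀ g, Inv b (rho J g) z) ∧ star z = z ∧ z * hat V 1 = z ∧ ‖z‖ ≤ 1 ∧
      (∀ q ∈ G0, ‖⟪b q.2, z (b (1, q.1))⟫‖ₑ ^ 2 ≤ κ) ∧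
      (∀ x ∈ F, nn (fun j => b (1, j)) (hat V x * z - z * hat V x) ≤ κ) ∧
      nn (fun j => b (1, j)) (hat V p) ≤ nn (fun j => b (1, j)) (hat V p * z) + κ := by
  classical
  have c0 := k.cst_ne
  have ct : cst e Ω ≠ ∞ := cst_top
  obtain ⟨η, hη, h1, h2⟩ : ∃ η : ℝ, 0 < η ∧ ENNReal.ofReal η ≤ κ * (cst e Ω * cst e Ω) ∧ ENNReal.ofReal η ≤ κ * cst e Ω := by
    set a := min 1 (min (κ * (cst e Ω * cst e Ω)) (κ * cst e Ω)) with ha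
    have hat : a ≠ ∞ := ne_top_of_le_ne_top ENNReal.one_ne_top (min_le_left _ _)
    have ha0 : a ≠ 0 := by
      have e1 : κ * (cst e Ω * cst e Ω) ≠ 0 := mul_ne_zero hκ (mul_ne_zero c0 c0)
      have e2 : κ * cst e Ω ≠ 0 := mul_ne_zero hκ c0
      rw [ha]
      exact (lt_min one_pos (lt_min (pos_iff_ne_zero.2 e1) (pos_iff_ne_zero.2 e2))).ne'
    refine ⟨a.toReal, ENNReal.toReal_pos ha0 hat, ?_, ?_⟩ <;> rw [ENNReal.ofReal_toReal hat]
    · exact (min_le_right _ _).trans (min_le_left _ _)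
    · exact (min_le_right _ _).trans (min_le_right _ _)
  obtain ⟨z, hzM, hzs, hz1, hzF, hzG, hzp⟩ := ultra_lift U Q hQ hdiff F
    (G0.image fun q => v q.2.2 * (h.lam q.2.1).1 * e * star (v q.1)) hF (by
      intro m hm
      obtain ⟨q, -, rfl⟩ := Finset.mem_image.1 hm
      exact mul_mem (mul_mem (mul_mem (k.vM _) (h.lamM _)) h.eM) (star_mem (k.vM _))) hη
  refine ⟨hat V z, fun g => k.hat_inv hzM g, by rw [hat_star, hzs.star_eq], by rw [k.hat_mul _ (one_mem _), mul_one],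
    k.norm_hat hz1, fun q hq => ?_, fun x hx => ?_, ?_⟩
  · have e1 := k.entry_hat hzM q.2.1 q.2.2 q.1
    have e2 := hzG _ (Finset.mem_image_of_mem _ hq)
    refine (ENNReal.mul_le_mul_iff_left (mul_ne_zero c0 c0) (mul_ne_top ct ct)).1 ((e1.le.trans ?_).trans h1)
    rw [enorm_sq_ofReal]
    exact ofReal_le_ofReal e2
  · have hxM : x ∈ M := hQ (hF x hx)
    rw [k.hat_mul _ hzM, k.hat_mul _ hxM, ← hat_sub]
    refine (ENNReal.mul_le_mul_iff_left c0 ct).1 (((k.nn_hat (sub_mem (mul_mem hxM hzM) (mul_mem hzM hxM))).le.trans ?_).trans h2)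
    rw [enorm_sq_ofReal]
    exact ofReal_le_ofReal (hzF x hx)
  · have hpM : p ∈ M := hQ (hF p hp)
    rw [k.hat_mul _ hzM]
    refine (ENNReal.mul_le_mul_iff_left c0 ct).1 ?_
    rw [add_mul, k.nn_hat hpM, k.nn_hat (mul_mem hpM hzM)]
    refine le_trans ?_ (add_le_add_right h2 _)
    rw [enorm_sq_ofReal, enorm_sq_ofReal, ← ENNReal.ofReal_add (by positivity) hη.le]
    exact ofReal_le_ofReal (by rw [mul_apply_eq_comp]; linarith [hzp p hp])

theorem propP (k : FR h v b V) {ω : Ultrafilter ℕ} (U : Ultrapower M Ω ω) (Q : 𝔳𝔑) (hQ : Q ≤ M)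
    (hdiff : DiffuseSet (relComm U.Mw {z : U.carrier →L[ℂ] U.carrier | ∃ a ∈ Q, z = U.Φ fun _ => a}))
    {ι : Type w} (d : HilbertBasis ι ℂ H) : PropP Q d := by
  classical
  intro F hF p hpQ hp hp0 δ hδ
  have c0 := k.cst_ne
  have ct : cst e Ω ≠ ∞ := cst_top
  set F' := insert p (insert 1 F) with hF'
  have hF'Q : ∀ x ∈ F', x ∈ Q := fun x hx => by
    rcases Finset.mem_insert.1 hx with rfl | hx
    · exact hpQ
    rcases Finset.mem_insert.1 hx with rfl | hx
    exacts [one_mem _, hF x hx]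
  have hnt : ∀ x ∈ M, nn (fun j => b (1, j)) (hat V x) ≠ ∞ := fun x hx h' => by
    have := k.nn_hat hx
    rw [h', ENNReal.top_mul c0] at this
    exact ENNReal.pow_ne_top (by simp) this.symm
  have hpM : p ∈ M := hQ hpQ
  set δ' : ℝ≥0∞ := min (δ / 4) 4⁻¹ with hδ'
  have hδ0 : δ' ≠ 0 := (lt_min (ENNReal.div_pos hδ (by simp)) (by simp)).ne'
  have hδt : δ' ≠ ∞ := ne_top_of_le_ne_top (by simp) (min_le_right _ _)
  have hpn : ‖p‖ ≤ 1 := norm_proj_le hp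
  obtain ⟨T, hT1, hT2, hT3⟩ := deform_main b (hat V 1) (hat V p) (hnt 1 (one_mem _)) F' (hat V)
    (fun x hx => ⟨fun g => k.hat_inv (hQ (hF'Q x hx)) g, hnt x (hQ (hF'Q x hx))⟩) p (Finset.mem_insert_self _ _) rfl
    (k.norm_hat hpn) (fun h' => by
      have := k.nn_hat hpM
      rw [h', zero_mul, eq_comm, pow_eq_zero_iff two_ne_zero, enorm_eq_zero] at this
      exact hp0 (h.hT.separating _ hpM this))
    (fun G0 κ hκ => k.hz U Q hQ hdiff F' hF'Q (Finset.mem_insert_self _ _) G0 κ hκ) δ' hδ0 hδt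
  set A := adjoint V with hA
  have nV : ‖V‖ₑ ^ 2 ≤ 1 := by
    refine pow_le_one' ?_ 2
    rw [← ofReal_norm]; exact ofReal_le_one.2 k.norm_V
  have nA : ‖A‖ₑ ^ 2 ≤ 1 := by rw [hA, enorm_adj]; exact nV
  have hcmp : ∀ S : L →L[ℂ] L, hs d (A ∘L (S ∘L V)) ≤ hs b S := fun S => by
    refine (hs_left d A _).trans ((mul_le_mul_left nA _).trans ?_)
    rw [one_mul]
    exact (hs_right d b S V).trans ((mul_le_mul_left nV _).trans (by rw [one_mul]))
  have hcmp2 : ∀ S : 𝔹, hs b (V ∘L (S ∘L A)) ≤ hs d S := fun S => by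
    refine (hs_left b V _).trans ((mul_le_mul_left nV _).trans ?_)
    rw [one_mul]
    exact (hs_right b d S A).trans ((mul_le_mul_left nA _).trans (by rw [one_mul]))
  set T' : 𝔹 := A ∘L (T ∘L V) with hT'
  have hcom : ∀ x ∈ F, hs d (x * T' - T' * x) ≤ hs b (hat V x * T - T * hat V x) := fun x hx => by
    have hxM : x ∈ M := hQ (hF x hx)
    have : x * T' - T' * x = A ∘L ((hat V x * T - T * hat V x) ∘L V) := by
      ext w
      change x (A (T (V w))) - A (T (V (x w))) = A (hat V x (T (V w)) - T (hat V x (V w)))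
      rw [map_sub, k.hat_V hxM, k.adj_hat hxM]
    rw [this]; exact hcmp _
  have hmain : hs b (hat V p * T) ≤ 4 * hs d (p * T') := by
    have e1 : hat V p * T = V ∘L ((p * T') ∘L A) + hat V p ∘L (hat V 1 * T - T * hat V 1) := by
      ext ξ
      change hat V p (T ξ) = hat V p (T (hat V 1 ξ)) + hat V p (hat V 1 (T ξ) - T (hat V 1 ξ))
      rw [map_sub, ← mul_apply_eq_comp _ (hat V 1) (T ξ), k.hat_mul _ (one_mem _), mul_one]; abel
    have e2 : hs b (hat V 1 * T - T * hat V 1) ≤ δ' * hs b (hat V p * T) :=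
      (single_le_sum (f := fun x => hs b (hat V x * T - T * hat V x)) (fun _ _ => zero_le)
        (show (1 : 𝔹) ∈ F' from Finset.mem_insert_of_mem (Finset.mem_insert_self _ _))).trans hT3
    have nP : ‖hat V p‖ₑ ^ 2 ≤ 1 := by
      refine pow_le_one' ?_ 2
      rw [← ofReal_norm]; exact ofReal_le_one.2 (k.norm_hat hpn)
    have e3 : hs b (hat V p * T) ≤ 2 * hs d (p * T') + 2 * (4⁻¹ * hs b (hat V p * T)) := by
      conv_lhs => rw [e1]
      refine (hs_add b _ _).trans (add_le_add (mul_le_mul_right (hcmp2 _) _) (mul_le_mul_right ?_ _))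
      refine (hs_left b _ _).trans ((mul_le_mul_left nP _).trans ?_)
      rw [one_mul]
      exact e2.trans (mul_le_mul_left (min_le_right _ _) _)
    have hft : hs b (hat V p * T) ≠ ∞ :=
      ne_top_of_le_ne_top (mul_ne_top (by simp) hT1) (hs_left b (hat V p) T)
    generalize hs b (hat V p * T) = a at e3 hft
    generalize hs d (p * T') = c at e3
    by_cases hct : c = ∞
    · rw [hct]; simp
    have e4 := ENNReal.toReal_mono (by finiteness) e3
    rw [ENNReal.toReal_add (by finiteness) (by finiteness)] at e4
    simp only [ENNReal.toReal_mul, ENNReal.toReal_inv, ENNReal.toReal_ofNat] at e4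
    rw [← ENNReal.toReal_le_toReal hft (by finiteness), ENNReal.toReal_mul, ENNReal.toReal_ofNat]
    linarith
  refine ⟨T', ne_top_of_le_ne_top hT1 (hcmp T), fun h' => hT2 ?_, ?_⟩
  · rw [h', mul_zero] at hmain
    exact le_antisymm hmain zero_le
  · refine (sum_le_sum hcom).trans ((Finset.sum_le_sum_of_subset (fun x hx =>
      Finset.mem_insert_of_mem (Finset.mem_insert_of_mem hx))).trans (hT3.trans ?_))
    refine (mul_le_mul_right hmain _).trans ?_
    rw [← mul_assoc]
    refine mul_le_mul_left ?_ _
    exact (mul_le_mul_left (min_le_left _ _) _).trans (by rw [ENNReal.div_mul_cancel (by simp) (by simp)])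

end FR

theorem main (t : ℝ) (ht : 1 < t) (M : 𝔳𝔑) (Ω : H)
    (hM : IsIFGF t M Ω) (ω : Ultrafilter ℕ) (U : Ultrapower M Ω ω) (Q : 𝔳𝔑) (hQ : Q ≤ M)
    (hdiff : DiffuseSet (relComm U.Mw {z : U.carrier →L[ℂ] U.carrier | ∃ a ∈ Q, z = U.Φ fun _ => a})) :
    IsAmenableSet (Q : Set 𝔹) := by
  obtain ⟨hT, hF, r, e, hr, htr, heM, he, het, u, hu, hfree, hgen⟩ := hM
  have he' : IsStarProjection e := isProj_iff.1 he
  have hee := he'.isIdempotentElem.eq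
  have h : FD M Ω e u := ⟨hT, heM, he', fun i => (hu i).1,
    fun i => by rw [(hu i).2.1, ← mul_assoc, ← mul_assoc, hee],
    fun i => by rw [(hu i).2.1, mul_assoc, hee], fun i => (hu i).2.2, hfree, hgen⟩
  have h0 : e Ω ≠ 0 := fun h' => by
    rw [h', inner_zero_left, eq_comm] at het
    have h2 : (2 : ℝ) ≤ r := by exact_mod_cast hr
    have h3 : 0 < Real.sqrt ((t - 1) / ((r : ℝ) - 1)) := Real.sqrt_pos.2 (div_pos (by linarith) (by linarith))
    exact h3.ne' (by exact_mod_cast het)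
  have hene : e ≠ 0 := fun h' => h0 (by rw [h']; rfl)
  obtain ⟨J, v, hv, hvs⟩ := factor_part hF heM he' hene
  let b : HilbertBasis (FreeGroup (Fin r) × J) ℂ (lp (fun _ : FreeGroup (Fin r) × J => ℂ) 2) := default
  obtain ⟨V, k⟩ := FR_exists h h0 (fun j => (hv j).1) (fun j => (hv j).2.1) hvs b
  have := k.sep (fun j => (hv j).2.2)
  obtain ⟨w, d, -⟩ := exists_hilbertBasis ℂ H
  have hsep : ∀ a ∈ Q, a Ω = 0 → a = 0 := fun a ha => hT.separating a (hQ ha)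
  have hTr : TrV Q Ω := ⟨hT.norm_one, fun a ha c hc => by
    have := hT.tracial a c (hQ ha) (hQ hc)
    rw [← inner_conj_symm, ← inner_conj_symm Ω (c (a Ω))]
    exact congrArg _ this, hsep⟩
  exact amenable_of_HI hTr (HI_of_PropP hsep d (k.propP U Q hQ hdiff d))
end

end S6

/-- for `t > 1`, a free ultrafilter `ω` and a von Neumann subalgebra
`Q ≤ L(F_t)` whose relative commutant `Q' ∩ L(F_t)^ω` is diffuse, `Q` is amenable. -/
theorem statement6 (t : ℝ) (ht : 1 < t) (M : VonNeumannAlgebra H) (Ω : H)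
    (hM : IsIFGF t M Ω) (ω : Ultrafilter ℕ) (hfree : Ultrafilter.IsFreeUltrafilter ω)
    (U : Ultrapower M Ω ω) (Q : VonNeumannAlgebra H) (hQ : Q ≤ M)
    (hdiff : DiffuseSet
      (relComm U.Mw {z : U.carrier →L[ℂ] U.carrier | ∃ a ∈ Q, z = U.Φ fun _ => a})) :
    IsAmenableSet (Q : Set (H →L[ℂ] H)) := by
  exact S6.main t ht M Ω hM ω U Q hQ hdiff

end
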